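/- For every integer d ≥ 1 there exists an integer N = N(d) such that for every field K and every finite symmetric subset F of GL_d(K) containing the identity, at least one of the following holds: (1) the set F^N of products of at most N elements of F contains two elements x and y that freely generate a nonabelian free subgroup, i.e. the group homomorphism from the free group on two generators to GL_d(K) sending the two generators to x and y is injective; or (2) the subgroup generated by F contains a solvable subgroup of finite index. -/

import Mathlib

namespace Tits
open Filter
/-! ### Ultraproducts of fields -/
section Ult
variable (U : Ultrafilter ℕ) (Ω : ℕ → Type) [∀ n, Field (Ω n)]

def ultIdeal : Ideal (∀ n, Ω n) where
  carrier := {x | ∀ᶠ n in (U : Filter ℕ), x n = 0}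
  zero_mem' := by simp
  add_mem' := by
    intro a b ha hb
    filter_upwards [ha, hb] with n h1 h2
    simp [h1, h2]
  smul_mem' := by
    intro c x hx
    filter_upwards [hx] with n h1
    simp [h1]

instance ultIdeal_max : (ultIdeal U Ω).IsMaximal := by
  rw [Ideal.isMaximal_iff]
  constructor
  · intro h
    have h : ∀ᶠ n in (U : Filter ℕ), (1 : ∀ n, Ω n) n = 0 := h
    simp at h
    exact U.neBot.ne h
  · intro J x hIJ hx hxJ
    have hx : ¬ ∀ᶠ n in (U : Filter ℕ), x n = 0 := hx
    rw [← Ultrafilter.eventually_not] at hx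
    have h1 : (1 - (fun n => (x n)⁻¹) * x) ∈ J := by
      apply hIJ
      change ∀ᶠ n in (U : Filter ℕ), _
      filter_upwards [hx] with n hn
      simp [hn]
    have h2 := J.mul_mem_left (fun n => (x n)⁻¹) hxJ
    have := J.add_mem h1 h2
    simpa using this

def Ult : Type := (∀ n, Ω n) ⧸ ultIdeal U Ω

noncomputable def ultField : Field (Ult U Ω) :=
  Ideal.Quotient.field (ultIdeal U Ω)

noncomputable instance : Field (Ult U Ω) := ultField U Ω

variable {Ω}
noncomputable def umk : (∀ n, Ω n) →+* Ult U Ω := Ideal.Quotient.mk (ultIdeal U Ω)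

lemma umk_surj : Function.Surjective (umk U (Ω := Ω)) := Ideal.Quotient.mk_surjective

lemma umk_eq_zero {x : ∀ n, Ω n} : umk U x = 0 ↔ ∀ᶠ n in (U : Filter ℕ), x n = 0 :=
  Ideal.Quotient.eq_zero_iff_mem

lemma umk_eq {x y : ∀ n, Ω n} : umk U x = umk U y ↔ ∀ᶠ n in (U : Filter ℕ), x n = y n := by
  rw [← sub_eq_zero, ← map_sub, umk_eq_zero]
  simp [sub_eq_zero]

section Uj
variable {B : ℕ → Type} [∀ n, Field (B n)]
noncomputable def umap (j : ∀ n, B n →+* Ω n) : Ult U B →+* Ult U Ω :=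
  Ideal.Quotient.lift (ultIdeal U B) ((umk U).comp (Pi.ringHom fun n => (j n).comp (Pi.evalRingHom B n))) (by
    intro x hx
    have hx : ∀ᶠ n in (U : Filter ℕ), x n = 0 := hx
    rw [RingHom.comp_apply, umk_eq_zero]
    filter_upwards [hx] with n hn
    show j n (x n) = 0
    rw [hn, map_zero])
lemma umap_umk (j : ∀ n, B n →+* Ω n) (x : ∀ n, B n) : umap U j (umk U x) = umk U (fun n => j n (x n)) := rfl
end Uj
attribute [irreducible] ultField

lemma umk_inv (x : ∀ n, Ω n) : umk U (fun n => (x n)⁻¹) = (umk U x)⁻¹ := by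
  by_cases h : umk U x = 0
  · rw [h, inv_zero, umk_eq_zero]
    rw [umk_eq_zero] at h
    filter_upwards [h] with n hn
    simp [hn]
  · apply eq_inv_of_mul_eq_one_left
    rw [← map_mul, ← map_one (umk U), umk_eq]
    rw [umk_eq_zero, ← Ultrafilter.eventually_not] at h
    filter_upwards [h] with n hn
    simp [hn]

noncomputable def urep : Ult U Ω → ∀ n, Ω n := Function.surjInv (umk_surj U)

@[simp] lemma umk_urep (x : Ult U Ω) : umk U (urep U x) = x := Function.surjInv_eq (umk_surj U) x

instance ult_algClosed [∀ n, IsAlgClosed (Ω n)] : IsAlgClosed (Ult U Ω) := by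
  apply IsAlgClosed.of_exists_root
  intro p hp hirr
  have hdeg : p.natDegree ≠ 0 := by
    intro h
    exact hirr.not_isUnit (by rw [hp.natDegree_eq_zero.mp h]; exact isUnit_one)
  have hex : ∀ n, ∃ x : Ω n, x ^ p.natDegree
      + ∑ i ∈ Finset.range p.natDegree, urep U (p.coeff i) n * x ^ i = 0 := by
    intro n
    set q : Polynomial (Ω n) := Polynomial.X ^ p.natDegree
      + ∑ i ∈ Finset.range p.natDegree, Polynomial.C (urep U (p.coeff i) n) * Polynomial.X ^ i
      with hq
    have hlt : (∑ i ∈ Finset.range p.natDegree,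
        Polynomial.C (urep U (p.coeff i) n) * Polynomial.X ^ i).degree < ((p.natDegree : ℕ) : WithBot ℕ) := by
      apply lt_of_le_of_lt (Polynomial.degree_sum_le _ _)
      rw [Finset.sup_lt_iff (WithBot.bot_lt_coe _)]
      intro i hi
      refine lt_of_le_of_lt (Polynomial.degree_C_mul_X_pow_le _ _) ?_
      exact_mod_cast Finset.mem_range.mp hi
    have hd : q.degree = ((p.natDegree : ℕ) : WithBot ℕ) := by
      rw [hq, Polynomial.degree_add_eq_left_of_degree_lt]
      · simp
      · rw [Polynomial.degree_X_pow]; exact hlt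
    obtain ⟨x, hx⟩ := IsAlgClosed.exists_root q (by rw [hd]; exact_mod_cast hdeg)
    refine ⟨x, ?_⟩
    simpa [hq, Polynomial.IsRoot, Polynomial.eval_finsetSum] using hx
  choose x hx using hex
  refine ⟨umk U x, ?_⟩
  have h0 : (umk U) (x ^ p.natDegree
      + ∑ i ∈ Finset.range p.natDegree, urep U (p.coeff i) * x ^ i) = 0 := by
    rw [umk_eq_zero]
    filter_upwards with n
    simpa using hx n
  rw [hp.as_sum, Polynomial.eval_add, Polynomial.eval_finsetSum]
  simpa using h0

section Mat
variable {a b c : Type} 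

noncomputable def umat (M : ∀ n, Matrix a b (Ω n)) : Matrix a b (Ult U Ω) :=
  fun i j => umk U (fun n => M n i j)

noncomputable def urepMat (M : Matrix a b (Ult U Ω)) (n : ℕ) : Matrix a b (Ω n) :=
  fun i j => urep U (M i j) n

@[simp] lemma umat_urepMat (M : Matrix a b (Ult U Ω)) : umat U (urepMat U M) = M := by
  ext i j; simp [umat, urepMat]

lemma umat_eq [Finite a] [Finite b] {M N : ∀ n, Matrix a b (Ω n)} :
    umat U M = umat U N ↔ ∀ᶠ n in (U : Filter ℕ), M n = N n := by
  simp only [← Matrix.ext_iff, umat, umk_eq, eventually_all]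

lemma umat_mul [Fintype b] (M : ∀ n, Matrix a b (Ω n)) (N : ∀ n, Matrix b c (Ω n)) :
    umat U (fun n => M n * N n) = umat U M * umat U N := by
  ext i j
  simp only [umat, Matrix.mul_apply]
  simp only [← map_mul, ← map_sum]
  congr 1; ext n; simp

lemma umat_one [DecidableEq a] : umat U (fun n => (1 : Matrix a a (Ω n))) = 1 := by
  ext i j
  simp only [umat, Matrix.one_apply]
  split_ifs
  · exact map_one _
  · exact map_zero _

lemma umat_trace [Fintype a] (M : ∀ n, Matrix a a (Ω n)) :
    (umat U M).trace = umk U (fun n => (M n).trace) := by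
  simp only [umat, Matrix.trace, Matrix.diag]
  rw [← map_sum]
  congr 1; ext n; simp

lemma umat_det [Fintype a] [DecidableEq a] (M : ∀ n, Matrix a a (Ω n)) :
    (umat U M).det = umk U (fun n => (M n).det) := by
  simp only [umat, Matrix.det_apply]
  simp only [← map_prod, Units.smul_def, ← map_zsmul]
  rw [← map_sum]
  congr 1; ext n; simp
end Mat
end Ult
end Tits

namespace Tits
set_option linter.unusedSectionVars false
set_option linter.all false
open Filter Pointwise
section Reg
variable {G k : Type} [Group G] [Field k]

structure Reg (R : Subalgebra k (G → k)) : Prop where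
  left : ∀ a, ∀ f ∈ R, (fun x => f (a * x)) ∈ R
  right : ∀ a, ∀ f ∈ R, (fun x => f (x * a)) ∈ R
  inv : ∀ f ∈ R, (fun x => f x⁻¹) ∈ R
  conj : ∀ b, ∀ f ∈ R, (fun x => f (x * b * x⁻¹)) ∈ R

def Irr (R : Subalgebra k (G → k)) (S : Set G) : Prop :=
  ∀ f₁ ∈ R, ∀ f₂ ∈ R, (∃ s ∈ S, f₁ s ≠ 0) → (∃ s ∈ S, f₂ s ≠ 0) → ∃ s ∈ S, f₁ s ≠ 0 ∧ f₂ s ≠ 0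

variable {R : Subalgebra k (G → k)}

lemma Irr.image {S : Set G} (h : Irr R S) (φ : G → G) (hφ : ∀ f ∈ R, (fun x => f (φ x)) ∈ R) :
    Irr R (φ '' S) := by
  rintro f₁ h₁ f₂ h₂ ⟨_, ⟨s, hs, rfl⟩, hs1⟩ ⟨_, ⟨t, ht, rfl⟩, ht1⟩
  obtain ⟨u, hu, h3⟩ := h _ (hφ f₁ h₁) _ (hφ f₂ h₂) ⟨s, hs, hs1⟩ ⟨t, ht, ht1⟩
  exact ⟨φ u, ⟨u, hu, rfl⟩, h3⟩

lemma Irr.mul (hR : Reg R) {S T : Set G} (hS : Irr R S) (hT : Irr R T) : Irr R (S * T) := by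
  rintro f₁ h₁ f₂ h₂ ⟨_, ⟨s, hs, t, ht, rfl⟩, hs1⟩ ⟨_, ⟨s', hs', t', ht', rfl⟩, ht1⟩
  obtain ⟨u, hu, h3, h4⟩ := hS _ (hR.right t f₁ h₁) _ (hR.right t' f₂ h₂) ⟨s, hs, hs1⟩ ⟨s', hs', ht1⟩
  obtain ⟨w, hw, h5, h6⟩ := hT _ (hR.left u f₁ h₁) _ (hR.left u f₂ h₂) ⟨t, ht, h3⟩ ⟨t', ht', h4⟩
  exact ⟨u * w, ⟨u, hu, w, hw, rfl⟩, h5, h6⟩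

lemma Irr.closure (hR : Reg R) {ι : Type} (S : ι → Set G) (hS : ∀ i, Irr R (S i))
    (h1 : ∀ i, (1 : G) ∈ S i) : Irr R (Subgroup.closure (⋃ i, S i) : Set G) := by
  have key : ∀ x ∈ Subgroup.closure (⋃ i, S i), ∃ P : Set G, Irr R P ∧ 1 ∈ P ∧ x ∈ P ∧
      P ⊆ Subgroup.closure (⋃ i, S i) := by
    intro x hx
    induction hx using Subgroup.closure_induction with
    | mem x hx =>
      obtain ⟨i, hi⟩ := Set.mem_iUnion.mp hx
      exact ⟨S i, hS i, h1 i, hi, (Set.subset_iUnion S i).trans Subgroup.subset_closure⟩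
    | one =>
      refine ⟨{1}, ?_, rfl, rfl, by simp⟩
      rintro f₁ - f₂ - ⟨s, hs, h2⟩ ⟨t, ht, h3⟩
      rw [Set.mem_singleton_iff] at hs ht
      subst hs; subst ht
      exact ⟨1, rfl, h2, h3⟩
    | mul x y hx hy ihx ihy =>
      obtain ⟨P, a1, a2, a3, a4⟩ := ihx
      obtain ⟨Q, b1, b2, b3, b4⟩ := ihy
      refine ⟨P * Q, a1.mul hR b1, ⟨1, a2, 1, b2, by simp⟩, ⟨x, a3, y, b3, rfl⟩, ?_⟩
      rintro _ ⟨u, hu, v, hv, rfl⟩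
      exact mul_mem (a4 hu) (b4 hv)
    | inv x hx ih =>
      obtain ⟨P, a1, a2, a3, a4⟩ := ih
      refine ⟨(fun y => y⁻¹) '' P, a1.image _ hR.inv, ⟨1, a2, by simp⟩, ⟨x, a3, rfl⟩, ?_⟩
      rintro _ ⟨u, hu, rfl⟩
      exact inv_mem (a4 hu)
  rintro f₁ h₁ f₂ h₂ ⟨s, hs, hs1⟩ ⟨t, ht, ht1⟩
  obtain ⟨P, a1, a2, a3, a4⟩ := key s hs
  obtain ⟨Q, b1, b2, b3, b4⟩ := key t ht
  obtain ⟨u, ⟨x, hx, y, hy, rfl⟩, hu1⟩ := (a1.mul hR b1) f₁ h₁ f₂ h₂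
    ⟨s, ⟨s, a3, 1, b2, by simp⟩, hs1⟩ ⟨t, ⟨1, a2, t, b3, by simp⟩, ht1⟩
  exact ⟨x * y, mul_mem (a4 hx) (b4 hy), hu1⟩

lemma Irr.exists_all {S : Set G} (h : Irr R S) (hne : S.Nonempty) {ι : Type} (s : Finset ι)
    (f : ι → G → k) (hf : ∀ i ∈ s, f i ∈ R) (hnz : ∀ i ∈ s, ∃ x ∈ S, f i x ≠ 0) :
    ∃ x ∈ S, ∀ i ∈ s, f i x ≠ 0 := by
  classical
  have : ∃ x ∈ S, (∏ i ∈ s, f i) x ≠ 0 := by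
    induction s using Finset.induction_on with
    | empty => obtain ⟨x, hx⟩ := hne; exact ⟨x, hx, by simp⟩
    | insert a s ha ih =>
      have := ih (fun i hi => hf i (Finset.mem_insert_of_mem hi))
        (fun i hi => hnz i (Finset.mem_insert_of_mem hi))
      obtain ⟨x, hx, h1, h2⟩ := h _ (hf a (Finset.mem_insert_self _ _)) _
        (prod_mem (fun i hi => hf i (Finset.mem_insert_of_mem hi)))
        (hnz a (Finset.mem_insert_self _ _)) this
      refine ⟨x, hx, ?_⟩
      rw [Finset.prod_insert ha]
      exact mul_ne_zero h1 h2
  obtain ⟨x, hx, h1⟩ := this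
  refine ⟨x, hx, fun i hi h0 => h1 ?_⟩
  rw [Finset.prod_apply]
  exact Finset.prod_eq_zero hi h0

/-- A regular function with finitely many values on an irreducible set is constant. -/
lemma Irr.const {S : Set G} (h : Irr R S) {f : G → k} (hf : f ∈ R) (T : Set k) (hT : T.Finite)
    (hfT : ∀ s ∈ S, f s ∈ T) {x y : G} (hx : x ∈ S) (hy : y ∈ S) : f x = f y := by
  by_contra hxy
  obtain ⟨z, hz, h1⟩ := h.exists_all ⟨x, hx⟩ hT.toFinset (fun c g => f g - c)
    (fun c _ => R.sub_mem hf (R.algebraMap_mem c)) (by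
      intro c _
      by_cases hc : f x = c
      · exact ⟨y, hy, by rw [sub_ne_zero, ← hc]; exact Ne.symm hxy⟩
      · exact ⟨x, hx, by rwa [sub_ne_zero]⟩)
  exact h1 (f z) (by simpa using hfT z hz) (sub_self _)

section Ent
variable {m : Type} [Fintype m] [DecidableEq m]
def entAlg (ρ : G →* Matrix m m k) : Subalgebra k (G → k) :=
  Algebra.adjoin k (Set.range (fun p : m × m => fun g => ρ g p.1 p.2) ∪
    Set.range (fun p : m × m => fun g => ρ g⁻¹ p.1 p.2))

lemma ent_mem (ρ : G →* Matrix m m k) (i j : m) : (fun g => ρ g i j) ∈ entAlg ρ :=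
  Algebra.subset_adjoin (Or.inl ⟨(i, j), rfl⟩)

lemma ent_inv_mem (ρ : G →* Matrix m m k) (i j : m) : (fun g => ρ g⁻¹ i j) ∈ entAlg ρ :=
  Algebra.subset_adjoin (Or.inr ⟨(i, j), rfl⟩)

lemma entAlg_comp (ρ : G →* Matrix m m k) (φ : G → G)
    (h : ∀ i j, (fun g => ρ (φ g) i j) ∈ entAlg ρ)
    (h' : ∀ i j, (fun g => ρ (φ g)⁻¹ i j) ∈ entAlg ρ) :
    ∀ f ∈ entAlg ρ, (fun x => f (φ x)) ∈ entAlg ρ := by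
  intro f hf
  induction hf using Algebra.adjoin_induction with
  | mem x hx =>
    rcases hx with ⟨p, rfl⟩ | ⟨p, rfl⟩
    · exact h _ _
    · exact h' _ _
  | algebraMap r => exact (entAlg ρ).algebraMap_mem r
  | add x y _ _ hx hy => exact (entAlg ρ).add_mem hx hy
  | mul x y _ _ hx hy => exact (entAlg ρ).mul_mem hx hy

lemma fun_sum_mem {ι : Type} (R : Subalgebra k (G → k)) (s : Finset ι) (f : ι → G → k)
    (h : ∀ i ∈ s, f i ∈ R) : (fun g => ∑ i ∈ s, f i g) ∈ R := by
  have := sum_mem h (S := R)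
  convert this using 1
  ext g; simp

lemma fun_prod_mem {ι : Type} (R : Subalgebra k (G → k)) (s : Finset ι) (f : ι → G → k)
    (h : ∀ i ∈ s, f i ∈ R) : (fun g => ∏ i ∈ s, f i g) ∈ R := by
  have := prod_mem h (S := R)
  convert this using 1
  ext g; simp

lemma fun_const_mem (R : Subalgebra k (G → k)) (c : k) : (fun _ => c) ∈ R := R.algebraMap_mem c
lemma fun_mul_mem (R : Subalgebra k (G → k)) {f g : G → k} (hf : f ∈ R) (hg : g ∈ R) :
    (fun x => f x * g x) ∈ R := R.mul_mem hf hg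

lemma mat_mul_mem {a b c : Type} [Fintype b] (R : Subalgebra k (G → k))
    (A : G → Matrix a b k) (B : G → Matrix b c k)
    (hA : ∀ i j, (fun g => A g i j) ∈ R) (hB : ∀ i j, (fun g => B g i j) ∈ R) :
    ∀ i j, (fun g => (A g * B g) i j) ∈ R := by
  intro i j
  simp only [Matrix.mul_apply]
  exact fun_sum_mem R _ _ (fun k _ => fun_mul_mem R (hA i k) (hB k j))

lemma entAlg_reg (ρ : G →* Matrix m m k) : Reg (entAlg ρ) := by
  have hc : ∀ a : G, ∀ i j, (fun _ : G => ρ a i j) ∈ entAlg ρ :=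
    fun a i j => fun_const_mem _ _
  have h1 := ent_mem ρ
  have h2 := ent_inv_mem ρ
  constructor
  · intro a
    apply entAlg_comp <;> intro i j <;> simp only [mul_inv_rev, map_mul]
    · exact mat_mul_mem _ _ _ (hc a) h1 i j
    · exact mat_mul_mem _ _ _ h2 (hc a⁻¹) i j
  · intro a
    apply entAlg_comp <;> intro i j <;> simp only [mul_inv_rev, map_mul]
    · exact mat_mul_mem _ _ _ h1 (hc a) i j
    · exact mat_mul_mem _ _ _ (hc a⁻¹) h2 i j
  · apply entAlg_comp <;> intro i j
    · exact h2 i j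
    · simpa using h1 i j
  · intro b
    apply entAlg_comp <;> intro i j <;> simp only [mul_inv_rev, inv_inv, map_mul]
    · exact mat_mul_mem _ _ _ (mat_mul_mem _ _ _ h1 (hc b)) h2 i j
    · exact mat_mul_mem _ _ _ h1 (mat_mul_mem _ _ _ (hc b⁻¹) h2) i j

lemma entAlg_noeth (ρ : G →* Matrix m m k) : IsNoetherianRing (entAlg ρ) := by
  have : (entAlg ρ).FG := Subalgebra.fg_def.mpr ⟨_, Set.toFinite _, rfl⟩
  have : Algebra.FiniteType k (entAlg ρ) := (Subalgebra.fg_iff_finiteType _).mp this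
  exact Algebra.FiniteType.isNoetherianRing k _
end Ent

/-- Points of the spectrum. -/
noncomputable def ptSpec (R : Subalgebra k (G → k)) (g : G) : PrimeSpectrum R :=
  ⟨RingHom.ker ((Pi.evalRingHom (fun _ : G => k) g).comp R.val.toRingHom), RingHom.ker_isPrime _⟩

/-- identity component -/
theorem exists_component (hR : Reg R) [IsNoetherianRing R] :
    ∃ N : Subgroup G, N.Normal ∧ N.FiniteIndex ∧ Irr R (N : Set G) := by
  let τ : TopologicalSpace G := TopologicalSpace.induced (ptSpec R) inferInstance
  have hind : Topology.IsInducing (ptSpec R) := ⟨rfl⟩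
  have hN : TopologicalSpace.NoetherianSpace G := hind.noetherianSpace
  have hopen : ∀ f (hf : f ∈ R), IsOpen {g : G | f g ≠ 0} := by
    intro f hf
    have := (PrimeSpectrum.isOpen_basicOpen (a := (⟨f, hf⟩ : R))).preimage hind.continuous
    convert this using 1
    ext g
    simp only [Set.mem_setOf_eq, Set.mem_preimage, SetLike.mem_coe, PrimeSpectrum.mem_basicOpen]
    rfl
  have hcont : ∀ φ : G → G, (∀ f ∈ R, (fun x => f (φ x)) ∈ R) → Continuous φ := by
    intro φ hφ
    rw [hind.continuous_iff]
    rw [PrimeSpectrum.isTopologicalBasis_basic_opens.continuous_iff]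
    rintro _ ⟨⟨f, hf⟩, rfl⟩
    exact hopen _ (hφ f hf)
  have hl : ∀ a : G, Continuous (fun x => a * x) := fun a => hcont _ (hR.left a)
  have hr : ∀ a : G, Continuous (fun x => x * a) := fun a => hcont _ (hR.right a)
  let L : G → G ≃ₜ G := fun a => ⟨Equiv.mulLeft a, hl a, hl a⁻¹⟩
  let Rt : G → G ≃ₜ G := fun a => ⟨Equiv.mulRight a, hr a, hr a⁻¹⟩
  have hcomp : ∀ (e : G ≃ₜ G) (Z : Set G), Z ∈ irreducibleComponents G →
      e '' Z ∈ irreducibleComponents G := by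
    intro e Z hZ
    refine ⟨hZ.1.image e e.continuous.continuousOn, ?_⟩
    intro W hW hle
    have h1 : Z ⊆ e.symm '' W := by
      intro z hz
      exact ⟨e z, hle ⟨z, hz, rfl⟩, by simp⟩
    have h2 := hZ.2 (hW.image e.symm e.symm.continuous.continuousOn) h1
    intro w hw
    exact ⟨e.symm w, h2 ⟨w, hw, rfl⟩, by simp⟩
  have hfin : (irreducibleComponents G).Finite :=
    TopologicalSpace.NoetherianSpace.finite_irreducibleComponents
  obtain ⟨x, hx0, hx⟩ : ∃ x ∈ irreducibleComponent (1 : G), ∀ Z ∈ irreducibleComponents G, x ∈ Z →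
      Z = irreducibleComponent (1 : G) := by
    by_contra hcon
    push Not at hcon
    have := mem_of_subset_sUnion_irreducibleComponents (irreducibleComponent (1 : G))
      (irreducibleComponent_mem_irreducibleComponents _)
      (irreducibleComponents G \ {irreducibleComponent (1 : G)}) hfin.sdiff Set.sdiff_subset (by
        intro x hx
        obtain ⟨Z, h1, h2, h3⟩ := hcon x hx
        exact ⟨Z, ⟨h1, h3⟩, h2⟩)
    exact this.2 rfl
  have huniq : ∀ Z ∈ irreducibleComponents G, (1 : G) ∈ Z → Z = irreducibleComponent (1 : G) := by
    intro Z hZ h1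
    have e1 := hx _ (hcomp (L x) Z hZ) ⟨1, h1, mul_one x⟩
    have e2 := hx _ (hcomp (L x) _ (irreducibleComponent_mem_irreducibleComponents 1))
      ⟨1, mem_irreducibleComponent, mul_one x⟩
    exact (Set.image_injective.mpr (L x).injective) (e1.trans e2.symm)
  set Z := irreducibleComponent (1 : G) with hZdef
  have hZ : Z ∈ irreducibleComponents G := irreducibleComponent_mem_irreducibleComponents 1
  have h1Z : (1 : G) ∈ Z := mem_irreducibleComponent
  have htr : ∀ h ∈ Z, (L h⁻¹) '' Z = Z := fun h hh =>
    huniq _ (hcomp _ _ hZ) ⟨h, hh, inv_mul_cancel h⟩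
  have hinv : ∀ h ∈ Z, h⁻¹ ∈ Z := by
    intro h hh
    rw [← htr h hh]
    exact ⟨1, h1Z, mul_one _⟩
  let N : Subgroup G :=
    { carrier := Z
      one_mem' := h1Z
      inv_mem' := fun {h} hh => hinv h hh
      mul_mem' := by
        intro a b ha hb
        rw [← htr _ (hinv a ha)]
        exact ⟨b, hb, show a⁻¹⁻¹ * b = a * b by simp⟩ }
  have hNZ : ∀ g, g ∈ N ↔ g ∈ Z := fun g => Iff.rfl
  refine ⟨N, ⟨?_⟩, ?_, ?_⟩
  · intro n hn g
    have : (Rt g⁻¹) '' ((L g) '' Z) = Z :=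
      huniq _ (hcomp _ _ (hcomp _ _ hZ)) ⟨g, ⟨1, h1Z, mul_one g⟩, mul_inv_cancel g⟩
    rw [hNZ, ← this]
    exact ⟨g * n, ⟨n, hn, rfl⟩, rfl⟩
  · let φ : G ⧸ N → irreducibleComponents G := fun q => ⟨(L q.out) '' Z, hcomp _ _ hZ⟩
    have hφ : Function.Injective φ := by
      intro a b hab
      have hab : (L a.out) '' Z = (L b.out) '' Z := congrArg Subtype.val hab
      have : a.out ∈ (L b.out) '' Z := by
        rw [← hab]; exact ⟨1, h1Z, mul_one _⟩
      obtain ⟨z, hz, hz1⟩ := this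
      rw [← a.out_eq', ← b.out_eq']
      symm
      apply Quotient.sound'
      rw [QuotientGroup.leftRel_apply, hNZ, ← hz1]
      change (Quotient.out b)⁻¹ * (Quotient.out b * z) ∈ Z
      simpa using hz
    haveI : Finite (irreducibleComponents G) := hfin
    haveI : Finite (G ⧸ N) := Finite.of_injective φ hφ
    exact Subgroup.finiteIndex_of_finite_quotient
  · rintro f₁ h₁ f₂ h₂ ⟨s, hs, hs1⟩ ⟨t, ht, ht1⟩
    obtain ⟨u, hu, h3, h4⟩ := hZ.1.2 _ _ (hopen f₁ h₁) (hopen f₂ h₂) ⟨s, hs, hs1⟩ ⟨t, ht, ht1⟩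
    exact ⟨u, hu, h3, h4⟩
end Reg
end Tits

namespace Tits
set_option linter.unusedSectionVars false
set_option linter.all false
open Filter Pointwise
open scoped commutatorElement
section Rep
variable {H k V : Type} [Group H] [Field k] [AddCommGroup V] [Module k V]

def IsSc (z : Module.End k V) : Prop := ∃ c : k, z = c • (1 : Module.End k V)

def Simple (ρ : H →* Module.End k V) : Prop :=
  ∀ W : Submodule k V, (∀ h, ∀ w ∈ W, ρ h w ∈ W) → W = ⊥ ∨ W = ⊤

def Coef (R : Subalgebra k (H → k)) (ρ : H →* Module.End k V) : Prop :=
  ∀ (ξ : Module.Dual k V) (v : V), (fun g => ξ (ρ g v)) ∈ R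

lemma rho_inv_mul (ρ : H →* Module.End k V) (h : H) (v : V) : ρ h⁻¹ (ρ h v) = v := by
  rw [← Module.End.mul_apply, ← map_mul]; simp
lemma rho_mul_inv (ρ : H →* Module.End k V) (h : H) (v : V) : ρ h (ρ h⁻¹ v) = v := by
  rw [← Module.End.mul_apply, ← map_mul]; simp
lemma rho_mul (ρ : H →* Module.End k V) (g h : H) (v : V) : ρ (g * h) v = ρ g (ρ h v) := by
  rw [map_mul]; rfl

lemma isSc_of_forall {z : Module.End k V} (h : ∀ v (ξ : Module.Dual k V), ξ v = 0 → ξ (z v) = 0) :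
    IsSc z := by
  have h1 : ∀ v, ∃ c : k, z v = c • v := by
    intro v
    by_contra hc
    push Not at hc
    have : z v ∉ Submodule.span k {v} := by
      rw [Submodule.mem_span_singleton]
      rintro ⟨c, hc'⟩
      exact hc c hc'.symm
    obtain ⟨f, hf1, hf2⟩ := Submodule.exists_le_ker_of_notMem this
    exact hf1 (h v f (hf2 (Submodule.mem_span_singleton_self v)))
  by_cases hV : ∃ v : V, v ≠ 0
  · obtain ⟨v, hv⟩ := hV
    obtain ⟨c, hc⟩ := h1 v
    refine ⟨c, LinearMap.ext fun w => ?_⟩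
    obtain ⟨ξ, hξ⟩ : ∃ ξ : Module.Dual k V, ξ v = 1 := by
      obtain ⟨g, hg⟩ := Module.Projective.exists_dual_ne_zero k hv
      exact ⟨(g v)⁻¹ • g, by simp [hg]⟩
    have := h (w - ξ w • v)
    by_cases hw : w - ξ w • v = 0
    · rw [sub_eq_zero] at hw
      rw [hw]; simp [hc, smul_smul, mul_comm]
    obtain ⟨a, ha⟩ := h1 (w - ξ w • v)
    obtain ⟨b, hb⟩ := h1 (v + (w - ξ w • v))
    rw [map_add, hc, ha] at hb
    have h2 : c = b := by
      have := congrArg ξ hb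
      simpa [hξ] using this
    rw [smul_add, ← h2] at hb
    have h3 := add_left_cancel hb
    rw [map_sub, map_smul, hc] at ha
    have h4 : z w - ξ w • c • v = c • (w - ξ w • v) := ha.trans h3
    simp only [LinearMap.smul_apply, Module.End.one_apply]
    rw [smul_sub, smul_smul, smul_smul, mul_comm c] at h4
    exact sub_left_injective h4
  · push Not at hV
    exact ⟨0, LinearMap.ext fun w => by rw [hV w]; simp⟩

lemma exists_of_not_isSc {z : Module.End k V} (h : ¬ IsSc z) :
    ∃ v, ∃ ξ : Module.Dual k V, ξ v = 0 ∧ ξ (z v) ≠ 0 := by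
  by_contra hc
  push Not at hc
  exact h (isSc_of_forall hc)

variable [FiniteDimensional k V] 

lemma schur [IsAlgClosed k] [Nontrivial V] {ρ : H →* Module.End k V} (hs : Simple ρ) (z : Module.End k V)
    (hz : ∀ h, ρ h * z = z * ρ h) : IsSc z := by
  obtain ⟨c, hc⟩ := Module.End.exists_eigenvalue z
  rcases hs (z.eigenspace c) (by
    intro h w hw
    rw [Module.End.mem_eigenspace_iff] at hw ⊢
    rw [← Module.End.mul_apply, ← hz, Module.End.mul_apply, hw, map_smul]) with h1 | h1
  · exact absurd h1 hc
  · refine ⟨c, LinearMap.ext fun v => ?_⟩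
    have : v ∈ z.eigenspace c := by rw [h1]; trivial
    simpa [Module.End.mem_eigenspace_iff] using this

variable {R : Subalgebra k (H → k)} {ρ : H →* Module.End k V}

lemma conj_mem (hR : Reg R) (hc : Coef R ρ) (z : Module.End k V) (ξ : Module.Dual k V) (v : V) :
    (fun h => ξ (ρ h (z (ρ h⁻¹ v)))) ∈ R := by
  let b := Module.finBasis k V
  have : (fun h => ξ (ρ h (z (ρ h⁻¹ v)))) =
      fun h => ∑ i, (b.coord i ∘ₗ z) (ρ h⁻¹ v) * ξ (ρ h (b i)) := by
    ext h
    have hb := b.sum_repr (z (ρ h⁻¹ v))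
    conv_lhs => rw [← hb]
    simp only [map_sum, map_smul, smul_eq_mul, LinearMap.comp_apply, Module.Basis.coord_apply]
  rw [this]
  exact fun_sum_mem R _ _ fun i _ => fun_mul_mem R (hR.inv _ (hc _ v)) (hc ξ _)

lemma conj_const (hR : Reg R) (hc : Coef R ρ) (hI : Irr R Set.univ) (z : Module.End k V)
    (hfin : (Set.range fun h => ρ h * z * ρ h⁻¹).Finite) (h : H) : ρ h * z = z * ρ h := by
  have key : ρ h * z * ρ h⁻¹ = z := by
    ext v
    rw [← sub_eq_zero]
    by_contra hne
    obtain ⟨ξ, hξ⟩ := Module.Projective.exists_dual_ne_zero k hne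
    rw [map_sub, sub_ne_zero] at hξ
    apply hξ
    have := hI.const (conj_mem hR hc z ξ v) ((fun y : Module.End k V => ξ (y v)) ''
      (Set.range fun h => ρ h * z * ρ h⁻¹)) (hfin.image _) (by
        intro s _
        exact ⟨_, ⟨s, rfl⟩, rfl⟩) (Set.mem_univ h) (Set.mem_univ 1)
    simpa using this
  calc ρ h * z = ρ h * z * (ρ h⁻¹ * ρ h) := by rw [← map_mul]; simp
    _ = z * ρ h := by rw [← mul_assoc, key]

/-- common eigenvectors of normal subgroups -/
lemma eig_scalar (hR : Reg R) (hc : Coef R ρ) (hI : Irr R Set.univ) (hs : Simple ρ)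
    (M : Subgroup H) (hM : M.Normal) (v : V) (hv : v ≠ 0) (he : ∀ m ∈ M, ∃ c : k, ρ m v = c • v)
    (m : H) (hm : m ∈ M) : IsSc (ρ m) := by
  obtain ⟨ξ, hξ⟩ : ∃ ξ : Module.Dual k V, ξ v = 1 := by
    obtain ⟨g, hg⟩ := Module.Projective.exists_dual_ne_zero k hv
    exact ⟨(g v)⁻¹ • g, by simp [hg]⟩
  have h1 : ∀ h, ρ m (ρ h v) = ξ (ρ (h⁻¹ * m * h) v) • ρ h v := by
    intro h
    obtain ⟨c, hc⟩ := he _ (by simpa using hM.conj_mem m hm h⁻¹ : h⁻¹ * m * h ∈ M)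
    rw [hc, map_smul, hξ]
    have : ρ (h * (h⁻¹ * m * h)) v = c • ρ h v := by rw [rho_mul, hc, map_smul]
    rw [show h * (h⁻¹ * m * h) = m * h by group, rho_mul] at this
    simpa using this
  have h2 : ∀ h, ξ (ρ (h⁻¹ * m * h) v) = ξ (ρ m v) := by
    intro h
    have hf : (fun h => ξ (ρ (h⁻¹ * m * h) v)) ∈ R := by
      have := hR.inv _ (hR.conj m _ (hc ξ v))
      simpa using this
    have := hI.const hf {c | (ρ m).HasEigenvalue c} (Module.End.finite_hasEigenvalue _) (by
      intro s _
      apply Module.End.hasEigenvalue_of_hasEigenvector (x := ρ s v)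
      refine ⟨Module.End.mem_eigenspace_iff.mpr (h1 s), ?_⟩
      intro h0
      apply hv
      rw [← rho_inv_mul ρ s v, h0, map_zero]) (Set.mem_univ h) (Set.mem_univ 1)
    simpa using this
  refine ⟨ξ (ρ m v), ?_⟩
  have hinv : ∀ h, ∀ w ∈ (Module.End.eigenspace (ρ m) (ξ (ρ m v)) ⊓ Submodule.span k (Set.range fun h => ρ h v)),
      ρ h w ∈ (Module.End.eigenspace (ρ m) (ξ (ρ m v)) ⊓ Submodule.span k (Set.range fun h => ρ h v)) := by
    have hle : Submodule.span k (Set.range fun h => ρ h v) ≤ Module.End.eigenspace (ρ m) (ξ (ρ m v)) := by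
      rw [Submodule.span_le]
      rintro _ ⟨h, rfl⟩
      exact Module.End.mem_eigenspace_iff.mpr (by rw [h1, h2])
    rw [inf_eq_right.mpr hle]
    intro h w hw
    induction hw using Submodule.span_induction with
    | mem x hx =>
      obtain ⟨g, rfl⟩ := hx
      exact Submodule.subset_span ⟨h * g, by simp [rho_mul]⟩
    | zero => simp
    | add x y _ _ hx hy => rw [map_add]; exact add_mem hx hy
    | smul a x _ hx => rw [map_smul]; exact Submodule.smul_mem _ _ hx
  rcases hs (Module.End.eigenspace (ρ m) (ξ (ρ m v)) ⊓ Submodule.span k (Set.range fun h => ρ h v)) hinv with h | h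
  · exfalso
    apply hv
    have : v ∈ (⊥ : Submodule k V) := by
      rw [← h]
      refine ⟨Module.End.mem_eigenspace_iff.mpr ?_, Submodule.subset_span ⟨1, by simp⟩⟩
      simpa using h1 1
    simpa using this
  · ext w
    have : w ∈ (⊤ : Submodule k V) := trivial
    rw [← h] at this
    simpa using Module.End.mem_eigenspace_iff.mp this.1

lemma hom_comm {A : Type} [CommMonoid A] (χ : H →* A) (x y : H) : χ ⁅x, y⁆ = 1 := by
  have : Group.toDivInvMonoid.toMonoid = Group.toDivInvMonoid.toMonoid (G := H) := rfl
  rw [commutatorElement_def, map_mul, map_mul, map_mul, mul_right_comm (χ x), ← map_mul χ x, mul_inv_cancel,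
    map_one, one_mul, ← map_mul, mul_inv_cancel, map_one]

lemma det_comm (x y : H) : LinearMap.det (ρ ⁅x, y⁆) = 1 :=
  hom_comm ((LinearMap.det : Module.End k V →* k).comp ρ) x y

/-- scalar-valued maps with determinant one are constant -/
lemma sc_const [Nontrivial V] (hc : Coef R ρ) (hI : Irr R Set.univ) (φ : H → H)
    (hφ : ∀ f ∈ R, (fun x => f (φ x)) ∈ R) (hsc : ∀ y, IsSc (ρ (φ y)))
    (hdet : ∀ y, LinearMap.det (ρ (φ y)) = 1) (x y : H) : ρ (φ x) = ρ (φ y) := by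
  obtain ⟨v, hv⟩ := exists_ne (0 : V)
  obtain ⟨ξ, hξ⟩ : ∃ ξ : Module.Dual k V, ξ v = 1 := by
    obtain ⟨g, hg⟩ := Module.Projective.exists_dual_ne_zero k hv
    exact ⟨(g v)⁻¹ • g, by simp [hg]⟩
  have h1 : ∀ y, ρ (φ y) = ξ (ρ (φ y) v) • (1 : Module.End k V) := by
    intro y
    obtain ⟨c, hc⟩ := hsc y
    rw [hc]; simp [hξ]
  have hd : 0 < Module.finrank k V := Module.finrank_pos
  have := hI.const (hφ _ (hc ξ v)) {c | c ^ Module.finrank k V = 1} (by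
      classical
      refine ((Polynomial.nthRoots (Module.finrank k V) (1 : k)).toFinset.finite_toSet).subset ?_
      intro c hc'
      simpa [Polynomial.mem_nthRoots hd] using hc') (by
      intro s _
      have h3 := hdet s
      rw [h1 s, LinearMap.det_smul] at h3
      simpa using h3) (Set.mem_univ x) (Set.mem_univ y)
  rw [h1 x, this, ← h1 y]
end Rep
end Tits

namespace Tits
set_option linter.unusedSectionVars false
set_option linter.all false
open Filter Pointwise
open scoped commutatorElement
section Pull
variable {H H' k V : Type} [Group H] [Group H'] [Field k] [AddCommGroup V] [Module k V]

def pull (φ : H' →* H) (R : Subalgebra k (H → k)) : Subalgebra k (H' → k) where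
  carrier := {f | ∃ g ∈ R, f = fun x => g (φ x)}
  mul_mem' := by
    rintro _ _ ⟨g, hg, rfl⟩ ⟨g', hg', rfl⟩
    exact ⟨_, R.mul_mem hg hg', rfl⟩
  add_mem' := by
    rintro _ _ ⟨g, hg, rfl⟩ ⟨g', hg', rfl⟩
    exact ⟨_, R.add_mem hg hg', rfl⟩
  algebraMap_mem' := fun r => ⟨_, R.algebraMap_mem r, rfl⟩

lemma pull_reg (φ : H' →* H) {R : Subalgebra k (H → k)} (hR : Reg R) : Reg (pull φ R) := by
  constructor
  · rintro a _ ⟨g, hg, rfl⟩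
    exact ⟨_, hR.left (φ a) g hg, by simp⟩
  · rintro a _ ⟨g, hg, rfl⟩
    exact ⟨_, hR.right (φ a) g hg, by simp⟩
  · rintro _ ⟨g, hg, rfl⟩
    exact ⟨_, hR.inv g hg, by simp⟩
  · rintro a _ ⟨g, hg, rfl⟩
    exact ⟨_, hR.conj (φ a) g hg, by simp⟩

lemma pull_irr (M : Subgroup H) {R : Subalgebra k (H → k)} (h : Irr R (M : Set H)) :
    Irr (pull M.subtype R) Set.univ := by
  rintro _ ⟨g, hg, rfl⟩ _ ⟨g', hg', rfl⟩ ⟨s, -, hs⟩ ⟨t, -, ht⟩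
  obtain ⟨u, hu, h1⟩ := h g hg g' hg' ⟨s, s.2, hs⟩ ⟨t, t.2, ht⟩
  exact ⟨⟨u, hu⟩, trivial, h1⟩

/-- subrepresentation -/
def subRep (φ : H' →* H) (ρ : H →* Module.End k V) (X : Submodule k V)
    (hX : ∀ m, ∀ x ∈ X, ρ (φ m) x ∈ X) : H' →* Module.End k X where
  toFun m := (ρ (φ m)).restrict (hX m)
  map_one' := by ext; simp
  map_mul' a b := by ext; simp

lemma subRep_apply (φ : H' →* H) (ρ : H →* Module.End k V) (X : Submodule k V)
    (hX : ∀ m, ∀ x ∈ X, ρ (φ m) x ∈ X) (m : H') (x : X) :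
    (subRep φ ρ X hX m x : V) = ρ (φ m) x := rfl

lemma subRep_coef (φ : H' →* H) {ρ : H →* Module.End k V} (X : Submodule k V)
    (hX : ∀ m, ∀ x ∈ X, ρ (φ m) x ∈ X) {R : Subalgebra k (H → k)} (hc : Coef R ρ) :
    Coef (pull φ R) (subRep φ ρ X hX) := by
  intro ξ v
  obtain ⟨η, hη⟩ := LinearMap.exists_extend ξ
  refine ⟨_, hc η v, ?_⟩
  ext m
  rw [← hη]; rfl

lemma subRep_isSc (φ : H' →* H) {ρ : H →* Module.End k V} (X : Submodule k V)
    (hX : ∀ m, ∀ x ∈ X, ρ (φ m) x ∈ X) (m : H') (h : IsSc (ρ (φ m))) :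
    IsSc (subRep φ ρ X hX m) := by
  obtain ⟨c, hc⟩ := h
  refine ⟨c, ?_⟩
  ext x
  rw [subRep_apply, hc]; rfl

lemma exists_min_sub [FiniteDimensional k V] [Nontrivial V] (φ : H' →* H) (ρ : H →* Module.End k V) :
    ∃ (X : Submodule k V) (hX : ∀ m, ∀ x ∈ X, ρ (φ m) x ∈ X), X ≠ ⊥ ∧ Simple (subRep φ ρ X hX) ∧
      ∀ Y ≤ X, (∀ m, ∀ x ∈ Y, ρ (φ m) x ∈ Y) → Y = ⊥ ∨ Y = X := by
  obtain ⟨X, ⟨hX, h0⟩, hmin⟩ := (wellFounded_lt (α := Submodule k V)).has_min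
    {X | (∀ m, ∀ x ∈ X, ρ (φ m) x ∈ X) ∧ X ≠ ⊥} ⟨⊤, by simp⟩
  have key : ∀ Y ≤ X, (∀ m, ∀ x ∈ Y, ρ (φ m) x ∈ Y) → Y = ⊥ ∨ Y = X := by
    intro Y hY hinv
    by_contra hcon
    push Not at hcon
    exact hmin Y ⟨hinv, hcon.1⟩ (lt_of_le_of_ne hY hcon.2)
  refine ⟨X, hX, h0, ?_, key⟩
  intro W hW
  rcases key (W.map X.subtype) (Submodule.map_subtype_le X W) (by
    rintro m _ ⟨w, hw, rfl⟩
    exact ⟨_, hW m w hw, rfl⟩) with h | h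
  · left
    apply Submodule.map_injective_of_injective X.injective_subtype
    rw [h]; simp
  · right
    apply Submodule.map_injective_of_injective X.injective_subtype
    rw [h]; simp
end Pull

/-! ### Nested commutators -/
inductive Nest {H : Type} [Group H] : List H → H → Prop
  | single (a : H) : Nest [a] a
  | cons (a : H) (l : List H) (b y : H) : Nest l b → Nest (a :: l) ⁅b, y * a * y⁻¹⁆

lemma Nest.map {H H' : Type} [Group H] [Group H'] (f : H →* H') {l : List H} {b : H} (h : Nest l b) :
    Nest (l.map f) (f b) := by
  induction h with
  | single a => exact Nest.single _
  | cons a l b y _ ih =>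
    have := Nest.cons (f a) _ _ (f y) ih
    simpa [commutatorElement_def, mul_assoc] using this

noncomputable def pairs (J : ℕ) : List (Fin J × Fin J) :=
  (Finset.univ.filter (fun p : Fin J × Fin J => p.1 ≠ p.2)).toList

lemma mem_pairs {J : ℕ} {p : Fin J × Fin J} : p ∈ pairs J ↔ p.1 ≠ p.2 := by simp [pairs]

def ALc {H : Type} [Group H] (J M : ℕ) (P : H → Prop) : Prop :=
  ∃ (z : Fin J → H) (e : Fin J × Fin J → H) (b : H),
    (∀ p ∈ pairs J, Nest (List.replicate M ((z p.1)⁻¹ * z p.2)) (e p)) ∧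
    Nest ((pairs J).map e) b ∧ P b

lemma ALc.map {H H' : Type} [Group H] [Group H'] (f : H →* H') {J M : ℕ} {P : H' → Prop} {Q : H → Prop}
    (hPQ : ∀ b, Q b → P (f b)) (h : ALc J M Q) : ALc J M P := by
  obtain ⟨z, e, b, h1, h2, h3⟩ := h
  refine ⟨f ∘ z, f ∘ e, f b, ?_, ?_, hPQ b h3⟩
  · intro p hp
    simpa using (h1 p hp).map f
  · simpa using h2.map f

section AL
variable {H k V : Type} [Group H] [Field k] [AddCommGroup V] [Module k V]

def Mb (b : H) : Subgroup H := Subgroup.closure (Set.range fun y : H => ⁅y, b⁆)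

lemma mb_normal (b : H) : (Mb b).Normal := by
  constructor
  intro n hn g
  unfold Mb at hn ⊢
  induction hn using Subgroup.closure_induction with
  | mem x hx =>
    obtain ⟨y, rfl⟩ := hx
    have : g * ⁅y, b⁆ * g⁻¹ = ⁅g * y, b⁆ * ⁅g, b⁆⁻¹ := by
      simp only [commutatorElement_def]; group
    simp only [this]
    exact mul_mem (Subgroup.subset_closure ⟨_, rfl⟩) (inv_mem (Subgroup.subset_closure ⟨_, rfl⟩))
  | one => simp
  | mul x y _ _ hx hy =>
    have : g * (x * y) * g⁻¹ = (g * x * g⁻¹) * (g * y * g⁻¹) := by group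
    rw [this]; exact mul_mem hx hy
  | inv x _ hx =>
    have : g * x⁻¹ * g⁻¹ = (g * x * g⁻¹)⁻¹ := by group
    rw [this]; exact inv_mem hx

lemma comm_mem_reg {R : Subalgebra k (H → k)} (hR : Reg R) (b : H) :
    ∀ f ∈ R, (fun y => f ⁅y, b⁆) ∈ R := by
  intro f hf
  exact hR.conj b _ (hR.right b⁻¹ f hf)

lemma mb_irr {R : Subalgebra k (H → k)} (hR : Reg R) (hI : Irr R Set.univ) (b : H) :
    Irr R (Mb b : Set H) := by
  have := Irr.closure hR (fun _ : Unit => Set.range fun y : H => ⁅y, b⁆) (fun _ => by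
    rw [← Set.image_univ]
    exact hI.image _ (comm_mem_reg hR b)) (fun _ => ⟨1, commutatorElement_one_left b⟩)
  rw [Set.iUnion_const] at this
  exact this

variable [FiniteDimensional k V] [IsAlgClosed k] [Nontrivial V]
  {R : Subalgebra k (H → k)} {ρ : H →* Module.End k V}

lemma mb_not_sc (hR : Reg R) (hc : Coef R ρ) (hI : Irr R Set.univ) (hs : Simple ρ) (b : H)
    (hb : ¬ IsSc (ρ b)) : ∃ y : H, ¬ IsSc (ρ ⁅y, b⁆) := by
  by_contra hcon
  push Not at hcon
  apply hb
  apply schur hs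
  intro h
  have := sc_const hc hI (fun y => ⁅y, b⁆) (comm_mem_reg hR b) hcon (fun y => det_comm _ _) h 1
  simp only [commutatorElement_one_left, map_one] at this
  have h2 : h * b = ⁅h, b⁆ * (b * h) := by rw [commutatorElement_def]; group
  rw [← map_mul, h2, map_mul, this, one_mul, map_mul]

lemma nc_step (hR : Reg R) (hc : Coef R ρ) (hI : Irr R Set.univ) (a b : H)
    (hb : Simple (ρ.comp (Mb b).subtype)) (ha : ¬ IsSc (ρ a)) :
    ∃ y, ¬ IsSc (ρ ⁅a, y * b * y⁻¹⁆) := by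
  by_contra hcon
  push Not at hcon
  have hreg : ∀ f ∈ R, (fun y => f ⁅a, y * b * y⁻¹⁆) ∈ R := by
    intro f hf
    have h1 : ∀ y, ⁅a, y * b * y⁻¹⁆ = a * (y * b * y⁻¹ * a⁻¹ * (y * b * y⁻¹)⁻¹) := by
      intro y; rw [commutatorElement_def]; group
    simp only [h1]
    -- use conjugation twice
    have h2 := hR.inv _ (hR.conj a⁻¹ _ (hR.left a f hf))
    have h3 := hR.conj b _ (hR.inv _ h2)
    simpa using h3
  have hconst := sc_const hc hI _ hreg hcon (fun y => det_comm _ _)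
  apply ha
  apply schur hb
  have hgen : ∀ m ∈ Mb b, ρ m * ρ a = ρ a * ρ m := by
    intro m hm
    unfold Mb at hm
    induction hm using Subgroup.closure_induction with
    | mem x hx =>
      obtain ⟨y, rfl⟩ := hx
      obtain ⟨s, hs⟩ := hcon 1
      have e1 : ∀ y, ρ (a * (y * b * y⁻¹)) = s • ρ (y * b * y⁻¹ * a) := by
        intro y
        have : a * (y * b * y⁻¹) = ⁅a, y * b * y⁻¹⁆ * (y * b * y⁻¹ * a) := by
          rw [commutatorElement_def]; group
        rw [this, map_mul, hconst y 1, hs]; simp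
      have hs0 : s ≠ 0 := by
        rintro rfl
        obtain ⟨v, hv⟩ := exists_ne (0 : V)
        have := rho_inv_mul ρ ⁅a, 1 * b * 1⁻¹⁆ v
        rw [hs] at this
        simp at this
        exact hv this.symm
      have e2 : ρ (a * ⁅y, b⁆) * ρ b = s • ρ (⁅y, b⁆ * b * a) := by
        rw [← map_mul, show a * ⁅y, b⁆ * b = a * (y * b * y⁻¹) by rw [commutatorElement_def]; group,
          e1, show ⁅y, b⁆ * b * a = y * b * y⁻¹ * a by rw [commutatorElement_def]; group]
      have e3 : ρ (a * b) = s • ρ (b * a) := by simpa using e1 1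
      have e4 : ρ (⁅y, b⁆ * a) * ρ b = s • ρ (⁅y, b⁆ * b * a) := by
        rw [← map_mul, mul_assoc, map_mul, e3, mul_smul_comm, ← map_mul, mul_assoc]
      have e5 : ρ (a * ⁅y, b⁆) * ρ b * ρ b⁻¹ = ρ (⁅y, b⁆ * a) * ρ b * ρ b⁻¹ := by rw [e2, e4]
      simp only [← map_mul, mul_inv_cancel_right] at e5
      rw [← map_mul, ← map_mul, e5]
    | one => simp
    | mul x y _ _ hx hy => rw [map_mul, mul_assoc, hy, ← mul_assoc, hx, mul_assoc]
    | inv x _ hx =>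
      rw [← map_mul, ← map_mul] at hx ⊢
      have : x⁻¹ * a = x⁻¹ * (a * x) * x⁻¹ := by group
      rw [this, map_mul, map_mul, ← hx, ← map_mul, ← map_mul]
      congr 1; group
  exact fun h => hgen h h.2

lemma nest_exists (hR : Reg R) (hc : Coef R ρ) (hI : Irr R Set.univ)
    (hb : ∀ b, ¬ IsSc (ρ b) → Simple (ρ.comp (Mb b).subtype)) (l : List H) (hl : l ≠ [])
    (hns : ∀ a ∈ l, ¬ IsSc (ρ a)) : ∃ b, Nest l b ∧ ¬ IsSc (ρ b) := by
  induction l with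
  | nil => exact absurd rfl hl
  | cons a l ih =>
    by_cases hl0 : l = []
    · subst hl0
      exact ⟨a, Nest.single a, hns a (by simp)⟩
    · obtain ⟨b, h1, h2⟩ := ih hl0 (fun x hx => hns x (by simp [hx]))
      have ha := hns a (by simp)
      obtain ⟨y, hy⟩ := nc_step hR hc hI b a (hb a ha) h2
      exact ⟨_, Nest.cons a l b y h1, hy⟩

lemma exists_z (hR : Reg R) (hc : Coef R ρ) (hI : Irr R Set.univ) (hex : ∃ a, ¬ IsSc (ρ a)) (J : ℕ) :
    ∃ z : Fin J → H, ∀ i j, i ≠ j → ¬ IsSc (ρ ((z i)⁻¹ * z j)) := by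
  have hinv : ∀ x, IsSc (ρ x) → IsSc (ρ x⁻¹) := by
    rintro x ⟨c, hx⟩
    have hc0 : c ≠ 0 := by
      rintro rfl
      obtain ⟨v, hv⟩ := exists_ne (0 : V)
      have := rho_inv_mul ρ x v
      rw [hx] at this
      simp at this
      exact hv this.symm
    refine ⟨c⁻¹, ?_⟩
    have h1 : ρ x⁻¹ * ρ x = 1 := by rw [← map_mul]; simp
    rw [hx, mul_smul_comm, mul_one] at h1
    rw [← h1, smul_smul, inv_mul_cancel₀ hc0, one_smul]
  induction J with
  | zero => exact ⟨fun _ => 1, fun i => i.elim0⟩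
  | succ J ih =>
    obtain ⟨z, hz⟩ := ih
    obtain ⟨a, ha⟩ := hex
    obtain ⟨v, ξ, h1, h2⟩ := exists_of_not_isSc ha
    obtain ⟨x, -, hx⟩ := hI.exists_all ⟨1, trivial⟩ (Finset.univ : Finset (Fin J))
      (fun i g => ξ (ρ ((z i)⁻¹ * g) v)) (fun i _ => hR.left _ _ (hc ξ v))
      (fun i _ => ⟨z i * a, trivial, by simpa using h2⟩)
    have hx' : ∀ i, ¬ IsSc (ρ ((z i)⁻¹ * x)) := by
      rintro i ⟨c, hc'⟩
      apply hx i (Finset.mem_univ i)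
      simp only [hc']
      simp [h1]
    refine ⟨Fin.snoc z x, ?_⟩
    intro i j
    refine Fin.lastCases ?_ (fun i => ?_) i <;> refine Fin.lastCases ?_ (fun j => ?_) j
    · intro h; exact absurd rfl h
    · intro _ h
      rw [Fin.snoc_last, Fin.snoc_castSucc] at h
      apply hx' j
      simpa using hinv _ h
    · intro _
      rw [Fin.snoc_last, Fin.snoc_castSucc]
      exact hx' i
    · intro h
      rw [Fin.snoc_castSucc, Fin.snoc_castSucc]
      exact hz i j (by rintro rfl; exact h rfl)

end AL

/-- **Almost law lemma** -/
theorem almost_law (J M : ℕ) (hJ : 2 ≤ J) (hM : 1 ≤ M) (k : Type) [Field k] [IsAlgClosed k] (d : ℕ) :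
    ∀ (H V : Type) [Group H] [AddCommGroup V] [Module k V] [FiniteDimensional k V]
      (R : Subalgebra k (H → k)) (ρ : H →* Module.End k V), Reg R → Coef R ρ → Irr R Set.univ →
      Simple ρ → Module.finrank k V = d → 2 ≤ d → ALc J M (fun b => ¬ IsSc (ρ b)) := by
  induction d using Nat.strong_induction_on with
  | _ d ih =>
  intro H V _ _ _ _ R ρ hR hc hI hs hd h2
  haveI : Nontrivial V := Module.nontrivial_of_finrank_pos (R := k) (by omega)
  by_cases hB : ∀ b, ¬ IsSc (ρ b) → Simple (ρ.comp (Mb b).subtype)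
  · have hex : ∃ a, ¬ IsSc (ρ a) := by
      by_contra hcon
      push Not at hcon
      obtain ⟨v, hv⟩ := exists_ne (0 : V)
      rcases hs (Submodule.span k {v}) (by
        intro h w hw
        obtain ⟨c, hc⟩ := hcon h
        rw [hc]
        exact Submodule.smul_mem _ _ hw) with h | h
      · exact hv (by simpa using h)
      · have := finrank_span_singleton (K := k) hv
        rw [h, finrank_top] at this
        omega
    obtain ⟨z, hz⟩ := exists_z hR hc hI hex J
    have he : ∀ p : Fin J × Fin J, ∃ e, p ∈ pairs J →
        Nest (List.replicate M ((z p.1)⁻¹ * z p.2)) e ∧ ¬ IsSc (ρ e) := by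
      intro p
      by_cases hp : p ∈ pairs J
      · obtain ⟨e, h1, h2⟩ := nest_exists hR hc hI hB (List.replicate M ((z p.1)⁻¹ * z p.2))
          (by simp; omega) (by
            intro a ha
            rw [List.eq_of_mem_replicate ha]
            exact hz _ _ (mem_pairs.mp hp))
        exact ⟨e, fun _ => ⟨h1, h2⟩⟩
      · exact ⟨1, fun h => absurd h hp⟩
    choose e he using he
    obtain ⟨b, h1, h2⟩ := nest_exists hR hc hI hB ((pairs J).map e) (by
        have : ((⟨0, by omega⟩, ⟨1, by omega⟩) : Fin J × Fin J) ∈ pairs J := by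
          rw [mem_pairs]; simp
        intro h
        rw [List.map_eq_nil_iff] at h
        rw [h] at this
        simp at this) (by
        intro a ha
        obtain ⟨p, hp, rfl⟩ := List.mem_map.mp ha
        exact (he p hp).2)
    exact ⟨z, e, b, fun p hp => (he p hp).1, h1, h2⟩
  · push Not at hB
    obtain ⟨b, hb, hbs⟩ := hB
    obtain ⟨X, hX, hX0, hXs, hXm⟩ := exists_min_sub (Mb b).subtype ρ
    have hne : X ≠ ⊤ := by
      rintro rfl
      apply hbs
      intro W hW
      exact hXm W le_top (fun m x hx => hW m x hx)
    have hlt : Module.finrank k X < d := by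
      rw [← hd]; exact Submodule.finrank_lt hne
    have hge : 2 ≤ Module.finrank k X := by
      by_contra hcon
      have hpos : 0 < Module.finrank k X := by
        haveI := (Submodule.nontrivial_iff_ne_bot).mpr hX0
        exact Module.finrank_pos
      have h1 : Module.finrank k X = 1 := by omega
      obtain ⟨v, hv0, hv⟩ := finrank_eq_one_iff'.mp h1
      obtain ⟨y, hy⟩ := mb_not_sc hR hc hI hs b hb
      apply hy
      apply eig_scalar hR hc hI hs (Mb b) (mb_normal b) (v : V) (by simpa using hv0) ?_ _
        (Subgroup.subset_closure ⟨y, rfl⟩)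
      intro m hm
      obtain ⟨c, hc⟩ := hv ⟨ρ m v, hX ⟨m, hm⟩ v v.2⟩
      refine ⟨c, ?_⟩
      have := congrArg Subtype.val hc
      simpa using this.symm
    have := ih _ hlt (Mb b) X (pull (Mb b).subtype R) (subRep (Mb b).subtype ρ X hX)
      (pull_reg _ hR) (subRep_coef _ X hX hc) (pull_irr _ (mb_irr hR hI b)) hXs rfl hge
    refine this.map (Mb b).subtype ?_
    intro c hc' h
    exact hc' (subRep_isSc _ X hX c h)
end Tits

namespace Tits
set_option linter.unusedSectionVars false
set_option linter.all false
open Filter Pointwise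
open scoped commutatorElement
section Comm
variable {H k V : Type} [Group H] [Field k] [AddCommGroup V] [Module k V]
  [FiniteDimensional k V] [IsAlgClosed k] [Nontrivial V]
  {R : Subalgebra k (H → k)} {ρ : H →* Module.End k V}

lemma eig_conj (z : Module.End k V) (h : H) (c : k) (hc : (ρ h * z * ρ h⁻¹).HasEigenvalue c) :
    z.HasEigenvalue c := by
  obtain ⟨v, hv, hv0⟩ := hc.exists_hasEigenvector
  rw [Module.End.mem_eigenspace_iff] at hv
  apply Module.End.hasEigenvalue_of_hasEigenvector (x := ρ h⁻¹ v)
  refine ⟨Module.End.mem_eigenspace_iff.mpr ?_, ?_⟩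
  · have := congrArg (ρ h⁻¹) hv
    simp only [Module.End.mul_apply, rho_inv_mul, map_smul] at this
    exact this
  · intro h0
    apply hv0
    rw [← rho_mul_inv ρ h v, h0, map_zero]

lemma affine_scalar (hR : Reg R) (hc : Coef R ρ) (hI : Irr R Set.univ) (hs : Simple ρ)
    (z : Module.End k V)
    (hz : ∀ h, ∃ c β : k, ρ h * z * ρ h⁻¹ = c • z + β • (1 : Module.End k V)) : IsSc z := by
  have haff : ∀ h (c β : k), ρ h * z * ρ h⁻¹ = c • z + β • (1 : Module.End k V) →
      ∀ s, z.HasEigenvalue s → z.HasEigenvalue (c * s + β) := by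
    intro h c β he s hs'
    apply eig_conj (ρ := ρ) z h
    rw [he]
    obtain ⟨v, hv, hv0⟩ := hs'.exists_hasEigenvector
    rw [Module.End.mem_eigenspace_iff] at hv
    apply Module.End.hasEigenvalue_of_hasEigenvector (x := v)
    refine ⟨Module.End.mem_eigenspace_iff.mpr ?_, hv0⟩
    simp [hv, add_smul, mul_smul]
  obtain ⟨s, hs1⟩ := Module.End.exists_eigenvalue z
  by_cases h1 : ∃ t, z.HasEigenvalue t ∧ t ≠ s
  · obtain ⟨t, ht, hts⟩ := h1
    apply schur hs
    apply conj_const hR hc hI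
    have hfin : {c | z.HasEigenvalue c}.Finite := Module.End.finite_hasEigenvalue _
    refine ((hfin.prod hfin).image (fun p : k × k => ((p.1 - p.2) / (t - s)) • z +
      (p.1 - ((p.1 - p.2) / (t - s)) * t) • (1 : Module.End k V))).subset ?_
    rintro _ ⟨h, rfl⟩
    obtain ⟨c, β, he⟩ := hz h
    refine ⟨(c * t + β, c * s + β), ⟨haff h c β he t ht, haff h c β he s hs1⟩, ?_⟩
    have hts' : t - s ≠ 0 := sub_ne_zero.mpr hts
    have e1 : (c * t + β - (c * s + β)) / (t - s) = c := by field_simp; ring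
    simp only [e1, he]
    congr 2; ring
  · push Not at h1
    have hinv : ∀ h, ∀ w ∈ z.eigenspace s, ρ h w ∈ z.eigenspace s := by
      intro h w hw
      obtain ⟨c, β, he⟩ := hz h⁻¹
      have e1 := h1 _ (haff _ c β he s hs1)
      rw [Module.End.mem_eigenspace_iff] at hw ⊢
      have e2 := congrArg (fun f : Module.End k V => ρ h (f w)) he
      simp only [Module.End.mul_apply, inv_inv, rho_mul_inv, LinearMap.add_apply,
        LinearMap.smul_apply, hw, Module.End.one_apply] at e2
      rw [e2, smul_smul, ← add_smul, e1, map_smul]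
    rcases hs _ hinv with h | h
    · exact absurd h hs1
    · refine ⟨s, LinearMap.ext fun v => ?_⟩
      have : v ∈ z.eigenspace s := by rw [h]; trivial
      simpa [Module.End.mem_eigenspace_iff] using this

/-- conjugation action on endomorphisms -/
def conjRep (ρ : H →* Module.End k V) : H →* Module.End k (Module.End k V) where
  toFun h := LinearMap.mulLeft k (ρ h) ∘ₗ LinearMap.mulRight k (ρ h⁻¹)
  map_one' := by ext; simp
  map_mul' a b := by ext; simp [mul_assoc]

lemma conjRep_apply (h : H) (z : Module.End k V) : conjRep ρ h z = ρ h * z * ρ h⁻¹ := by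
  simp [conjRep, mul_assoc]

lemma commutant_scalar (hR : Reg R) (hc : Coef R ρ) (hI : Irr R Set.univ) (hs : Simple ρ)
    (z : Module.End k V) (hz : ∀ d ∈ commutator H, ρ d * z = z * ρ d) : IsSc z := by
  by_contra hzs
  let C : Submodule k (Module.End k V) :=
    { carrier := {z | ∀ d ∈ commutator H, ρ d * z = z * ρ d}
      zero_mem' := by intro d _; simp
      add_mem' := by
        intro a b ha hb d hd
        rw [mul_add, add_mul, ha d hd, hb d hd]
      smul_mem' := by
        intro c a ha d hd
        rw [mul_smul_comm, smul_mul_assoc, ha d hd] }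
  have hCinv : ∀ h, ∀ x ∈ C, conjRep ρ h x ∈ C := by
    intro h x hx d hd
    have hd' : h⁻¹ * d * h ∈ commutator H := by
      simpa using (inferInstance : (commutator H).Normal).conj_mem d hd h⁻¹
    have := hx _ hd'
    rw [conjRep_apply]
    calc ρ d * (ρ h * x * ρ h⁻¹) = ρ h * (ρ (h⁻¹ * d * h) * x) * ρ h⁻¹ := by
          simp only [← mul_assoc, ← map_mul]; congr 3; group
      _ = ρ h * x * ρ h⁻¹ * ρ d := by
          rw [this]; simp only [mul_assoc, ← map_mul]; congr 3; group
  let S : Submodule k (Module.End k V) := Submodule.span k {1}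
  have hSinv : ∀ h, S ≤ S.comap (conjRep ρ h) := by
    intro h
    rw [Submodule.span_le]
    rintro _ rfl
    simp only [Submodule.comap_coe, Set.mem_preimage, conjRep_apply, mul_one, ← map_mul,
      mul_inv_cancel, map_one]
    exact Submodule.subset_span rfl
  let τ : H →* Module.End k (Module.End k V ⧸ S) :=
    { toFun := fun h => S.mapQ S (conjRep ρ h) (hSinv h)
      map_one' := by ext; simp
      map_mul' := by intro a b; ext; simp }
  let Cb := C.map S.mkQ
  have hCb : ∀ h, ∀ x ∈ Cb, τ ((MonoidHom.id H) h) x ∈ Cb := by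
    rintro h _ ⟨x, hx, rfl⟩
    exact ⟨conjRep ρ h x, hCinv h x hx, rfl⟩
  let σ := subRep (MonoidHom.id H) τ Cb hCb
  have hcomm : ∀ g h, σ g * σ h = σ h * σ g := by
    intro g h
    ext ⟨x, hx⟩
    obtain ⟨y, hy, rfl⟩ := hx
    have e : conjRep ρ g (conjRep ρ h y) = conjRep ρ h (conjRep ρ g y) := by
      simp only [conjRep_apply]
      have hd : (h * g)⁻¹ * (g * h) ∈ commutator H := by
        have : (h * g)⁻¹ * (g * h) = ⁅g⁻¹, h⁻¹⁆ := by rw [commutatorElement_def]; group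
        rw [this, commutator_def]
        exact Subgroup.commutator_mem_commutator trivial trivial
      have := hy _ hd
      calc ρ g * (ρ h * y * ρ h⁻¹) * ρ g⁻¹ = ρ (h * g) * (ρ ((h * g)⁻¹ * (g * h)) * y) * ρ (g * h)⁻¹ := by
            simp only [← mul_assoc, ← map_mul]
            rw [mul_assoc _ (ρ h⁻¹), ← map_mul]; congr 3 <;> group
        _ = ρ h * (ρ g * y * ρ g⁻¹) * ρ h⁻¹ := by
            rw [this]; simp only [mul_assoc, ← map_mul]
            rw [← mul_assoc (ρ h), ← map_mul]; congr 3; group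
    exact congrArg S.mkQ e
  haveI : Nontrivial Cb := by
    refine ⟨⟨⟨S.mkQ z, ⟨z, hz, rfl⟩⟩, 0, ?_⟩⟩
    intro h0
    have h0 : S.mkQ z = 0 := congrArg Subtype.val h0
    rw [Submodule.mkQ_apply, Submodule.Quotient.mk_eq_zero, Submodule.mem_span_singleton] at h0
    obtain ⟨c, hc'⟩ := h0
    exact hzs ⟨c, hc'.symm⟩
  obtain ⟨X, hX, hX0, hXs, -⟩ := exists_min_sub (MonoidHom.id H) σ
  haveI := (Submodule.nontrivial_iff_ne_bot).mpr hX0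
  obtain ⟨v, hv⟩ := exists_ne (0 : X)
  obtain ⟨⟨_, ⟨y, hy, rfl⟩⟩, hvX⟩ := v
  have hys : IsSc y := by
    apply affine_scalar hR hc hI hs
    intro h
    obtain ⟨c, hc'⟩ := schur hXs (subRep (MonoidHom.id H) σ X hX h) (by
      intro g
      ext x
      have := congrArg (fun f => f (x : Cb)) (hcomm g h)
      exact congrArg Subtype.val this)
    have e1 := congrArg (fun f => f (⟨⟨_, ⟨y, hy, rfl⟩⟩, hvX⟩ : X)) hc'
    have e2 : S.mkQ (conjRep ρ h y) = c • S.mkQ y :=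
      congrArg (fun w : X => ((w : Cb) : Module.End k V ⧸ S)) e1
    rw [← map_smul, ← sub_eq_zero, ← map_sub, Submodule.mkQ_apply, Submodule.Quotient.mk_eq_zero,
      Submodule.mem_span_singleton] at e2
    obtain ⟨β, hβ⟩ := e2
    refine ⟨c, β, ?_⟩
    rw [hβ, ← conjRep_apply]; abel
  obtain ⟨c, hc'⟩ := hys
  apply hv
  apply Subtype.ext
  apply Subtype.ext
  change S.mkQ y = 0
  rw [Submodule.mkQ_apply, Submodule.Quotient.mk_eq_zero, Submodule.mem_span_singleton]
  exact ⟨c, hc'.symm⟩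

theorem span_commutator (hR : Reg R) (hc : Coef R ρ) (hI : Irr R Set.univ) (hs : Simple ρ) :
    Submodule.span k (ρ '' (commutator H : Set H)) = ⊤ := by
  let A : Subalgebra k (Module.End k V) := Algebra.adjoin k (ρ '' (commutator H : Set H))
  have hspan : Subalgebra.toSubmodule A = Submodule.span k (ρ '' (commutator H : Set H)) := by
    rw [Algebra.adjoin_eq_span]
    congr 1
    have : ρ '' (commutator H : Set H) = ((commutator H).toSubmonoid.map ρ : Set _) := rfl
    rw [this, Submonoid.closure_eq]
  rw [← hspan]
  have hAmem : ∀ d ∈ commutator H, ρ d ∈ A := fun d hd => Algebra.subset_adjoin ⟨d, hd, rfl⟩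
  -- A-submodules are the D-invariant submodules
  let mk : ∀ X : Submodule k V, (∀ d ∈ commutator H, ∀ x ∈ X, ρ d x ∈ X) → Submodule A V :=
    fun X hX =>
      { carrier := X
        zero_mem' := X.zero_mem
        add_mem' := X.add_mem
        smul_mem' := by
          rintro ⟨a, ha⟩ x hx
          change a x ∈ X
          have ha' : a ∈ Submodule.span k (ρ '' (commutator H : Set H)) := by rw [← hspan]; exact ha
          induction ha' using Submodule.span_induction with
          | mem y hy => obtain ⟨d, hd, rfl⟩ := hy; exact hX d hd x hx
          | zero => simp
          | add y z h1 h2 hy hz =>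
            exact X.add_mem (hy (by rw [← hspan] at h1; exact h1)) (hz (by rw [← hspan] at h2; exact h2))
          | smul c y h1 hy => exact X.smul_mem c (hy (by rw [← hspan] at h1; exact h1)) }
  have hDinv : ∀ (Y : Submodule A V), ∀ d ∈ commutator H, ∀ x ∈ Y, ρ d x ∈ Y :=
    fun Y d hd x hx => Y.smul_mem ⟨ρ d, hAmem d hd⟩ hx
  let tr : H → Submodule A V → Submodule A V := fun h Y =>
    mk ((Y.restrictScalars k).comap (ρ h)) (by
      intro d hd x hx
      change ρ h (ρ d x) ∈ Y
      have hd' : h * d * h⁻¹ ∈ commutator H := (inferInstance : (commutator H).Normal).conj_mem d hd h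
      have := hDinv Y _ hd' _ hx
      rw [← rho_mul, inv_mul_cancel_right, rho_mul] at this
      exact this)
  have htr : ∀ h Y x, x ∈ tr h Y ↔ ρ h x ∈ Y := fun h Y x => Iff.rfl
  let E : H → Submodule A V ≃o Submodule A V := fun h =>
    { toFun := tr h
      invFun := tr h⁻¹
      left_inv := by intro Y; ext x; rw [htr, htr, rho_mul_inv]
      right_inv := by intro Y; ext x; rw [htr, htr, rho_inv_mul]
      map_rel_iff' := by
        intro Y Z
        constructor
        · intro h1 x hx
          have := h1 (show ρ h⁻¹ x ∈ tr h Y by rw [htr, rho_mul_inv]; exact hx)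
          have := (htr _ _ _).mp this
          rwa [rho_mul_inv] at this
        · intro h1 x hx
          exact h1 hx }
  have hss : IsSemisimpleModule A V := by
    rw [← sSup_simples_eq_top_iff_isSemisimpleModule]
    simp only [isSimpleModule_iff_isAtom]
    set S := sSup {m : Submodule A V | IsAtom m} with hS
    have hE : ∀ h, tr h S = S := by
      intro h
      have : (E h) S = S := by
        rw [hS, OrderIso.map_sSup]
        apply le_antisymm
        · refine iSup₂_le fun Y hY => le_sSup ?_
          exact (OrderIso.isAtom_iff (E h) Y).mpr hY
        · refine sSup_le fun Y hY => ?_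
          have hY' : IsAtom ((E h).symm Y) := (OrderIso.isAtom_iff (E h).symm Y).mpr hY
          have := le_iSup₂ (f := fun (Z : Submodule A V) (_ : Z ∈ {m : Submodule A V | IsAtom m}) => E h Z)
            ((E h).symm Y) hY'
          simpa using this
      exact this
    rcases hs (S.restrictScalars k) (by
      intro h w hw
      have : w ∈ tr h S := by rw [hE]; exact hw
      exact this) with h | h
    · exfalso
      obtain ⟨X, hX, hX0, -, hXm⟩ := exists_min_sub (commutator H).subtype ρ
      have hat : IsAtom (mk X (fun d hd => hX ⟨d, hd⟩)) := by
        constructor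
        · intro h0
          apply hX0
          rw [eq_bot_iff]
          intro x hx
          have : x ∈ (⊥ : Submodule A V) := by rw [← h0]; exact hx
          simpa using this
        · intro Y hY
          rcases hXm (Y.restrictScalars k) (fun x hx => hY.le hx) (fun m x hx => hDinv Y m m.2 x hx) with h | h
          · simpa using h
          · exfalso
            apply hY.ne
            ext x
            have : x ∈ Y.restrictScalars k ↔ x ∈ X := by rw [h]
            exact this
      have hle := le_sSup (s := {m : Submodule A V | IsAtom m}) hat
      apply hX0
      rw [eq_bot_iff, ← h]
      intro x hx
      exact hle hx
    · simpa using h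
  have hcom : ∀ f : Module.End A V, ∃ c : k, ∀ v, f v = c • v := by
    intro f
    obtain ⟨c, hc'⟩ := commutant_scalar hR hc hI hs (f.restrictScalars k) (by
      intro d hd
      ext v
      exact (f.map_smul ⟨ρ d, hAmem d hd⟩ v).symm)
    exact ⟨c, fun v => congrArg (fun g : Module.End k V => g v) hc'⟩
  rw [eq_top_iff]
  intro g _
  let g' : Module.End (Module.End A V) V :=
    { toFun := g
      map_add' := g.map_add
      map_smul' := by
        intro f v
        obtain ⟨c, hc'⟩ := hcom f
        simp [hc'] }
  classical
  let b := Module.finBasis k V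
  obtain ⟨r, hr⟩ := jacobson_density (R := A) g' (Finset.univ.image b)
  have : g = (r : Module.End k V) := by
    apply b.ext
    intro i
    exact hr (b i) (by simp)
  rw [this]
  exact r.2
end Comm
end Tits

namespace Tits
set_option linter.unusedSectionVars false
set_option linter.all false
open Filter Pointwise
open scoped commutatorElement

/-! ### Virtually solvable groups -/
def VS (G : Type*) [Group G] : Prop := ∃ H : Subgroup G, H.FiniteIndex ∧ Group.IsSolvable H

lemma fi_comap {G G' : Type*} [Group G] [Group G'] (f : G →* G') (H : Subgroup G') [H.FiniteIndex] :
    (H.comap f).FiniteIndex := by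
  constructor
  rw [Subgroup.index_comap]
  exact (inferInstance : (H.subgroupOf f.range).FiniteIndex).index_ne_zero

lemma VS.of_inj {G G' : Type*} [Group G] [Group G'] (f : G →* G') (hf : Function.Injective f)
    (h : VS G') : VS G := by
  obtain ⟨H, hH, hs⟩ := h
  refine ⟨H.comap f, fi_comap f H, ?_⟩
  let φ : (H.comap f) →* H := (f.subgroupComap H)
  exact solvable_of_solvable_injective (f := φ) (by
    intro x y hxy
    apply Subtype.ext; apply hf
    exact congrArg Subtype.val hxy)

lemma VS.of_finiteIndex {G : Type*} [Group G] (K : Subgroup G) [hK : K.FiniteIndex] (h : VS K) : VS G := by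
  obtain ⟨H, hH, hs⟩ := h
  refine ⟨H.map K.subtype, ?_, ?_⟩
  · constructor
    rw [Subgroup.index_map]
    simp
    exact ⟨hH.index_ne_zero, hK.index_ne_zero⟩
  · exact solvable_of_surjective (f := (K.subtype).subgroupMap H) ((K.subtype).subgroupMap_surjective H)

lemma VS.of_two {G G₁ G₂ : Type*} [Group G] [Group G₁] [Group G₂] (f : G →* G₁) (g : G →* G₂)
    (h₁ : VS f.range) (h₂ : VS g.range) (hc : ∀ x y : G, f x = 1 → g x = 1 → f y = 1 → g y = 1 → x * y = y * x) :
    VS G := by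
  obtain ⟨H₁, hH₁, hs₁⟩ := h₁
  obtain ⟨H₂, hH₂, hs₂⟩ := h₂
  let K : Subgroup G := H₁.comap f.rangeRestrict ⊓ H₂.comap g.rangeRestrict
  haveI := fi_comap f.rangeRestrict H₁
  haveI := fi_comap g.rangeRestrict H₂
  refine ⟨K, inferInstance, ?_⟩
  let φ : K →* H₁ × H₂ := MonoidHom.prod
    ((f.rangeRestrict.subgroupComap H₁).comp (Subgroup.inclusion inf_le_left))
    ((g.rangeRestrict.subgroupComap H₂).comp (Subgroup.inclusion inf_le_right))
  have : Group.IsSolvable φ.ker := by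
    apply Group.isSolvable_of_comm
    rintro ⟨⟨x, hx⟩, hx'⟩ ⟨⟨y, hy⟩, hy'⟩
    apply Subtype.ext; apply Subtype.ext
    simp [φ, MonoidHom.mem_ker, Prod.ext_iff] at hx' hy'
    have hx1 := congrArg Subtype.val (congrArg Subtype.val hx'.1)
    have hx2 := congrArg Subtype.val (congrArg Subtype.val hx'.2)
    have hy1 := congrArg Subtype.val (congrArg Subtype.val hy'.1)
    have hy2 := congrArg Subtype.val (congrArg Subtype.val hy'.2)
    exact hc x y hx1 hx2 hy1 hy2
  exact solvable_of_ker_le_range (φ.ker.subtype) φ (by simp)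

lemma VS.of_comm {G : Type*} [Group G] (h : ∀ x y : G, x * y = y * x) : VS G :=
  ⟨⊤, inferInstance, Group.isSolvable_of_comm (fun x y => Subtype.ext (h x y))⟩

lemma VS.of_finite {G : Type*} [Group G] [Finite G] : VS G :=
  ⟨⊥, inferInstance, inferInstance⟩

/-! ### products of bounded length -/
def Pw {G : Type*} [Group G] (F : Set G) (N : ℕ) : Set G :=
  {x | ∃ l : List G, l.length ≤ N ∧ (∀ g ∈ l, g ∈ F) ∧ l.prod = x}

def FreePair {G : Type*} [Group G] (x y : G) : Prop :=
  Function.Injective ⇑(FreeGroup.lift (fun i : Fin 2 => if i = 0 then x else y))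

section Pw
variable {G G' : Type*} [Group G] [Group G'] {F : Set G}
lemma Pw.mul {a b : ℕ} {x y : G} (hx : x ∈ Pw F a) (hy : y ∈ Pw F b) : x * y ∈ Pw F (a + b) := by
  obtain ⟨l, h1, h2, rfl⟩ := hx
  obtain ⟨m, h3, h4, rfl⟩ := hy
  refine ⟨l ++ m, by simp; omega, ?_, by simp⟩
  intro g hg
  rcases List.mem_append.mp hg with h | h
  exacts [h2 g h, h4 g h]
lemma Pw.of_mem {x : G} (hx : x ∈ F) : x ∈ Pw F 1 := ⟨[x], by simp, by simpa using hx, by simp⟩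
lemma Pw.one (n : ℕ) : (1 : G) ∈ Pw F n := ⟨[], by simp, by simp, by simp⟩
lemma Pw.mono {a b : ℕ} (h : a ≤ b) : Pw F a ⊆ Pw F b := by
  rintro x ⟨l, h1, h2, h3⟩; exact ⟨l, h1.trans h, h2, h3⟩
lemma Pw.inv (hF : ∀ f ∈ F, f⁻¹ ∈ F) {a : ℕ} {x : G} (hx : x ∈ Pw F a) : x⁻¹ ∈ Pw F a := by
  obtain ⟨l, h1, h2, rfl⟩ := hx
  refine ⟨(l.map (·⁻¹)).reverse, by simpa using h1, ?_, by rw [List.prod_inv_reverse]⟩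
  intro g hg
  simp at hg
  have := hF _ (h2 _ hg); simpa using this
lemma Pw.pw {a b : ℕ} {S : Set G} (hS : S ⊆ Pw F a) {x : G} (hx : x ∈ Pw S b) : x ∈ Pw F (a * b) := by
  obtain ⟨l, h1, h2, rfl⟩ := hx
  suffices ∀ l : List G, (∀ g ∈ l, g ∈ S) → l.prod ∈ Pw F (a * l.length) from
    Pw.mono (Nat.mul_le_mul_left a h1) (this l h2)
  intro l
  induction l with
  | nil => intro _; exact Pw.one _
  | cons g l ih =>
    intro h
    simp only [List.mem_cons, forall_eq_or_imp] at h
    have := Pw.mul (hS h.1) (ih h.2)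
    rw [List.prod_cons, List.length_cons, Nat.mul_succ, add_comm]; exact this
lemma Pw.finite (hF : F.Finite) (n : ℕ) : (Pw F n).Finite := by
  induction n with
  | zero =>
    apply (Set.finite_singleton (1 : G)).subset
    rintro x ⟨l, h1, h2, rfl⟩
    simp at h1; simp [h1]
  | succ n ih =>
    apply ((Set.finite_singleton (1 : G)).union (hF.mul ih)).subset
    rintro x ⟨l, h1, h2, rfl⟩
    cases l with
    | nil => simp
    | cons g l =>
      simp at h1 h2
      right
      rw [List.prod_cons]
      exact Set.mul_mem_mul h2.1 ⟨l, h1, h2.2, rfl⟩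
lemma Pw.le_closure (n : ℕ) : Pw F n ⊆ Subgroup.closure F := by
  rintro x ⟨l, h1, h2, rfl⟩
  exact Subgroup.list_prod_mem _ (fun g hg => Subgroup.subset_closure (h2 g hg))
lemma Pw.image (f : G →* G') {n : ℕ} {y : G'} (hy : y ∈ Pw (f '' F) n) : ∃ x ∈ Pw F n, f x = y := by
  obtain ⟨l, h1, h2, rfl⟩ := hy
  choose! s hs using h2
  refine ⟨(l.map s).prod, ⟨l.map s, by simpa using h1, ?_, rfl⟩, ?_⟩
  · intro g hg
    obtain ⟨a, ha, rfl⟩ := List.mem_map.mp hg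
    exact (hs a ha).1
  · rw [map_list_prod, List.map_map]
    congr 1
    conv_rhs => rw [← List.map_id l]
    apply List.map_congr_left
    intro a ha; exact (hs a ha).2
lemma FreePair.of_map (f : G →* G') {x y : G} (h : FreePair (f x) (f y)) : FreePair x y := by
  intro a b hab
  apply h
  have e : FreeGroup.lift (fun i : Fin 2 => if i = 0 then f x else f y) =
      f.comp (FreeGroup.lift (fun i : Fin 2 => if i = 0 then x else y)) := by
    ext i; simp; split_ifs <;> rfl
  rw [e]; simp only [MonoidHom.comp_apply]; rw [hab]
end Pw

/-- The property to be proved. -/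
def Prp (d : ℕ) : Prop := ∃ N : ℕ, ∀ (K : Type) [Field K], ∀ F : Set (GL (Fin d) K),
  F.Finite → (1 : GL (Fin d) K) ∈ F → (∀ f ∈ F, f⁻¹ ∈ F) →
    ((∃ x y, x ∈ Pw F N ∧ y ∈ Pw F N ∧ FreePair x y) ∨ VS (Subgroup.closure F))

structure Bad {d : ℕ} {Ω : ℕ → Type} [∀ n, Field (Ω n)] (F : ∀ n, Set (GL (Fin d) (Ω n))) : Prop where
  fin : ∀ n, (F n).Finite
  one : ∀ n, 1 ∈ F n
  symm : ∀ n, ∀ f ∈ F n, f⁻¹ ∈ F n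
  nofree : ∀ n x y, x ∈ Pw (F n) n → y ∈ Pw (F n) n → ¬ FreePair x y
  nvs : ∀ n, ¬ VS (Subgroup.closure (F n))

lemma exists_bad {d : ℕ} (h : ¬ Prp d) : ∃ (Ω : ℕ → Type) (_ : ∀ n, Field (Ω n)) (_ : ∀ n, IsAlgClosed (Ω n))
    (F : ∀ n, Set (GL (Fin d) (Ω n))), Bad F := by
  unfold Prp at h
  push Not at h
  choose K hK F hF1 hF2 hF3 hF4 hF5 using h
  let j : ∀ n, GL (Fin d) (K n) →* GL (Fin d) (AlgebraicClosure (K n)) := fun n =>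
    Matrix.GeneralLinearGroup.map (algebraMap (K n) (AlgebraicClosure (K n)))
  have hj : ∀ n, Function.Injective (j n) := by
    intro n x y hxy
    apply Units.ext
    ext a b
    have := congrArg (fun z : GL (Fin d) (AlgebraicClosure (K n)) => z.val a b) hxy
    simp [j] at this
    exact this
  refine ⟨fun n => AlgebraicClosure (K n), fun n => inferInstance, fun n => inferInstance,
    fun n => j n '' F n, ?_, ?_, ?_, ?_, ?_⟩
  · intro n; exact (hF1 n).image _
  · intro n; exact ⟨1, hF2 n, map_one _⟩
  · rintro n _ ⟨f, hf, rfl⟩; exact ⟨f⁻¹, hF3 n f hf, map_inv _ _⟩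
  · intro n x y hx hy hxy
    obtain ⟨x', hx', rfl⟩ := Pw.image (j n) hx
    obtain ⟨y', hy', rfl⟩ := Pw.image (j n) hy
    exact hF4 n x' y' hx' hy' (hxy.of_map)
  · intro n hvs
    rw [← MonoidHom.map_closure] at hvs
    exact hF5 n (VS.of_inj ((j n).subgroupMap (Subgroup.closure (F n))) (by
      intro x y hxy
      apply Subtype.ext; apply hj n; exact congrArg Subtype.val hxy) hvs)

section Gam
variable {d : ℕ} {Ω : ℕ → Type} [∀ n, Field (Ω n)] (F : ∀ n, Set (GL (Fin d) (Ω n)))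
def Gam : Subgroup (∀ n, GL (Fin d) (Ω n)) := Subgroup.closure {f | ∀ n, f n ∈ F n}

variable {F}
lemma Gam.pw (hF : ∀ n, ∀ f ∈ F n, f⁻¹ ∈ F n) {x : ∀ n, GL (Fin d) (Ω n)} (hx : x ∈ Gam F) :
    ∃ c, ∀ n, x n ∈ Pw (F n) c := by
  induction hx using Subgroup.closure_induction with
  | mem x hx => exact ⟨1, fun n => Pw.of_mem (hx n)⟩
  | one => exact ⟨0, fun n => Pw.one _⟩
  | mul x y _ _ hx hy =>
    obtain ⟨a, ha⟩ := hx
    obtain ⟨b, hb⟩ := hy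
    exact ⟨a + b, fun n => Pw.mul (ha n) (hb n)⟩
  | inv x _ hx =>
    obtain ⟨a, ha⟩ := hx
    exact ⟨a, fun n => Pw.inv (hF n) (ha n)⟩

variable (U : Ultrafilter ℕ) (F)
noncomputable def rho : Gam F →* Matrix (Fin d) (Fin d) (Ult U Ω) where
  toFun x := umat U (fun n => ((x : ∀ n, GL (Fin d) (Ω n)) n : Matrix (Fin d) (Fin d) (Ω n)))
  map_one' := umat_one U
  map_mul' x y := by rw [← umat_mul]; rfl

lemma ev_forall {α : ℕ → Type*} (S : ∀ n, Set (α n)) (hS : ∀ n, (S n).Nonempty) (P : ∀ n, α n → Prop)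
    (h : ∀ f : ∀ n, α n, (∀ n, f n ∈ S n) → ∀ᶠ n in (U : Filter ℕ), P n (f n)) :
    ∀ᶠ n in (U : Filter ℕ), ∀ x ∈ S n, P n x := by
  classical
  by_contra hcon
  rw [← Ultrafilter.eventually_not] at hcon
  let f : ∀ n, α n := fun n => if h : ∃ x ∈ S n, ¬ P n x then h.choose else (hS n).some
  have hf : ∀ n, f n ∈ S n := by
    intro n; simp only [f]; split_ifs with h
    · exact h.choose_spec.1
    · exact (hS n).some_mem
  have := (h f hf).and hcon
  obtain ⟨n, h1, h2⟩ := this.exists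
  push Not at h2
  have h3 : ¬ P n (f n) := by
    simp only [f]; rw [dif_pos h2]; exact h2.choose_spec.2
  exact h3 h1
end Gam
end Tits

namespace Tits
set_option linter.unusedSectionVars false
set_option linter.all false
open Filter Pointwise
open scoped commutatorElement

section Block
variable {K : Type} [Field K] {d a b : ℕ} (C : Matrix (Fin d) (Fin a ⊕ Fin b) K) (D : Matrix (Fin a ⊕ Fin b) (Fin d) K)
  (hDC : D * C = 1) (hCD : C * D = 1)

def cj (x : Matrix (Fin d) (Fin d) K) : Matrix (Fin a ⊕ Fin b) (Fin a ⊕ Fin b) K := D * x * C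

lemma cj_mul (hCD : C * D = 1) (x y : Matrix (Fin d) (Fin d) K) : cj C D (x * y) = cj C D x * cj C D y := by
  simp only [cj]
  calc D * (x * y) * C = D * x * (1 : Matrix (Fin d) (Fin d) K) * y * C := by simp only [Matrix.mul_one, Matrix.mul_assoc]
    _ = _ := by rw [← hCD]; simp only [Matrix.mul_assoc]

lemma cj_inj (hCD : C * D = 1) {x y : Matrix (Fin d) (Fin d) K} (h : cj C D x = cj C D y) : x = y := by
  have : ∀ z : Matrix (Fin d) (Fin d) K, C * cj C D z * D = z := by
    intro z
    simp only [cj, Matrix.mul_assoc, hCD, Matrix.mul_one]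
    rw [← Matrix.mul_assoc, hCD, Matrix.one_mul]
  rw [← this x, h, this]

lemma t21_mul (x y : Matrix (Fin a ⊕ Fin b) (Fin a ⊕ Fin b) K) (hx : x.toBlocks₂₁ = 0) (hy : y.toBlocks₂₁ = 0) :
    (x * y).toBlocks₂₁ = 0 ∧ (x * y).toBlocks₁₁ = x.toBlocks₁₁ * y.toBlocks₁₁ ∧
    (x * y).toBlocks₂₂ = x.toBlocks₂₂ * y.toBlocks₂₂ := by
  rw [← Matrix.fromBlocks_toBlocks x, ← Matrix.fromBlocks_toBlocks y, hx, hy, Matrix.fromBlocks_multiply]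
  simp

def BU : Subgroup (GL (Fin d) K) where
  carrier := {x | (cj C D x.val).toBlocks₂₁ = 0 ∧ (cj C D (x⁻¹).val).toBlocks₂₁ = 0}
  one_mem' := by
    simp [cj, hDC]
    rw [← Matrix.fromBlocks_one, Matrix.toBlocks_fromBlocks₂₁]
  mul_mem' := by
    rintro x y ⟨h1, h2⟩ ⟨h3, h4⟩
    refine ⟨?_, ?_⟩
    · rw [Units.val_mul, cj_mul C D hCD]; exact (t21_mul _ _ h1 h3).1
    · rw [mul_inv_rev, Units.val_mul, cj_mul C D hCD]; exact (t21_mul _ _ h4 h2).1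
  inv_mem' := by
    rintro x ⟨h1, h2⟩
    exact ⟨h2, by rwa [inv_inv]⟩

def f11 : BU C D hDC hCD →* GL (Fin a) K := MonoidHom.toHomUnits
  { toFun := fun x => (cj C D x.1.val).toBlocks₁₁
    map_one' := by
      simp [cj, hDC]
      rw [← Matrix.fromBlocks_one, Matrix.toBlocks_fromBlocks₁₁]
    map_mul' := fun x y => by
      simp only [Subgroup.coe_mul, Units.val_mul]
      rw [cj_mul C D hCD]; exact (t21_mul _ _ x.2.1 y.2.1).2.1 }

def f22 : BU C D hDC hCD →* GL (Fin b) K := MonoidHom.toHomUnits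
  { toFun := fun x => (cj C D x.1.val).toBlocks₂₂
    map_one' := by
      simp [cj, hDC]
      rw [← Matrix.fromBlocks_one, Matrix.toBlocks_fromBlocks₂₂]
    map_mul' := fun x y => by
      simp only [Subgroup.coe_mul, Units.val_mul]
      rw [cj_mul C D hCD]; exact (t21_mul _ _ x.2.1 y.2.1).2.2 }

lemma block_step (S : Set (GL (Fin d) K)) (hfin : S.Finite) (h1 : 1 ∈ S) (hsym : ∀ s ∈ S, s⁻¹ ∈ S)
    (hS : ∀ s ∈ S, (cj C D s.val).toBlocks₂₁ = 0) (N : ℕ)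
    (hA : ∀ F : Set (GL (Fin a) K), F.Finite → 1 ∈ F → (∀ f ∈ F, f⁻¹ ∈ F) →
      ((∃ x y, x ∈ Pw F N ∧ y ∈ Pw F N ∧ FreePair x y) ∨ VS (Subgroup.closure F)))
    (hB : ∀ F : Set (GL (Fin b) K), F.Finite → 1 ∈ F → (∀ f ∈ F, f⁻¹ ∈ F) →
      ((∃ x y, x ∈ Pw F N ∧ y ∈ Pw F N ∧ FreePair x y) ∨ VS (Subgroup.closure F)))
    (hDC : D * C = 1) (hCD : C * D = 1) :
    (∃ x y, x ∈ Pw S N ∧ y ∈ Pw S N ∧ FreePair x y) ∨ VS (Subgroup.closure S) := by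
  let B := BU C D hDC hCD
  let S' : Set B := Subtype.val ⁻¹' S
  have hS'S : (B.subtype) '' S' = S := by
    ext x; constructor
    · rintro ⟨y, hy, rfl⟩; exact hy
    · intro hx; exact ⟨⟨x, hS x hx, hS _ (hsym x hx)⟩, hx, rfl⟩
  have hfin' : S'.Finite := hfin.preimage Subtype.val_injective.injOn
  have hfree : ∀ {m : ℕ} (f : B →* GL (Fin m) K), (∃ x y, x ∈ Pw (f '' S') N ∧ y ∈ Pw (f '' S') N ∧ FreePair x y) →
      (∃ x y, x ∈ Pw S N ∧ y ∈ Pw S N ∧ FreePair x y) := by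
    rintro m f ⟨x, y, hx, hy, hxy⟩
    obtain ⟨x', hx', rfl⟩ := Pw.image f hx
    obtain ⟨y', hy', rfl⟩ := Pw.image f hy
    have hxy' : FreePair x' y' := hxy.of_map
    refine ⟨x', y', ?_, ?_, ?_⟩
    · obtain ⟨l, h3, h4, h5⟩ := hx'
      refine ⟨l.map Subtype.val, by simpa using h3, ?_, by rw [← h5]; exact (map_list_prod B.subtype l).symm⟩
      intro g hg; obtain ⟨g', hg', rfl⟩ := List.mem_map.mp hg; exact h4 g' hg'
    · obtain ⟨l, h3, h4, h5⟩ := hy'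
      refine ⟨l.map Subtype.val, by simpa using h3, ?_, by rw [← h5]; exact (map_list_prod B.subtype l).symm⟩
      intro g hg; obtain ⟨g', hg', rfl⟩ := List.mem_map.mp hg; exact h4 g' hg'
    · intro u w huw
      apply hxy'
      have e : FreeGroup.lift (fun i : Fin 2 => if i = 0 then (x' : GL (Fin d) K) else y') =
        B.subtype.comp (FreeGroup.lift (fun i : Fin 2 => if i = 0 then x' else y')) := by
        ext1 i; simp; split_ifs <;> rfl
      rw [e] at huw
      exact Subtype.ext huw
  have himg : ∀ {m : ℕ} (f : B →* GL (Fin m) K), (f '' S').Finite ∧ 1 ∈ f '' S' ∧ ∀ g ∈ f '' S', g⁻¹ ∈ f '' S' := by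
    intro m f
    refine ⟨hfin'.image _, ⟨1, h1, map_one _⟩, ?_⟩
    rintro _ ⟨s, hs, rfl⟩
    exact ⟨s⁻¹, hsym _ hs, map_inv _ _⟩
  rcases hA _ (himg (f11 C D hDC hCD)).1 (himg _).2.1 (himg _).2.2 with h | h
  · exact Or.inl (hfree _ h)
  rcases hB _ (himg (f22 C D hDC hCD)).1 (himg _).2.1 (himg _).2.2 with h' | h'
  · exact Or.inl (hfree _ h')
  right
  rw [← MonoidHom.map_closure] at h h'
  have key : VS (Subgroup.closure S') := by
    apply VS.of_two ((f11 C D hDC hCD).comp (Subgroup.closure S').subtype)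
      ((f22 C D hDC hCD).comp (Subgroup.closure S').subtype)
    · rw [MonoidHom.range_comp, Subgroup.range_subtype]; exact h
    · rw [MonoidHom.range_comp, Subgroup.range_subtype]; exact h'
    · rintro ⟨x, hx⟩ ⟨y, hy⟩ h1 h2 h3 h4
      apply Subtype.ext; apply Subtype.ext
      apply Units.ext
      apply cj_inj C D hCD
      simp only [Subgroup.coe_mul, Units.val_mul, cj_mul C D hCD]
      have e1 : (cj C D x.1.val).toBlocks₁₁ = 1 := congrArg Units.val h1
      have e2 : (cj C D x.1.val).toBlocks₂₂ = 1 := congrArg Units.val h2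
      have e3 : (cj C D y.1.val).toBlocks₁₁ = 1 := congrArg Units.val h3
      have e4 : (cj C D y.1.val).toBlocks₂₂ = 1 := congrArg Units.val h4
      rw [← Matrix.fromBlocks_toBlocks (cj C D x.1.val), ← Matrix.fromBlocks_toBlocks (cj C D y.1.val),
        e1, e2, e3, e4, x.2.1, y.2.1, Matrix.fromBlocks_multiply, Matrix.fromBlocks_multiply]
      simp [add_comm]
  rw [← hS'S, ← MonoidHom.map_closure]
  exact VS.of_inj ((Subgroup.closure S').equivMapOfInjective B.subtype Subtype.val_injective).symm.toMonoidHom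
    (MulEquiv.injective _) key
end Block

/-- adapted coordinates for an invariant subspace -/
lemma adapted {k : Type} [Field k] {d : ℕ} (X : Submodule k (Fin d → k)) : ∃ (a b : ℕ) (C : Matrix (Fin d) (Fin a ⊕ Fin b) k)
    (D : Matrix (Fin a ⊕ Fin b) (Fin d) k), D * C = 1 ∧ C * D = 1 ∧ a + b = d ∧ (X ≠ ⊥ → 1 ≤ a) ∧ (X ≠ ⊤ → 1 ≤ b) ∧
    ∀ M : Matrix (Fin d) (Fin d) k, (∀ x ∈ X, M.mulVec x ∈ X) → (cj C D M).toBlocks₂₁ = 0 := by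
  obtain ⟨Y, hY⟩ := X.exists_isCompl
  let bX := Module.finBasis k X
  let bY := Module.finBasis k Y
  let e := Submodule.prodEquivOfIsCompl X Y hY
  let B : Module.Basis (Fin (Module.finrank k X) ⊕ Fin (Module.finrank k Y)) k (Fin d → k) := (bX.prod bY).map e
  let std := Pi.basisFun k (Fin d)
  have hsum : Module.finrank k X + Module.finrank k Y = d := by
    have := Submodule.finrank_add_eq_of_isCompl hY
    simpa using this
  refine ⟨Module.finrank k X, Module.finrank k Y, std.toMatrix B, B.toMatrix std, ?_, ?_, hsum, ?_, ?_, ?_⟩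
  · simp
  · simp
  · intro h
    rcases Nat.eq_zero_or_pos (Module.finrank k X) with h0 | h0
    · exact absurd (Submodule.finrank_eq_zero.mp h0) h
    · exact h0
  · intro h
    rcases Nat.eq_zero_or_pos (Module.finrank k Y) with h0 | h0
    · have := Submodule.finrank_eq_zero.mp h0
      subst this
      exact absurd (by simpa using hY.codisjoint.eq_top) h
    · exact h0
  · intro M hM
    have e1 : cj (std.toMatrix B) (B.toMatrix std) M = LinearMap.toMatrix B B (Matrix.toLin' M) := by
      have : M = LinearMap.toMatrix std std (Matrix.toLin' M) := by
        simp [std, LinearMap.toMatrix_eq_toMatrix']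
      conv_lhs => rw [this]
      rw [cj, basis_toMatrix_mul_linearMap_toMatrix_mul_basis_toMatrix]
    rw [e1]
    ext i j
    simp only [Matrix.toBlocks₂₁, Matrix.of_apply, LinearMap.toMatrix_apply, Matrix.zero_apply]
    have h1 : B (Sum.inl j) = bX j := by simp [B, e]
    rw [h1]
    have h2 : Matrix.toLin' M (bX j) ∈ X := by rw [Matrix.toLin'_apply]; exact hM _ (bX j).2
    have h3 : e.symm (Matrix.toLin' M (bX j)) = (⟨_, h2⟩, 0) := by
      rw [LinearEquiv.symm_apply_eq]; simp [e]
    simp only [B, Module.Basis.map_repr, LinearEquiv.trans_apply]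
    rw [h3]; simp

section Red
variable {d : ℕ} {Ω : ℕ → Type} [∀ n, Field (Ω n)] {F : ∀ n, Set (GL (Fin d) (Ω n))} (U : Ultrafilter ℕ)

lemma block_ev {a b : ℕ} (C : ∀ n, Matrix (Fin d) (Fin a ⊕ Fin b) (Ω n)) (D : ∀ n, Matrix (Fin a ⊕ Fin b) (Fin d) (Ω n))
    (x : Gam F) (h : (cj (umat U C) (umat U D) (rho F U x)).toBlocks₂₁ = 0) :
    ∀ᶠ n in (U : Filter ℕ), (cj (C n) (D n) (x.1 n).val).toBlocks₂₁ = 0 := by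
  have e : cj (umat U C) (umat U D) (rho F U x) = umat U (fun n => cj (C n) (D n) (x.1 n).val) := by
    simp only [cj, umat_mul]; rfl
  rw [e] at h
  simp only [← Matrix.ext_iff, eventually_all]
  intro i j
  have := congrFun (congrFun h i) j
  simpa [Matrix.toBlocks₂₁, umat, umk_eq_zero] using this

theorem simple_of_bad (hP : ∀ a, 1 ≤ a → a < d → Prp a) (hB : Bad F) (hU : ∀ N, ∀ᶠ n in (U : Filter ℕ), N ≤ n)
    (H : Subgroup (Gam F)) [H.FiniteIndex] (X : Submodule (Ult U Ω) (Fin d → Ult U Ω))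
    (hX : ∀ h ∈ H, ∀ x ∈ X, (rho F U h).mulVec x ∈ X) : X = ⊥ ∨ X = ⊤ := by
  by_contra hcon
  push Not at hcon
  obtain ⟨a, b, C, D, hDC, hCD, hab, ha, hb, hblk⟩ := adapted X
  have ha := ha hcon.1
  have hb := hb hcon.2
  obtain ⟨Na, hNa⟩ := hP a ha (by omega)
  obtain ⟨Nb, hNb⟩ := hP b hb (by omega)
  let Cn := urepMat U C
  let Dn := urepMat U D
  have hC : umat U Cn = C := umat_urepMat U C
  have hD : umat U Dn = D := umat_urepMat U D
  have ev1 : ∀ᶠ n in (U : Filter ℕ), Dn n * Cn n = 1 := by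
    rw [← umat_eq, umat_mul, hC, hD, umat_one, hDC]
  have ev2 : ∀ᶠ n in (U : Filter ℕ), Cn n * Dn n = 1 := by
    rw [← umat_eq, umat_mul, hC, hD, umat_one, hCD]
  let t : (Gam F ⧸ H) → Gam F := Quotient.out
  have ht : ∀ q, (t q : Gam F ⧸ H) = q := Quotient.out_eq'
  have hc0 : ∃ c, ∀ q n, (t q).1 n ∈ Pw (F n) c := by
    have : ∀ q, ∃ c, ∀ n, (t q).1 n ∈ Pw (F n) c := fun q => Gam.pw hB.symm (t q).2
    choose c hc using this
    haveI := Fintype.ofFinite (Gam F ⧸ H)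
    refine ⟨Finset.univ.sup c, fun q n => Pw.mono (Finset.le_sup (Finset.mem_univ q)) (hc q n)⟩
  obtain ⟨c0, hc0⟩ := hc0
  let c := c0 + 1 + c0
  let S : ∀ n, Set (GL (Fin d) (Ω n)) := fun n => {s | s ∈ Pw (F n) c ∧ (cj (Cn n) (Dn n) s.val).toBlocks₂₁ = 0 ∧
    (cj (Cn n) (Dn n) (s⁻¹).val).toBlocks₂₁ = 0}
  have ev3 : ∀ᶠ n in (U : Filter ℕ), ∀ f ∈ F n, ∀ q, ∃ q', ((t q').1 n)⁻¹ * f * (t q).1 n ∈ S n := by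
    apply ev_forall U F (fun n => ⟨1, hB.one n⟩)
    intro f hf
    rw [eventually_all]
    intro q
    let g : Gam F := ⟨f, Subgroup.subset_closure hf⟩
    let q' : Gam F ⧸ H := (g * t q : Gam F)
    have hmem : (t q')⁻¹ * (g * t q) ∈ H := by
      rw [← QuotientGroup.eq, ht]
    have h1 := block_ev U Cn Dn _ (by rw [hC, hD]; exact hblk _ (hX _ hmem))
    have h2 := block_ev U Cn Dn _ (by rw [hC, hD]; exact hblk _ (hX _ (H.inv_mem hmem)))
    filter_upwards [h1, h2] with n h1 h2
    refine ⟨q', ?_, ?_, ?_⟩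
    · exact Pw.mul (Pw.mul (Pw.inv (hB.symm n) (hc0 q' n)) (Pw.of_mem (hf n))) (hc0 q n)
    · rw [mul_assoc]; exact h1
    · rw [mul_assoc]; exact h2
  obtain ⟨n, hn1, hn2, hn3, hn4⟩ := (ev1.and (ev2.and (ev3.and (hU (c * max Na Nb))))).exists
  have hSfin : (S n).Finite := (Pw.finite (hB.fin n) c).subset (fun s hs => hs.1)
  have hS1 : 1 ∈ S n := by
    have : (cj (Cn n) (Dn n) (1 : GL (Fin d) (Ω n)).val).toBlocks₂₁ = 0 := (BU (Cn n) (Dn n) hn1 hn2).one_mem.1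
    exact ⟨Pw.one _, this, by simpa using this⟩
  have hSsym : ∀ s ∈ S n, s⁻¹ ∈ S n := by
    rintro s ⟨h1, h2, h3⟩
    exact ⟨Pw.inv (hB.symm n) h1, h3, by rwa [inv_inv]⟩
  have hmaxa : Na ≤ max Na Nb := le_max_left _ _
  have hmaxb : Nb ≤ max Na Nb := le_max_right _ _
  have := block_step (Cn n) (Dn n) (S n) hSfin hS1 hSsym (fun s hs => hs.2.1) (max Na Nb)
    (by
      intro F h1 h2 h3
      rcases hNa _ F h1 h2 h3 with ⟨x, y, hx, hy, hxy⟩ | h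
      · exact Or.inl ⟨x, y, Pw.mono hmaxa hx, Pw.mono hmaxa hy, hxy⟩
      · exact Or.inr h)
    (by
      intro F h1 h2 h3
      rcases hNb _ F h1 h2 h3 with ⟨x, y, hx, hy, hxy⟩ | h
      · exact Or.inl ⟨x, y, Pw.mono hmaxb hx, Pw.mono hmaxb hy, hxy⟩
      · exact Or.inr h) hn1 hn2
  have hSF : S n ⊆ Pw (F n) c := fun s hs => hs.1
  rcases this with ⟨x, y, hx, hy, hxy⟩ | hvs
  · exact hB.nofree n x y (Pw.mono hn4 (Pw.pw hSF hx)) (Pw.mono hn4 (Pw.pw hSF hy)) hxy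
  · have hle : Subgroup.closure (S n) ≤ Subgroup.closure (F n) := by
      rw [Subgroup.closure_le]
      exact fun s hs => Pw.le_closure c (hSF hs)
    let W : Set (GL (Fin d) (Ω n)) := {x | ∃ q, ∃ δ ∈ Subgroup.closure (S n), x = (t q).1 n * δ}
    have hW : ∀ x ∈ Subgroup.closure (F n), ∀ y ∈ W, x * y ∈ W ∧ x⁻¹ * y ∈ W := by
      have h1 : ∀ f ∈ F n, ∀ y ∈ W, f * y ∈ W := by
        rintro f hf _ ⟨q, δ, hδ, rfl⟩
        obtain ⟨q', hq'⟩ := hn3 f hf q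
        exact ⟨q', _, mul_mem (Subgroup.subset_closure hq') hδ, by group⟩
      intro x hx
      induction hx using Subgroup.closure_induction with
      | mem x hx => exact fun y hy => ⟨h1 x hx y hy, h1 _ (hB.symm n x hx) y hy⟩
      | one => intro y hy; simpa using hy
      | mul x x' _ _ hx hx' =>
        intro y hy
        refine ⟨?_, ?_⟩
        · rw [mul_assoc]; exact (hx _ (hx' y hy).1).1
        · rw [mul_inv_rev, mul_assoc]; exact (hx' _ (hx y hy).2).2
      | inv x _ hx => intro y hy; rw [inv_inv]; exact (hx y hy).symm
    have htF : ∀ q, (t q).1 n ∈ Subgroup.closure (F n) := fun q => Pw.le_closure _ (hc0 q n)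
    have hcov : ∀ x ∈ Subgroup.closure (F n), x ∈ W := by
      intro x hx
      let q : Gam F ⧸ H := (1 : Gam F)
      have := (hW (x * ((t q).1 n)⁻¹) (mul_mem hx (inv_mem (htF q))) ((t q).1 n)
        ⟨q, 1, one_mem _, by simp⟩).1
      simpa using this
    let Δ := (Subgroup.closure (S n)).subgroupOf (Subgroup.closure (F n))
    have hfi : Δ.FiniteIndex := by
      haveI : Finite (Subgroup.closure (F n) ⧸ Δ) := by
        apply Finite.of_surjective (fun q : Gam F ⧸ H => ((⟨(t q).1 n, htF q⟩ : Subgroup.closure (F n)) : _ ⧸ Δ))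
        intro z
        obtain ⟨x, rfl⟩ := QuotientGroup.mk_surjective z
        obtain ⟨q, δ, hδ, hx⟩ := hcov x.1 x.2
        refine ⟨q, ?_⟩
        simp only
        rw [QuotientGroup.eq, Subgroup.mem_subgroupOf]
        simp [hx, hδ]
      exact Subgroup.finiteIndex_of_finite_quotient
    exact hB.nvs n (VS.of_finiteIndex Δ (VS.of_inj (Subgroup.subgroupOfEquivOfLe hle).toMonoidHom
      (MulEquiv.injective _) hvs))
end Red
end Tits

namespace Tits
set_option linter.unusedSectionVars false
set_option linter.all false
open Filter Pointwise
open scoped commutatorElement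

section Dense
variable {G k : Type} [Group G] [Field k]

lemma Irr.of_emb {k' : Type} [Field k'] {m : Type} [Fintype m] [DecidableEq m] (σ : k →+* k') (A : G →* Matrix m m k)
    (R' : Subalgebra k' (G → k')) (h : ∀ i j, (fun g => σ (A g i j)) ∈ R') (h' : ∀ i j, (fun g => σ (A g⁻¹ i j)) ∈ R')
    {S : Set G} (hI : Irr R' S) : Irr (entAlg A) S := by
  have key : ∀ f ∈ entAlg A, (fun g => σ (f g)) ∈ R' := by
    intro f hf
    induction hf using Algebra.adjoin_induction with
    | mem f hf =>
      rcases hf with ⟨⟨i, j⟩, rfl⟩ | ⟨⟨i, j⟩, rfl⟩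
      exacts [h i j, h' i j]
    | algebraMap r => exact fun_const_mem R' (σ r)
    | add f g _ _ hf hg =>
      have := R'.add_mem hf hg
      convert this using 1; ext x; simp
    | mul f g _ _ hf hg =>
      have := R'.mul_mem hf hg
      convert this using 1; ext x; simp
  rintro f₁ h₁ f₂ h₂ ⟨s, hs, e1⟩ ⟨t, ht, e2⟩
  obtain ⟨u, hu, e3, e4⟩ := hI _ (key f₁ h₁) _ (key f₂ h₂)
    ⟨s, hs, by simpa using e1⟩ ⟨t, ht, by simpa using e2⟩
  exact ⟨u, hu, by simpa using e3, by simpa using e4⟩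

lemma finite_sep {X : Type} (W : Submodule k (X → k)) [FiniteDimensional k W] :
    ∃ S : Finset X, ∀ f ∈ W, (∀ x ∈ S, f x = 0) → f = 0 := by
  classical
  let K : Finset X → Submodule k W := fun S => ⨅ x ∈ S, LinearMap.ker ((LinearMap.proj x : (X → k) →ₗ[k] k).comp W.subtype)
  have hK : ∀ S f, f ∈ K S ↔ ∀ x ∈ S, f.1 x = 0 := by
    intro S f; simp [K]
  obtain ⟨S, hS⟩ : ∃ S, ∀ T, Module.finrank k (K S) ≤ Module.finrank k (K T) := by
    let m := sInf (Set.range fun S => Module.finrank k (K S))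
    obtain ⟨S, hS⟩ := Nat.sInf_mem (Set.range_nonempty fun S => Module.finrank k (K S))
    exact ⟨S, fun T => by
      have hS : Module.finrank k (K S) = _ := hS
      rw [hS]; exact Nat.sInf_le ⟨T, rfl⟩⟩
  refine ⟨S, ?_⟩
  intro f hf hz
  by_contra hne
  obtain ⟨x, hx⟩ := Function.ne_iff.mp hne
  have hlt : K (insert x S) < K S := by
    refine lt_of_le_of_ne ?_ ?_
    · intro g hg
      rw [hK] at hg ⊢
      exact fun y hy => hg y (Finset.mem_insert_of_mem hy)
    · intro heq
      have : (⟨f, hf⟩ : W) ∈ K S := (hK _ _).mpr hz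
      rw [← heq, hK] at this
      exact hx (this x (Finset.mem_insert_self _ _))
  exact absurd (Submodule.finrank_lt_finrank_of_lt hlt) (not_lt.mpr (hS _))

lemma cble_submonoid {M : Type*} [Monoid M] {s : Set M} (hs : s.Countable) : Countable (Submonoid.closure s) := by
  haveI := hs.to_subtype
  haveI : Countable (FreeMonoid s) := inferInstanceAs (Countable (List s))
  rw [Submonoid.closure_eq_mrange]
  exact (MonoidHom.mrangeRestrict_surjective _).countable

lemma cble_subgroup {M : Type*} [Group M] {s : Set M} (hs : s.Countable) : Countable (Subgroup.closure s) := by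
  have : Countable (Subgroup.closure s).toSubmonoid := by
    rw [Subgroup.closure_toSubmonoid]
    exact cble_submonoid (hs.union (by rw [← Set.image_inv_eq_inv]; exact hs.image _))
  exact this

lemma countable_dense (R : Subalgebra k (G → k)) (hR : R.FG) (Y : Set G) (hY : Y.Countable) :
    ∃ H1 : Subgroup G, Y ⊆ H1 ∧ Countable H1 ∧ ∀ f ∈ R, (∀ h ∈ H1, f h = 0) → ∀ h, f h = 0 := by
  classical
  obtain ⟨s, hs⟩ := hR
  let M : Set (G → k) := Submonoid.closure (s : Set (G → k))
  have hM : M.Countable := by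
    have : Countable (Submonoid.closure (s : Set (G → k))) := cble_submonoid s.countable_toSet
    exact Set.countable_coe_iff.mp this
  have hspan : Subalgebra.toSubmodule R = Submodule.span k M := by
    rw [← hs, Algebra.adjoin_eq_span]
  have hsep : ∀ t : Finset (G → k), ∃ S : Finset G, ∀ f ∈ Submodule.span k (t : Set (G → k)), (∀ x ∈ S, f x = 0) → f = 0 := by
    intro t
    haveI := FiniteDimensional.span_finset k t
    exact finite_sep _
  choose S hS using hsep
  let I : Set (Finset (G → k)) := {t | (t : Set (G → k)) ⊆ M}
  have hI : I.Countable := Set.countable_setOf_finite_subset hM |>.preimage_of_injOn (f := fun t : Finset (G → k) => (t : Set (G → k)))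
      (Finset.coe_injective.injOn) |>.mono (by intro t ht; exact ⟨t.finite_toSet, ht⟩)
  let Z : Set G := Y ∪ ⋃ t ∈ I, (S t : Set G)
  have hZ : Z.Countable := hY.union (hI.biUnion (fun t _ => (S t).countable_toSet))
  refine ⟨Subgroup.closure Z, fun y hy => Subgroup.subset_closure (Or.inl hy), ?_, ?_⟩
  · exact cble_subgroup hZ
  · intro f hf hz
    have hf' : f ∈ Submodule.span k M := by rw [← hspan]; exact hf
    obtain ⟨t, ht, hft⟩ := Submodule.mem_span_finite_of_mem_span hf'
    have : f = 0 := hS t f hft (fun x hx => hz x (Subgroup.subset_closure (Or.inr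
      (Set.mem_biUnion (show t ∈ I from ht) hx))))
    intro h; rw [this]; rfl

lemma commutator_irr {R : Subalgebra k (G → k)} (hR : Reg R) (hI : Irr R Set.univ) :
    Irr R (commutator G : Set G) := by
  have := Irr.closure hR (fun x : G => (fun y => ⁅y, x⁆) '' Set.univ) (fun x => hI.image _ (by
    intro f hf
    have h1 := hR.conj x _ (hR.right x⁻¹ f hf)
    simpa [commutatorElement_def] using h1)) (fun x => ⟨1, trivial, by simp⟩)
  convert this using 2
  rw [commutator_eq_closure]
  congr 1
  ext z
  simp [commutatorSet_def]
  exact ⟨fun ⟨a, b, h⟩ => ⟨b, a, h⟩, fun ⟨a, b, h⟩ => ⟨b, a, h⟩⟩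

lemma mem_comm_finite {z : G} (hz : z ∈ commutator G) : ∃ Y : Finset G, ∀ K : Subgroup G, (∀ y ∈ Y, y ∈ K) →
    z ∈ ⁅K, K⁆ := by
  classical
  rw [commutator_eq_closure] at hz
  induction hz using Subgroup.closure_induction with
  | mem x hx =>
    obtain ⟨a, b, rfl⟩ := hx
    exact ⟨{a, b}, fun K hK => Subgroup.commutator_mem_commutator (hK a (by simp)) (hK b (by simp))⟩
  | one => exact ⟨∅, fun K _ => one_mem _⟩
  | mul x y _ _ hx hy =>
    obtain ⟨Y, hY⟩ := hx
    obtain ⟨Y', hY'⟩ := hy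
    exact ⟨Y ∪ Y', fun K hK => mul_mem (hY K fun y hy => hK y (by simp [hy])) (hY' K fun y hy => hK y (by simp [hy]))⟩
  | inv x _ hx =>
    obtain ⟨Y, hY⟩ := hx
    exact ⟨Y, fun K hK => inv_mem (hY K hK)⟩
end Dense
end Tits

namespace Tits
set_option linter.unusedSectionVars false
set_option linter.all false
open Filter Pointwise
open scoped commutatorElement


structure Core (d : ℕ) (U : Ultrafilter ℕ) (Ω : ℕ → Type) [∀ n, Field (Ω n)] 
    (F : ∀ n, Set (GL (Fin d) (Ω n))) where
  bad : Bad F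
  hU : ∀ N, ∀ᶠ n in (U : Filter ℕ), N ≤ n
  hd : 2 ≤ d
  H : Subgroup (Gam F)
  normal : H.Normal
  irr : Irr (entAlg (rho F U)) (H : Set (Gam F))
  simple : ∀ X : Submodule (Ult U Ω) (Fin d → Ult U Ω), (∀ h ∈ H, ∀ x ∈ X, (rho F U h).mulVec x ∈ X) → X = ⊥ ∨ X = ⊤
  m : ℕ
  w : Fin m → Gam F
  w_mem : ∀ i, w i ∈ ⁅H, H⁆
  b : Module.Basis (Fin m) (Ult U Ω) (Matrix (Fin d) (Fin d) (Ult U Ω))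
  hb : ∀ i, b i = rho F U (w i)

lemma trace_nondeg {k : Type} [Field k] {d : ℕ} {x : Matrix (Fin d) (Fin d) k} (h : ∀ y, (x * y).trace = 0) : x = 0 := by
  ext i j
  have := h (Matrix.single j i 1)
  simpa [Matrix.trace_mul_single] using this

/-- endomorphism version of a matrix rep -/
noncomputable def toEnd {H k : Type} [Group H] [Field k] {d : ℕ} (ρ : H →* Matrix (Fin d) (Fin d) k) : H →* Module.End k (Fin d → k) :=
  (Matrix.toLinAlgEquiv' : Matrix (Fin d) (Fin d) k ≃ₐ[k] _).toAlgHom.toRingHom.toMonoidHom.comp ρ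

lemma toEnd_apply {H k : Type} [Group H] [Field k] {d : ℕ} (ρ : H →* Matrix (Fin d) (Fin d) k) (h : H) (v : Fin d → k) :
    toEnd ρ h v = (ρ h).mulVec v := by
  simp [toEnd]

lemma toEnd_coef {H k : Type} [Group H] [Field k] {d : ℕ} (ρ : H →* Matrix (Fin d) (Fin d) k) (R : Subalgebra k (H → k))
    (h : ∀ i j, (fun g => ρ g i j) ∈ R) : Coef R (toEnd ρ) := by
  intro ξ v
  have : (fun g => ξ (toEnd ρ g v)) = fun g => ∑ i, (∑ j, ρ g i j * v j) * ξ (Pi.single i 1) := by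
    ext g
    rw [toEnd_apply]
    conv_lhs => rw [pi_eq_sum_univ' ((ρ g).mulVec v)]
    rw [map_sum]
    apply Finset.sum_congr rfl
    intro i _
    rw [map_smul, smul_eq_mul]; rfl
  rw [this]
  apply fun_sum_mem
  intro i _
  apply fun_mul_mem _ _ (fun_const_mem _ _)
  apply fun_sum_mem
  intro j _
  exact fun_mul_mem _ (h i j) (fun_const_mem _ _)

theorem exists_core {d : ℕ} {Ω : ℕ → Type} [∀ n, Field (Ω n)] [∀ n, IsAlgClosed (Ω n)]
    {F : ∀ n, Set (GL (Fin d) (Ω n))} (U : Ultrafilter ℕ)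
    (hP : ∀ a, 1 ≤ a → a < d → Prp a) (hB : Bad F) (hU : ∀ N, ∀ᶠ n in (U : Filter ℕ), N ≤ n) (hd : 2 ≤ d) :
    Nonempty (Core d U Ω F) := by
  haveI := entAlg_noeth (rho F U)
  obtain ⟨H, hN, hfi, hI⟩ := exists_component (entAlg_reg (rho F U))
  have hs := simple_of_bad U hP hB hU H
  let ρ : H →* Matrix (Fin d) (Fin d) (Ult U Ω) := (rho F U).comp H.subtype
  haveI : NeZero d := ⟨by omega⟩
  have hsp := span_commutator (ρ := toEnd ρ) (pull_reg H.subtype (entAlg_reg (rho F U)))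
    (toEnd_coef ρ _ (fun i j => ⟨_, ent_mem (rho F U) i j, rfl⟩)) (pull_irr H hI) (by
      intro W hW
      exact hs W (fun h hh x hx => by have := hW ⟨h, hh⟩ x hx; rwa [toEnd_apply] at this))
  have hsp2 : Submodule.span (Ult U Ω) (rho F U '' (⁅H, H⁆ : Subgroup (Gam F))) = ⊤ := by
    let e : Matrix (Fin d) (Fin d) (Ult U Ω) ≃ₐ[Ult U Ω] Module.End (Ult U Ω) (Fin d → Ult U Ω) := Matrix.toLinAlgEquiv'
    have h1 : Submodule.map e.toLinearEquiv.toLinearMap (Submodule.span (Ult U Ω) (rho F U '' (⁅H, H⁆ : Subgroup (Gam F)))) = ⊤ := by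
      rw [Submodule.map_span, ← hsp]
      congr 1
      ext z
      constructor
      · rintro ⟨_, ⟨x, hx, rfl⟩, rfl⟩
        have hx : x ∈ Subgroup.map H.subtype (commutator H) := by
          rw [commutator_def, Subgroup.map_commutator, ← MonoidHom.range_eq_map, H.range_subtype]; exact hx
        obtain ⟨y, hy, rfl⟩ := hx
        exact ⟨y, hy, rfl⟩
      · rintro ⟨y, hy, rfl⟩
        refine ⟨_, ⟨y, ?_, rfl⟩, rfl⟩
        have : H.subtype y ∈ Subgroup.map H.subtype (commutator H) := ⟨y, hy, rfl⟩
        rw [commutator_def, Subgroup.map_commutator, ← MonoidHom.range_eq_map, H.range_subtype] at this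
        exact this
    have h2 := Submodule.map_injective_of_injective (f := e.toLinearEquiv.toLinearMap) e.injective
    apply h2
    rw [h1]
    symm
    rw [Submodule.map_top, LinearMap.range_eq_top]
    exact e.surjective
  let b0 := Module.Basis.ofSpan hsp2.ge
  haveI : Fintype ↑((linearIndepOn_empty (Ult U Ω) id).extend (Set.empty_subset (rho F U '' (⁅H, H⁆ : Subgroup (Gam F))))) :=
    FiniteDimensional.fintypeBasisIndex b0
  let eq := Fintype.equivFin ↑((linearIndepOn_empty (Ult U Ω) id).extend (Set.empty_subset (rho F U '' (⁅H, H⁆ : Subgroup (Gam F)))))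
  let b := b0.reindex eq
  have hb : ∀ i, ∃ g ∈ (⁅H, H⁆ : Subgroup (Gam F)), rho F U g = b i := by
    intro i
    have : b i ∈ Set.range b0 := ⟨eq.symm i, by simp [b]⟩
    exact Module.Basis.ofSpan_subset hsp2.ge this
  choose w hw1 hw2 using hb
  exact ⟨⟨hB, hU, hd, H, hN, hI, hs, _, w, hw1, b, fun i => (hw2 i).symm⟩⟩
end Tits

namespace Tits
set_option linter.unusedSectionVars false
set_option linter.all false
open Filter Pointwise
open scoped commutatorElement

section A
variable {d : ℕ} {U : Ultrafilter ℕ} {Ω : ℕ → Type} [∀ n, Field (Ω n)]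
    {F : ∀ n, Set (GL (Fin d) (Ω n))} (C : Core d U Ω F)
    {B : ℕ → Type} [∀ n, Field (B n)] (j : ∀ n, B n →+* Ω n)

/-- evaluation -/
def ev (γ : Gam F) (n : ℕ) : GL (Fin d) (Ω n) := (γ : ∀ n, GL (Fin d) (Ω n)) n
@[simp] lemma ev_mul (γ δ : Gam F) (n : ℕ) : ev (γ * δ) n = ev γ n * ev δ n := rfl
@[simp] lemma ev_one (n : ℕ) : ev (1 : Gam F) n = 1 := rfl
@[simp] lemma ev_inv (γ : Gam F) (n : ℕ) : ev (γ⁻¹) n = (ev γ n)⁻¹ := rfl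

lemma rho_eq (γ : Gam F) : rho F U γ = umat U (fun n => (ev γ n).val) := rfl
lemma trace_rho (γ : Gam F) : (rho F U γ).trace = umk U (fun n => (ev γ n).val.trace) := umat_trace U _

open Classical in
noncomputable def chi (n : ℕ) (x : GL (Fin d) (Ω n)) : B n := if h : ∃ y, j n y = x.val.trace then h.choose else 0
lemma j_chi {n : ℕ} {x : GL (Fin d) (Ω n)} (h : x.val.trace ∈ (j n).range) : j n (chi j n x) = x.val.trace := by
  have h' : ∃ y, j n y = x.val.trace := h
  unfold chi; rw [dif_pos h']; exact h'.choose_spec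

variable (U) in
noncomputable def Xc (γ : Gam F) : Ult U B := umk U (fun n => chi j n (ev γ n))

def HTr : Prop := ∀ γ ∈ ⁅C.H, C.H⁆, ∀ᶠ n in (U : Filter ℕ), (ev γ n).val.trace ∈ (j n).range

variable {j} {C}
lemma uj_Xc (htr : HTr C j) {γ : Gam F} (h : γ ∈ ⁅C.H, C.H⁆) : umap U j (Xc U j γ) = (rho F U γ).trace := by
  rw [trace_rho, Xc, umap_umk, umk_eq]
  filter_upwards [htr γ h] with n hn
  exact j_chi j hn

lemma uj_inj : Function.Injective (umap U j) := (umap U j).injective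

lemma normD : (⁅C.H, C.H⁆ : Subgroup (Gam F)).Normal := by
  haveI := C.normal
  infer_instance

lemma conj_memD (l k : Fin C.m) (γ : Gam F) : C.w l * (γ * C.w k * γ⁻¹) ∈ ⁅C.H, C.H⁆ :=
  Subgroup.mul_mem _ (C.w_mem l) ((normD (C := C)).conj_mem _ (C.w_mem k) γ)

variable (C j) in
noncomputable def gram : Matrix (Fin C.m) (Fin C.m) (Ult U B) := fun l k => Xc U j (C.w l * C.w k)

variable (C) in
noncomputable def gramΩ : Matrix (Fin C.m) (Fin C.m) (Ult U Ω) := fun l k => (rho F U (C.w l * C.w k)).trace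

variable (C) in
lemma gramΩ_inj (c : Fin C.m → Ult U Ω) (h : (gramΩ C).mulVec c = 0) : c = 0 := by
  have h1 : ∀ y, ((∑ k, c k • C.b k) * y).trace = 0 := by
    intro y
    have hy : y ∈ Submodule.span (Ult U Ω) (Set.range C.b) := by rw [C.b.span_eq]; trivial
    induction hy using Submodule.span_induction with
    | mem y hy =>
      obtain ⟨l, rfl⟩ := hy
      have := congrFun h l
      rw [Matrix.trace_mul_comm, Finset.mul_sum, Matrix.trace_sum]
      simp only [Matrix.mulVec, dotProduct, gramΩ, Pi.zero_apply] at this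
      rw [← this]
      apply Finset.sum_congr rfl
      intro k _
      rw [mul_smul_comm, Matrix.trace_smul, C.hb, C.hb, ← map_mul, smul_eq_mul, mul_comm]
    | zero => simp
    | add x y _ _ hx hy => rw [mul_add, Matrix.trace_add, hx, hy, add_zero]
    | smul a x _ hx => rw [mul_smul_comm, Matrix.trace_smul, hx, smul_zero]
  have h2 := trace_nondeg h1
  have := Fintype.linearIndependent_iff.mp C.b.linearIndependent c h2
  exact funext this

variable (C) in
lemma gramΩ_det : (gramΩ C).det ≠ 0 := by
  intro h
  obtain ⟨v, hv, hv2⟩ := Matrix.exists_mulVec_eq_zero_iff.mpr h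
  exact hv (gramΩ_inj C v hv2)

lemma gram_map (htr : HTr C j) : (gram C j).map (umap U j) = gramΩ C := by
  ext l k
  exact uj_Xc htr (Subgroup.mul_mem _ (C.w_mem l) (C.w_mem k))

lemma gram_det (htr : HTr C j) : (gram C j).det ≠ 0 := by
  intro h
  apply gramΩ_det C
  rw [← gram_map htr, ← RingHom.mapMatrix_apply, ← RingHom.map_det, h, map_zero]

variable (C j) in
noncomputable def Nmat (γ : Gam F) : Matrix (Fin C.m) (Fin C.m) (Ult U B) := fun l k => Xc U j (C.w l * (γ * C.w k * γ⁻¹))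

variable (C j) in
noncomputable def A0 (γ : Gam F) : Matrix (Fin C.m) (Fin C.m) (Ult U B) := (gram C j)⁻¹ * Nmat C j γ

variable (F U) in
noncomputable def cjL (γ : Gam F) : Matrix (Fin d) (Fin d) (Ult U Ω) →ₗ[Ult U Ω] Matrix (Fin d) (Fin d) (Ult U Ω) :=
  (LinearMap.mulLeft _ (rho F U γ)).comp (LinearMap.mulRight _ (rho F U γ⁻¹))
lemma cjL_apply (γ : Gam F) (x) : cjL U F γ x = rho F U γ * x * rho F U γ⁻¹ := by
  simp [cjL, mul_assoc]

lemma cjL_mul (γ δ : Gam F) : cjL U F (γ * δ) = (cjL U F γ).comp (cjL U F δ) := by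
  ext1 x
  simp [cjL_apply, mul_assoc]

lemma A0_map (htr : HTr C j) (γ : Gam F) : (A0 C j γ).map (umap U j) = LinearMap.toMatrix C.b C.b (cjL U F γ) := by
  have h1 : gram C j * A0 C j γ = Nmat C j γ := by
    unfold A0; rw [← mul_assoc, Matrix.mul_nonsing_inv _ (isUnit_iff_ne_zero.mpr (gram_det htr)), one_mul]
  have h2 : gramΩ C * (A0 C j γ).map (umap U j) = (Nmat C j γ).map (umap U j) := by
    rw [← h1, Matrix.map_mul, gram_map htr]
  have h3 : gramΩ C * LinearMap.toMatrix C.b C.b (cjL U F γ) = (Nmat C j γ).map (umap U j) := by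
    ext l k
    rw [Matrix.mul_apply, Matrix.map_apply, Nmat, uj_Xc htr (conj_memD l k γ)]
    have : cjL U F γ (C.b k) = ∑ i, LinearMap.toMatrix C.b C.b (cjL U F γ) i k • C.b i := by
      simp_rw [LinearMap.toMatrix_apply]
      rw [C.b.sum_repr]
    rw [map_mul, map_mul, map_mul, ← C.hb k, ← cjL_apply, this, Finset.mul_sum, Matrix.trace_sum]
    apply Finset.sum_congr rfl
    intro i _
    rw [gramΩ, mul_smul_comm, Matrix.trace_smul, C.hb, ← map_mul, smul_eq_mul, mul_comm]
  have hu := isUnit_iff_ne_zero.mpr (gramΩ_det C)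
  have := congrArg (fun z => (gramΩ C)⁻¹ * z) (h2.trans h3.symm)
  simpa only [← mul_assoc, Matrix.nonsing_inv_mul _ hu, one_mul] using this

variable (C j) in
noncomputable def Ar (htr : HTr C j) : Gam F →* Matrix (Fin C.m) (Fin C.m) (Ult U B) where
  toFun := A0 C j
  map_one' := by
    apply Matrix.map_injective (umap U j).injective
    show (A0 C j 1).map (umap U j) = Matrix.map 1 (umap U j)
    rw [A0_map htr]
    have : cjL U F 1 = LinearMap.id := by ext1 x; simp [cjL_apply]
    rw [this, LinearMap.toMatrix_id, Matrix.map_one _ (map_zero _) (map_one _)]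
  map_mul' γ δ := by
    apply Matrix.map_injective (umap U j).injective
    show (A0 C j (γ * δ)).map (umap U j) = Matrix.map (A0 C j γ * A0 C j δ) (umap U j)
    rw [Matrix.map_mul, A0_map htr, A0_map htr, A0_map htr, cjL_mul, LinearMap.toMatrix_comp C.b C.b C.b]

lemma Ar_map (htr : HTr C j) (γ : Gam F) : (Ar C j htr γ).map (umap U j) = LinearMap.toMatrix C.b C.b (cjL U F γ) :=
  A0_map htr γ

variable (C j) in
def rel (n : ℕ) (x : GL (Fin d) (Ω n)) (L : Matrix (Fin C.m) (Fin C.m) (B n)) : Prop :=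
  ∀ k, x.val * (ev (C.w k) n).val * (x⁻¹).val = ∑ l, j n (L l k) • (ev (C.w l) n).val

lemma umat_sum_smul {ι : Type} (s : Finset ι) (c : ι → ∀ n, Ω n) (M : ι → ∀ n, Matrix (Fin d) (Fin d) (Ω n)) :
    umat U (fun n => ∑ i ∈ s, c i n • M i n) = ∑ i ∈ s, umk U (c i) • umat U (M i) := by
  ext a b
  simp only [umat, Matrix.sum_apply, Matrix.smul_apply, smul_eq_mul]
  simp only [← map_mul, ← map_sum]
  congr 1; ext n; simp

lemma rel_of_lift (htr : HTr C j) (γ : Gam F) (L : ∀ n, Matrix (Fin C.m) (Fin C.m) (B n)) (hL : umat U L = Ar C j htr γ) :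
    ∀ᶠ n in (U : Filter ℕ), rel C j n (ev γ n) (L n) := by
  have key : ∀ k, ∀ᶠ n in (U : Filter ℕ), (ev γ n).val * (ev (C.w k) n).val * ((ev γ n)⁻¹).val = ∑ l, j n (L n l k) • (ev (C.w l) n).val := by
    intro k
    rw [← umat_eq, umat_mul, umat_mul, umat_sum_smul]
    have h1 : cjL U F γ (C.b k) = ∑ i, LinearMap.toMatrix C.b C.b (cjL U F γ) i k • C.b i := by
      simp_rw [LinearMap.toMatrix_apply]
      rw [C.b.sum_repr]
    rw [cjL_apply, C.hb] at h1
    refine h1.trans ?_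
    apply Finset.sum_congr rfl
    intro l _
    rw [← Ar_map htr, ← hL, C.hb]
    rfl
  have := eventually_all.mpr key
  filter_upwards [this] with n hn k
  exact hn k

lemma rel_mul {n : ℕ} {x y : GL (Fin d) (Ω n)} {L M : Matrix (Fin C.m) (Fin C.m) (B n)} (h : rel C j n x L) (h' : rel C j n y M) :
    rel C j n (x * y) (L * M) := by
  intro k
  have : (x * y).val * (ev (C.w k) n).val * ((x * y)⁻¹).val = x.val * (y.val * (ev (C.w k) n).val * (y⁻¹).val) * (x⁻¹).val := by
    simp [mul_assoc]
  rw [this, h' k, Finset.mul_sum, Finset.sum_mul]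
  have e1 : ∀ i, x.val * (j n (M i k) • (ev (C.w i) n).val) * (x⁻¹).val = ∑ l, (j n (M i k) * j n (L l i)) • (ev (C.w l) n).val := by
    intro i
    rw [mul_smul_comm, smul_mul_assoc, h i, Finset.smul_sum]
    simp_rw [smul_smul]
  rw [Finset.sum_congr rfl (fun i _ => e1 i), Finset.sum_comm]
  apply Finset.sum_congr rfl
  intro l _
  rw [Matrix.mul_apply, map_sum, Finset.sum_smul]
  apply Finset.sum_congr rfl
  intro i _
  rw [map_mul, mul_comm]

lemma rel_one {n : ℕ} : rel C j n 1 1 := by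
  intro k
  simp [Matrix.one_apply]

lemma rel_prod {n : ℕ} {Λ : Type} (x : Λ → GL (Fin d) (Ω n)) (L : Λ → Matrix (Fin C.m) (Fin C.m) (B n)) (h : ∀ i, rel C j n (x i) (L i))
    (ws : List Λ) : rel C j n (ws.map x).prod (ws.map L).prod := by
  induction ws with
  | nil => exact rel_one
  | cons a l ih => simp only [List.map_cons, List.prod_cons]; exact rel_mul (h a) ih

variable (C) in
def Li (n : ℕ) : Prop := LinearIndependent (Ω n) (fun l : Fin C.m => (ev (C.w l) n).val)

variable (C) in
lemma ev_li : ∀ᶠ n in (U : Filter ℕ), Li C n := by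
  have h : gramΩ C = umat U (fun n => Matrix.of fun l k => ((ev (C.w l * C.w k) n).val).trace) := by
    ext l k; exact trace_rho _
  have h2 := gramΩ_det C
  rw [h, umat_det, Ne, umk_eq_zero, ← Ultrafilter.eventually_not] at h2
  filter_upwards [h2] with n hn
  rw [Li, Fintype.linearIndependent_iff]
  intro c hc
  have : (Matrix.of fun l k => ((ev (C.w l * C.w k) n).val).trace).mulVec c = 0 := by
    ext l
    have := congrArg (fun z => ((ev (C.w l) n).val * z).trace) hc
    simp only [mul_zero, Matrix.trace_zero, Finset.mul_sum, Matrix.trace_sum, mul_smul_comm, Matrix.trace_smul] at this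
    simp only [Matrix.mulVec, dotProduct, Matrix.of_apply, Pi.zero_apply]
    rw [← this]
    apply Finset.sum_congr rfl
    intro k _
    rw [smul_eq_mul, mul_comm]; rfl
  exact congrFun (Matrix.eq_zero_of_mulVec_eq_zero hn this)

lemma rel_unique {n : ℕ} (hli : Li C n) {x : GL (Fin d) (Ω n)} {L M : Matrix (Fin C.m) (Fin C.m) (B n)} (h : rel C j n x L) (h' : rel C j n x M) :
    L = M := by
  ext l k
  have h3 := (h k).symm.trans (h' k)
  rw [← sub_eq_zero, ← Finset.sum_sub_distrib] at h3
  simp_rw [← sub_smul] at h3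
  have := Fintype.linearIndependent_iff.mp hli _ h3 l
  exact (j n).injective (sub_eq_zero.mp this)

/-- transfer of relations -/
def Good {K : Type} [Group K] (φ : K →* Gam F) {ι : Type} [Fintype ι] [DecidableEq ι] (M : K →* Matrix ι ι (Ult U B)) : Prop :=
  ∀ (Λ : Type) [Finite Λ] (x : Λ → K) (L : Λ → ∀ n, Matrix ι ι (B n)), (∀ i, umat U (L i) = M (x i)) →
    ∀ᶠ n in (U : Filter ℕ), ∀ ws : List Λ, (ws.map (fun i => ev (φ (x i)) n)).prod = 1 → (ws.map (fun i => L i n)).prod = 1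

lemma good_Ar (htr : HTr C j) {K : Type} [Group K] (φ : K →* Gam F) : Good φ ((Ar C j htr).comp φ) := by
  intro Λ _ x L hL
  have h := eventually_all.mpr (fun i => rel_of_lift htr (φ (x i)) (L i) (hL i))
  filter_upwards [h, ev_li C] with n hn hli ws hw
  have h1 := rel_prod (fun i => ev (φ (x i)) n) (fun i => L i n) hn ws
  rw [hw] at h1
  exact rel_unique hli h1 rel_one

/-- dimension -/
lemma m_eq : C.m = d * d := by
  have := Module.finrank_eq_card_basis C.b
  simpa [Module.finrank_matrix] using this.symm

lemma rel_scalar {n : ℕ} (hli : Li C n) {x : GL (Fin d) (Ω n)} (h : rel C j n x 1) (y : Matrix (Fin d) (Fin d) (Ω n)) :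
    x.val * y = y * x.val := by
  haveI : Nonempty (Fin C.m) := ⟨⟨0, by rw [m_eq]; have := C.hd; positivity⟩⟩
  let b := basisOfLinearIndependentOfCardEqFinrank hli (by simp [Module.finrank_matrix, m_eq])
  have hy : y ∈ Submodule.span (Ω n) (Set.range b) := by rw [b.span_eq]; trivial
  induction hy using Submodule.span_induction with
  | mem y hy =>
    obtain ⟨k, rfl⟩ := hy
    have := h k
    simp only [Matrix.one_apply] at this
    have h2 : b k = (ev (C.w k) n).val := 
      congrFun (coe_basisOfLinearIndependentOfCardEqFinrank hli _) k
    rw [h2]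
    have h3 : x.val * (ev (C.w k) n).val * (x⁻¹).val = (ev (C.w k) n).val := by
      rw [this]; simp [apply_ite]
    calc x.val * (ev (C.w k) n).val = x.val * (ev (C.w k) n).val * (x⁻¹).val * x.val := by
          rw [mul_assoc, ← Units.val_mul]; simp
      _ = _ := by rw [h3]
  | zero => simp
  | add a b _ _ ha hb => rw [mul_add, add_mul, ha, hb]
  | smul c a _ ha => rw [mul_smul_comm, smul_mul_assoc, ha]
end A
end Tits

namespace Tits
set_option linter.unusedSectionVars false
set_option linter.all false
open Filter Pointwise
open scoped commutatorElement

section A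
variable {d : ℕ} {U : Ultrafilter ℕ} {Ω : ℕ → Type} [∀ n, Field (Ω n)]
    {F : ∀ n, Set (GL (Fin d) (Ω n))} {C : Core d U Ω F}
    {B : ℕ → Type} [∀ n, Field (B n)] {j : ∀ n, B n →+* Ω n}

lemma vs_of_finite_ent {n : ℕ} (hli : Li C n) (S : Subring (B n)) [Finite S]
    (h : ∀ f ∈ F n, ∃ L : Matrix (Fin C.m) (Fin C.m) (B n), (∀ a b, L a b ∈ S) ∧ rel C j n f L) :
    VS (Subgroup.closure (F n)) := by
  have key : ∀ x ∈ Subgroup.closure (F n), ∃ L : Matrix (Fin C.m) (Fin C.m) (B n), (∀ a b, L a b ∈ S) ∧ rel C j n x L := by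
    intro x hx
    rw [← Subgroup.mem_toSubmonoid, Subgroup.closure_toSubmonoid] at hx
    induction hx using Submonoid.closure_induction with
    | mem x hx =>
      rcases hx with hx | hx
      · exact h x hx
      · have := C.bad.symm n _ hx
        rw [inv_inv] at this
        exact h x this
    | one => exact ⟨1, fun a b => by rw [Matrix.one_apply]; split_ifs; exacts [S.one_mem, S.zero_mem], rel_one⟩
    | mul x y _ _ hx hy =>
      obtain ⟨L, hL, hr⟩ := hx
      obtain ⟨M, hM, hr'⟩ := hy
      refine ⟨L * M, fun a b => ?_, rel_mul hr hr'⟩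
      rw [Matrix.mul_apply]
      exact S.sum_mem fun i _ => S.mul_mem (hL _ _) (hM _ _)
  choose L hL hr using key
  let Γ := Subgroup.closure (F n)
  let Lf : Γ → Matrix (Fin C.m) (Fin C.m) S := fun x a b => ⟨L x.1 x.2 a b, hL x.1 x.2 a b⟩
  have h1 : ∀ x y : Γ, Lf x = Lf y → x⁻¹ * y ∈ Subgroup.center Γ := by
    intro x y hxy
    have e1 : L x.1 x.2 = L y.1 y.2 := by
      ext a b
      exact congrArg Subtype.val (congrFun (congrFun hxy a) b)
    have e2 : L (x⁻¹).1 (x⁻¹).2 * L x.1 x.2 = 1 := by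
      have := rel_mul (hr (x⁻¹).1 (x⁻¹).2) (hr x.1 x.2)
      have e0 : (x⁻¹).1 * x.1 = 1 := inv_mul_cancel x.1
      rw [e0] at this
      exact rel_unique hli this rel_one
    have e3 : rel C j n ((x⁻¹).1 * y.1) 1 := by
      rw [← e2, e1]
      exact rel_mul (hr _ _) (hr _ _)
    rw [Subgroup.mem_center_iff]
    intro z
    apply Subtype.ext
    apply Units.ext
    exact (rel_scalar hli e3 z.1.val).symm
  haveI : Finite (Γ ⧸ Subgroup.center Γ) := by
    apply Finite.of_injective (fun q : Γ ⧸ Subgroup.center Γ => Lf q.out)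
    intro p q hpq
    have := h1 _ _ hpq
    rw [← QuotientGroup.eq] at this
    simpa using this
  haveI : (Subgroup.center Γ).FiniteIndex := Subgroup.finiteIndex_of_finite_quotient
  exact VS.of_finiteIndex (Subgroup.center Γ) (VS.of_comm (fun x y => by
    apply Subtype.ext
    exact (Subgroup.mem_center_iff.mp y.2 x.1)))
end A

section alg
/-- algebraic elements over the prime field -/
abbrev Bal (K : Type) [Field K] : Type := algebraicClosure (⊥ : Subfield K) K

lemma finite_subring (K : Type) [Field K] (h : ¬ CharZero K) (S : Finset (Bal K)) :
    ∃ R : Subring (Bal K), Finite R ∧ ∀ s ∈ S, s ∈ R := by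
  obtain ⟨p, hp⟩ := CharP.exists K
  have hp0 : p ≠ 0 := by
    rintro rfl
    exact h (CharP.charP_to_charZero K)
  haveI : Fact p.Prime := ⟨(CharP.char_is_prime_or_zero K p).resolve_right hp0⟩
  letI := ZMod.algebra K p
  haveI : Finite (⊥ : Subfield K) := by
    have : (⊥ : Subfield K) = (algebraMap (ZMod p) K).fieldRange := by
      apply le_antisymm bot_le
      rintro _ ⟨z, rfl⟩
      obtain ⟨k, rfl⟩ := ZMod.intCast_surjective z
      simp
    rw [this]
    exact inferInstanceAs (Finite (Set.range (algebraMap (ZMod p) K)))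
  let E := IntermediateField.adjoin (⊥ : Subfield K) (S : Set (Bal K))
  haveI : FiniteDimensional (⊥ : Subfield K) E := by
    apply IntermediateField.finiteDimensional_adjoin
    intro x hx
    exact Algebra.IsIntegral.isIntegral x
  haveI : Finite E := Module.finite_of_finite (⊥ : Subfield K)
  refine ⟨E.toSubring, inferInstanceAs (Finite E), fun s hs => IntermediateField.subset_adjoin _ _ hs⟩

variable {d : ℕ} {U : Ultrafilter ℕ} {Ω : ℕ → Type} [∀ n, Field (Ω n)]
    {F : ∀ n, Set (GL (Fin d) (Ω n))} {C : Core d U Ω F}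

lemma ev_charZero (htr : HTr C (fun n => algebraMap (Bal (Ω n)) (Ω n))) : ∀ᶠ n in (U : Filter ℕ), CharZero (Ω n) := by
  by_contra hcon
  rw [← Ultrafilter.eventually_not] at hcon
  have h1 : ∀ᶠ n in (U : Filter ℕ), ∀ x ∈ F n, ∃ L, rel C (fun n => algebraMap (Bal (Ω n)) (Ω n)) n x L := by
    apply ev_forall U F (fun n => ⟨1, C.bad.one n⟩)
    intro f hf
    have := rel_of_lift htr ⟨f, Subgroup.subset_closure hf⟩ _ (umat_urepMat U _)
    filter_upwards [this] with n hn
    exact ⟨_, hn⟩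
  obtain ⟨n, ⟨hn1, hn2⟩, hn3⟩ := ((hcon.and h1).and (ev_li C)).exists
  choose L hL using hn2
  haveI := (C.bad.fin n).to_subtype
  haveI := Fintype.ofFinite (F n)
  classical
  obtain ⟨R, hR, hS⟩ := finite_subring (Ω n) hn1
    (Finset.univ.image (fun q : F n × Fin C.m × Fin C.m => L q.1.1 q.1.2 q.2.1 q.2.2))
  exact C.bad.nvs n (vs_of_finite_ent (j := fun n => algebraMap (Bal (Ω n)) (Ω n)) hn3 R (fun f hf => ⟨L f hf, fun a b => hS _ (by
    rw [Finset.mem_image]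
    exact ⟨(⟨f, hf⟩, a, b), Finset.mem_univ _, rfl⟩), hL f hf⟩))
end alg
end Tits

namespace Tits
set_option linter.unusedSectionVars false
set_option linter.all false
open Filter Pointwise
open scoped commutatorElement

/-- A place. -/
structure Pl (B : Type) [Field B] where
  v : AbsoluteValue B ℝ
  ar : Bool
  na : ar = false → ∀ x y, v (x + y) ≤ max (v x) (v y)
  emb : ar = true → ∃ ι : B →+* ℂ, ∀ x, v x = ‖ι x‖

def Pl.comp {B B' : Type} [Field B] [Field B'] (P : Pl B) (σ : B' →+* B) : Pl B' where
  v := P.v.comp σ.injective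
  ar := P.ar
  na := fun h x y => by
    show P.v (σ (x + y)) ≤ max (P.v (σ x)) (P.v (σ y))
    rw [map_add]
    exact P.na h _ _
  emb := fun h => by
    obtain ⟨ι, hι⟩ := P.emb h
    exact ⟨ι.comp σ, fun x => hι (σ x)⟩

lemma Pl.comp_v {B B' : Type} [Field B] [Field B'] (P : Pl B) (σ : B' →+* B) (x : B') : (P.comp σ).v x = P.v (σ x) := rfl

lemma fixed_pow {k L : Type} [Field k] [Field L] [Algebra k L] [Normal k L] (y : L) (hy : ∀ σ : L ≃ₐ[k] L, σ y = y) :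
    ∃ n : ℕ, 0 < n ∧ ∃ z : k, algebraMap k L z = y ^ n := by
  have hi : IsIntegral k y := Normal.isIntegral inferInstance y
  have hs : ((minpoly k y).map (algebraMap k L)).Splits := Normal.splits inferInstance y
  have hm : ((minpoly k y).map (algebraMap k L)).Monic := (minpoly.monic hi).map _
  have hroots : ((minpoly k y).map (algebraMap k L)).roots = Multiset.replicate (minpoly k y).natDegree y := by
    rw [Multiset.eq_replicate]
    constructor
    · rw [← Polynomial.natDegree_map (algebraMap k L)]
      exact hs.natDegree_eq_card_roots.symm
    · intro r hr
      have : Polynomial.aeval r (minpoly k y) = 0 := by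
        have := Polynomial.isRoot_of_mem_roots hr
        rwa [Polynomial.IsRoot, Polynomial.eval_map_algebraMap] at this
      obtain ⟨σ, hσ⟩ := minpoly.exists_algEquiv_of_root' hi.isAlgebraic this
      rw [← hσ, hy]
  refine ⟨(minpoly k y).natDegree, minpoly.natDegree_pos hi, (-1) ^ (minpoly k y).natDegree * (minpoly k y).coeff 0, ?_⟩
  have h0 := hs.coeff_zero_eq_prod_roots_of_monic hm
  rw [hroots, Multiset.prod_replicate, Polynomial.natDegree_map, Polynomial.coeff_map] at h0
  rw [map_mul, h0, map_pow, map_neg, map_one, ← mul_assoc, ← mul_pow]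
  simp

theorem pf_lift {k Ω J : Type} [Field k] [Field Ω] [Algebra k Ω] [Normal k Ω] (pl : J → Pl Ω) (j0 : J)
    (h : ∀ Q0 : Finset k, ∃ S : Finset J, j0 ∈ S ∧ ∀ q ∈ Q0, q ≠ 0 → ∑ i ∈ S, Real.log ((pl i).v (algebraMap k Ω q)) = 0)
    (Q : Finset Ω) :
    ∃ (I : Type) (_ : Fintype I) (P : I → Pl Ω), (∀ q ∈ Q, q ≠ 0 → ∑ i, Real.log ((P i).v q) = 0) ∧
      (∀ i, ∃ j, (P i).ar = (pl j).ar) ∧ ∃ i0, (P i0).ar = (pl j0).ar ∧ ∀ z : k, (P i0).v (algebraMap k Ω z) = (pl j0).v (algebraMap k Ω z) := by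
  classical
  haveI : Algebra.IsAlgebraic k Ω := Normal.toIsAlgebraic
  let E := IntermediateField.adjoin k (Q : Set Ω)
  haveI : FiniteDimensional k E := IntermediateField.finiteDimensional_adjoin (fun x _ => Algebra.IsIntegral.isIntegral x)
  let L := IntermediateField.normalClosure k E Ω
  have hQL : ∀ q ∈ Q, q ∈ L := fun q hq => E.le_normalClosure (IntermediateField.subset_adjoin k _ hq)
  haveI : FiniteDimensional k L := inferInstance
  haveI : Normal k L := inferInstance
  have hN : ∀ q : L, ∃ n : ℕ, 0 < n ∧ ∃ z : k, algebraMap k L z = (∏ σ : L ≃ₐ[k] L, σ q) ^ n := by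
    intro q
    apply fixed_pow
    intro τ
    rw [map_prod]
    exact Fintype.prod_equiv (Equiv.mulLeft τ) _ _ (fun σ => rfl)
  choose n hn z hz using hN
  obtain ⟨S, hS0, hS⟩ := h (Q.attach.image (fun q : {x // x ∈ Q} => z ⟨q.1, hQL q.1 q.2⟩))
  refine ⟨S × (L ≃ₐ[k] L), inferInstance, fun p => (pl p.1).comp ((p.2.liftNormal Ω : Ω ≃ₐ[k] Ω) : Ω →+* Ω), ?_, fun i => ⟨i.1, rfl⟩, (⟨j0, hS0⟩, 1), rfl, ?_⟩
  · intro q hq hq0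
    let q' : L := ⟨q, hQL q hq⟩
    have hq'0 : q' ≠ 0 := fun h => hq0 (congrArg Subtype.val h)
    have hz0 : z q' ≠ 0 := by
      intro h
      have := hz q'
      rw [h, map_zero] at this
      have := eq_zero_of_pow_eq_zero this.symm
      rw [Finset.prod_eq_zero_iff] at this
      obtain ⟨σ, _, hσ⟩ := this
      exact hq'0 (by simpa using hσ)
    have h1 := hS (z q') (Finset.mem_image.mpr ⟨⟨q, hq⟩, Finset.mem_attach _ _, rfl⟩) hz0
    have h2 : ∀ i, Real.log ((pl i).v (algebraMap k Ω (z q'))) = n q' * ∑ σ : L ≃ₐ[k] L, Real.log ((pl i).v (σ q' : Ω)) := by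
      intro i
      have : algebraMap k Ω (z q') = ((∏ σ : L ≃ₐ[k] L, σ q' : L) : Ω) ^ n q' := by
        rw [← SubmonoidClass.coe_pow, ← hz]; rfl
      rw [this, map_pow, Real.log_pow]
      congr 1
      have e : ((∏ σ : L ≃ₐ[k] L, σ q' : L) : Ω) = ∏ σ : L ≃ₐ[k] L, (σ q' : Ω) := map_prod L.val _ _
      rw [e, map_prod, Real.log_prod]
      intro σ _
      rw [(pl i).v.ne_zero_iff]
      intro h
      exact hq'0 (by simpa using h)
    simp_rw [h2] at h1
    rw [← Finset.mul_sum] at h1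
    have h3 := (mul_eq_zero.mp h1).resolve_left (by exact_mod_cast (hn q').ne')
    rw [Fintype.sum_prod_type]
    rw [← h3, ← Finset.sum_coe_sort S]
    apply Finset.sum_congr rfl
    intro i _
    apply Finset.sum_congr rfl
    intro σ _
    rw [Pl.comp_v]
    have := σ.liftNormal_commutes Ω q'
    congr 2
  · intro w
    rw [Pl.comp_v]
    congr 1
    exact AlgEquiv.commutes _ w
end Tits

namespace Tits
set_option linter.unusedSectionVars false
set_option linter.all false
open Filter Pointwise
open scoped commutatorElement

noncomputable def normAV (K : Type) [NormedField K] : AbsoluteValue K ℝ where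
  toFun x := ‖x‖
  map_mul' := norm_mul
  nonneg' := norm_nonneg
  eq_zero' _ := norm_eq_zero
  add_le' := norm_add_le

noncomputable def plC : Pl ℂ where
  v := normAV ℂ
  ar := true
  na := by simp
  emb := fun _ => ⟨RingHom.id ℂ, fun x => rfl⟩

noncomputable def plP (p : ℕ) [Fact p.Prime] : Pl (PadicAlgCl p) where
  v := normAV (PadicAlgCl p)
  ar := false
  na := fun _ x y => PadicAlgCl.isNonarchimedean p x y
  emb := by simp

lemma nat_pf (n : ℕ) (hn : n ≠ 0) (S : Finset Nat.Primes) (hS : ∀ p : Nat.Primes, (p : ℕ) ∣ n → p ∈ S) :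
    Real.log n + ∑ p ∈ S, Real.log ((padicNorm p n : ℚ) : ℝ) = 0 := by
  classical
  have h1 : Real.log n = ∑ p ∈ n.primeFactors, (n.factorization p) * Real.log p := by
    conv_lhs => rw [← Nat.prod_factorization_pow_eq_self hn]
    rw [Finsupp.prod, Nat.support_factorization]
    push_cast
    rw [Real.log_prod]
    · simp_rw [Real.log_pow]
    · intro p hp
      have := (Nat.prime_of_mem_primeFactors hp).pos
      positivity
  have h2 : ∀ p : Nat.Primes, Real.log ((padicNorm p n : ℚ) : ℝ) = - (n.factorization p * Real.log p) := by
    intro p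
    rw [padicNorm.eq_zpow_of_nonzero (by exact_mod_cast hn)]
    rw [Rat.cast_zpow, Rat.cast_natCast, zpow_neg, Real.log_inv, padicValRat.of_nat, zpow_natCast, Real.log_pow, Nat.factorization_def _ p.2]
  simp_rw [h2]
  rw [Finset.sum_neg_distrib, h1, add_neg_eq_zero]
  have h3 : ∑ p ∈ S, (n.factorization p * Real.log p : ℝ) = ∑ p ∈ S.image (fun p : Nat.Primes => (p : ℕ)), (n.factorization p * Real.log p : ℝ) := by
    exact (Finset.sum_image (f := fun p : ℕ => (n.factorization p * Real.log p : ℝ)) (fun a _ b _ h => Subtype.ext h)).symm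
  rw [h3]
  apply Finset.sum_subset
  · intro p hp
    rw [Finset.mem_image]
    exact ⟨⟨p, Nat.prime_of_mem_primeFactors hp⟩, hS _ (Nat.dvd_of_mem_primeFactors hp), rfl⟩
  · intro p hp hp'
    rw [← Nat.support_factorization, Finsupp.notMem_support_iff] at hp'
    rw [hp']; simp

lemma rat_pf (q : ℚ) (hn : q ≠ 0) (S : Finset Nat.Primes) (hS : ∀ p : Nat.Primes, (p : ℕ) ∣ q.num.natAbs * q.den → p ∈ S) :
    Real.log |(q : ℝ)| + ∑ p ∈ S, Real.log ((padicNorm p q : ℚ) : ℝ) = 0 := by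
  have ha : q.num.natAbs ≠ 0 := by simpa using hn
  have hb := q.den_nz
  have h1 := nat_pf _ ha S (fun p hp => hS p (dvd_mul_of_dvd_left hp _))
  have h2 := nat_pf _ hb S (fun p hp => hS p (dvd_mul_of_dvd_right hp _))
  have e1 : |(q : ℝ)| = (q.num.natAbs : ℝ) / q.den := by
    conv_lhs => rw [← Rat.num_div_den q]
    push_cast
    rw [abs_div, Nat.abs_cast, Nat.cast_natAbs, Int.cast_abs]
  have e2 : ∀ p : Nat.Primes, padicNorm p q = padicNorm p q.num.natAbs / padicNorm p q.den := by
    intro p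
    haveI : Fact (p : ℕ).Prime := ⟨p.2⟩
    conv_lhs => rw [← Rat.num_div_den q]
    rw [padicNorm.div]
    congr 1
    rcases Int.natAbs_eq q.num with h | h
    · conv_lhs => rw [h]
      simp
    · conv_lhs => rw [h]
      simp
  rw [e1, Real.log_div (by exact_mod_cast ha) (by exact_mod_cast hb)]
  have e3 : ∀ p : Nat.Primes, Real.log ((padicNorm p q : ℚ) : ℝ) = Real.log ((padicNorm p q.num.natAbs : ℚ) : ℝ) - Real.log ((padicNorm p q.den : ℚ) : ℝ) := by
    intro p
    haveI : Fact (p : ℕ).Prime := ⟨p.2⟩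
    rw [e2]
    push_cast
    rw [Real.log_div]
    · exact_mod_cast padicNorm.nonzero (by exact_mod_cast ha)
    · exact_mod_cast padicNorm.nonzero (by exact_mod_cast hb)
  simp_rw [e3]
  rw [Finset.sum_sub_distrib]
  linarith

instance pfact (p : Nat.Primes) : Fact (p : ℕ).Prime := ⟨p.2⟩

theorem pf_num (B : Type) [Field B] [CharZero B] [Algebra.IsAlgebraic ℚ B] [IsAlgClosed B] (Q : Finset B) :
    ∃ (I : Type) (_ : Fintype I) (P : I → Pl B), (∀ q ∈ Q, q ≠ 0 → ∑ i, Real.log ((P i).v q) = 0) ∧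
      ∃ i0, (P i0).ar = true := by
  classical
  haveI : Normal ℚ B := normal_iff.mpr fun x => ⟨Algebra.IsIntegral.isIntegral x, IsAlgClosed.splits _⟩
  let ι : B →ₐ[ℚ] ℂ := IsAlgClosed.lift
  let κ : ∀ p : Nat.Primes, B →ₐ[ℚ] PadicAlgCl p := fun p => IsAlgClosed.lift
  let pl : Option Nat.Primes → Pl B := fun o => match o with
    | none => plC.comp (ι : B →+* ℂ)
    | some p => (plP p).comp (κ p : B →+* PadicAlgCl p)
  obtain ⟨I, hI, P, h1, -, i0, h2, -⟩ := pf_lift (k := ℚ) (Ω := B) pl none (by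
    intro Q0
    let S : Finset Nat.Primes := Q0.biUnion fun q => (q.num.natAbs * q.den).primeFactors.attach.image fun p => ⟨p.1, Nat.prime_of_mem_primeFactors p.2⟩
    refine ⟨insert none (S.map Function.Embedding.some), Finset.mem_insert_self _ _, ?_⟩
    intro q hq hq0
    rw [Finset.sum_insert (by simp), Finset.sum_map]
    rw [← rat_pf q hq0 S ?_]
    · congr 1
      · show Real.log ‖ι (algebraMap ℚ B q)‖ = _
        rw [AlgHom.commutes]
        simp
      · apply Finset.sum_congr rfl
        intro p _
        show Real.log ‖κ p (algebraMap ℚ B q)‖ = _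
        rw [AlgHom.commutes]
        congr 1
        have : algebraMap ℚ (PadicAlgCl p) q = ((q : ℚ_[p]) : PadicAlgCl p) := by
          simp
        rw [this, PadicAlgCl.norm_extends]
        simp
    · intro p hp
      rw [Finset.mem_biUnion]
      refine ⟨q, hq, Finset.mem_image.mpr ⟨⟨p, ?_⟩, Finset.mem_attach _ _, rfl⟩⟩
      rw [Nat.mem_primeFactors]
      exact ⟨p.2, hp, mul_ne_zero (by simpa using hq0) q.den_nz⟩) Q
  exact ⟨I, hI, P, h1, i0, h2⟩

lemma bal_alg (K : Type) [Field K] [CharZero K] : Algebra.IsAlgebraic ℚ (Bal K) := by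
  haveI : Algebra.IsAlgebraic ℚ (⊥ : Subfield K) := by
    constructor
    intro x
    have : (x : K) ∈ (algebraMap ℚ K).fieldRange := (bot_le : (⊥ : Subfield K) ≤ _) x.2
    obtain ⟨q, hq⟩ := this
    have : x = algebraMap ℚ (⊥ : Subfield K) q := by
      apply Subtype.ext
      rw [← hq]; rfl
    rw [this]
    exact isAlgebraic_algebraMap q
  exact Algebra.IsAlgebraic.trans ℚ (⊥ : Subfield K) (Bal K)

instance bal_algClosed (K : Type) [Field K] [IsAlgClosed K] : IsAlgClosed (Bal K) :=
  (algebraicClosure.isAlgClosure (⊥ : Subfield K) K).isAlgClosed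
end Tits

namespace Tits
set_option linter.unusedSectionVars false
set_option linter.all false
open Filter Pointwise
open scoped commutatorElement

lemma hom_ext {k0 Ω Ω' : Type} [Field k0] [Field Ω] [Field Ω'] [IsAlgClosed Ω'] [Algebra k0 Ω] [Algebra.IsAlgebraic k0 Ω]
    (g : k0 →+* Ω') : ∃ h : Ω →+* Ω', ∀ x, h (algebraMap k0 Ω x) = g x := by
  letI := g.toAlgebra
  let l : Ω →ₐ[k0] Ω' := IsAlgClosed.lift
  exact ⟨l, fun x => l.commutes x⟩

theorem na_extend {k0 Ω : Type} [Field k0] [Field Ω] [Algebra k0 Ω] [Algebra.IsAlgebraic k0 Ω]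
    (v : AbsoluteValue k0 ℝ) (hna : ∀ x y, v (x + y) ≤ max (v x) (v y)) (t : k0) (ht : 1 < v t) :
    ∃ w : AbsoluteValue Ω ℝ, (∀ x y, w (x + y) ≤ max (w x) (w y)) ∧ ∀ x, w (algebraMap k0 Ω x) = v x := by
  let C := v.Completion
  let em : k0 → C := fun x => ((WithAbs.toAbs v x : WithAbs v) : C)
  have hem : ∀ x, ‖em x‖ = v x := fun x => by
    show ‖((WithAbs.toAbs v x : WithAbs v) : C)‖ = v x
    rw [UniformSpace.Completion.norm_coe]
    rfl
  letI nC : NontriviallyNormedField C := { (inferInstance : NormedField C) with non_trivial := ⟨em t, by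
      rw [show _ = v t from hem t]; exact ht⟩ }
  haveI : IsUltrametricDist C := by
    apply IsUltrametricDist.isUltrametricDist_of_forall_norm_add_le_max_norm
    intro x y
    induction x, y using UniformSpace.Completion.induction_on₂ with
    | hp => 
      apply isClosed_le
      · fun_prop
      · fun_prop
    | ih a b =>
      have := hna (WithAbs.ofAbs a) (WithAbs.ofAbs b)
      rw [← UniformSpace.Completion.coe_add, UniformSpace.Completion.norm_coe, UniformSpace.Completion.norm_coe, UniformSpace.Completion.norm_coe]
      exact this
  let eh : k0 →+* C := (UniformSpace.Completion.coeRingHom).comp (WithAbs.equiv v).symm.toRingHom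
  obtain ⟨h, hh⟩ := hom_ext (Ω := Ω) ((algebraMap C (AlgebraicClosure C)).comp eh)
  let N := spectralMulAlgNorm C (AlgebraicClosure C)
  refine ⟨{ toFun := fun x => N (h x), map_mul' := ?_, nonneg' := ?_, eq_zero' := ?_, add_le' := ?_ }, ?_, ?_⟩
  · intro x y; rw [map_mul, map_mul]
  · intro x; exact apply_nonneg _ _
  · intro x; rw [map_eq_zero_iff_eq_zero, map_eq_zero]
  · intro x y; rw [map_add]; exact map_add_le_add _ _ _
  · intro x y
    show N (h (x + y)) ≤ max (N (h x)) (N (h y))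
    rw [map_add]
    exact isNonarchimedean_spectralNorm (h x) (h y)
  · intro x
    show N (h (algebraMap k0 Ω x)) = _
    rw [hh]
    show spectralNorm C (AlgebraicClosure C) (algebraMap C _ (eh x)) = _
    rw [spectralNorm_extends]
    exact hem x

open Classical in
noncomputable def vinf (k : Type) [Field k] : AbsoluteValue (RatFunc k) ℝ where
  toFun x := if x = 0 then 0 else Real.exp (x.intDegree)
  map_mul' x y := by
    by_cases hx : x = 0
    · simp [hx]
    by_cases hy : y = 0
    · simp [hy]
    simp only [hx, hy, mul_eq_zero, or_self, if_false]
    rw [RatFunc.intDegree_mul hx hy, ← Real.exp_add]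
    push_cast; rfl
  nonneg' x := by split_ifs <;> positivity
  eq_zero' x := by
    split_ifs with h
    · simp [h]
    · simp [h, Real.exp_ne_zero]
  add_le' x y := by
    by_cases hx : x = 0
    · simp [hx]
    by_cases hy : y = 0
    · simp [hy]
    by_cases hxy : x + y = 0
    · simp only [hx, hy, hxy, if_true, if_false]; positivity
    simp only [hx, hy, hxy, if_false]
    have := RatFunc.intDegree_add_le hy hxy
    rcases le_max_iff.mp this with h | h
    · have : Real.exp ((x+y).intDegree) ≤ Real.exp (x.intDegree) := Real.exp_le_exp.mpr (by exact_mod_cast h)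
      have := Real.exp_pos (y.intDegree)
      linarith
    · have : Real.exp ((x+y).intDegree) ≤ Real.exp (y.intDegree) := Real.exp_le_exp.mpr (by exact_mod_cast h)
      have := Real.exp_pos (x.intDegree)
      linarith

lemma vinf_apply {k : Type} [Field k] (x : RatFunc k) (hx : x ≠ 0) : vinf k x = Real.exp (x.intDegree) := if_neg hx

lemma vinf_na {k : Type} [Field k] (x y : RatFunc k) : vinf k (x + y) ≤ max (vinf k x) (vinf k y) := by
  by_cases hx : x = 0
  · simp [hx]
  by_cases hy : y = 0
  · simp [hy]
  by_cases hxy : x + y = 0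
  · simp [hxy]
  rw [vinf_apply _ hx, vinf_apply _ hy, vinf_apply _ hxy]
  have := RatFunc.intDegree_add_le hy hxy
  rcases le_max_iff.mp this with h | h
  · exact le_max_of_le_left (Real.exp_le_exp.mpr (by exact_mod_cast h))
  · exact le_max_of_le_right (Real.exp_le_exp.mpr (by exact_mod_cast h))

lemma subst_hom {k : Type} [Field k] (a : k) : ∃ ψ : RatFunc k →+* RatFunc k, (∀ c, ψ (RatFunc.C c) = RatFunc.C c) ∧
    ψ RatFunc.X = RatFunc.C a + RatFunc.X⁻¹ := by
  have ht : Transcendental k (RatFunc.C a + RatFunc.X⁻¹ : RatFunc k) := by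
    intro h
    have h1 : IsAlgebraic k (RatFunc.C a : RatFunc k) := isAlgebraic_algebraMap a
    have h2 := h.sub h1
    rw [add_sub_cancel_left] at h2
    have h3 := h2.inv
    rw [inv_inv] at h3
    have hX : Transcendental k (RatFunc.X : RatFunc k) := by
      rw [← RatFunc.algebraMap_X]
      rw [transcendental_iff_injective]
      intro p q hpq
      apply RatFunc.algebraMap_injective k
      simpa [Polynomial.aeval_algebraMap_apply] using hpq
    exact hX h3
  have hi := transcendental_iff_injective.mp ht
  let ψ : RatFunc k →+* RatFunc k := IsFractionRing.lift (A := Polynomial k) (g := (Polynomial.aeval (R := k) (RatFunc.C a + RatFunc.X⁻¹ : RatFunc k)).toRingHom) hi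
  have hψ : ∀ p : Polynomial k, ψ (algebraMap _ _ p) = Polynomial.aeval (RatFunc.C a + RatFunc.X⁻¹ : RatFunc k) p := fun p => IsFractionRing.lift_algebraMap hi p
  refine ⟨ψ, fun c => ?_, ?_⟩
  · rw [← RatFunc.algebraMap_C, hψ, Polynomial.aeval_C]
    rw [RatFunc.algebraMap_C]; rfl
  · rw [← RatFunc.algebraMap_X, hψ, Polynomial.aeval_X]
    rw [RatFunc.algebraMap_X]

theorem pf_rat (k Ω : Type) [Field k] [IsAlgClosed k] [Field Ω] [IsAlgClosed Ω] [Algebra (RatFunc k) Ω] [Algebra.IsAlgebraic (RatFunc k) Ω]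
    (Q : Finset Ω) :
    ∃ (I : Type) (_ : Fintype I) (P : I → Pl Ω), (∀ q ∈ Q, q ≠ 0 → ∑ i, Real.log ((P i).v q) = 0) ∧
      (∀ i, (P i).ar = false) ∧ ∃ i0, 1 < (P i0).v (algebraMap (RatFunc k) Ω RatFunc.X) := by
  classical
  haveI : Normal (RatFunc k) Ω := normal_iff.mpr fun x => ⟨Algebra.IsIntegral.isIntegral x, IsAlgClosed.splits _⟩
  have hX1 : 1 < vinf k RatFunc.X := by
    rw [vinf_apply _ RatFunc.X_ne_zero, RatFunc.intDegree_X]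
    simp
  obtain ⟨w, hw1, hw2⟩ := na_extend (Ω := Ω) (vinf k) vinf_na RatFunc.X hX1
  let Pinf : Pl Ω := ⟨w, false, fun _ => hw1, by simp⟩
  choose ψ hψC hψX using fun a : k => subst_hom a
  choose σ hσ using fun a : k => hom_ext (Ω := Ω) ((algebraMap (RatFunc k) Ω).comp (ψ a))
  let pl : Option k → Pl Ω := fun o => match o with
    | none => Pinf
    | some a => Pinf.comp (σ a)
  have hv0 : ∀ f, (pl none).v (algebraMap (RatFunc k) Ω f) = vinf k f := hw2
  have hva : ∀ a f, (pl (some a)).v (algebraMap (RatFunc k) Ω f) = vinf k (ψ a f) := by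
    intro a f
    show w (σ a (algebraMap _ _ f)) = _
    rw [hσ]
    exact hw2 _
  let Lf : Finset k → RatFunc k → ℝ := fun S f => ∑ i ∈ insert none (S.map Function.Embedding.some), Real.log ((pl i).v (algebraMap (RatFunc k) Ω f))
  have hLm : ∀ S f g, f ≠ 0 → g ≠ 0 → Lf S (f * g) = Lf S f + Lf S g := by
    intro S f g hf hg
    rw [← Finset.sum_add_distrib]
    apply Finset.sum_congr rfl
    intro i _
    rw [map_mul, map_mul, Real.log_mul]
    · rw [(pl i).v.ne_zero_iff]; simpa using hf
    · rw [(pl i).v.ne_zero_iff]; simpa using hg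
  have hLe : ∀ S f, Lf S f = Real.log (vinf k f) + ∑ a ∈ S, Real.log (vinf k (ψ a f)) := by
    intro S f
    show ∑ i ∈ _, _ = _
    rw [Finset.sum_insert (by simp), Finset.sum_map, hv0]
    congr 1
    apply Finset.sum_congr rfl
    intro a _
    exact congrArg _ (hva a f)
  have hvC : ∀ c : k, c ≠ 0 → vinf k (RatFunc.C c) = 1 := by
    intro c hc
    rw [vinf_apply _ (by simpa using hc), RatFunc.intDegree_C]; simp
  have hLC : ∀ S c, c ≠ 0 → Lf S (RatFunc.C c) = 0 := by
    intro S c hc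
    rw [hLe, hvC c hc]
    simp [hψC, hvC c hc]
  have hXi : vinf k (RatFunc.X⁻¹) = Real.exp (-1) := by
    rw [vinf_apply _ (inv_ne_zero RatFunc.X_ne_zero), RatFunc.intDegree_inv, RatFunc.intDegree_X]
    simp
  have hXC : ∀ b : k, (RatFunc.X - RatFunc.C b : RatFunc k) = algebraMap (Polynomial k) _ (Polynomial.X - Polynomial.C b) := by
    intro b; simp
  have hXCne : ∀ b : k, (RatFunc.X - RatFunc.C b : RatFunc k) ≠ 0 := by
    intro b
    rw [hXC]
    exact RatFunc.algebraMap_ne_zero (Polynomial.X_sub_C_ne_zero b)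
  have hLX : ∀ (S : Finset k) b, b ∈ S → Lf S (RatFunc.X - RatFunc.C b) = 0 := by
    intro S b hb
    rw [hLe, Finset.sum_eq_single_of_mem b hb]
    · rw [vinf_apply _ (hXCne b), map_sub, hψC, hψX, add_sub_cancel_left, hXi, hXC, RatFunc.intDegree_polynomial]
      simp
    · intro a _ hab
      rw [map_sub, hψC, hψX]
      have e : (RatFunc.C a + RatFunc.X⁻¹ - RatFunc.C b : RatFunc k) = RatFunc.C (a - b) + RatFunc.X⁻¹ := by
        rw [map_sub]; ring
      rw [e]
      have h1 : vinf k (RatFunc.C (a - b)) = 1 := hvC _ (sub_ne_zero.mpr hab)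
      have h2 : vinf k (RatFunc.X⁻¹) < 1 := by
        rw [hXi]; simp
      have h3 := vinf_na (RatFunc.C (a - b)) (RatFunc.X⁻¹ : RatFunc k)
      have h4 := vinf_na (RatFunc.C (a - b) + RatFunc.X⁻¹) (-RatFunc.X⁻¹ : RatFunc k)
      rw [add_neg_cancel_right, (vinf k).map_neg, h1] at h4
      rw [h1, max_eq_left h2.le] at h3
      have h5 : 1 ≤ vinf k (RatFunc.C (a - b) + RatFunc.X⁻¹) := by
        rcases le_max_iff.mp h4 with h | h
        · exact h
        · linarith
      rw [le_antisymm h3 h5, Real.log_one]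
  have hLp : ∀ (S : Finset k) (p : Polynomial k), p ≠ 0 → (∀ a ∈ p.roots, a ∈ S) → Lf S (algebraMap _ _ p) = 0 := by
    intro S p hp hS
    have hsp := (IsAlgClosed.splits p).eq_prod_roots
    rw [hsp, map_mul, hLm, RatFunc.algebraMap_C, hLC _ _ (by simpa using hp), zero_add]
    · generalize p.roots = m at hS
      induction m using Multiset.induction_on with
      | empty =>
        simp only [Multiset.map_zero, Multiset.prod_zero, map_one]
        have := hLC S 1 one_ne_zero
        rwa [map_one] at this
      | cons a m ih =>
        rw [Multiset.map_cons, Multiset.prod_cons, map_mul, hLm, ih (fun a ha => hS a (Multiset.mem_cons_of_mem ha)), add_zero, ← hXC]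
        · exact hLX S a (hS a (Multiset.mem_cons_self a m))
        · rw [← hXC]; exact hXCne a
        · apply RatFunc.algebraMap_ne_zero
          apply (Polynomial.monic_multiset_prod_of_monic _ _ (fun a _ => Polynomial.monic_X_sub_C a)).ne_zero
    · simpa using hp
    · apply RatFunc.algebraMap_ne_zero
      apply (Polynomial.monic_multiset_prod_of_monic _ _ (fun a _ => Polynomial.monic_X_sub_C a)).ne_zero
  obtain ⟨I, hI, P, h1, har, i0, h2, h3⟩ := pf_lift (k := RatFunc k) (Ω := Ω) pl none (by
    intro Q0
    let S : Finset k := Q0.biUnion fun q => q.num.roots.toFinset ∪ q.denom.roots.toFinset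
    refine ⟨insert none (S.map Function.Embedding.some), Finset.mem_insert_self _ _, ?_⟩
    intro q hq hq0
    show Lf S q = 0
    have e : q * algebraMap _ _ q.denom = algebraMap _ _ q.num := by
      have : algebraMap (Polynomial k) (RatFunc k) q.denom ≠ 0 := by simpa using q.denom_ne_zero
      have h2 := RatFunc.num_div_denom q
      rw [div_eq_iff this] at h2
      exact h2.symm
    have h1 := hLm S q (algebraMap _ _ q.denom) hq0 (by simpa using q.denom_ne_zero)
    rw [e, hLp, hLp] at h1
    · linarith
    · exact q.denom_ne_zero
    · intro a ha
      exact Finset.mem_biUnion.mpr ⟨q, hq, Finset.mem_union_right _ (Multiset.mem_toFinset.mpr ha)⟩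
    · exact RatFunc.num_ne_zero hq0
    · intro a ha
      exact Finset.mem_biUnion.mpr ⟨q, hq, Finset.mem_union_left _ (Multiset.mem_toFinset.mpr ha)⟩) Q
  refine ⟨I, hI, P, h1, ?_, i0, ?_⟩
  · intro i
    obtain ⟨j, hj⟩ := har i
    rw [hj]
    cases j <;> rfl
  · rw [h3, hv0]; exact hX1

theorem pf_tr (Ω : Type) [Field Ω] [IsAlgClosed Ω] (θ : Ω) (hθ : Transcendental (⊥ : Subfield Ω) θ) (Q : Finset Ω) :
    ∃ (I : Type) (_ : Fintype I) (P : I → Pl Ω), (∀ q ∈ Q, q ≠ 0 → ∑ i, Real.log ((P i).v q) = 0) ∧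
      (∀ i, (P i).ar = false) ∧ ∃ i0, 1 < (P i0).v θ := by
  classical
  have h0 : AlgebraicIndepOn (⊥ : Subfield Ω) id {θ} := by
    have : AlgebraicIndependent (⊥ : Subfield Ω) (fun x : ({θ} : Set Ω) => (x : Ω)) := by
      haveI : Unique ({θ} : Set Ω) := Set.uniqueSingleton θ
      rw [algebraicIndependent_unique_type_iff]
      rw [show ((default : ({θ} : Set Ω)) : Ω) = θ from (default : ({θ} : Set Ω)).2]
      exact hθ
    exact this
  obtain ⟨t, ht, hb⟩ := exists_isTranscendenceBasis_superset h0
  have hθt : θ ∈ t := ht rfl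
  let L := IntermediateField.adjoin (⊥ : Subfield Ω) (t \ {θ})
  let k := algebraicClosure L Ω
  haveI : IsAlgClosed k := (algebraicClosure.isAlgClosure L Ω).isAlgClosed
  have hL : Transcendental L θ := by
    have h1 := hb.1.transcendental_adjoin (s := {i | (i : Ω) ≠ θ}) (i := ⟨θ, hθt⟩) (by simp)
    have e : (Subtype.val '' {i : t | (i : Ω) ≠ θ}) = t \ {θ} := by
      ext y; simp [and_comm]
    have h2 : Transcendental (Algebra.adjoin (⊥ : Subfield Ω) (t \ {θ})) θ := by
      rw [← e]; exact h1
    open scoped IntermediateField.algebraAdjoinAdjoin in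
    exact fun h => h2 ((IsFractionRing.isAlgebraic_iff (Algebra.adjoin (⊥ : Subfield Ω) (t \ {θ})) L Ω).mpr h)
  have hk : Transcendental k θ := by
    intro h
    exact hL (h.restrictScalars L)
  have hi := transcendental_iff_injective.mp hk
  letI : Algebra (RatFunc k) Ω := (IsFractionRing.lift (A := Polynomial k) (g := (Polynomial.aeval (R := k) θ).toRingHom) hi).toAlgebra
  have hX : algebraMap (RatFunc k) Ω RatFunc.X = θ := by
    rw [← RatFunc.algebraMap_X]
    exact (IsFractionRing.lift_algebraMap hi _).trans (Polynomial.aeval_X θ)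
  haveI : Algebra.IsAlgebraic (RatFunc k) Ω := by
    have h1 := hb.isAlgebraic_field
    have hC : ∀ c : k, algebraMap (RatFunc k) Ω (RatFunc.C c) = (c : Ω) := by
      intro c
      rw [← RatFunc.algebraMap_C]
      exact (IsFractionRing.lift_algebraMap hi _).trans (Polynomial.aeval_C θ c)
    let R : IntermediateField (⊥ : Subfield Ω) Ω := (algebraMap (RatFunc k) Ω).fieldRange.toIntermediateField (fun x => (bot_le : (⊥ : Subfield Ω) ≤ _) x.2)
    have hR : IntermediateField.adjoin (⊥ : Subfield Ω) (Set.range (Subtype.val : t → Ω)) ≤ R := by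
      rw [IntermediateField.adjoin_le_iff]
      rintro _ ⟨⟨y, hy⟩, rfl⟩
      show y ∈ (algebraMap (RatFunc k) Ω).fieldRange
      by_cases hyθ : y = θ
      · exact ⟨RatFunc.X, by rw [hX, hyθ]⟩
      · have hyL : y ∈ L := IntermediateField.subset_adjoin _ _ ⟨hy, hyθ⟩
        have hyk : y ∈ k := (algebraMap L k ⟨y, hyL⟩).2
        exact ⟨RatFunc.C ⟨y, hyk⟩, hC _⟩
    constructor
    intro x
    have h2 : IsAlgebraic R x := by
      refine (h1.isAlgebraic x).ringHom_of_comp_eq (IntermediateField.inclusion hR) (RingHom.id Ω) (IntermediateField.inclusion_injective hR) ?_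
      rfl
    refine IsAlgebraic.of_ringHom_of_comp_eq (S := R) (B := Ω) ((algebraMap (RatFunc k) Ω).rangeRestrictField) (RingHom.id Ω) (a := x) h2 (RingHom.rangeRestrictField_bijective _).2 Function.injective_id ?_
    rfl
  obtain ⟨I, hI, P, h1, h2, i0, h3⟩ := pf_rat k Ω Q
  exact ⟨I, hI, P, h1, h2, i0, by rwa [hX] at h3⟩
end Tits

namespace Tits
set_option linter.unusedSectionVars false
set_option linter.all false
open Filter Pointwise
open scoped commutatorElement

section PingPong
variable {k : Type} [Field k] {r : ℕ}

noncomputable def vn (u : AbsoluteValue k ℝ) {ι : Type} [Fintype ι] (v : ι → k) : ℝ := ∑ i, u (v i)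
noncomputable def mn (u : AbsoluteValue k ℝ) {ι κ : Type} [Fintype ι] [Fintype κ] (E : Matrix ι κ k) : ℝ := ∑ i, ∑ j, u (E i j)

lemma vn_nonneg (u : AbsoluteValue k ℝ) {ι : Type} [Fintype ι] (v : ι → k) : 0 ≤ vn u v := Finset.sum_nonneg fun i _ => u.nonneg _
lemma mn_nonneg (u : AbsoluteValue k ℝ) {ι κ : Type} [Fintype ι] [Fintype κ] (E : Matrix ι κ k) : 0 ≤ mn u E :=
  Finset.sum_nonneg fun i _ => Finset.sum_nonneg fun j _ => u.nonneg _

lemma vn_le (u : AbsoluteValue k ℝ) {ι : Type} [Fintype ι] (v : ι → k) (i : ι) : u (v i) ≤ vn u v :=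
  Finset.single_le_sum (f := fun i => u (v i)) (fun i _ => u.nonneg _) (Finset.mem_univ i)

lemma vn_add (u : AbsoluteValue k ℝ) {ι : Type} [Fintype ι] (v w : ι → k) : vn u (v + w) ≤ vn u v + vn u w := by
  rw [vn, vn, vn, ← Finset.sum_add_distrib]
  exact Finset.sum_le_sum fun i _ => u.add_le _ _

lemma vn_smul (u : AbsoluteValue k ℝ) {ι : Type} [Fintype ι] (a : k) (w : ι → k) : vn u (a • w) = u a * vn u w := by
  rw [vn, vn, Finset.mul_sum]
  exact Finset.sum_congr rfl fun i _ => by rw [Pi.smul_apply, smul_eq_mul, map_mul]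

lemma vn_dot (u : AbsoluteValue k ℝ) {ι : Type} [Fintype ι] (φ v : ι → k) : u (φ ⬝ᵥ v) ≤ vn u φ * vn u v := by
  classical
  calc u (φ ⬝ᵥ v) ≤ ∑ i, u (φ i * v i) := u.sum_le _ _
    _ ≤ ∑ i, u (φ i) * vn u v := Finset.sum_le_sum fun i _ => by
        rw [map_mul]
        exact mul_le_mul_of_nonneg_left (vn_le u v i) (u.nonneg _)
    _ = _ := by rw [← Finset.sum_mul]; rfl

lemma mn_mulVec (u : AbsoluteValue k ℝ) {ι κ : Type} [Fintype ι] [Fintype κ] (E : Matrix ι κ k) (v : κ → k) :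
    vn u (E.mulVec v) ≤ mn u E * vn u v := by
  rw [mn, Finset.sum_mul]
  exact Finset.sum_le_sum fun i _ => vn_dot u (E i) v

abbrev Lam := Fin 2 × Bool
def Lam.inv (a : Lam) : Lam := (a.1, !a.2)

structure PPd (u : AbsoluteValue k ℝ) (L : Lam → Matrix (Fin r) (Fin r) k) (p φ θ : Lam → Fin r → k) (v0 : Fin r → k)
    (α : Lam → k) (E : Lam → Matrix (Fin r) (Fin r) k) (δ ε : ℝ) : Prop where
  hL : ∀ i, L i = α i • (Matrix.vecMulVec (p i) (φ i) + E i)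
  hα : ∀ i, α i ≠ 0
  hδ : 0 < δ
  hε : 0 < ε
  hp : ∀ i j, j ≠ i.inv → δ < u (φ i ⬝ᵥ p j)
  hv : ∀ i, δ < u (φ i ⬝ᵥ v0)
  h1 : ∀ i j, mn u (E i) * (vn u (p j) + ε) < ε * (δ - ε * vn u (φ i))
  h2 : ∀ i, mn u (E i) * vn u v0 < ε * δ
  hθp : ∀ i, θ i ⬝ᵥ p i = 0
  hθv : ∀ i, θ i ⬝ᵥ v0 = 1
  h3 : ∀ i, ε * vn u (θ i) * vn u v0 < vn u (p i) - ε

variable {u : AbsoluteValue k ℝ} {L : Lam → Matrix (Fin r) (Fin r) k} {p φ θ : Lam → Fin r → k} {v0 : Fin r → k}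
    {α : Lam → k} {E : Lam → Matrix (Fin r) (Fin r) k} {δ ε : ℝ}

def Cone (u : AbsoluteValue k ℝ) (p : Fin r → k) (ε : ℝ) (v : Fin r → k) : Prop :=
  ∃ a e, v = a • p + e ∧ vn u e ≤ ε * u a ∧ a ≠ 0

lemma PPd.apply (h : PPd u L p φ θ v0 α E δ ε) (i : Lam) (v : Fin r → k) :
    (L i).mulVec v = (α i * (φ i ⬝ᵥ v)) • p i + α i • (E i).mulVec v := by
  rw [h.hL, Matrix.smul_mulVec, Matrix.add_mulVec, Matrix.vecMulVec_mulVec, smul_add, mul_smul]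
  congr 2
  exact op_smul_eq_smul _ _

lemma PPd.step (h : PPd u L p φ θ v0 α E δ ε) (i j : Lam) (hij : j ≠ i.inv) (v : Fin r → k) (hv : Cone u (p j) ε v) :
    Cone u (p i) ε ((L i).mulVec v) := by
  obtain ⟨a, e, rfl, he, ha⟩ := hv
  have hua : 0 < u a := u.pos ha
  have hm := mn_nonneg u (E i)
  have hfn := vn_nonneg u (φ i)
  have hN : vn u (a • p j + e) ≤ u a * (vn u (p j) + ε) := by
    have := vn_add u (a • p j) e
    rw [vn_smul] at this
    nlinarith
  have hlow : u a * (δ - ε * vn u (φ i)) ≤ u (φ i ⬝ᵥ (a • p j + e)) := by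
    have e1 : φ i ⬝ᵥ (a • p j + e) = a * (φ i ⬝ᵥ p j) - (-(φ i ⬝ᵥ e)) := by
      rw [dotProduct_add, dotProduct_smul, smul_eq_mul]; ring
    have h4 := u.le_sub (a * (φ i ⬝ᵥ p j)) (-(φ i ⬝ᵥ e))
    rw [← e1, u.map_neg, map_mul] at h4
    have h5 := vn_dot u (φ i) e
    have h6 := h.hp i j hij
    have h7 : vn u (φ i) * vn u e ≤ vn u (φ i) * (ε * u a) := mul_le_mul_of_nonneg_left he hfn
    nlinarith
  have hpos : 0 < δ - ε * vn u (φ i) := by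
    have h8 := h.h1 i j
    have h9 : 0 ≤ mn u (E i) * (vn u (p j) + ε) := mul_nonneg hm (add_nonneg (vn_nonneg _ _) h.hε.le)
    by_contra hc
    have := mul_nonpos_of_nonneg_of_nonpos h.hε.le (not_lt.mp hc)
    linarith
  have hne : φ i ⬝ᵥ (a • p j + e) ≠ 0 := by
    intro h0
    rw [h0, map_zero] at hlow
    nlinarith
  refine ⟨_, _, h.apply i _, ?_, mul_ne_zero (h.hα i) hne⟩
  rw [vn_smul, map_mul]
  have h10 := mn_mulVec u (E i) (a • p j + e)
  have h11 : vn u ((E i).mulVec (a • p j + e)) ≤ ε * u (φ i ⬝ᵥ (a • p j + e)) := by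
    calc _ ≤ mn u (E i) * vn u (a • p j + e) := h10
      _ ≤ mn u (E i) * (u a * (vn u (p j) + ε)) := mul_le_mul_of_nonneg_left hN hm
      _ = u a * (mn u (E i) * (vn u (p j) + ε)) := by ring
      _ ≤ u a * (ε * (δ - ε * vn u (φ i))) := mul_le_mul_of_nonneg_left (h.h1 i j).le hua.le
      _ = ε * (u a * (δ - ε * vn u (φ i))) := by ring
      _ ≤ _ := mul_le_mul_of_nonneg_left hlow h.hε.le
  calc _ ≤ u (α i) * (ε * u (φ i ⬝ᵥ (a • p j + e))) := mul_le_mul_of_nonneg_left h11 (u.nonneg _)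
    _ = _ := by ring

lemma PPd.start (h : PPd u L p φ θ v0 α E δ ε) (i : Lam) : Cone u (p i) ε ((L i).mulVec v0) := by
  have hne : φ i ⬝ᵥ v0 ≠ 0 := by
    intro h0
    have := h.hv i
    rw [h0, map_zero] at this
    linarith [h.hδ]
  refine ⟨_, _, h.apply i _, ?_, mul_ne_zero (h.hα i) hne⟩
  rw [vn_smul, map_mul]
  have h11 : vn u ((E i).mulVec v0) ≤ ε * u (φ i ⬝ᵥ v0) := by
    calc _ ≤ mn u (E i) * vn u v0 := mn_mulVec u (E i) _
      _ ≤ ε * δ := (h.h2 i).le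
      _ ≤ _ := mul_le_mul_of_nonneg_left (h.hv i).le h.hε.le
  calc _ ≤ u (α i) * (ε * u (φ i ⬝ᵥ v0)) := mul_le_mul_of_nonneg_left h11 (u.nonneg _)
    _ = _ := by ring

lemma PPd.notin (h : PPd u L p φ θ v0 α E δ ε) (i : Lam) : ¬ Cone u (p i) ε v0 := by
  rintro ⟨a, e, hv, he, ha⟩
  have hua : 0 < u a := u.pos ha
  have h1 := h.hθv i
  rw [hv, dotProduct_add, dotProduct_smul, h.hθp, smul_zero, zero_add] at h1
  have h2 := vn_dot u (θ i) e
  rw [h1, u.map_one] at h2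
  have h3 := h.h3 i
  have h4 : u a * vn u (p i) ≤ vn u v0 + vn u e := by
    have : a • p i = v0 + (-1 : k) • e := by rw [hv]; simp
    rw [← vn_smul, this]
    refine (vn_add u _ _).trans ?_
    rw [vn_smul]; simp
  have h5 := vn_nonneg u (θ i)
  have h6 : vn u (θ i) * vn u e ≤ vn u (θ i) * (ε * u a) := mul_le_mul_of_nonneg_left he h5
  have h7 := vn_nonneg u v0
  have hε := h.hε
  -- 1 ≤ εθ|a|, |a|(P-ε) ≤ N0
  have h8 : u a * (vn u (p i) - ε) ≤ vn u v0 := by linarith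
  have h9 : u a * (ε * vn u (θ i) * vn u v0) < vn u v0 := lt_of_lt_of_le (mul_lt_mul_of_pos_left h3 hua) h8
  have h10 : vn u v0 * 1 ≤ vn u v0 * (vn u (θ i) * (ε * u a)) := mul_le_mul_of_nonneg_left (h2.trans h6) h7
  nlinarith

theorem PPd.free (h : PPd u L p φ θ v0 α E δ ε) (w : List Lam) (hw : w ≠ []) (hr : FreeGroup.IsReduced w) : (w.map L).prod ≠ 1 := by
  have key : ∀ (l : List Lam) (a : Lam), FreeGroup.IsReduced (a :: l) → Cone u (p a) ε (((a :: l).map L).prod.mulVec v0) := by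
    intro l
    induction l with
    | nil => intro a _; simpa using h.start a
    | cons b l ih =>
      intro a ha
      rw [FreeGroup.isReduced_cons_cons] at ha
      rw [List.map_cons, List.prod_cons, ← Matrix.mulVec_mulVec]
      refine h.step a b ?_ _ (ih b ha.2)
      intro hb
      have := ha.1 (by rw [hb]; rfl)
      rw [hb] at this
      simp [Lam.inv] at this
  match w, hw with
  | a :: l, _ =>
    intro h1
    have := key l a hr
    rw [h1, Matrix.one_mulVec] at this
    exact h.notin a this

lemma freePair_of {G : Type*} [Group G] (x y : G)
    (h : ∀ w : List Lam, w ≠ [] → FreeGroup.IsReduced w → (w.map (fun a : Lam => (fun z => cond a.2 z z⁻¹) (if a.1 = 0 then x else y))).prod ≠ 1) :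
    FreePair x y := by
  rw [FreePair, injective_iff_map_eq_one]
  intro a ha
  by_contra hne
  refine h a.toWord (by simpa using hne) FreeGroup.isReduced_toWord ?_
  rw [← FreeGroup.mk_toWord (x := a), FreeGroup.lift_mk] at ha
  exact ha
end PingPong
end Tits

namespace Tits
set_option linter.unusedSectionVars false
set_option linter.all false
open Filter Pointwise
open scoped commutatorElement

section Tens
variable {k : Type} [Field k] {ι : Type} [Fintype ι] [DecidableEq ι]

def tensM (q : ℕ) (M : Matrix ι ι k) : Matrix (Fin q → ι) (Fin q → ι) k := fun f g => ∏ i, M (f i) (g i)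
lemma tensM_one (q : ℕ) : tensM q (1 : Matrix ι ι k) = 1 := by
  ext f g
  rw [tensM, Matrix.one_apply]
  split_ifs with h
  · subst h; simp
  · obtain ⟨i, hi⟩ := Function.ne_iff.mp h
    exact Finset.prod_eq_zero (Finset.mem_univ i) (by rw [Matrix.one_apply, if_neg hi])
lemma tensM_mul (q : ℕ) (M N : Matrix ι ι k) : tensM q (M * N) = tensM q M * tensM q N := by
  ext f g
  simp only [tensM, Matrix.mul_apply, Finset.prod_univ_sum, Fintype.piFinset_univ, Finset.prod_mul_distrib]

def tens (q : ℕ) {H : Type} [Group H] (M : H →* Matrix ι ι k) : H →* Matrix (Fin q → ι) (Fin q → ι) k where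
  toFun h := tensM q (M h)
  map_one' := by rw [map_one, tensM_one]
  map_mul' a b := by rw [map_mul, tensM_mul]

structure ClosedP (k : Type) [Field k] (H : Type) [Group H] (PP : ∀ (ι : Type) [Fintype ι] [DecidableEq ι], (H →* Matrix ι ι k) → Prop) : Prop where
  sub : ∀ (ι κ : Type) [Fintype ι] [DecidableEq ι] [Fintype κ] [DecidableEq κ] (M : H →* Matrix ι ι k) (M' : H →* Matrix κ κ k)
    (P : Matrix ι κ k) (P' : Matrix κ ι k), PP ι M → P' * P = 1 → (∀ h, M h * P = P * M' h) → PP κ M'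
  quot : ∀ (ι κ : Type) [Fintype ι] [DecidableEq ι] [Fintype κ] [DecidableEq κ] (M : H →* Matrix ι ι k) (M' : H →* Matrix κ κ k)
    (Q : Matrix κ ι k) (Q' : Matrix ι κ k), PP ι M → Q * Q' = 1 → (∀ h, Q * M h = M' h * Q) → PP κ M'
  tens : ∀ (ι : Type) [Fintype ι] [DecidableEq ι] (M : H →* Matrix ι ι k) (q : ℕ), PP ι M → PP (Fin q → ι) (tens q M)
end Tens

section Closure
variable {d : ℕ} {U : Ultrafilter ℕ} {Ω : ℕ → Type} [∀ n, Field (Ω n)]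
    {F : ∀ n, Set (GL (Fin d) (Ω n))} {B : ℕ → Type} [∀ n, Field (B n)] {H : Type} [Group H] (φ : H →* Gam F)
    {ι κ : Type} [Fintype ι] [DecidableEq ι] [Fintype κ] [DecidableEq κ]

lemma prod_intertwine {k : Type} [Field k] {Λ : Type} (N : Λ → Matrix ι ι k) (L : Λ → Matrix κ κ k) (P : Matrix ι κ k)
    (h : ∀ i, N i * P = P * L i) (ws : List Λ) : (ws.map N).prod * P = P * (ws.map L).prod := by
  induction ws with
  | nil => simp
  | cons a l ih => simp only [List.map_cons, List.prod_cons]; rw [Matrix.mul_assoc, ih, ← Matrix.mul_assoc, h a, Matrix.mul_assoc]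

lemma good_sub (M : H →* Matrix ι ι (Ult U B)) (M' : H →* Matrix κ κ (Ult U B)) (P : Matrix ι κ (Ult U B)) (P' : Matrix κ ι (Ult U B))
    (hM : Good φ M) (hP : P' * P = 1) (hi : ∀ h, M h * P = P * M' h) : Good φ M' := by
  intro Λ _ x L hL
  have h1 := hM Λ x (fun i => urepMat U (M (x i))) (fun i => umat_urepMat U _)
  have h2 : ∀ᶠ n in (U : Filter ℕ), urepMat U P' n * urepMat U P n = 1 := by
    rw [← umat_eq, umat_mul, umat_urepMat, umat_urepMat, hP, umat_one]
  have h3 : ∀ i, ∀ᶠ n in (U : Filter ℕ), urepMat U (M (x i)) n * urepMat U P n = urepMat U P n * L i n := by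
    intro i
    rw [← umat_eq, umat_mul, umat_urepMat, umat_urepMat, umat_mul, umat_urepMat, hL, hi]
  filter_upwards [h1, h2, eventually_all.mpr h3] with n h4 h5 h6 ws hw
  have h7 := prod_intertwine _ _ _ h6 ws
  rw [h4 ws hw, Matrix.one_mul] at h7
  have := congrArg (fun z => urepMat U P' n * z) h7
  simp only [← Matrix.mul_assoc, h5, Matrix.one_mul] at this
  exact this.symm

lemma good_quot (M : H →* Matrix ι ι (Ult U B)) (M' : H →* Matrix κ κ (Ult U B)) (P : Matrix κ ι (Ult U B)) (P' : Matrix ι κ (Ult U B))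
    (hM : Good φ M) (hP : P * P' = 1) (hi : ∀ h, P * M h = M' h * P) : Good φ M' := by
  intro Λ _ x L hL
  have h1 := hM Λ x (fun i => urepMat U (M (x i))) (fun i => umat_urepMat U _)
  have h2 : ∀ᶠ n in (U : Filter ℕ), urepMat U P n * urepMat U P' n = 1 := by
    rw [← umat_eq, umat_mul, umat_urepMat, umat_urepMat, hP, umat_one]
  have h3 : ∀ i, ∀ᶠ n in (U : Filter ℕ), L i n * urepMat U P n = urepMat U P n * urepMat U (M (x i)) n := by
    intro i
    rw [← umat_eq, umat_mul, umat_urepMat, umat_mul, umat_urepMat, umat_urepMat, hL, hi]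
  filter_upwards [h1, h2, eventually_all.mpr h3] with n h4 h5 h6 ws hw
  have h7 := prod_intertwine _ _ _ h6 ws
  rw [h4 ws hw, Matrix.mul_one] at h7
  have := congrArg (fun z => z * urepMat U P' n) h7
  simp only [Matrix.mul_assoc, h5, Matrix.mul_one] at this
  exact this

lemma good_tens (M : H →* Matrix ι ι (Ult U B)) (q : ℕ) (hM : Good φ M) : Good φ (tens q M) := by
  intro Λ _ x L hL
  have h1 := hM Λ x (fun i => urepMat U (M (x i))) (fun i => umat_urepMat U _)
  have h3 : ∀ i, ∀ᶠ n in (U : Filter ℕ), L i n = tensM q (urepMat U (M (x i)) n) := by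
    intro i
    rw [← umat_eq, hL]
    ext f g
    show ∏ j, M (x i) (f j) (g j) = umk U (fun n => ∏ j, urepMat U (M (x i)) n (f j) (g j))
    rw [show (fun n => ∏ j, urepMat U (M (x i)) n (f j) (g j)) = ∏ j, fun n => urepMat U (M (x i)) n (f j) (g j) by ext n; simp, map_prod]
    refine Finset.prod_congr rfl fun j _ => ?_
    exact (congrFun (congrFun (umat_urepMat U (M (x i))) (f j)) (g j)).symm
  filter_upwards [h1, eventually_all.mpr h3] with n h4 h6 ws hw
  have h5 := h4 ws hw
  have key : ∀ l : List Λ, (l.map (fun i => L i n)).prod = tensM q (l.map (fun i => urepMat U (M (x i)) n)).prod := by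
    intro l
    induction l with
    | nil => simp [tensM_one]
    | cons a l ih => simp only [List.map_cons, List.prod_cons]; rw [ih, h6, tensM_mul]
  rw [key, h5, tensM_one]

/-- base change of a matrix representation -/
def bch {k k' : Type} [Field k] [Field k'] (f : k →+* k') (M : H →* Matrix ι ι k) : H →* Matrix ι ι k' :=
  (f.mapMatrix : Matrix ι ι k →+* Matrix ι ι k').toMonoidHom.comp M
lemma bch_apply {k k' : Type} [Field k] [Field k'] (f : k →+* k') (M : H →* Matrix ι ι k) (h : H) : bch f M h = (M h).map f := rfl

lemma good_closed {k : Type} [Field k] (f : k →+* Ult U B) : ClosedP k H (fun ι _ _ M => Good φ (bch f M)) where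
  sub ι κ _ _ _ _ M M' P P' hM hP hi := good_sub φ (bch f M) (bch f M') (P.map f) (P'.map f) hM
    (by rw [← Matrix.map_mul, hP, Matrix.map_one _ (map_zero f) (map_one f)])
    (fun h => by rw [bch_apply, bch_apply, ← Matrix.map_mul, ← Matrix.map_mul, hi])
  quot ι κ _ _ _ _ M M' P P' hM hP hi := good_quot φ (bch f M) (bch f M') (P.map f) (P'.map f) hM
    (by rw [← Matrix.map_mul, hP, Matrix.map_one _ (map_zero f) (map_one f)])
    (fun h => by rw [bch_apply, bch_apply, ← Matrix.map_mul, ← Matrix.map_mul, hi])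
  tens ι _ _ M q hM := by
    have := good_tens φ (bch f M) q hM
    convert this using 1
    ext h a b
    show f (∏ i, M h (a i) (b i)) = ∏ i, f (M h (a i) (b i))
    rw [map_prod]
end Closure

section Transfer
variable {d : ℕ} {U : Ultrafilter ℕ} {Ω : ℕ → Type} [∀ n, Field (Ω n)]
    {F : ∀ n, Set (GL (Fin d) (Ω n))} {B : ℕ → Type} [∀ n, Field (B n)] {H : Type} [Group H] (φ : H →* Gam F)

def lett {H : Type*} [Group H] (x y : H) (a : Lam) : H := (fun z => cond a.2 z z⁻¹) (if a.1 = 0 then x else y)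

theorem transfer {k : Type} [Field k] (f : k →+* Ult U B) (av : AbsoluteValue k ℝ) (u : ∀ n, AbsoluteValue (B n) ℝ)
    (hav : ∀ x (z : ∀ n, B n), umk U z = f x → Tendsto (fun n => u n (z n)) U (nhds (av x)))
    (hbad : Bad F) (hU : ∀ N, ∀ᶠ n in (U : Filter ℕ), N ≤ n)
    {r : ℕ} (M : H →* Matrix (Fin r) (Fin r) k) (hG : Good φ (bch f M)) (x y : H)
    (p φ' θ : Lam → Fin r → k) (v0 : Fin r → k) (α : Lam → k) (E : Lam → Matrix (Fin r) (Fin r) k) (δ ε : ℝ)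
    (h : PPd av (fun a => M (lett x y a)) p φ' θ v0 α E δ ε) : False := by
  -- representatives
  let R : k → ∀ n, B n := fun x => urep U (f x)
  have hR : ∀ x, umk U (R x) = f x := fun x => umk_urep U _
  let V : (Fin r → k) → ∀ n, Fin r → B n := fun v n i => R (v i) n
  let W : Matrix (Fin r) (Fin r) k → ∀ n, Matrix (Fin r) (Fin r) (B n) := fun A n i j => R (A i j) n
  have tvn : ∀ v, Tendsto (fun n => vn (u n) (V v n)) U (nhds (vn av v)) := fun v =>
    tendsto_finsetSum _ fun i _ => hav _ _ (hR _)
  have tmn : ∀ v, Tendsto (fun n => mn (u n) (W v n)) U (nhds (mn av v)) := fun v =>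
    tendsto_finsetSum _ fun i _ => tendsto_finsetSum _ fun j _ => hav _ _ (hR _)
  have hdot : ∀ v w, umk U (fun n => V v n ⬝ᵥ V w n) = f (v ⬝ᵥ w) := by
    intro v w
    rw [show (fun n => V v n ⬝ᵥ V w n) = ∑ i, (R (v i)) * (R (w i)) by ext n; simp [dotProduct, V], map_sum, dotProduct, map_sum]
    refine Finset.sum_congr rfl fun i _ => ?_
    rw [map_mul, map_mul, hR, hR]
  have tdot : ∀ v w, Tendsto (fun n => u n (V v n ⬝ᵥ V w n)) U (nhds (av (v ⬝ᵥ w))) := fun v w => hav _ _ (hdot v w)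
  let Ln : Lam → ∀ n, Matrix (Fin r) (Fin r) (B n) := fun a n => R (α a) n • (Matrix.vecMulVec (V (p a) n) (V (φ' a) n) + W (E a) n)
  have hLn : ∀ a, umat U (Ln a) = bch f M (lett x y a) := by
    intro a
    rw [bch_apply, h.hL a]
    ext i j
    show umk U (R (α a) * (R (p a i) * R (φ' a j) + R (E a i j))) = f (α a * (p a i * φ' a j + E a i j))
    simp only [map_mul, map_add, hR]
  have e1 : ∀ a, ∀ᶠ n in (U : Filter ℕ), R (α a) n ≠ 0 := by
    intro a
    have : umk U (R (α a)) ≠ 0 := by rw [hR]; exact (map_ne_zero f).mpr (h.hα a)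
    rwa [Ne, umk_eq_zero, ← Ultrafilter.eventually_not] at this
  have e2 : ∀ i j, j ≠ i.inv → ∀ᶠ n in (U : Filter ℕ), δ < u n (V (φ' i) n ⬝ᵥ V (p j) n) := fun i j hij =>
    (tdot _ _).eventually_const_lt (h.hp i j hij)
  have e3 : ∀ i, ∀ᶠ n in (U : Filter ℕ), δ < u n (V (φ' i) n ⬝ᵥ V v0 n) := fun i =>
    (tdot _ _).eventually_const_lt (h.hv i)
  have e4 : ∀ i j, ∀ᶠ n in (U : Filter ℕ), mn (u n) (W (E i) n) * (vn (u n) (V (p j) n) + ε) < ε * (δ - ε * vn (u n) (V (φ' i) n)) := by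
    intro i j
    refine Tendsto.eventually_lt ((tmn (E i)).mul ((tvn (p j)).add_const ε)) ((((tvn (φ' i)).const_mul ε).const_sub δ).const_mul ε) (h.h1 i j)
  have e5 : ∀ i, ∀ᶠ n in (U : Filter ℕ), mn (u n) (W (E i) n) * vn (u n) (V v0 n) < ε * δ := fun i =>
    ((tmn (E i)).mul (tvn v0)).eventually_lt_const (h.h2 i)
  have e6 : ∀ i, ∀ᶠ n in (U : Filter ℕ), V (θ i) n ⬝ᵥ V (p i) n = 0 := by
    intro i
    rw [← umk_eq_zero, hdot, h.hθp, map_zero]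
  have e7 : ∀ i, ∀ᶠ n in (U : Filter ℕ), V (θ i) n ⬝ᵥ V v0 n = 1 := by
    intro i
    have : umk U (fun n => V (θ i) n ⬝ᵥ V v0 n) = umk U 1 := by rw [hdot, h.hθv, map_one, map_one]
    exact (umk_eq U).mp this
  have e8 : ∀ i, ∀ᶠ n in (U : Filter ℕ), ε * vn (u n) (V (θ i) n) * vn (u n) (V v0 n) < vn (u n) (V (p i) n) - ε := fun i =>
    Tendsto.eventually_lt (((tvn (θ i)).const_mul ε).mul (tvn v0)) ((tvn (p i)).sub_const ε) (h.h3 i)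
  have e9 := hG Lam (fun a => lett x y a) Ln hLn
  obtain ⟨cx, hcx⟩ := Gam.pw hbad.symm (φ x).2
  obtain ⟨cy, hcy⟩ := Gam.pw hbad.symm (φ y).2
  have e2' := eventually_all.mpr fun i => eventually_all.mpr fun j => eventually_all.mpr (e2 i j)
  have e4' := eventually_all.mpr fun i => eventually_all.mpr (e4 i)
  obtain ⟨n, a1, a2, a3, a4, a5, a6, a7, a8, a9, a10, a11⟩ := ((eventually_all.mpr e1).and (e2'.and ((eventually_all.mpr e3).and (e4'.and ((eventually_all.mpr e5).and
    ((eventually_all.mpr e6).and ((eventually_all.mpr e7).and ((eventually_all.mpr e8).and (e9.and ((hU cx).and (hU cy))))))))))).exists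
  have hPP : PPd (u n) (fun a => Ln a n) (fun a => V (p a) n) (fun a => V (φ' a) n) (fun a => V (θ a) n) (V v0 n) (fun a => R (α a) n)
      (fun a => W (E a) n) δ ε := ⟨fun i => rfl, a1, h.hδ, h.hε, a2, a3, a4, a5, a6, a7, a8⟩
  refine hbad.nofree n (ev (φ x) n) (ev (φ y) n) (Pw.mono a10 (hcx n)) (Pw.mono a11 (hcy n)) ?_
  apply freePair_of
  intro w hw hr hprod
  refine hPP.free w hw hr (a9 w ?_)
  rw [← hprod]
  congr 2
  ext1 a
  obtain ⟨a, b⟩ := a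
  unfold lett
  by_cases ha : a = 0 <;> cases b <;> simp [ha]
end Transfer
end Tits

namespace Tits
set_option linter.unusedSectionVars false
set_option linter.all false
open Filter Pointwise
open scoped commutatorElement

lemma real_rec (a b : ℕ → ℝ) (q : ℝ) (hq0 : 0 ≤ q) (hq : q < 1) (ha : ∀ n, 0 ≤ a n) (h : ∀ n, a (n+1) ≤ q * a n + b n)
    (hb : Tendsto b atTop (nhds 0)) : Tendsto a atTop (nhds 0) := by
  rw [Metric.tendsto_atTop]
  intro ε hε
  have h1 : 0 < (1 - q) * (ε / 2) := by have : 0 < 1 - q := by linarith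
                                        positivity
  obtain ⟨N, hN⟩ := eventually_atTop.mp (hb.eventually_lt_const h1)
  have key : ∀ m, a (N + m) ≤ q ^ m * a N + ε / 2 := by
    intro m
    induction m with
    | zero => simp; linarith
    | succ m ih =>
      have := h (N + m)
      have h2 := hN (N + m) (by omega)
      have h3 := mul_le_mul_of_nonneg_left ih hq0
      rw [← add_assoc, pow_succ]
      nlinarith
  have h4 : Tendsto (fun m => q ^ m * a N) atTop (nhds (0 * a N)) := (tendsto_pow_atTop_nhds_zero_of_lt_one hq0 hq).mul_const _
  rw [zero_mul] at h4
  obtain ⟨m, hm⟩ := eventually_atTop.mp (h4.eventually_lt_const (half_pos hε))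
  refine ⟨N + m, fun n hn => ?_⟩
  obtain ⟨c, rfl⟩ := Nat.exists_eq_add_of_le hn
  rw [Real.dist_eq, sub_zero, abs_of_nonneg (ha _), add_assoc]
  have := key (m + c)
  have := hm (m + c) (by omega)
  linarith

section Growth
variable {k : Type} [NormedField k]

lemma growth {W : Type*} [AddCommGroup W] [Module k W] (T : Module.End k W) (t : ℝ) (ht : 0 < t) (s : Multiset k) (hs : ∀ μ ∈ s, ‖μ‖ < t) :
    ∀ (v : W), Polynomial.aeval T (s.map (fun μ => Polynomial.X - Polynomial.C μ)).prod v = 0 → ∀ ℓ : W →ₗ[k] k,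
      Tendsto (fun n => ‖ℓ ((T ^ n) v)‖ / t ^ n) atTop (nhds 0) := by
  induction s using Multiset.induction_on with
  | empty =>
    intro v hv ℓ
    have : v = 0 := by simpa using hv
    simp [this]
  | cons μ s ih =>
    intro v hv ℓ
    have h1 := ih (fun x hx => hs x (Multiset.mem_cons_of_mem hx)) (T v - μ • v) (by
      rw [Multiset.map_cons, Multiset.prod_cons, mul_comm, map_mul] at hv
      simpa [Module.algebraMap_end_apply] using hv) ℓ
    have h2 := hs μ (Multiset.mem_cons_self _ _)
    refine real_rec _ (fun n => (‖ℓ ((T ^ n) (T v - μ • v))‖ / t ^ n) / t) (‖μ‖ / t) (by positivity) (by rwa [div_lt_one ht]) (fun n => by positivity) ?_ ?_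
    · intro n
      have e : ℓ ((T ^ (n+1)) v) = μ * ℓ ((T ^ n) v) + ℓ ((T ^ n) (T v - μ • v)) := by
        rw [pow_succ, Module.End.mul_apply, map_sub, map_sub, map_smul, map_smul, smul_eq_mul]; ring
      have e2 : ‖ℓ ((T ^ (n+1)) v)‖ ≤ ‖μ‖ * ‖ℓ ((T ^ n) v)‖ + ‖ℓ ((T ^ n) (T v - μ • v))‖ := by
        rw [e, ← norm_mul]; exact norm_add_le _ _
      have e3 : ‖μ‖ / t * (‖ℓ ((T ^ n) v)‖ / t ^ n) + (‖ℓ ((T ^ n) (T v - μ • v))‖ / t ^ n) / t = (‖μ‖ * ‖ℓ ((T ^ n) v)‖ + ‖ℓ ((T ^ n) (T v - μ • v))‖) / t ^ (n+1) := by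
        rw [pow_succ]; field_simp
      rw [e3]
      gcongr
    · simpa using h1.div_const t

variable [IsAlgClosed k]
lemma root_iff {ι : Type} [Fintype ι] [DecidableEq ι] (F : Matrix ι ι k) (μ : k) :
    μ ∈ F.charpoly.roots ↔ ∃ v, v ≠ 0 ∧ F.mulVec v = μ • v := by
  rw [Polynomial.mem_roots F.charpoly_monic.ne_zero, Polynomial.IsRoot, Matrix.eval_charpoly, ← Matrix.exists_mulVec_eq_zero_iff]
  refine exists_congr fun v => and_congr_right fun _ => ?_
  rw [Matrix.sub_mulVec, sub_eq_zero, eq_comm]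
  simp [Matrix.scalar_apply]

lemma growth_mat {ι : Type} [Fintype ι] [DecidableEq ι] (F : Matrix ι ι k) (t : ℝ) (ht : 0 < t) (h : ∀ μ ∈ F.charpoly.roots, ‖μ‖ < t) (a b : ι) :
    Tendsto (fun n => ‖(F ^ n) a b‖ / t ^ n) atTop (nhds 0) := by
  have h1 : (F.charpoly.roots.map (fun μ => Polynomial.X - Polynomial.C μ)).prod = F.charpoly :=
    ((IsAlgClosed.splits F.charpoly).eq_prod_roots_of_monic F.charpoly_monic).symm
  have := growth (Matrix.toLin' F) t ht F.charpoly.roots h (Pi.single b 1) (by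
    rw [h1, ← Matrix.charpoly_toLin', LinearMap.aeval_self_charpoly]; rfl) (LinearMap.proj a)
  convert this using 4 with n
  rw [← Matrix.toLin'_pow, Matrix.toLin'_apply, Matrix.mulVec_single_one]
  rfl

lemma coprime_prod (s1 s2 : Multiset k) (h : ∀ a ∈ s1, ∀ b ∈ s2, a ≠ b) :
    IsCoprime (s1.map (fun μ => Polynomial.X - Polynomial.C μ)).prod (s2.map (fun μ => Polynomial.X - Polynomial.C μ)).prod := by
  induction s1 using Multiset.induction_on with
  | empty => simp [isCoprime_one_left]
  | cons a s1 ih =>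
    rw [Multiset.map_cons, Multiset.prod_cons]
    refine IsCoprime.mul_left ?_ (ih fun x hx => h x (Multiset.mem_cons_of_mem hx))
    have h2 := h a (Multiset.mem_cons_self _ _)
    clear ih h
    induction s2 using Multiset.induction_on with
    | empty => simp [isCoprime_one_right]
    | cons b s2 ih =>
      rw [Multiset.map_cons, Multiset.prod_cons]
      refine IsCoprime.mul_right ?_ (ih fun x hx => h2 x (Multiset.mem_cons_of_mem hx))
      exact Polynomial.isCoprime_X_sub_C_of_isUnit_sub (isUnit_iff_ne_zero.mpr (sub_ne_zero.mpr (h2 b (Multiset.mem_cons_self _ _))))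

lemma exists_t (s : Multiset k) (μ : k) (h : 1 < ‖μ‖) : ∃ t : ℝ, 1 < t ∧ t < ‖μ‖ ∧ ∀ x ∈ s, ‖x‖ ≠ t := by
  have h1 : (Set.Ioo 1 ‖μ‖ \ ((fun x : k => ‖x‖) '' {x | x ∈ s})).Nonempty := by
    apply Set.Infinite.nonempty
    apply (Set.Ioo_infinite h).diff
    apply Set.Finite.image
    classical
    exact Set.Finite.subset s.toFinset.finite_toSet (fun x hx => by simpa using hx)
  obtain ⟨t, ht, ht2⟩ := h1
  exact ⟨t, ht.1, ht.2, fun x hx hxt => ht2 ⟨x, hx, hxt⟩⟩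

set_option maxHeartbeats 1000000 in
theorem block {m : ℕ} (G : Matrix (Fin m) (Fin m) k) (μ : k) (hμ : μ ∈ G.charpoly.roots) (hμ1 : 1 < ‖μ‖) :
    ∃ (q q' : ℕ) (C : Matrix (Fin m) (Fin q ⊕ Fin q') k) (C' : Matrix (Fin q ⊕ Fin q') (Fin m) k) (Ag : Matrix (Fin q) (Fin q) k)
      (Bg : Matrix (Fin q') (Fin q') k) (t : ℝ), C' * C = 1 ∧ C * C' = 1 ∧ G * C = C * Matrix.fromBlocks Ag 0 0 Bg ∧ 0 < t ∧ 1 < ‖Ag.det‖ ∧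
      (∀ a b, Tendsto (fun n => ‖((Ag⁻¹) ^ n) a b‖ / (t⁻¹) ^ n) atTop (nhds 0)) ∧ (∀ a b, Tendsto (fun n => ‖(Bg ^ n) a b‖ / t ^ n) atTop (nhds 0)) := by
  classical
  obtain ⟨t, ht1, htμ, ht⟩ := exists_t G.charpoly.roots μ hμ1
  have ht0 : 0 < t := by linarith
  set s := G.charpoly.roots with hs
  set s1 := s.filter (fun x => t < ‖x‖) with hs1
  set s2 := s.filter (fun x => ¬ t < ‖x‖) with hs2
  set P1 := (s1.map (fun μ => Polynomial.X - Polynomial.C μ)).prod with hP1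
  set P2 := (s2.map (fun μ => Polynomial.X - Polynomial.C μ)).prod with hP2
  have hP : P1 * P2 = G.charpoly := by
    rw [hP1, hP2, ← Multiset.prod_add, ← Multiset.map_add, hs1, hs2, Multiset.filter_add_not]
    exact ((IsAlgClosed.splits G.charpoly).eq_prod_roots_of_monic G.charpoly_monic).symm
  have hcop : IsCoprime P1 P2 := coprime_prod _ _ (by
    rintro a ha b hb rfl
    exact (Multiset.mem_filter.mp hb).2 (Multiset.mem_filter.mp ha).2)
  set T := Matrix.toLin' G with hT
  set W1 := LinearMap.ker (Polynomial.aeval T P1) with hW1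
  set W2 := LinearMap.ker (Polynomial.aeval T P2) with hW2
  have hcompl : IsCompl W1 W2 := by
    refine ⟨Polynomial.disjoint_ker_aeval_of_isCoprime T hcop, codisjoint_iff.mpr ?_⟩
    rw [hW1, hW2, Polynomial.sup_ker_aeval_eq_ker_aeval_mul_of_coprime T hcop, hP, hT, ← Matrix.charpoly_toLin', LinearMap.aeval_self_charpoly, LinearMap.ker_zero]
  have hinv : ∀ P : Polynomial k, ∀ w ∈ LinearMap.ker (Polynomial.aeval T P), T w ∈ LinearMap.ker (Polynomial.aeval T P) := by
    intro P w hw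
    rw [LinearMap.mem_ker] at hw ⊢
    have : Commute (Polynomial.aeval T P) T := by
      have := (Polynomial.commute_X P).symm.map (Polynomial.aeval T)
      simpa using this
    have h2 := LinearMap.congr_fun this.eq w
    simp only [Module.End.mul_apply] at h2
    rw [h2, hw, map_zero]
  let b1 := Module.finBasis k W1
  let b2 := Module.finBasis k W2
  let T1 : Module.End k W1 := T.restrict (hinv P1)
  let T2 : Module.End k W2 := T.restrict (hinv P2)
  let b : Module.Basis (Fin (Module.finrank k W1) ⊕ Fin (Module.finrank k W2)) k (Fin m → k) := (b1.prod b2).map (Submodule.prodEquivOfIsCompl W1 W2 hcompl)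
  have hb1 : ∀ i, b (Sum.inl i) = (b1 i : Fin m → k) := fun i => by simp [b]
  have hb2 : ∀ i, b (Sum.inr i) = (b2 i : Fin m → k) := fun i => by simp [b]
  set Ag := LinearMap.toMatrix b1 b1 T1 with hAg
  set Bg := LinearMap.toMatrix b2 b2 T2 with hBg
  have rt : ∀ (W : Submodule k (Fin m → k)) (P : Polynomial k) (hW : W = LinearMap.ker (Polynomial.aeval T P)) (b : Module.Basis (Fin (Module.finrank k W)) k W)
      (S : Module.End k W) (hS : ∀ w, ((S w : W) : Fin m → k) = T w) (ν : k), ν ∈ (LinearMap.toMatrix b b S).charpoly.roots → P.IsRoot ν := by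
    intro W P hW b S hS ν hν
    rw [LinearMap.charpoly_toMatrix, Polynomial.mem_roots (LinearMap.charpoly_monic S).ne_zero, ← Module.End.hasEigenvalue_iff_isRoot_charpoly] at hν
    obtain ⟨w, hw⟩ := hν.exists_hasEigenvector
    have h1 : T (w : Fin m → k) = ν • (w : Fin m → k) := by
      rw [← hS, hw.apply_eq_smul]; rfl
    have hw0 : (w : Fin m → k) ≠ 0 := fun h => hw.2 (Subtype.ext h)
    have h2 := Module.End.aeval_apply_of_hasEigenvector (p := P) (f := T) (μ := ν) (x := (w : Fin m → k)) ⟨Module.End.mem_eigenspace_iff.mpr h1, hw0⟩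
    have h3 : Polynomial.aeval T P (w : Fin m → k) = 0 := by
      exact LinearMap.mem_ker.mp (hW.le w.2)
    rw [h3] at h2
    exact (smul_eq_zero.mp h2.symm).resolve_right hw0
  have rootP : ∀ (σ : Multiset k) ν, (σ.map (fun μ => Polynomial.X - Polynomial.C μ)).prod.IsRoot ν → ν ∈ σ := by
    intro σ ν h
    rw [Polynomial.IsRoot, Polynomial.eval_multiset_prod, Multiset.prod_eq_zero_iff, Multiset.map_map] at h
    obtain ⟨a, ha, h2⟩ := Multiset.mem_map.mp h
    simp [sub_eq_zero] at h2
    rwa [h2]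
  have rA : ∀ ν ∈ Ag.charpoly.roots, t < ‖ν‖ := fun ν hν =>
    (Multiset.mem_filter.mp (rootP s1 ν (rt W1 P1 rfl b1 T1 (fun w => rfl) ν hν))).2
  have rB : ∀ ν ∈ Bg.charpoly.roots, ‖ν‖ < t := fun ν hν => by
    have := (Multiset.mem_filter.mp (rootP s2 ν (rt W2 P2 rfl b2 T2 (fun w => rfl) ν hν)))
    exact lt_of_le_of_ne (not_lt.mp this.2) (ht ν this.1)
  have hdet : 1 < ‖Ag.det‖ := by
    rw [Matrix.det_eq_prod_roots_charpoly, ← coe_nnnorm]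
    have hne : Ag.charpoly.roots ≠ 0 := by
      intro h0
      have hc := (IsAlgClosed.splits Ag.charpoly).natDegree_eq_card_roots
      rw [h0, Ag.charpoly_natDegree_eq_dim] at hc
      simp only [Fintype.card_fin, Multiset.card_zero] at hc
      have hbot : W1 = ⊥ := Submodule.finrank_eq_zero.mp hc
      obtain ⟨v, hv0, hv⟩ := (root_iff G μ).mp hμ
      apply hv0
      have h2 := Module.End.aeval_apply_of_hasEigenvector (p := P1) (f := T) (μ := μ) (x := v) ⟨Module.End.mem_eigenspace_iff.mpr (by rw [hT, Matrix.toLin'_apply, hv]), hv0⟩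
      have : Polynomial.eval μ P1 = 0 := by
        rw [hP1, Polynomial.eval_multiset_prod, Multiset.prod_eq_zero_iff, Multiset.map_map]
        exact Multiset.mem_map.mpr ⟨μ, Multiset.mem_filter.mpr ⟨hμ, htμ⟩, by simp⟩
      rw [this, zero_smul] at h2
      have h3 : v ∈ W1 := h2
      rw [hbot] at h3
      simpa using h3
    have gen : ∀ σ : Multiset k, (∀ x ∈ σ, 1 < ‖x‖) → 1 ≤ ‖σ.prod‖ ∧ (σ ≠ 0 → 1 < ‖σ.prod‖) := by
      intro σ
      induction σ using Multiset.induction_on with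
      | empty => simp
      | cons a σ ih =>
        intro h
        have h1 := (ih fun x hx => h x (Multiset.mem_cons_of_mem hx)).1
        have h2 := h a (Multiset.mem_cons_self _ _)
        rw [Multiset.prod_cons, norm_mul]
        have : 1 < ‖a‖ * ‖σ.prod‖ := by nlinarith
        exact ⟨this.le, fun _ => this⟩
    exact (gen _ (fun x hx => ht1.trans (rA x hx))).2 hne
  have hdet0 : Ag.det ≠ 0 := by
    intro h; rw [h, norm_zero] at hdet; linarith
  refine ⟨_, _, Matrix.of fun i x => b x i, LinearMap.toMatrix (Pi.basisFun k (Fin m)) b LinearMap.id, Ag, Bg, t, ?_, ?_, ?_, ht0, hdet, ?_, ?_⟩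
  · have : (Matrix.of fun i x => b x i) = LinearMap.toMatrix b (Pi.basisFun k (Fin m)) LinearMap.id := by
      ext i x; simp [LinearMap.toMatrix_apply]
    rw [this, ← LinearMap.toMatrix_comp, LinearMap.id_comp, LinearMap.toMatrix_id]
  · have : (Matrix.of fun i x => b x i) = LinearMap.toMatrix b (Pi.basisFun k (Fin m)) LinearMap.id := by
      ext i x; simp [LinearMap.toMatrix_apply]
    rw [this, ← LinearMap.toMatrix_comp, LinearMap.id_comp, LinearMap.toMatrix_id]
  · have key : ∀ (W : Submodule k (Fin m → k)) {ι : Type} [Fintype ι] [DecidableEq ι] (b : Module.Basis ι k W)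
      (S : Module.End k W) (hS : ∀ w, ((S w : W) : Fin m → k) = T w) (a : ι), T (b a : Fin m → k) = ∑ c, LinearMap.toMatrix b b S c a • (b c : Fin m → k) := by
      intro W ι _ _ b S hS a
      rw [← hS, ← b.sum_repr (S (b a)), Submodule.coe_sum]
      refine Finset.sum_congr rfl fun c _ => ?_
      rw [LinearMap.toMatrix_apply]; rfl
    ext i x
    have e1 : (G * (Matrix.of fun i x => b x i)) i x = T (b x) i := by
      rw [hT, Matrix.toLin'_apply]; rfl
    rw [e1, Matrix.mul_apply, Fintype.sum_sum_type]
    cases x with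
    | inl x =>
      rw [hb1, key W1 b1 T1 (fun w => rfl), Finset.sum_apply, Finset.sum_eq_zero (s := (Finset.univ : Finset (Fin (Module.finrank k W2)))) (fun y _ => by rw [Matrix.fromBlocks_apply₂₁, Matrix.zero_apply, mul_zero]), add_zero]
      refine Finset.sum_congr rfl fun c _ => ?_
      rw [Matrix.fromBlocks_apply₁₁, Matrix.of_apply, hb1, Pi.smul_apply, smul_eq_mul, mul_comm]
    | inr x =>
      rw [hb2, key W2 b2 T2 (fun w => rfl), Finset.sum_apply, Finset.sum_eq_zero (s := (Finset.univ : Finset (Fin (Module.finrank k W1)))) (fun y _ => by rw [Matrix.fromBlocks_apply₁₂, Matrix.zero_apply, mul_zero]), zero_add]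
      refine Finset.sum_congr rfl fun c _ => ?_
      rw [Matrix.fromBlocks_apply₂₂, Matrix.of_apply, hb2, Pi.smul_apply, smul_eq_mul, mul_comm]
  · apply growth_mat _ _ (inv_pos.mpr ht0)
    intro ν hν
    obtain ⟨v, hv0, hv⟩ := (root_iff _ _).mp hν
    have h1 : v = ν • Ag.mulVec v := by
      rw [← Matrix.mulVec_smul, ← hv, Matrix.mulVec_mulVec, Matrix.mul_nonsing_inv _ (isUnit_iff_ne_zero.mpr hdet0), Matrix.one_mulVec]
    have hν0 : ν ≠ 0 := by
      rintro rfl; rw [zero_smul] at h1; exact hv0 h1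
    have h2 := rA ν⁻¹ ((root_iff _ _).mpr ⟨v, hv0, by
      conv_rhs => rw [h1]
      rw [smul_smul, inv_mul_cancel₀ hν0, one_smul]⟩)
    rw [norm_inv] at h2
    exact (lt_inv_comm₀ ht0 (norm_pos_iff.mpr hν0)).mp h2
  · exact growth_mat _ _ ht0 rB
end Growth
end Tits

namespace Tits
set_option linter.unusedSectionVars false
set_option linter.all false
open Filter Pointwise
open scoped commutatorElement

section Lim
variable {k : Type} [NormedField k]

lemma climit {q q' : ℕ} (D E : Matrix (Fin q ⊕ Fin q') (Fin q ⊕ Fin q') k) (Ag : Matrix (Fin q) (Fin q) k) (Bg : Matrix (Fin q') (Fin q') k) (t : ℝ)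
    (ht : 0 < t) (hA : Ag.det ≠ 0) (h1 : ∀ a b, Tendsto (fun n => ‖((Ag⁻¹) ^ n) a b‖ / (t⁻¹) ^ n) atTop (nhds 0))
    (h2 : ∀ a b, Tendsto (fun n => ‖(Bg ^ n) a b‖ / t ^ n) atTop (nhds 0)) (hD : D.toBlocks₁₁.det ≠ 0) (hE : E.toBlocks₁₁.det ≠ 0) :
    Tendsto (fun n => (D * Matrix.fromBlocks Ag 0 0 Bg ^ n * E).toBlocks₁₁.det / Ag.det ^ n) atTop (nhds (D.toBlocks₁₁.det * E.toBlocks₁₁.det)) := by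
  set D1 := D.toBlocks₁₁ with hD1
  set E1 := E.toBlocks₁₁ with hE1
  set X := D1⁻¹ * D.toBlocks₁₂ with hX
  set Y := E.toBlocks₂₁ * E1⁻¹ with hY
  have hAu := isUnit_iff_ne_zero.mpr hA
  have hDu := isUnit_iff_ne_zero.mpr hD
  have hEu := isUnit_iff_ne_zero.mpr hE
  have e1 : ∀ n, (D * Matrix.fromBlocks Ag 0 0 Bg ^ n * E).toBlocks₁₁ = D1 * (Ag ^ n * ((1 + (Ag⁻¹) ^ n * X * Bg ^ n * Y) * E1)) := by
    intro n
    have hAn : Ag ^ n * (Ag⁻¹) ^ n = 1 := by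
      rw [← Commute.mul_pow, Matrix.mul_nonsing_inv _ hAu, one_pow]
      show Ag * Ag⁻¹ = Ag⁻¹ * Ag
      rw [Matrix.mul_nonsing_inv _ hAu, Matrix.nonsing_inv_mul _ hAu]
    have e2 : D1 * (Ag ^ n * ((1 + (Ag⁻¹) ^ n * X * Bg ^ n * Y) * E1)) = D1 * Ag ^ n * E1 + (D1 * D1⁻¹) * D.toBlocks₁₂ * Bg ^ n * E.toBlocks₂₁ * (E1⁻¹ * E1) := by
      rw [hX, hY]
      have : Ag ^ n * ((1 + (Ag⁻¹) ^ n * (D1⁻¹ * D.toBlocks₁₂) * Bg ^ n * (E.toBlocks₂₁ * E1⁻¹)) * E1) = Ag ^ n * E1 + (Ag ^ n * (Ag⁻¹) ^ n) * (D1⁻¹ * D.toBlocks₁₂) * Bg ^ n * (E.toBlocks₂₁ * E1⁻¹) * E1 := by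
        simp only [Matrix.add_mul, Matrix.mul_add, Matrix.one_mul, Matrix.mul_assoc]
      rw [this, hAn]
      simp only [Matrix.add_mul, Matrix.mul_add, Matrix.one_mul, Matrix.mul_assoc]
    rw [e2, Matrix.mul_nonsing_inv _ hDu, Matrix.nonsing_inv_mul _ hEu, Matrix.one_mul, Matrix.mul_one]
    conv_lhs => rw [← Matrix.fromBlocks_toBlocks D, ← Matrix.fromBlocks_toBlocks E, Matrix.fromBlocks_diagonal_pow]
    simp [Matrix.fromBlocks_multiply, Matrix.mul_assoc]
    rfl
  have e3 : ∀ n, (D * Matrix.fromBlocks Ag 0 0 Bg ^ n * E).toBlocks₁₁.det / Ag.det ^ n = D1.det * ((1 + (Ag⁻¹) ^ n * X * Bg ^ n * Y).det * E1.det) := by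
    intro n
    rw [e1, Matrix.det_mul, Matrix.det_mul, Matrix.det_mul, Matrix.det_pow]
    field_simp
  simp_rw [e3]
  have h3 : Tendsto (fun n => (1 + (Ag⁻¹) ^ n * X * Bg ^ n * Y)) atTop (nhds ((1 : Matrix (Fin q) (Fin q) k) + (0 : Matrix (Fin q) (Fin q') k) * Y)) := by
    have h4 : Tendsto (fun n => (Ag⁻¹) ^ n * X * Bg ^ n) atTop (nhds (0 : Matrix (Fin q) (Fin q') k)) := by
      refine tendsto_pi_nhds.mpr fun a => tendsto_pi_nhds.mpr fun b => ?_
      simp only [Matrix.mul_apply, Matrix.zero_apply, Finset.sum_mul]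
      rw [show nhds (0 : k) = nhds (∑ c : Fin q', ∑ c' : Fin q, 0) by simp]
      refine tendsto_finsetSum _ fun c _ => tendsto_finsetSum _ fun c' _ => ?_
      rw [tendsto_zero_iff_norm_tendsto_zero]
      have := ((h1 a c').mul (h2 c b)).mul_const ‖X c' c‖
      simp only [mul_zero, zero_mul] at this
      refine this.congr fun n => ?_
      rw [norm_mul, norm_mul, inv_pow]
      have : t ^ n ≠ 0 := by positivity
      field_simp
    exact tendsto_const_nhds.add (((continuous_id.matrix_mul continuous_const : Continuous fun Z : Matrix (Fin q) (Fin q') k => id Z * Y).tendsto _).comp h4)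
  have h5 := ((Continuous.matrix_det continuous_id).tendsto ((1 : Matrix (Fin q) (Fin q) k) + (0 : Matrix (Fin q) (Fin q') k) * Y)).comp h3
  simp only [Matrix.zero_mul, add_zero, id, Matrix.det_one] at h5
  have h5 : Tendsto (fun n => (1 + (Ag⁻¹) ^ n * X * Bg ^ n * Y).det) atTop (nhds 1) := h5
  have h6 := (h5.mul_const E1.det).const_mul D1.det
  rw [one_mul] at h6
  exact h6
end Lim

section Cyc
variable {k : Type} [Field k] {H : Type} [Group H] {ι : Type} [Fintype ι] [DecidableEq ι]

lemma sub_lemma (M : H →* Matrix ι ι k) (p : ι → k) : ∃ (r : ℕ) (P : Matrix ι (Fin r) k) (P' : Matrix (Fin r) ι k) (M1 : H →* Matrix (Fin r) (Fin r) k),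
    P' * P = 1 ∧ (∀ h, M h * P = P * M1 h) ∧ P.mulVec (P'.mulVec p) = p ∧ (∀ ψ : Fin r → k, (∀ h, ψ ⬝ᵥ (M1 h).mulVec (P'.mulVec p) = 0) → ψ = 0) := by
  classical
  set W := Submodule.span k (Set.range fun h => (M h).mulVec p) with hW
  let b := Module.finBasis k W
  let L : (Fin (Module.finrank k W) → k) →ₗ[k] (ι → k) := W.subtype.comp b.equivFun.symm.toLinearMap
  have hL : LinearMap.ker L = ⊥ := by
    rw [LinearMap.ker_eq_bot]
    exact W.injective_subtype.comp b.equivFun.symm.injective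
  obtain ⟨L', hL'⟩ := LinearMap.exists_leftInverse_of_injective L hL
  set P := LinearMap.toMatrix' L with hP
  set P' := LinearMap.toMatrix' L' with hP'
  have h1 : P' * P = 1 := by rw [hP, hP', ← LinearMap.toMatrix'_comp, hL', LinearMap.toMatrix'_id]
  have hPP : ∀ w ∈ W, P.mulVec (P'.mulVec w) = w := by
    intro w hw
    have : w = P.mulVec (b.equivFun ⟨w, hw⟩) := by
      rw [hP, LinearMap.toMatrix'_mulVec]; simp [L]
    rw [this, Matrix.mulVec_mulVec _ P' P, h1, Matrix.one_mulVec]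
  have hPW : ∀ x, P.mulVec x ∈ W := by
    intro x; rw [hP, LinearMap.toMatrix'_mulVec]; exact (b.equivFun.symm x).2
  have hinv : ∀ h, ∀ w ∈ W, (M h).mulVec w ∈ W := by
    intro h w hw
    induction hw using Submodule.span_induction with
    | mem w hw =>
      obtain ⟨h', rfl⟩ := hw
      refine Submodule.subset_span ⟨h * h', ?_⟩
      simp [Matrix.mulVec_mulVec]
    | zero => simp
    | add x y _ _ hx hy => rw [Matrix.mulVec_add]; exact W.add_mem hx hy
    | smul a x _ hx => rw [Matrix.mulVec_smul]; exact W.smul_mem _ hx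
  have h2 : ∀ h, P * (P' * M h * P) = M h * P := by
    intro h
    apply Matrix.ext_of_mulVec_single
    intro i
    rw [← Matrix.mulVec_mulVec, ← Matrix.mulVec_mulVec, ← Matrix.mulVec_mulVec]
    rw [hPP _ (hinv h _ (hPW _)), Matrix.mulVec_mulVec]
  have hp : p ∈ W := Submodule.subset_span ⟨1, by simp⟩
  refine ⟨_, P, P', ⟨⟨fun h => P' * M h * P, by simp [h1]⟩, ?_⟩, h1, fun h => (h2 h).symm, hPP p hp, ?_⟩
  · intro x y
    show P' * M (x * y) * P = P' * M x * P * (P' * M y * P)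
    rw [Matrix.mul_assoc (P' * M x) P, h2, map_mul]
    simp only [Matrix.mul_assoc]
  · intro ψ hψ
    have h3 : ∀ w ∈ W, ψ ⬝ᵥ P'.mulVec w = 0 := by
      intro w hw
      induction hw using Submodule.span_induction with
      | mem w hw =>
        obtain ⟨h, rfl⟩ := hw
        have := hψ h
        simp only [MonoidHom.coe_mk, OneHom.coe_mk] at this
        rw [← Matrix.mulVec_mulVec, ← Matrix.mulVec_mulVec, hPP p hp] at this
        exact this
      | zero => simp
      | add x y _ _ hx hy => rw [Matrix.mulVec_add, dotProduct_add, hx, hy, add_zero]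
      | smul a x _ hx => rw [Matrix.mulVec_smul, dotProduct_smul, hx, smul_zero]
    ext i
    have := h3 _ (hPW (Pi.single i 1))
    rw [Matrix.mulVec_mulVec, h1, Matrix.one_mulVec] at this
    simpa using this

lemma dot_tr {a b : Type} [Fintype a] [Fintype b] (x : a → k) (S : Matrix a b k) (y : b → k) : x ⬝ᵥ S.mulVec y = S.transpose.mulVec x ⬝ᵥ y := by
  rw [Matrix.dotProduct_mulVec, Matrix.mulVec_transpose]

def dualR (M : H →* Matrix ι ι k) : H →* Matrix ι ι k where
  toFun h := (M h⁻¹).transpose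
  map_one' := by simp
  map_mul' a b := by rw [mul_inv_rev, map_mul, Matrix.transpose_mul]

lemma cyc {PP : ∀ (ι : Type) [Fintype ι] [DecidableEq ι], (H →* Matrix ι ι k) → Prop} (hPP : ClosedP k H PP)
    (M : H →* Matrix ι ι k) (hM : PP ι M) (p φ : ι → k) :
    ∃ (r : ℕ) (M2 : H →* Matrix (Fin r) (Fin r) k) (p2 φ2 : Fin r → k) (L : Matrix (Fin r) ι k) (L' : Matrix ι (Fin r) k), PP (Fin r) M2 ∧
      (∀ h, M2 h = L * M h * L') ∧ (∀ h, φ2 ⬝ᵥ (M2 h).mulVec p2 = φ ⬝ᵥ (M h).mulVec p) ∧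
      (∀ ψ : Fin r → k, (∀ h, ψ ⬝ᵥ (M2 h).mulVec p2 = 0) → ψ = 0) ∧ (∀ v : Fin r → k, (∀ h, φ2 ⬝ᵥ (M2 h).mulVec v = 0) → v = 0) := by
  obtain ⟨r1, P, P', M1, a1, a2, a3, a4⟩ := sub_lemma M p
  set p1 := P'.mulVec p with hp1
  set φ1 := P.transpose.mulVec φ with hφ1
  obtain ⟨r, S, S', N, b1, b2, b3, b4⟩ := sub_lemma (dualR M1) φ1
  have b5 : ∀ h, S.transpose * M1 h = (dualR N h) * S.transpose := by
    intro h
    have := congrArg Matrix.transpose (b2 h⁻¹)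
    rw [Matrix.transpose_mul, Matrix.transpose_mul] at this
    simpa [dualR] using this
  have b6 : S.transpose * S'.transpose = 1 := by rw [← Matrix.transpose_mul, b1, Matrix.transpose_one]
  have hM1 : PP _ M1 := hPP.sub _ _ M M1 P P' hM a1 a2
  have a5 : ∀ h, M1 h = P' * M h * P := by
    intro h; rw [Matrix.mul_assoc, a2, ← Matrix.mul_assoc, a1, Matrix.one_mul]
  have b7 : ∀ h v, (dualR N h).mulVec (S.transpose.mulVec v) = S.transpose.mulVec ((M1 h).mulVec v) := by
    intro h v; rw [Matrix.mulVec_mulVec, Matrix.mulVec_mulVec, b5]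
  refine ⟨r, dualR N, S.transpose.mulVec p1, S'.mulVec φ1, S.transpose * P', P * S'.transpose, hPP.quot _ _ M1 _ S.transpose S'.transpose hM1 b6 b5, ?_, ?_, ?_, ?_⟩
  · intro h
    have : S.transpose * P' * M h * (P * S'.transpose) = S.transpose * (P' * M h * P) * S'.transpose := by simp only [Matrix.mul_assoc]
    rw [this, ← a5, b5, Matrix.mul_assoc, b6, Matrix.mul_one]
  · intro h
    rw [b7, dot_tr, Matrix.transpose_transpose, b3, hφ1, ← dot_tr, Matrix.mulVec_mulVec, ← a2, ← Matrix.mulVec_mulVec, a3]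
  · intro ψ h
    have : S.mulVec ψ = 0 := by
      apply a4
      intro x
      have := h x
      rwa [b7, dot_tr, Matrix.transpose_transpose] at this
    have h2 := congrArg S'.mulVec this
    rwa [Matrix.mulVec_mulVec, b1, Matrix.one_mulVec, Matrix.mulVec_zero] at h2
  · intro v h
    apply b4
    intro x
    have := h x⁻¹
    rw [dot_tr] at this
    rw [dotProduct_comm]
    simpa [dualR] using this
end Cyc

section Prox
variable {k : Type} [Field k]

lemma det_tens {q q' : ℕ} : ∃ p φ : (Fin q → Fin q ⊕ Fin q') → k, ∀ X : Matrix (Fin q ⊕ Fin q') (Fin q ⊕ Fin q') k,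
    φ ⬝ᵥ (tensM q X).mulVec p = X.toBlocks₁₁.det := by
  classical
  refine ⟨Pi.single (fun i => Sum.inl i) 1, fun f => ∑ σ : Equiv.Perm (Fin q), if f = (fun i => Sum.inl (σ i)) then ((Equiv.Perm.sign σ : ℤ) : k) else 0, fun X => ?_⟩
  rw [Matrix.mulVec_single_one, Matrix.det_apply', dotProduct]
  simp only [Finset.sum_mul]
  rw [Finset.sum_comm]
  refine Finset.sum_congr rfl fun σ _ => ?_
  simp only [ite_mul, zero_mul, Finset.sum_ite_eq', Finset.mem_univ, if_true]
  rfl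

lemma span_top {r : ℕ} (V : Submodule k (Fin r → k)) (h : ∀ ψ : Fin r → k, (∀ v ∈ V, ψ ⬝ᵥ v = 0) → ψ = 0) : V = ⊤ := by
  by_contra hV
  obtain ⟨f, hf, hfV⟩ := Submodule.exists_le_ker_of_lt_top V (lt_top_iff_ne_top.mpr hV)
  apply hf
  have e : ∀ v, f v = (fun i => f (Pi.single i 1)) ⬝ᵥ v := by
    intro v
    conv_lhs => rw [pi_eq_sum_univ' v, map_sum]
    simp [dotProduct, mul_comm]
  have := h (fun i => f (Pi.single i 1)) (fun v hv => by rw [← e]; exact hfV hv)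
  ext v
  simp [congrFun this]

lemma fin_one_comm {r : ℕ} (hr : r = 1) (X Y : Matrix (Fin r) (Fin r) k) : X * Y = Y * X := by
  subst hr
  ext i j
  simp only [Matrix.mul_apply, Finset.univ_unique, Finset.sum_singleton]
  rw [Subsingleton.elim i default, Subsingleton.elim j default, mul_comm]

end Prox

section Prox2
variable {k : Type} [NormedField k] [IsAlgClosed k] {H : Type} [Group H]

theorem prox {PP : ∀ (ι : Type) [Fintype ι] [DecidableEq ι], (H →* Matrix ι ι k) → Prop} (hPP : ClosedP k H PP) {m : ℕ}
    (A : H →* Matrix (Fin m) (Fin m) k) (hA : PP (Fin m) A) (hI : Irr (entAlg A) Set.univ) (g : H) (hg : g ∈ commutator H)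
    (μ : k) (hμ : μ ∈ (A g).charpoly.roots) (hμ1 : 1 < ‖μ‖) :
    ∃ (r : ℕ) (M : H →* Matrix (Fin r) (Fin r) k) (p φ : Fin r → k) (lam : k), 2 ≤ r ∧ PP (Fin r) M ∧ lam ≠ 0 ∧ (∀ i j, (fun h => M h i j) ∈ entAlg A) ∧
      φ ⬝ᵥ p = 1 ∧ (∀ ψ : Fin r → k, (∀ h, ψ ⬝ᵥ (M h).mulVec p = 0) → ψ = 0) ∧ (∀ v : Fin r → k, (∀ h, φ ⬝ᵥ (M h).mulVec v = 0) → v = 0) ∧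
      ∀ a b, Tendsto (fun n => (M g ^ n) a b / lam ^ n) atTop (nhds (p a * φ b)) := by
  classical
  obtain ⟨q, q', C, C', Ag, Bg, t, c1, c2, c3, ht, hdet, h1, h2⟩ := block (A g) μ hμ hμ1
  let A' : H →* Matrix (Fin q ⊕ Fin q') (Fin q ⊕ Fin q') k :=
    { toFun := fun h => C' * A h * C
      map_one' := by simp [c1]
      map_mul' := by
        intro x y
        have : C' * A x * C * (C' * A y * C) = C' * A x * (C * C') * A y * C := by simp only [Matrix.mul_assoc]
        rw [this, c2, Matrix.mul_one, map_mul, ← Matrix.mul_assoc C'] }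
  have hA'd : ∀ h, A' h = C' * A h * C := fun h => rfl
  have hA'g : A' g = Matrix.fromBlocks Ag 0 0 Bg := by
    rw [hA'd, Matrix.mul_assoc, c3, ← Matrix.mul_assoc, c1, Matrix.one_mul]
  have hA' : PP _ A' := hPP.sub _ _ A A' C C' hA c1 (fun h => by
    rw [hA'd, ← Matrix.mul_assoc, ← Matrix.mul_assoc, c2, Matrix.one_mul])
  have hA'e : ∀ i j, (fun h => A' h i j) ∈ entAlg A :=
    mat_mul_mem _ (fun h => C' * A h) (fun _ => C) (mat_mul_mem _ (fun _ => C') (fun h => A h) (fun _ _ => fun_const_mem _ _) (ent_mem A))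
      (fun _ _ => fun_const_mem _ _)
  obtain ⟨p0, φ0, hpφ⟩ := det_tens (k := k) (q := q) (q' := q')
  obtain ⟨r, M, p, φ, L, L', hM, hML, hc, hn1, hn2⟩ := cyc hPP (tens q A') (hPP.tens _ A' q hA') p0 φ0
  have hc' : ∀ h, φ ⬝ᵥ (M h).mulVec p = (A' h).toBlocks₁₁.det := fun h => by rw [hc, ← hpφ]; rfl
  have hMe : ∀ i j, (fun h => M h i j) ∈ entAlg A := by
    intro i j
    simp only [hML]
    refine mat_mul_mem _ (fun h => L * tens q A' h) (fun _ => L') (mat_mul_mem _ (fun _ => L) (fun h => tens q A' h) (fun _ _ => fun_const_mem _ _) ?_)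
      (fun _ _ => fun_const_mem _ _) i j
    intro f f'
    exact fun_prod_mem _ Finset.univ (fun i h => A' h (f i) (f' i)) (fun i _ => hA'e _ _)
  have hdot : ∀ ψ v : Fin r → k, (fun h => ψ ⬝ᵥ (M h).mulVec v) ∈ entAlg A := by
    intro ψ v
    simp only [dotProduct, Matrix.mulVec]
    refine fun_sum_mem _ _ (fun i h => ψ i * ∑ j, M h i j * v j) fun i _ => fun_mul_mem _ (fun_const_mem _ _) ?_
    exact fun_sum_mem _ _ (fun j h => M h i j * v j) fun j _ => fun_mul_mem _ (hMe _ _) (fun_const_mem _ _)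
  have hdne : Ag.det ≠ 0 := by
    intro h; rw [h, norm_zero] at hdet; linarith
  set lam := Ag.det with hlam
  have hone : φ ⬝ᵥ p = 1 := by
    have := hc' 1
    rw [map_one, map_one, Matrix.one_mulVec] at this
    rw [this, ← Matrix.fromBlocks_one, Matrix.toBlocks_fromBlocks₁₁, Matrix.det_one]
  set c : H → k := fun h => φ ⬝ᵥ (M h).mulVec p with hcdef
  have hc1 : c 1 ≠ 0 := by simp [hcdef, hone]
  have hlim : ∀ δ γ, c δ ≠ 0 → c γ ≠ 0 → Tendsto (fun n : ℕ => c (δ * g ^ n * γ) / lam ^ n) atTop (nhds (c δ * c γ)) := by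
    intro δ γ hδ hγ
    have := climit (A' δ) (A' γ) Ag Bg t ht hdne h1 h2 (by rw [← hc']; exact hδ) (by rw [← hc']; exact hγ)
    rw [← hc', ← hc'] at this
    refine this.congr fun n => ?_
    rw [← hA'g, ← map_pow, ← map_mul, ← map_mul, ← hc']
  have hgood : ∀ f ∈ entAlg A, (∃ h, f h ≠ 0) → ∃ h, f h ≠ 0 ∧ c h ≠ 0 := by
    rintro f hf ⟨h, hh⟩
    obtain ⟨s, -, h3⟩ := hI f hf c (hdot φ p) ⟨h, trivial, hh⟩ ⟨1, trivial, hc1⟩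
    exact ⟨s, h3⟩
  have key1 : ∀ δ, c δ ≠ 0 → ∀ v, Tendsto (fun n : ℕ => (φ ⬝ᵥ (M (δ * g ^ n)).mulVec v) / lam ^ n) atTop (nhds (c δ * (φ ⬝ᵥ v))) := by
    intro δ hδ
    let V : Submodule k (Fin r → k) :=
      { carrier := {v | Tendsto (fun n : ℕ => (φ ⬝ᵥ (M (δ * g ^ n)).mulVec v) / lam ^ n) atTop (nhds (c δ * (φ ⬝ᵥ v)))}
        add_mem' := by
          intro a b ha hb
          have := Tendsto.add ha hb
          simpa only [Set.mem_setOf_eq, Matrix.mulVec_add, dotProduct_add, add_div, mul_add] using this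
        zero_mem' := by simp
        smul_mem' := by
          intro s a ha
          have := Tendsto.const_mul s ha
          simpa only [Set.mem_setOf_eq, Matrix.mulVec_smul, dotProduct_smul, smul_eq_mul, mul_div_assoc, mul_left_comm] using this }
    have hV : V = ⊤ := by
      apply span_top
      intro ψ hψ
      by_contra hne
      have : ∃ h, ψ ⬝ᵥ (M h).mulVec p ≠ 0 := by
        by_contra! hcon
        exact hne (hn1 ψ hcon)
      obtain ⟨γ, h3, h4⟩ := hgood _ (hdot ψ p) this
      apply h3
      apply hψ
      refine (hlim δ γ hδ h4).congr fun n => ?_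
      rw [hcdef]
      simp only [map_mul, Matrix.mulVec_mulVec]
    intro v
    have : v ∈ V := by rw [hV]; trivial
    exact this
  have key2 : ∀ ψ v : Fin r → k, Tendsto (fun n : ℕ => (ψ ⬝ᵥ (M (g ^ n)).mulVec v) / lam ^ n) atTop (nhds ((ψ ⬝ᵥ p) * (φ ⬝ᵥ v))) := by
    intro ψ v
    let V : Submodule k (Fin r → k) :=
      { carrier := {ψ | Tendsto (fun n : ℕ => (ψ ⬝ᵥ (M (g ^ n)).mulVec v) / lam ^ n) atTop (nhds ((ψ ⬝ᵥ p) * (φ ⬝ᵥ v)))}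
        add_mem' := by
          intro a b ha hb
          have := Tendsto.add ha hb
          simpa only [Set.mem_setOf_eq, add_dotProduct, add_div, add_mul] using this
        zero_mem' := by simp
        smul_mem' := by
          intro s a ha
          have := Tendsto.const_mul s ha
          simpa only [Set.mem_setOf_eq, smul_dotProduct, smul_eq_mul, mul_div_assoc, mul_assoc] using this }
    have hV : V = ⊤ := by
      apply span_top
      intro w hw
      by_contra hne
      have : ∃ h, φ ⬝ᵥ (M h).mulVec w ≠ 0 := by
        by_contra! hcon
        exact hne (hn2 w hcon)
      obtain ⟨δ, h3, h4⟩ := hgood _ (hdot φ w) this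
      apply h3
      have h5 : (M δ).transpose.mulVec φ ∈ V := by
        have := key1 δ h4 v
        simp only [map_mul, ← Matrix.mulVec_mulVec] at this
        rw [hcdef] at this
        simp only [dot_tr _ (M δ)] at this
        exact this
      rw [dot_tr, dotProduct_comm]
      exact hw _ h5
    have : ψ ∈ V := by rw [hV]; trivial
    exact this
  have key3 : ∀ a b, Tendsto (fun n => (M g ^ n) a b / lam ^ n) atTop (nhds (p a * φ b)) := by
    intro a b
    have := key2 (Pi.single a 1) (Pi.single b 1)
    simpa using this
  refine ⟨r, M, p, φ, lam, ?_, hM, hdne, hMe, hone, hn1, hn2, key3⟩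
  by_contra hr
  have hr' : r = 0 ∨ r = 1 := by omega
  rcases hr' with hr' | hr'
  · subst hr'
    simp [dotProduct] at hone
  · have hker : commutator H ≤ M.ker := by
      rw [commutator_def, Subgroup.commutator_le]
      intro a _ b _
      rw [MonoidHom.mem_ker, commutatorElement_def, map_mul, map_mul, fin_one_comm hr' (M (a * b)), ← map_mul, ← map_mul]
      simp
    have hg1 : M g = 1 := hker hg
    have h3 := key2 φ p
    simp only [map_pow, hg1, one_pow, Matrix.one_mulVec, hone, one_mul] at h3
    have h4 : Tendsto (fun n : ℕ => 1 / lam ^ n) atTop (nhds 0) := by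
      have : ‖lam⁻¹‖ < 1 := by rw [norm_inv]; exact inv_lt_one_of_one_lt₀ hdet
      simpa using tendsto_pow_atTop_nhds_zero_of_norm_lt_one this
    exact one_ne_zero (tendsto_nhds_unique h3 h4)
end Prox2
end Tits

namespace Tits
set_option linter.unusedSectionVars false
set_option linter.all false
open Filter Pointwise
open scoped commutatorElement

section MN
variable {k : Type} [Field k] (u : AbsoluteValue k ℝ)

lemma mn_mul {a b c : Type} [Fintype a] [Fintype b] [Fintype c] (A : Matrix a b k) (B : Matrix b c k) : mn u (A * B) ≤ mn u A * mn u B := by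
  have h1 : mn u B = ∑ j, vn u (fun i => B i j) := by rw [mn, Finset.sum_comm]; rfl
  have h2 : mn u A = ∑ i, vn u (A i) := rfl
  rw [h1, h2, Finset.sum_mul_sum]
  exact Finset.sum_le_sum fun i _ => Finset.sum_le_sum fun j _ => vn_dot u (A i) (fun i => B i j)

lemma vn_vecMul {a b : Type} [Fintype a] [Fintype b] (φ : a → k) (B : Matrix a b k) : vn u (Matrix.vecMul φ B) ≤ vn u φ * mn u B := by
  rw [← Matrix.mulVec_transpose]
  refine (mn_mulVec u _ _).trans (le_of_eq ?_)
  rw [mul_comm, mn, Finset.sum_comm]; rfl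

lemma vn_pos {a : Type} [Fintype a] (v : a → k) (hv : v ≠ 0) : 0 < vn u v := by
  obtain ⟨i, hi⟩ := Function.ne_iff.mp hv
  exact lt_of_lt_of_le (u.pos hi) (vn_le u v i)
end MN

section Gen
variable {k : Type} [NormedField k] {H : Type} [Group H] (U : Ultrafilter ℕ)

def nul : Submodule k (ℕ → k) where
  carrier := {x | Tendsto x U (nhds 0)}
  add_mem' := by
    intro a b ha hb
    have := Tendsto.add ha hb
    rwa [add_zero] at this
  zero_mem' := tendsto_const_nhds
  smul_mem' := by
    intro s a ha
    have := Tendsto.const_mul s ha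
    rwa [mul_zero] at this

lemma not_nul {x : ℕ → k} (h : x ∉ nul U) : ∃ δ : ℝ, 0 < δ ∧ ∀ᶠ n in (U : Filter ℕ), δ < ‖x n‖ := by
  have h : ¬ Tendsto x U (nhds 0) := h
  rw [Metric.tendsto_nhds] at h
  push Not at h
  obtain ⟨ε, hε, h⟩ := h
  refine ⟨ε / 2, by linarith, ?_⟩
  have h : ∀ᶠ n in (U : Filter ℕ), ¬ dist (x n) 0 < ε := by
    rw [Ultrafilter.eventually_not]; simpa using h
  filter_upwards [h] with n hn
  rw [dist_zero_right] at hn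
  linarith

lemma gen {R : Subalgebra k (H → k)} (hI : Irr R Set.univ) {ι : Type} (s : Finset ι) (f : ι → H → ℕ → k)
    (hf : ∀ i ∈ s, ∀ l : (ℕ → k) →ₗ[k] k, (fun h => l (f i h)) ∈ R) (hn : ∀ i ∈ s, ∃ h, f i h ∉ nul U) :
    ∃ h, ∀ i ∈ s, f i h ∉ nul U := by
  classical
  have h1 : ∀ i, ∃ l : (ℕ → k) →ₗ[k] k, i ∈ s → (∀ x ∈ nul U, l x = 0) ∧ ∃ h, l (f i h) ≠ 0 := by
    intro i
    by_cases hi : i ∈ s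
    · obtain ⟨h, hh⟩ := hn i hi
      obtain ⟨l, hl, hl2⟩ := Submodule.exists_le_ker_of_notMem hh
      exact ⟨l, fun _ => ⟨fun x hx => hl2 hx, h, hl⟩⟩
    · exact ⟨0, fun h => absurd h hi⟩
  choose l hl using h1
  obtain ⟨x, -, hx⟩ := hI.exists_all ⟨1, trivial⟩ s (fun i h => l i (f i h)) (fun i hi => hf i hi _) (fun i hi => by
    obtain ⟨h, hh⟩ := (hl i hi).2
    exact ⟨h, trivial, hh⟩)
  exact ⟨x, fun i hi hc => hx i hi ((hl i hi).1 _ hc)⟩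

variable {r : ℕ}

lemma gen_mem {R : Subalgebra k (H → k)} (ψ : ℕ → Fin r → k) (N : H → Matrix (Fin r) (Fin r) k) (hN : ∀ i j, (fun h => N h i j) ∈ R)
    (v : Fin r → k) (l : (ℕ → k) →ₗ[k] k) : (fun h => l (fun n => ψ n ⬝ᵥ (N h).mulVec v)) ∈ R := by
  have : ∀ h, (fun n => ψ n ⬝ᵥ (N h).mulVec v) = ∑ a, (∑ b, N h a b * v b) • (fun n => ψ n a) := by
    intro h; ext n
    simp [dotProduct, Matrix.mulVec, mul_comm]
  simp only [this, map_sum, map_smul, smul_eq_mul]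
  refine fun_sum_mem _ _ (fun a h => (∑ b, N h a b * v b) * l (fun n => ψ n a)) fun a _ => fun_mul_mem _ ?_ (fun_const_mem _ _)
  exact fun_sum_mem _ _ (fun b h => N h a b * v b) fun b _ => fun_mul_mem _ (hN _ _) (fun_const_mem _ _)

lemma gen_ex (ψ : ℕ → Fin r → k) (hψ : ∃ a, (fun n => ψ n a) ∉ nul U) (N : H → Matrix (Fin r) (Fin r) k) (v : Fin r → k)
    (hv : ∀ χ : Fin r → k, (∀ h, χ ⬝ᵥ (N h).mulVec v = 0) → χ = 0) : ∃ h, (fun n => ψ n ⬝ᵥ (N h).mulVec v) ∉ nul U := by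
  by_contra! hcon
  obtain ⟨a, ha⟩ := hψ
  let L : (Fin r → k) →ₗ[k] (ℕ → k) :=
    { toFun := fun v n => ψ n ⬝ᵥ v
      map_add' := by intro x y; ext n; simp [dotProduct_add]
      map_smul' := by intro c x; ext n; simp [dotProduct_smul] }
  have : (nul U).comap L = ⊤ := by
    apply span_top
    intro χ hχ
    exact hv χ fun h => hχ _ (hcon h)
  apply ha
  have h1 : Pi.single a 1 ∈ (nul U).comap L := by rw [this]; trivial
  have h2 : L (Pi.single a 1) ∈ nul U := h1
  have h3 : L (Pi.single a 1) = fun n => ψ n a := by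
    ext n
    show ψ n ⬝ᵥ Pi.single a 1 = ψ n a
    simp
  rwa [h3] at h2
end Gen

section PPE
variable {k : Type} [NormedField k] {H : Type} [Group H] {r : ℕ}

def tt (a : Lam) : ℕ := (if a.1 = 0 then 0 else 2) + (if a.2 then 0 else 1)

lemma tt_lt (a : Lam) : tt a < 4 := by
  unfold tt; split_ifs <;> omega
lemma tt_inj : ∀ a b : Lam, tt a = tt b → a = b := by decide

theorem pingpong {R : Subalgebra k (H → k)} (hR : Reg R) (hI : Irr R Set.univ) (M : H →* Matrix (Fin r) (Fin r) k)
    (hM : ∀ i j, (fun h => M h i j) ∈ R) (hr : 2 ≤ r) (p φ : Fin r → k) (lam : k) (hlam : lam ≠ 0)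
    (hn1 : ∀ ψ : Fin r → k, (∀ h, ψ ⬝ᵥ (M h).mulVec p = 0) → ψ = 0) (hn2 : ∀ v : Fin r → k, (∀ h, φ ⬝ᵥ (M h).mulVec v = 0) → v = 0)
    (g : H) (hlim : ∀ a b, Tendsto (fun n => (M g ^ n) a b / lam ^ n) atTop (nhds (p a * φ b))) :
    ∃ x y p' φ' θ v0 α E δ ε, PPd (NormedField.toAbsoluteValue k) (fun a => M (lett x y a)) p' φ' θ v0 α E δ ε := by
  classical
  haveI : Nonempty (Fin r) := ⟨⟨0, by omega⟩⟩
  set u := NormedField.toAbsoluteValue k with hu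
  have hun : ∀ x, u x = ‖x‖ := fun x => rfl
  let U : Ultrafilter ℕ := Ultrafilter.of atTop
  have hU : (U : Filter ℕ) ≤ atTop := Ultrafilter.of_le _
  -- normalization
  have hmax : ∀ n, ∃ ab : Fin r × Fin r, ∀ cd : Fin r × Fin r, ‖M (g⁻¹ ^ n) cd.1 cd.2‖ ≤ ‖M (g⁻¹ ^ n) ab.1 ab.2‖ := fun n =>
    Finite.exists_max (fun cd : Fin r × Fin r => ‖M (g⁻¹ ^ n) cd.1 cd.2‖)
  choose ab hab using hmax
  set κ : ℕ → k := fun n => M (g⁻¹ ^ n) (ab n).1 (ab n).2 with hκ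
  have hκ0 : ∀ n, κ n ≠ 0 := by
    intro n h0
    have h1 : M (g⁻¹ ^ n) = 0 := by
      ext a b
      have := hab n (a, b)
      rw [show M (g⁻¹ ^ n) (ab n).1 (ab n).2 = 0 from h0, norm_zero] at this
      simpa using this
    have h2 : M (g ^ n) * M (g⁻¹ ^ n) = 1 := by rw [← map_mul]; simp
    rw [h1, mul_zero] at h2
    exact zero_ne_one h2
  set Q : ℕ → Matrix (Fin r) (Fin r) k := fun n => (κ n)⁻¹ • M (g⁻¹ ^ n) with hQ
  have hQ1 : ∀ n a b, ‖Q n a b‖ ≤ 1 := by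
    intro n a b
    have := hab n (a, b)
    simp only [hQ, Matrix.smul_apply, smul_eq_mul, norm_mul, norm_inv]
    have h2 : 0 < ‖κ n‖ := norm_pos_iff.mpr (hκ0 n)
    rw [inv_mul_le_iff₀ h2, mul_one]; exact this
  have hQ2 : ∀ n, Q n (ab n).1 (ab n).2 = 1 := by
    intro n
    simp only [hQ, Matrix.smul_apply, smul_eq_mul]
    exact inv_mul_cancel₀ (hκ0 n)
  have hmnQ : ∀ n, mn u (Q n) ≤ r * r := by
    intro n
    calc mn u (Q n) ≤ ∑ i : Fin r, ∑ j : Fin r, (1 : ℝ) := Finset.sum_le_sum fun i _ => Finset.sum_le_sum fun j _ => hQ1 n i j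
      _ = _ := by simp
  -- sum criterion
  have hsum : ∀ v : ℕ → Fin r → k, (∀ a, (fun n => v n a) ∈ nul U) → Tendsto (fun n => vn u (v n)) U (nhds 0) := by
    intro v hv
    have : Tendsto (fun n => ∑ i, ‖v n i‖) U (nhds (∑ i : Fin r, (0 : ℝ))) := tendsto_finsetSum _ fun i _ => by
      have h1 : Tendsto (fun n => v n i) U (nhds 0) := hv i
      exact tendsto_zero_iff_norm_tendsto_zero.mp h1
    rw [Finset.sum_const_zero] at this
    exact this
  have hMi : ∀ i j, (fun h => M h⁻¹ i j) ∈ R := fun i j => hR.inv _ (hM i j)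
  -- choice of X
  set y : ℕ → Fin r → k := fun n i => Q n i (ab n).2 with hy
  have hy0 : ∃ a, (fun n => y n a) ∉ nul U := by
    by_contra! hcon
    have h1 := hsum y hcon
    have h2 : ∀ n, 1 ≤ vn u (y n) := by
      intro n
      refine le_trans (le_of_eq ?_) (vn_le u (y n) (ab n).1)
      rw [hun, hy]; simp [hQ2]
    have := ge_of_tendsto' h1 h2
    linarith
  have hnT : ∀ χ : Fin r → k, (∀ h, χ ⬝ᵥ (M h).transpose.mulVec φ = 0) → χ = 0 := by
    intro χ h
    apply hn2
    intro x
    have := h x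
    rwa [dot_tr, Matrix.transpose_transpose, dotProduct_comm] at this
  have hX : ∃ X : H, ∀ s ∈ (Finset.univ : Finset Bool), (fun n => y n ⬝ᵥ (M (cond s X X⁻¹)).transpose.mulVec φ) ∉ nul U := by
    refine gen U hI Finset.univ (fun s X n => y n ⬝ᵥ (M (cond s X X⁻¹)).transpose.mulVec φ) ?_ ?_
    · intro s _ l
      refine gen_mem y (fun X => (M (cond s X X⁻¹)).transpose) ?_ φ l
      intro i j
      cases s
      · exact hMi j i
      · exact hM j i
    · intro s _
      obtain ⟨h, hh⟩ := gen_ex U y hy0 (fun h => (M h).transpose) φ hnT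
      cases s
      · exact ⟨h⁻¹, by simpa using hh⟩
      · exact ⟨h, hh⟩
  obtain ⟨X, hX⟩ := hX
  set Xs : Bool → H := fun s => cond s X X⁻¹ with hXs
  set ψ : Bool → ℕ → Fin r → k := fun s n => Matrix.vecMul φ (M (Xs s) * Q n) with hψ
  have hψ0 : ∀ s, ∃ a, (fun n => ψ s n a) ∉ nul U := by
    intro s
    by_contra! hcon
    have h1 := hsum (ψ s) hcon
    apply hX s (Finset.mem_univ _)
    show Tendsto _ _ _
    rw [tendsto_zero_iff_norm_tendsto_zero]
    refine squeeze_zero (fun n => norm_nonneg _) (fun n => ?_) h1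
    refine le_trans (le_of_eq ?_) (vn_le u (ψ s n) (ab n).2)
    rw [hun, dot_tr, Matrix.transpose_transpose, dotProduct_comm]
    congr 1
  -- choice of c
  have hχ : ∀ a : H, ∃ χ : Fin r → k, χ ≠ 0 ∧ χ ⬝ᵥ (M a).mulVec p = 0 := by
    intro a
    by_contra! hcon
    have hV : Submodule.span k {(M a).mulVec p} = ⊤ := by
      apply span_top
      intro ψ hψ
      by_contra hne
      exact hcon ψ hne (hψ _ (Submodule.subset_span rfl))
    have h1 := finrank_span_le_card (R := k) ({(M a).mulVec p} : Set (Fin r → k))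
    rw [hV, finrank_top] at h1
    simp at h1
    omega
  choose χ hχ0 hχp using hχ
  have hc : ∃ c : ℕ → H, (∀ n : ℕ, True) ∧ ∀ m n, m < n → ((∀ s, (fun i => ψ s i ⬝ᵥ (M ((c m)⁻¹ * c n)).mulVec p) ∉ nul U) ∧
      (∀ s, (fun i => ψ s i ⬝ᵥ (M ((c n)⁻¹ * c m)).mulVec p) ∉ nul U) ∧ χ (c m) ⬝ᵥ (M (c n)).mulVec p ≠ 0) := by
    refine exists_seq_of_forall_finset_exists (fun _ => True) (fun a h => ((∀ s, (fun i => ψ s i ⬝ᵥ (M (a⁻¹ * h)).mulVec p) ∉ nul U) ∧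
      (∀ s, (fun i => ψ s i ⬝ᵥ (M (h⁻¹ * a)).mulVec p) ∉ nul U) ∧ χ a ⬝ᵥ (M h).mulVec p ≠ 0)) ?_
    intro S _
    have h1 := gen (k := k) U hI (S ×ˢ (Finset.univ : Finset (Option (Bool × Bool)))) (fun i h n =>
      match i.2 with
      | none => χ i.1 ⬝ᵥ (M h).mulVec p
      | some (true, s) => ψ s n ⬝ᵥ (M (i.1⁻¹ * h)).mulVec p
      | some (false, s) => ψ s n ⬝ᵥ (M (h⁻¹ * i.1)).mulVec p) ?_ ?_
    · obtain ⟨h, hh⟩ := h1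
      refine ⟨h, trivial, fun a ha => ⟨fun s => ?_, fun s => ?_, ?_⟩⟩
      · exact hh (a, some (true, s)) (by simp [ha])
      · exact hh (a, some (false, s)) (by simp [ha])
      · intro h0
        apply hh (a, none) (by simp [ha])
        show Tendsto _ _ _
        simp only [h0]
        exact tendsto_const_nhds
    · rintro ⟨a, o⟩ - l
      rcases o with _ | ⟨_ | _, s⟩
      · exact gen_mem (fun n => χ a) (fun h => M h) hM p l
      · exact gen_mem (ψ s) (fun h => M (h⁻¹ * a)) (fun i j => hR.inv _ (hR.right a _ (hM i j))) p l
      · exact gen_mem (ψ s) (fun h => M (a⁻¹ * h)) (fun i j => hR.left a⁻¹ _ (hM i j)) p l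
    · rintro ⟨a, o⟩ -
      rcases o with _ | ⟨_ | _, s⟩
      · have : ∃ h, χ a ⬝ᵥ (M h).mulVec p ≠ 0 := by
          by_contra! hcon
          exact hχ0 a (hn1 _ hcon)
        obtain ⟨h, hh⟩ := this
        refine ⟨h, fun hc => hh ?_⟩
        have hc : Tendsto (fun n : ℕ => χ a ⬝ᵥ (M h).mulVec p) U (nhds 0) := hc
        exact tendsto_nhds_unique tendsto_const_nhds hc
      · obtain ⟨h, hh⟩ := gen_ex U (ψ s) (hψ0 s) (fun h => M h) p hn1
        refine ⟨a * h⁻¹, ?_⟩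
        simpa using hh
      · obtain ⟨h, hh⟩ := gen_ex U (ψ s) (hψ0 s) (fun h => M h) p hn1
        refine ⟨a * h, ?_⟩
        simpa using hh
  obtain ⟨c, -, hc⟩ := hc
  have hc1 : ∀ m n s, m ≠ n → (fun i => ψ s i ⬝ᵥ (M ((c m)⁻¹ * c n)).mulVec p) ∉ nul U := by
    intro m n s hmn
    rcases lt_or_gt_of_ne hmn with h | h
    · exact (hc m n h).1 s
    · exact (hc n m h).2.1 s
  have hδ' : ∀ mns : ℕ × ℕ × Bool, ∃ δ : ℝ, 0 < δ ∧ (mns.1 ≠ mns.2.1 → ∀ᶠ i in (U : Filter ℕ), δ < ‖ψ mns.2.2 i ⬝ᵥ (M ((c mns.1)⁻¹ * c mns.2.1)).mulVec p‖) := by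
    rintro ⟨m, n, s⟩
    by_cases h : m = n
    · exact ⟨1, one_pos, fun h' => absurd h h'⟩
    · obtain ⟨δ, h1, h2⟩ := not_nul U (hc1 m n s h)
      exact ⟨δ, h1, fun _ => h2⟩
  choose dl hdl hdl2 using hδ'
  have hmin : ∃ δ : ℝ, 0 < δ ∧ ∀ m < 5, ∀ n < 5, ∀ s, δ ≤ dl (m, n, s) := by
    obtain ⟨x0, hx0, hx1⟩ := Finset.exists_min_image (Finset.range 5 ×ˢ Finset.range 5 ×ˢ (Finset.univ : Finset Bool)) dl ⟨(0, 0, true), by simp⟩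
    refine ⟨dl x0, hdl _, fun m hm n hn s => hx1 _ (by simp [hm, hn])⟩
  obtain ⟨δ, hδ, hδmin⟩ := hmin
  -- constants
  set pp : ℕ → Fin r → k := fun m => (M (c m)).mulVec p with hpp
  set v0 := pp 4 with hv0
  set θ : Lam → Fin r → k := fun a => (χ (c (tt a)) ⬝ᵥ v0)⁻¹ • χ (c (tt a)) with hθ
  have hp0 : p ≠ 0 := by
    intro h
    have := hn1 (fun _ => 1) (fun h' => by rw [h]; simp)
    exact one_ne_zero (congrFun this (Classical.arbitrary _))
  have hpp0 : ∀ m, pp m ≠ 0 := by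
    intro m h
    apply hp0
    have := congrArg (M (c m)⁻¹).mulVec h
    rw [hpp] at this
    simpa [Matrix.mulVec_mulVec, ← map_mul] using this
  set Bd : ℝ := vn u φ * ((mn u (M X) + mn u (M X⁻¹)) * (r * r)) with hBd
  have hψb : ∀ s n, vn u (ψ s n) ≤ Bd := by
    intro s n
    refine (vn_vecMul u _ _).trans (mul_le_mul_of_nonneg_left ?_ (vn_nonneg _ _))
    refine (mn_mul u _ _).trans (mul_le_mul ?_ (hmnQ n) (mn_nonneg _ _) (add_nonneg (mn_nonneg _ _) (mn_nonneg _ _)))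
    have h1 := mn_nonneg u (M X)
    have h2 := mn_nonneg u (M X⁻¹)
    cases s
    · simp only [hXs, cond_false]; linarith
    · simp only [hXs, cond_true]; linarith
  set φ' : ℕ → Lam → Fin r → k := fun n a => Matrix.vecMul (ψ a.2 n) (M (c (tt a.inv))⁻¹) with hφ'
  set Bd2 : Lam → ℝ := fun a => Bd * mn u (M (c (tt a.inv))⁻¹) with hBd2
  have hφb : ∀ n a, vn u (φ' n a) ≤ Bd2 a := fun n a => (vn_vecMul u _ _).trans (mul_le_mul_of_nonneg_right (hψb _ _) (mn_nonneg _ _))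
  have hε : ∃ ε : ℝ, 0 < ε ∧ ∀ a : Lam, ε * Bd2 a < δ / 2 ∧ ε * vn u (θ a) * vn u v0 + ε < vn u (pp (tt a)) := by
    have h1 : ∀ᶠ ε in nhdsWithin (0 : ℝ) (Set.Ioi 0), ∀ a : Lam, ε * Bd2 a < δ / 2 ∧ ε * vn u (θ a) * vn u v0 + ε < vn u (pp (tt a)) := by
      rw [eventually_all]
      intro a
      apply Filter.Eventually.filter_mono nhdsWithin_le_nhds
      refine Filter.Eventually.and ?_ ?_
      · have : Tendsto (fun ε : ℝ => ε * Bd2 a) (nhds 0) (nhds (0 * Bd2 a)) := (continuous_id.mul continuous_const).tendsto 0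
        rw [zero_mul] at this
        exact this.eventually_lt_const (by linarith)
      · have : Tendsto (fun ε : ℝ => ε * vn u (θ a) * vn u v0 + ε) (nhds 0) (nhds (0 * vn u (θ a) * vn u v0 + 0)) :=
          (((continuous_id.mul continuous_const).mul continuous_const).add continuous_id).tendsto 0
        simp only [zero_mul, add_zero] at this
        exact this.eventually_lt_const (vn_pos u _ (hpp0 _))
    obtain ⟨ε, h2, h3⟩ := (h1.and self_mem_nhdsWithin).exists
    exact ⟨ε, h3, h2⟩
  obtain ⟨ε, hε0, hε⟩ := hε
  -- errors
  set P : ℕ → Matrix (Fin r) (Fin r) k := fun n => (lam ^ n)⁻¹ • M (g ^ n) with hP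
  set Z : ℕ → Matrix (Fin r) (Fin r) k := fun n => P n - Matrix.vecMulVec p φ with hZ
  have hZ0 : Tendsto (fun n => mn u (Z n)) atTop (nhds 0) := by
    have : Tendsto (fun n => ∑ i, ∑ j, ‖Z n i j‖) atTop (nhds (∑ i : Fin r, ∑ j : Fin r, (0 : ℝ))) :=
      tendsto_finsetSum _ fun i _ => tendsto_finsetSum _ fun j _ => by
        rw [← tendsto_zero_iff_norm_tendsto_zero]
        have := (hlim i j).sub_const (p i * φ j)
        rw [sub_self] at this
        refine this.congr fun n => ?_
        simp only [hZ, hP, Matrix.sub_apply, Matrix.smul_apply, Matrix.vecMulVec_apply, smul_eq_mul, map_pow]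
        rw [div_eq_inv_mul]
    simp only [Finset.sum_const_zero] at this
    exact this
  set E : ℕ → Lam → Matrix (Fin r) (Fin r) k := fun n a => M (c (tt a)) * (Z n * (M (Xs a.2) * Q n)) * M (c (tt a.inv))⁻¹ with hE
  have hE0 : ∀ a, Tendsto (fun n => mn u (E n a)) atTop (nhds 0) := by
    intro a
    have h1 : Tendsto (fun n => mn u (M (c (tt a))) * (mn u (Z n) * (mn u (M (Xs a.2)) * (r * r))) * mn u (M (c (tt a.inv))⁻¹)) atTop
        (nhds (mn u (M (c (tt a))) * (0 * (mn u (M (Xs a.2)) * (r * r))) * mn u (M (c (tt a.inv))⁻¹))) :=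
      ((hZ0.mul_const _).const_mul _).mul_const _
    rw [zero_mul, mul_zero, zero_mul] at h1
    refine squeeze_zero (fun n => mn_nonneg _ _) (fun n => ?_) h1
    refine (mn_mul u _ _).trans (mul_le_mul_of_nonneg_right ?_ (mn_nonneg _ _))
    refine (mn_mul u _ _).trans (mul_le_mul_of_nonneg_left ?_ (mn_nonneg _ _))
    refine (mn_mul u _ _).trans (mul_le_mul_of_nonneg_left ?_ (mn_nonneg _ _))
    exact (mn_mul u _ _).trans (mul_le_mul_of_nonneg_left (hmnQ n) (mn_nonneg _ _))
  have hE1 : ∀ a (C D : ℝ), 0 < D → ∀ᶠ n in atTop, mn u (E n a) * C < D := by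
    intro a C D hD
    have := (hE0 a).mul_const C
    rw [zero_mul] at this
    exact this.eventually_lt_const hD
  have hfin : ∀ᶠ n in (U : Filter ℕ), (∀ a b : Lam, mn u (E n a) * (vn u (pp (tt b)) + ε) < ε * (δ / 2)) ∧ (∀ a, mn u (E n a) * vn u v0 < ε * δ) ∧
      ∀ i : Fin 5, ∀ j : Fin 5, ∀ s, i ≠ j → δ < ‖ψ s n ⬝ᵥ (M ((c i)⁻¹ * c j)).mulVec p‖ := by
    refine Filter.Eventually.and ?_ (Filter.Eventually.and ?_ ?_)
    · refine Filter.Eventually.filter_mono hU ?_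
      rw [eventually_all]; intro a
      rw [eventually_all]; intro b
      exact hE1 _ _ _ (by positivity)
    · refine Filter.Eventually.filter_mono hU ?_
      rw [eventually_all]; intro a
      exact hE1 _ _ _ (by positivity)
    · rw [eventually_all]; intro i
      rw [eventually_all]; intro j
      rw [eventually_all]; intro s
      by_cases hij : i = j
      · exact Filter.Eventually.of_forall fun _ h => absurd hij h
      · have := hdl2 (i, j, s) (fun h => hij (Fin.ext h))
        filter_upwards [this] with n hn _
        exact lt_of_le_of_lt (hδmin i i.2 j j.2 s) hn
  obtain ⟨n, hn1', hn2', hn3'⟩ := hfin.exists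
  have hpair : ∀ i j s, i < 5 → j < 5 → i ≠ j → δ < ‖ψ s n ⬝ᵥ (M ((c i)⁻¹ * c j)).mulVec p‖ := by
    intro i j s hi hj hij
    exact hn3' ⟨i, hi⟩ ⟨j, hj⟩ s (fun h => hij (congrArg Fin.val h))
  have hφp : ∀ a m, φ' n a ⬝ᵥ pp m = ψ a.2 n ⬝ᵥ (M ((c (tt a.inv))⁻¹ * c m)).mulVec p := by
    intro a m
    rw [map_mul, ← Matrix.mulVec_mulVec]
    show Matrix.vecMul (ψ a.2 n) (M (c (tt a.inv))⁻¹) ⬝ᵥ _ = _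
    rw [← Matrix.dotProduct_mulVec]
  set w : H := g ^ n * X * g⁻¹ ^ n with hw
  refine ⟨c 0 * w * (c 1)⁻¹, c 2 * w * (c 3)⁻¹, fun a => pp (tt a), φ' n, θ, v0, fun _ => lam ^ n * κ n, E n, δ, ε, ?_⟩
  have hlett : ∀ a, lett (c 0 * w * (c 1)⁻¹) (c 2 * w * (c 3)⁻¹) a = c (tt a) * (g ^ n * Xs a.2 * g⁻¹ ^ n) * (c (tt a.inv))⁻¹ := by
    rintro ⟨i, s⟩
    have hi : i = 0 ∨ i = 1 := by omega
    rcases hi with rfl | rfl <;> cases s <;> simp [lett, tt, Lam.inv, hXs, hw, mul_assoc]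
  have hα : lam ^ n * κ n ≠ 0 := mul_ne_zero (pow_ne_zero _ hlam) (hκ0 n)
  constructor
  · intro a
    simp only [hlett, map_mul M]
    have e1 : M (g ^ n) * M (Xs a.2) * M (g⁻¹ ^ n) = (lam ^ n * κ n) • (P n * (M (Xs a.2) * Q n)) := by
      simp only [hP, hQ, Matrix.smul_mul, Matrix.mul_smul, smul_smul, Matrix.mul_assoc]
      rw [show lam ^ n * κ n * ((κ n)⁻¹ * (lam ^ n)⁻¹) = 1 by rw [mul_assoc, mul_inv_cancel_left₀ (hκ0 n), mul_inv_cancel₀ (pow_ne_zero _ hlam)], one_smul]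
    have e2 : P n = Matrix.vecMulVec p φ + Z n := by rw [hZ]; simp
    rw [e1, e2, Matrix.mul_smul, Matrix.smul_mul, Matrix.add_mul, Matrix.mul_add, Matrix.add_mul, Matrix.vecMulVec_mul, Matrix.mul_vecMulVec, Matrix.vecMulVec_mul]
  · exact fun _ => hα
  · exact hδ
  · exact hε0
  · intro a b hab
    rw [hφp]
    exact hpair _ _ _ (by have := tt_lt a.inv; omega) (by have := tt_lt b; omega) (fun h => hab (tt_inj _ _ h).symm)
  · intro a
    rw [hv0, hφp]
    exact hpair _ _ _ (by have := tt_lt a.inv; omega) (by omega) (by have := tt_lt a.inv; omega)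
  · intro a b
    refine lt_of_lt_of_le (hn1' a b) (mul_le_mul_of_nonneg_left ?_ hε0.le)
    have := mul_le_mul_of_nonneg_left (hφb n a) hε0.le
    have := (hε a).1
    linarith
  · exact hn2'
  · intro a
    rw [hθ]
    simp only [smul_dotProduct]
    rw [hχp, smul_zero]
  · intro a
    rw [hθ]
    simp only [smul_dotProduct]
    exact inv_mul_cancel₀ (hc (tt a) 4 (tt_lt a)).2.2
  · intro a
    have := (hε a).2
    linarith
end PPE
end Tits

namespace Tits
set_option linter.unusedSectionVars false
set_option linter.all false
open Filter Pointwise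
open scoped commutatorElement

section Ht
variable {B : Type} [Field B]

/-- height -/
noncomputable def Ht {I : Type} [Fintype I] (P : I → Pl B) (x : B) : ℝ := ∑ i, Real.posLog ((P i).v x)

/-- number of archimedean places -/
noncomputable def Wt {I : Type} [Fintype I] (P : I → Pl B) : ℝ := ∑ i, if (P i).ar = true then (1 : ℝ) else 0

noncomputable def Pl.dv (P : Pl B) (d : ℕ) : ℝ := if P.ar = true then (d : ℝ) else 1

variable {I : Type} [Fintype I] (P : I → Pl B)

lemma Wt_nonneg : 0 ≤ Wt P := Finset.sum_nonneg fun i _ => by split_ifs <;> norm_num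

lemma Ht_nonneg (x : B) : 0 ≤ Ht P x := Finset.sum_nonneg fun i _ => Real.posLog_nonneg

lemma Ht_zero : Ht P 0 = 0 := by simp [Ht]
lemma Ht_one : Ht P 1 = 0 := by simp [Ht]
lemma Ht_neg (x : B) : Ht P (-x) = Ht P x := by simp [Ht]
lemma Ht_mul (x y : B) : Ht P (x * y) ≤ Ht P x + Ht P y := by
  unfold Ht
  rw [← Finset.sum_add_distrib]
  refine Finset.sum_le_sum fun i _ => ?_
  rw [map_mul]
  exact Real.posLog_mul

lemma Pl.add_le (P : Pl B) (x y : B) : Real.posLog (P.v (x + y)) ≤ Real.posLog (P.v x) + Real.posLog (P.v y) + Real.log 2 * (if P.ar = true then (1 : ℝ) else 0) := by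
  by_cases h : P.ar = true
  · rw [if_pos h]
    have h1 := Real.posLog_add (x := P.v x) (y := P.v y)
    have h2 := Real.posLog_le_posLog (P.v.nonneg (x + y)) (P.v.add_le x y)
    linarith
  · rw [if_neg h, mul_zero, add_zero]
    have h1 := P.na (by simpa using h) x y
    have h2 := Real.posLog_le_posLog (P.v.nonneg (x + y)) h1
    have h3 : Real.posLog (P.v x) ≥ 0 := Real.posLog_nonneg
    have h4 : Real.posLog (P.v y) ≥ 0 := Real.posLog_nonneg
    rcases max_choice (P.v x) (P.v y) with h | h <;> rw [h] at h2 <;> linarith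

lemma Ht_add (x y : B) : Ht P (x + y) ≤ Ht P x + Ht P y + Real.log 2 * Wt P := by
  unfold Ht Wt
  rw [← Finset.sum_add_distrib, Finset.mul_sum, ← Finset.sum_add_distrib]
  exact Finset.sum_le_sum fun i _ => (P i).add_le x y

lemma Ht_inv (x : B) (h : ∑ i, Real.log ((P i).v x) = 0) : Ht P x⁻¹ = Ht P x := by
  have : Ht P x - Ht P x⁻¹ = 0 := by
    unfold Ht
    rw [← Finset.sum_sub_distrib, ← h]
    refine Finset.sum_congr rfl fun i _ => ?_
    rw [map_inv₀]
    exact Real.posLog_sub_posLog_inv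
  linarith

/-- one step of closure -/
def stp (s : Set B) : Set B := s ∪ ((s + s) ∪ (s * s) ∪ (-s) ∪ s⁻¹)

lemma stp_fin {s : Set B} (h : s.Finite) : (stp s).Finite :=
  h.union ((((h.add h).union (h.mul h)).union h.neg).union h.inv)

def Cs (s : Set B) : ℕ → Set B
  | 0 => s ∪ {0, 1}
  | k + 1 => stp (Cs s k)

lemma Cs_fin {s : Set B} (h : s.Finite) (k : ℕ) : (Cs s k).Finite := by
  induction k with
  | zero => exact h.union (by simp)
  | succ k ih => exact stp_fin ih

lemma Cs_mono (s : Set B) : Monotone (Cs s) := monotone_nat_of_le_succ fun k => Set.subset_union_left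

lemma Cs_add {s : Set B} {k l : ℕ} {x y : B} (hx : x ∈ Cs s k) (hy : y ∈ Cs s l) : x + y ∈ Cs s (k + l + 1) :=
  Or.inr (Or.inl (Or.inl (Or.inl (Set.add_mem_add (Cs_mono s (by omega) hx) (Cs_mono s (by omega) hy)))))
lemma Cs_mul {s : Set B} {k l : ℕ} {x y : B} (hx : x ∈ Cs s k) (hy : y ∈ Cs s l) : x * y ∈ Cs s (k + l + 1) :=
  Or.inr (Or.inl (Or.inl (Or.inr (Set.mul_mem_mul (Cs_mono s (by omega) hx) (Cs_mono s (by omega) hy)))))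
lemma Cs_neg {s : Set B} {k : ℕ} {x : B} (hx : x ∈ Cs s k) : -x ∈ Cs s (k + 1) :=
  Or.inr (Or.inl (Or.inr (by simpa using hx)))
lemma Cs_inv {s : Set B} {k : ℕ} {x : B} (hx : x ∈ Cs s k) : x⁻¹ ∈ Cs s (k + 1) :=
  Or.inr (Or.inr (by simpa using hx))
end Ht

section Bsub
variable (U : Ultrafilter ℕ) {B : ℕ → Type} [∀ n, Field (B n)] {I : ℕ → Type} [∀ n, Fintype (I n)]
  (P : ∀ n, I n → Pl (B n)) (Q0 : ∀ n, Set (B n)) (S : ℕ → ℝ)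

/-- elements of bounded height -/
def Bpred (x : Ult U B) : Prop := ∃ z : ∀ n, B n, umk U z = x ∧ ∃ (k : ℕ) (c : ℝ), ∀ᶠ n in (U : Filter ℕ), z n ∈ Cs (Q0 n) k ∧ Ht (P n) (z n) ≤ c * S n

def Bsub (hU : ∀ N, ∀ᶠ n in (U : Filter ℕ), N ≤ n)
    (hPF : ∀ᶠ n in (U : Filter ℕ), ∀ q ∈ Cs (Q0 n) n, q ≠ 0 → ∑ i, Real.log ((P n i).v q) = 0)
    (c0 : ℝ) (hW : ∀ᶠ n in (U : Filter ℕ), Wt (P n) ≤ c0 * S n) : Subfield (Ult U B) where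
  carrier := {x | Bpred U P Q0 S x}
  mul_mem' := by
    rintro _ _ ⟨x, rfl, k, c, hx⟩ ⟨y, rfl, l, c', hy⟩
    refine ⟨x * y, map_mul _ _ _, k + l + 1, c + c', ?_⟩
    filter_upwards [hx, hy] with n h1 h2
    refine ⟨Cs_mul h1.1 h2.1, (Ht_mul _ _ _).trans ?_⟩
    linarith [h1.2, h2.2]
  one_mem' := by
    refine ⟨1, map_one _, 0, 0, Eventually.of_forall fun n => ⟨Or.inr (by simp), ?_⟩⟩
    simp [Ht_one]
  add_mem' := by
    rintro _ _ ⟨x, rfl, k, c, hx⟩ ⟨y, rfl, l, c', hy⟩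
    refine ⟨x + y, map_add _ _ _, k + l + 1, c + c' + Real.log 2 * c0, ?_⟩
    filter_upwards [hx, hy, hW] with n h1 h2 h3
    refine ⟨Cs_add h1.1 h2.1, (Ht_add _ _ _).trans ?_⟩
    have : 0 ≤ Real.log 2 := Real.log_nonneg (by norm_num)
    nlinarith [h1.2, h2.2, mul_le_mul_of_nonneg_left h3 this]
  zero_mem' := by
    refine ⟨0, map_zero _, 0, 0, Eventually.of_forall fun n => ⟨Or.inr (by simp), ?_⟩⟩
    simp [Ht_zero]
  neg_mem' := by
    rintro _ ⟨x, rfl, k, c, hx⟩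
    refine ⟨-x, map_neg _ _, k + 1, c, ?_⟩
    filter_upwards [hx] with n h1
    exact ⟨Cs_neg h1.1, (Ht_neg _ _).trans_le h1.2⟩
  inv_mem' := by
    rintro _ ⟨x, rfl, k, c, hx⟩
    refine ⟨fun n => (x n)⁻¹, umk_inv U x, k + 1, c, ?_⟩
    filter_upwards [hx, hPF, hU k] with n h1 h2 h3
    refine ⟨Cs_inv h1.1, ?_⟩
    by_cases h : x n = 0
    · have := h1.2
      rw [h] at this ⊢
      simpa using this
    · rw [Ht_inv _ _ (h2 _ (Cs_mono _ h3 h1.1) h)]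
      exact h1.2
end Bsub

lemma sub_mul_mem {k : Type} [Field k] (E : Subfield k) {m : ℕ} {M N : Matrix (Fin m) (Fin m) k} (hM : ∀ i j, M i j ∈ E) (hN : ∀ i j, N i j ∈ E) (i j : Fin m) :
    (M * N) i j ∈ E := by
  rw [Matrix.mul_apply]
  exact sum_mem fun a _ => mul_mem (hM _ _) (hN _ _)

lemma sub_inv_mem {k : Type} [Field k] (E : Subfield k) {m : ℕ} {M : Matrix (Fin m) (Fin m) k} (hM : ∀ i j, M i j ∈ E) (i j : Fin m) :
    M⁻¹ i j ∈ E := by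
  let M0 : Matrix (Fin m) (Fin m) E := fun i j => ⟨M i j, hM i j⟩
  have h : M = E.subtype.mapMatrix M0 := rfl
  rw [Matrix.inv_def, Matrix.smul_apply, smul_eq_mul, Ring.inverse_eq_inv', h, ← RingHom.map_det, ← RingHom.map_adjugate]
  exact mul_mem (inv_mem (M0.det).2) (M0.adjugate i j).2

section Arch
variable {d : ℕ} {U : Ultrafilter ℕ} {Ω : ℕ → Type} [∀ n, Field (Ω n)]
    {F : ∀ n, Set (GL (Fin d) (Ω n))} (C : Core d U Ω F)
    {B : ℕ → Type} [∀ n, Field (B n)] (j : ∀ n, B n →+* Ω n)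
    {I : ℕ → Type} [∀ n, Fintype (I n)] (P : ∀ n, I n → Pl (B n))

/-- traces of short words -/
def Q0 (F : ∀ n, Set (GL (Fin d) (Ω n))) (n : ℕ) : Set (B n) := chi j n '' Pw (F n) n

/-- all elements where the product formula is required -/
def Qs (F : ∀ n, Set (GL (Fin d) (Ω n))) (n : ℕ) : Set (B n) := Cs (Q0 j F n) n

lemma Qs_fin (hF : ∀ n, (F n).Finite) (n : ℕ) : (Qs j F n).Finite := Cs_fin ((Pw.finite (hF n) n).image _) n

lemma ev_Q0 (hU : ∀ N, ∀ᶠ n in (U : Filter ℕ), N ≤ n) (hF : ∀ n, ∀ f ∈ F n, f⁻¹ ∈ F n) (γ : Gam F) :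
    ∀ᶠ n in (U : Filter ℕ), chi j n (ev γ n) ∈ Q0 j F n := by
  obtain ⟨c, hc⟩ := Gam.pw hF γ.2
  filter_upwards [hU c] with n hn
  exact ⟨_, Pw.mono hn (hc n), rfl⟩

/-- local size -/
noncomputable def tv (T : Finset (Gam F)) (n : ℕ) (i : I n) : ℝ :=
  ∑ g ∈ T, Real.posLog ((P n i).v (chi j n (ev g n)) / (P n i).dv d)

noncomputable def Sn (T : Finset (Gam F)) (n : ℕ) : ℝ := ∑ i, tv j P T n i

lemma tv_nonneg (T : Finset (Gam F)) (n : ℕ) (i : I n) : 0 ≤ tv j P T n i := Finset.sum_nonneg fun _ _ => Real.posLog_nonneg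

lemma tv_mono {T T' : Finset (Gam F)} (h : T ⊆ T') (n : ℕ) (i : I n) : tv j P T n i ≤ tv j P T' n i :=
  Finset.sum_le_sum_of_subset_of_nonneg h fun _ _ _ => Real.posLog_nonneg

lemma Sn_mono {T T' : Finset (Gam F)} (h : T ⊆ T') (n : ℕ) : Sn j P T n ≤ Sn j P T' n :=
  Finset.sum_le_sum fun i _ => tv_mono j P h n i

lemma Ht_chi {T : Finset (Gam F)} {g : Gam F} (hd : 1 ≤ d) (hg : g ∈ T) (n : ℕ) :
    Ht (P n) (chi j n (ev g n)) ≤ Sn j P T n + Real.log d * Wt (P n) := by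
  unfold Ht Sn Wt
  rw [Finset.mul_sum, ← Finset.sum_add_distrib]
  refine Finset.sum_le_sum fun i _ => ?_
  have h1 : Real.posLog ((P n i).v (chi j n (ev g n)) / (P n i).dv d) ≤ tv j P T n i :=
    Finset.single_le_sum (f := fun g => Real.posLog ((P n i).v (chi j n (ev g n)) / (P n i).dv d)) (fun _ _ => Real.posLog_nonneg) hg
  refine le_trans ?_ (add_le_add_left h1 _)
  have hd' : (1 : ℝ) ≤ d := by exact_mod_cast hd
  unfold Pl.dv
  split_ifs
  · have := Real.posLog_mul (x := (P n i).v (chi j n (ev g n)) / d) (y := d)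
    rw [div_mul_cancel₀ _ (by positivity)] at this
    rw [Real.posLog_eq_log (x := (d : ℝ)) (by rwa [abs_of_nonneg (by positivity)])] at this
    linarith
  · simp

lemma gam_ent_mem {k : Type} [Field k] {m : ℕ} (A : Gam F →* Matrix (Fin m) (Fin m) k) (E : Subfield k) 
    (hA : ∀ f : Gam F, (∀ n, ev f n ∈ F n) → ∀ i k, A f i k ∈ E) : ∀ γ i k, A γ i k ∈ E := by
  rintro ⟨γ, hγ⟩
  induction hγ using Subgroup.closure_induction with
  | mem x hx => exact hA _ hx
  | one => 
    have : A 1 = 1 := map_one _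
    intro i k
    show A 1 i k ∈ E
    rw [this, Matrix.one_apply]
    split_ifs
    exacts [one_mem _, zero_mem _]
  | mul x y hx hy h1 h2 =>
    have : A (⟨x, hx⟩ * ⟨y, hy⟩) = _ := map_mul _ _ _
    intro i k
    show A (⟨x, hx⟩ * ⟨y, hy⟩) i k ∈ E
    rw [this]
    exact sub_mul_mem E h1 h2 i k
  | inv x hx h1 =>
    have : A (⟨x, hx⟩⁻¹) * A ⟨x, hx⟩ = 1 := by rw [← map_mul, inv_mul_cancel, map_one]
    have := Matrix.inv_eq_left_inv this
    intro i k
    show A (⟨x, hx⟩⁻¹) i k ∈ E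
    rw [← this]
    exact sub_inv_mem E h1 i k

lemma exists_big (hbad : Bad F) (hU : ∀ N, ∀ᶠ n in (U : Filter ℕ), N ≤ n) (htr : HTr C j)
    (hPF : ∀ᶠ n in (U : Filter ℕ), ∀ q ∈ Qs j F n, q ≠ 0 → ∑ i, Real.log ((P n i).v q) = 0)
    (T : Finset (Gam F)) (hT : ∀ g ∈ T, g ∈ ⁅C.H, C.H⁆) (c0 : ℝ) (hW : ∀ᶠ n in (U : Filter ℕ), Wt (P n) ≤ c0 * Sn j P T n) (hc0 : 0 ≤ c0) :
    ∃ T' : Finset (Gam F), T ⊆ T' ∧ (∀ g ∈ T', g ∈ ⁅C.H, C.H⁆) ∧ ∃ E : Subfield (Ult U B), (∀ x ∈ E, Bpred U P (Q0 j F) (Sn j P T') x) ∧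
      ∀ γ i k, Ar C j htr γ i k ∈ E := by
  classical
  have hmax : ∀ n, ∃ s ∈ F n, ∀ f ∈ F n, ∑ l, ∑ k, Ht (P n) (chi j n (ev (C.w l) n * (f * ev (C.w k) n * f⁻¹))) ≤
      ∑ l, ∑ k, Ht (P n) (chi j n (ev (C.w l) n * (s * ev (C.w k) n * s⁻¹))) := fun n =>
    (hbad.fin n).exists_maximalFor (fun f => ∑ l, ∑ k, Ht (P n) (chi j n (ev (C.w l) n * (f * ev (C.w k) n * f⁻¹)))) _ ⟨1, hbad.one n⟩ |>.imp
      fun s hs => ⟨hs.1, fun f hf => (le_total _ _).elim id (fun h => hs.2 hf h)⟩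
  choose s hs hsmax using hmax
  let s' : Gam F := ⟨s, Subgroup.subset_closure hs⟩
  let T' : Finset (Gam F) := T ∪ (Finset.univ.image (fun p : Fin C.m × Fin C.m => C.w p.1 * (s' * C.w p.2 * s'⁻¹)) ∪
    Finset.univ.image (fun p : Fin C.m × Fin C.m => C.w p.1 * C.w p.2))
  have hTT : T ⊆ T' := Finset.subset_union_left
  have hW' : ∀ᶠ n in (U : Filter ℕ), Wt (P n) ≤ c0 * Sn j P T' n := by
    filter_upwards [hW] with n hn
    exact hn.trans (mul_le_mul_of_nonneg_left (Sn_mono j P hTT n) hc0)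
  let E := Bsub U P (Q0 j F) (Sn j P T') hU hPF c0 hW'
  have hd1 : 1 ≤ d := by have := C.hd; omega
  have hlog : 0 ≤ Real.log d := Real.log_nonneg (by exact_mod_cast hd1)
  have key : ∀ g ∈ T', ∀ᶠ n in (U : Filter ℕ), Ht (P n) (chi j n (ev g n)) ≤ (1 + Real.log d * c0) * Sn j P T' n := by
    intro g hg
    filter_upwards [hW'] with n hn
    have := Ht_chi j P hd1 hg n
    nlinarith [mul_le_mul_of_nonneg_left hn hlog]
  have mem1 : ∀ g ∈ T', Xc U j g ∈ E := by
    intro g hg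
    refine ⟨_, rfl, 0, 1 + Real.log d * c0, ?_⟩
    filter_upwards [key g hg, ev_Q0 j hU hbad.symm g] with n h1 h2
    exact ⟨Or.inl h2, h1⟩
  have hgram : ∀ l k, gram C j l k ∈ E := fun l k => mem1 _ (by
    simp only [T', Finset.mem_union, Finset.mem_image]
    exact Or.inr (Or.inr ⟨(l, k), Finset.mem_univ _, rfl⟩))
  have hs' : ∀ l k, C.w l * (s' * C.w k * s'⁻¹) ∈ T' := fun l k => by
    simp only [T', Finset.mem_union, Finset.mem_image]
    exact Or.inr (Or.inl ⟨(l, k), Finset.mem_univ _, rfl⟩)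
  have hN : ∀ (f : Gam F), (∀ n, ev f n ∈ F n) → ∀ l k, Nmat C j f l k ∈ E := by
    intro f hf l k
    refine ⟨_, rfl, 0, ∑ l : Fin C.m, ∑ k : Fin C.m, (1 + Real.log d * c0), ?_⟩
    have h3 : ∀ᶠ n in (U : Filter ℕ), ∀ l k, Ht (P n) (chi j n (ev (C.w l * (s' * C.w k * s'⁻¹)) n)) ≤ (1 + Real.log d * c0) * Sn j P T' n :=
      eventually_all.mpr fun l => eventually_all.mpr fun k => key _ (hs' l k)
    filter_upwards [h3, ev_Q0 j hU hbad.symm (C.w l * (f * C.w k * f⁻¹))] with n h1 h2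
    refine ⟨Or.inl h2, ?_⟩
    simp only [Finset.sum_mul]
    calc Ht (P n) (chi j n (ev (C.w l * (f * C.w k * f⁻¹)) n)) ≤ ∑ k, Ht (P n) (chi j n (ev (C.w l * (f * C.w k * f⁻¹)) n)) :=
          Finset.single_le_sum (f := fun k => Ht (P n) (chi j n (ev (C.w l * (f * C.w k * f⁻¹)) n))) (fun _ _ => Ht_nonneg _ _) (Finset.mem_univ k)
      _ ≤ ∑ l, ∑ k, Ht (P n) (chi j n (ev (C.w l * (f * C.w k * f⁻¹)) n)) :=
          Finset.single_le_sum (f := fun l => ∑ k, Ht (P n) (chi j n (ev (C.w l * (f * C.w k * f⁻¹)) n))) (fun _ _ => Finset.sum_nonneg fun _ _ => Ht_nonneg _ _) (Finset.mem_univ l)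
      _ ≤ _ := hsmax n _ (hf n)
      _ ≤ _ := Finset.sum_le_sum fun l _ => Finset.sum_le_sum fun k _ => h1 l k
  have hA : ∀ f : Gam F, (∀ n, ev f n ∈ F n) → ∀ i k, Ar C j htr f i k ∈ E := fun f hf i k => 
    sub_mul_mem E (sub_inv_mem E hgram) (hN f hf) i k
  refine ⟨T', hTT, ?_, E, fun x hx => hx, ?_⟩
  · intro g hg
    simp only [T', Finset.mem_union, Finset.mem_image] at hg
    rcases hg with hg | ⟨p, _, rfl⟩ | ⟨p, _, rfl⟩
    · exact hT g hg
    · exact conj_memD _ _ _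
    · exact mul_mem (C.w_mem _) (C.w_mem _)
  · exact gam_ent_mem (Ar C j htr) E hA
end Arch
end Tits

namespace Tits
set_option linter.unusedSectionVars false
set_option linter.all false
open Filter Pointwise
open scoped commutatorElement

/-- countable saturation -/
lemma saturate {U : Ultrafilter ℕ} (hU : ∀ N, ∀ᶠ n in (U : Filter ℕ), N ≤ n) {I : ℕ → Type} [∀ n, Nonempty (I n)] (p : ℕ → ∀ n, I n → Prop)
    (h : ∀ J, ∀ᶠ n in (U : Filter ℕ), ∃ v : I n, ∀ i < J, p i n v) : ∃ v : ∀ n, I n, ∀ i, ∀ᶠ n in (U : Filter ℕ), p i n (v n) := by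
  classical
  have h1 : ∀ n, ∃ v : I n, ∀ i < Nat.findGreatest (fun J => ∃ v : I n, ∀ i < J, p i n v) n, p i n v := by
    intro n
    exact Nat.findGreatest_spec (P := fun J => ∃ v : I n, ∀ i < J, p i n v) (m := 0) (Nat.zero_le _) ⟨Classical.arbitrary _, by simp⟩
  choose v hv using h1
  refine ⟨v, fun i => ?_⟩
  filter_upwards [h (i + 1), hU (i + 1)] with n h2 h3
  refine hv n i ?_
  exact Nat.lt_of_succ_le (Nat.le_findGreatest h3 h2)

lemma averaging {I : Type} [Fintype I] (t : I → ℝ) (h : ℕ → I → ℝ) (h0 : ∀ i v, 0 ≤ h i v) (c : ℕ → ℝ) (hc : ∀ i, 0 ≤ c i) (S : ℝ) (hS : 0 < S)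
    (ht : S / 2 ≤ ∑ v, t v) (J : ℕ) (hh : ∀ i < J, ∑ v, h i v ≤ c i * S) :
    ∃ v, 0 < t v ∧ ∀ i < J, h i v ≤ 2 ^ (i + 2) * (c i + 1) * t v := by
  by_contra hcon
  push Not at hcon
  have h1 : ∀ v, t v ≤ ∑ i ∈ Finset.range J, h i v / (2 ^ (i + 2) * (c i + 1)) := by
    intro v
    have hn : ∀ i ∈ Finset.range J, 0 ≤ h i v / (2 ^ (i + 2) * (c i + 1)) := fun i _ => 
      div_nonneg (h0 i v) (by have := hc i; positivity)
    by_cases hv : 0 < t v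
    · obtain ⟨i, hi, h2⟩ := hcon v hv
      refine le_trans ?_ (Finset.single_le_sum hn (Finset.mem_range.mpr hi))
      rw [le_div_iff₀ (by have := hc i; positivity)]
      linarith
    · exact (not_lt.mp hv).trans (Finset.sum_nonneg hn)
  have h2 : S / 2 ≤ ∑ i ∈ Finset.range J, S * (1 / 2) ^ (i + 2) := by
    refine ht.trans ((Finset.sum_le_sum fun v _ => h1 v).trans ?_)
    rw [Finset.sum_comm]
    refine Finset.sum_le_sum fun i hi => ?_
    rw [← Finset.sum_div, div_le_iff₀ (by have := hc i; positivity)]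
    have := hh i (Finset.mem_range.mp hi)
    have h3 : S * (1 / 2) ^ (i + 2) * (2 ^ (i + 2) * (c i + 1)) = S * (c i + 1) * ((1/2) * 2) ^ (i + 2) := by
      rw [mul_pow]; ring
    rw [h3]
    norm_num
    nlinarith
  have h3 : ∀ J : ℕ, ∑ i ∈ Finset.range J, S * (1 / 2 : ℝ) ^ (i + 2) = S / 2 - S / 2 * (1 / 2) ^ J := by
    intro J
    induction J with
    | zero => simp
    | succ J ih => rw [Finset.sum_range_succ, ih]; ring
  rw [h3 J] at h2
  have : 0 < S / 2 * (1 / 2) ^ J := by positivity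
  linarith

/-- power of a place -/
noncomputable def Pl.pow {B : Type} [Field B] (P : Pl B) (r : ℝ) (hr : 0 < r) (h : P.ar = true → 1 ≤ r) : AbsoluteValue B ℝ where
  toFun x := (P.v x) ^ (1 / r)
  map_mul' x y := by
    rw [map_mul, Real.mul_rpow (P.v.nonneg _) (P.v.nonneg _)]
  nonneg' x := Real.rpow_nonneg (P.v.nonneg _) _
  eq_zero' x := by
    rw [Real.rpow_eq_zero (P.v.nonneg _) (by positivity), map_eq_zero]
  add_le' x y := by
    have hx := P.v.nonneg x
    have hy := P.v.nonneg y
    by_cases ha : P.ar = true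
    · have h1 : (P.v (x + y)) ^ (1 / r) ≤ (P.v x + P.v y) ^ (1 / r) := 
        Real.rpow_le_rpow (P.v.nonneg _) (P.v.add_le x y) (by positivity)
      refine h1.trans (Real.rpow_add_le_add_rpow hx hy (by positivity) ?_)
      rw [div_le_one hr]; exact h ha
    · have h1 : (P.v (x + y)) ^ (1 / r) ≤ (max (P.v x) (P.v y)) ^ (1 / r) := 
        Real.rpow_le_rpow (P.v.nonneg _) (P.na (by simpa using ha) x y) (by positivity)
      have hx' := Real.rpow_nonneg hx (1 / r)
      have hy' := Real.rpow_nonneg hy (1 / r)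
      rcases max_choice (P.v x) (P.v y) with h | h <;> rw [h] at h1 <;> linarith

lemma Pl.pow_apply {B : Type} [Field B] (P : Pl B) (r : ℝ) (hr : 0 < r) (h : P.ar = true → 1 ≤ r) (x : B) : P.pow r hr h x = (P.v x) ^ (1 / r) := rfl

lemma Pl.pow_le {B : Type} [Field B] (P : Pl B) (r : ℝ) (hr : 0 < r) (h : P.ar = true → 1 ≤ r) (x : B) (K : ℝ) (hK : Real.posLog (P.v x) ≤ K * r) : 
    P.pow r hr h x ≤ Real.exp K := by
  rw [Pl.pow_apply]
  have h1 : P.v x ≤ Real.exp (K * r) := by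
    by_cases h0 : P.v x = 0
    · rw [h0]; positivity
    · have h0 : 0 < P.v x := lt_of_le_of_ne (P.v.nonneg x) (Ne.symm h0)
      rw [← Real.log_le_iff_le_exp h0]
      exact (le_max_right _ _).trans hK
  refine (Real.rpow_le_rpow (P.v.nonneg _) h1 (by positivity)).trans ?_
  rw [← Real.exp_mul]
  rw [mul_assoc, mul_one_div_cancel hr.ne', mul_one]

lemma Pl.le_pow {B : Type} [Field B] (P : Pl B) (r : ℝ) (hr : 0 < r) (h : P.ar = true → 1 ≤ r) (x : B) (K : ℝ) (hK : Real.exp (K * r) ≤ P.v x) : 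
    Real.exp K ≤ P.pow r hr h x := by
  rw [Pl.pow_apply]
  refine le_trans ?_ (Real.rpow_le_rpow (by positivity) hK (by positivity))
  rw [← Real.exp_mul]
  rw [mul_assoc, mul_one_div_cancel hr.ne', mul_one]

lemma na_sum {B : Type} [Field B] (P : Pl B) (h : P.ar = false) {ι : Type} (s : Finset ι) (f : ι → B) (b : ℝ) (hb : 0 < b) (hf : ∀ i ∈ s, P.v (f i) < b) :
    P.v (∑ i ∈ s, f i) < b := by
  classical
  induction s using Finset.induction_on with
  | empty => simpa using hb
  | insert a s ha ih =>
    rw [Finset.sum_insert ha]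
    exact (P.na h _ _).trans_lt (max_lt (hf a (by simp)) (ih fun i hi => hf i (by simp [hi])))

lemma Pl.big_root {B : Type} [Field B] (P : Pl B) {d : ℕ} (hd : 1 ≤ d) (ν : Fin d → B) (x : B) (hx : x = ∑ i, ν i) (a : ℝ) (ha : 0 < a) 
    (h : a ≤ Real.posLog (P.v x / P.dv d)) : ∃ i, Real.exp a ≤ P.v (ν i) := by
  by_contra hcon
  push Not at hcon
  have hd0 : (0 : ℝ) < d := by exact_mod_cast hd
  have hdv : 0 < P.dv d := by unfold Pl.dv; split_ifs <;> positivity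
  have h1 : Real.exp a ≤ P.v x / P.dv d := by
    have h2 : a ≤ Real.log (P.v x / P.dv d) := by
      rcases le_max_iff.mp h with h | h
      · linarith
      · exact h
    have h3 : 0 < P.v x / P.dv d := by
      rcases (div_nonneg (P.v.nonneg x) hdv.le).eq_or_lt with h4 | h4
      · rw [← h4] at h2; simp at h2; linarith
      · exact h4
    exact (Real.le_log_iff_exp_le h3).mp h2
  rw [le_div_iff₀ hdv] at h1
  haveI : Nonempty (Fin d) := ⟨⟨0, hd⟩⟩
  by_cases har : P.ar = true
  · have h2 : P.v x < Real.exp a * d := by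
      rw [hx]
      refine (P.v.sum_le _ _).trans_lt ((Finset.sum_lt_sum_of_nonempty Finset.univ_nonempty fun i _ => hcon i).trans_le ?_)
      simp [mul_comm]
    rw [Pl.dv, if_pos har] at h1
    linarith
  · have h2 := na_sum P (by simpa using har) Finset.univ ν (Real.exp a) (Real.exp_pos _) (fun i _ => hcon i)
    rw [Pl.dv, if_neg har, mul_one, hx] at h1
    linarith

lemma lift_root {k l : Type} [Field k] [Field l] [IsAlgClosed k] (f : k →+* l) (p : Polynomial k) (hp : p ≠ 0) (x : l) (hx : x ∈ (p.map f).roots) :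
    ∃ y ∈ p.roots, f y = x := by
  rw [(IsAlgClosed.splits p).roots_map f] at hx
  simpa using hx

lemma root_iff' {k : Type} [Field k] {ι : Type} [Fintype ι] [DecidableEq ι] (F : Matrix ι ι k) (μ : k) :
    μ ∈ F.charpoly.roots ↔ ∃ v, v ≠ 0 ∧ F.mulVec v = μ • v := by
  rw [Polynomial.mem_roots F.charpoly_monic.ne_zero, Polynomial.IsRoot, Matrix.eval_charpoly, ← Matrix.exists_mulVec_eq_zero_iff]
  refine exists_congr fun v => and_congr_right fun _ => ?_
  rw [Matrix.sub_mulVec, sub_eq_zero, eq_comm]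
  simp [Matrix.scalar_apply]

section Eig
variable {d : ℕ} {U : Ultrafilter ℕ} {Ω : ℕ → Type} [∀ n, Field (Ω n)] [∀ n, IsAlgClosed (Ω n)]
    {F : ∀ n, Set (GL (Fin d) (Ω n))} {C : Core d U Ω F}
    {B : ℕ → Type} [∀ n, Field (B n)] [∀ n, IsAlgClosed (B n)] {j : ∀ n, B n →+* Ω n}

lemma det_rho_comm (g : Gam F) (hg : g ∈ ⁅C.H, C.H⁆) : (rho F U g).det = 1 := by
  have h1 : g ∈ commutator (Gam F) := Subgroup.commutator_mono le_top le_top hg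
  let δ : Gam F →* Ult U Ω := Matrix.detMonoidHom.comp (rho F U)
  have h2 := Abelianization.commutator_subset_ker (δ.toHomUnits) h1
  rw [MonoidHom.mem_ker] at h2
  have := congrArg Units.val h2
  simpa [δ] using this

lemma eig_data (htr : HTr C j) (g : Gam F) (hg : g ∈ ⁅C.H, C.H⁆) : ∃ (ν : Fin d → Ult U B) (μ : Fin d → Fin d → Ult U B),
    (∀ i k, μ i k ∈ (Ar C j htr g).charpoly.roots) ∧ (∀ i, ν i ^ d = ∏ k, μ i k) ∧ Xc U j g = ∑ i, ν i := by
  classical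
  have hd0 : d ≠ 0 := by have := C.hd; omega
  set M := rho F U g with hM
  have hdet : M.det = 1 := det_rho_comm (C := C) g hg
  have hcard : M.charpoly.roots.card = d := by
    rw [← (IsAlgClosed.splits M.charpoly).natDegree_eq_card_roots]
    simp
  obtain ⟨L, hL⟩ : ∃ L : Fin d → Ult U Ω, Finset.univ.val.map L = M.charpoly.roots := by
    have h1 : M.charpoly.roots.toList.length = d := by simpa using hcard
    refine ⟨fun i => M.charpoly.roots.toList.get (i.cast h1.symm), ?_⟩
    have h2 : (List.ofFn fun i : Fin d => M.charpoly.roots.toList.get (i.cast h1.symm)) = M.charpoly.roots.toList := by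
      apply List.ext_get
      · simp [hcard]
      · intro n h3 h4; simp
    conv_rhs => rw [← Multiset.coe_toList M.charpoly.roots, ← h2]
    rw [List.ofFn_eq_map]
    rfl
  have hprod : ∏ i, L i = 1 := by
    rw [← hdet, Matrix.det_eq_prod_roots_charpoly, ← hL]; rfl
  have hsum : ∑ i, L i = M.trace := by
    rw [Matrix.trace_eq_sum_roots_charpoly, ← hL]; rfl
  have hroot : ∀ i, L i ∈ M.charpoly.roots := fun i => by
    rw [← hL]; exact Multiset.mem_map_of_mem _ (Finset.mem_univ i)
  have hne : ∀ i, L i ≠ 0 := fun i h => by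
    have : ∏ i, L i = 0 := Finset.prod_eq_zero (Finset.mem_univ i) h
    rw [hprod] at this
    exact one_ne_zero this
  have hmu : ∀ i k, ∃ μ ∈ (Ar C j htr g).charpoly.roots, umap U j μ = L i / L k := by
    intro i k
    apply lift_root _ _ (Matrix.charpoly_monic _).ne_zero
    rw [← Matrix.charpoly_map, Ar_map]
    obtain ⟨v, hv, hv'⟩ := (root_iff' M (L i)).mp (hroot i)
    obtain ⟨w, hw, hw'⟩ := (root_iff' M.transpose (L k)).mp (by rw [Matrix.charpoly_transpose]; exact hroot k)
    rw [root_iff']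
    let x : Matrix (Fin d) (Fin d) (Ult U Ω) := Matrix.vecMulVec v w
    have hx0 : x ≠ 0 := by
      obtain ⟨a, ha⟩ := Function.ne_iff.mp hv
      obtain ⟨b, hb⟩ := Function.ne_iff.mp hw
      intro h
      have := congrFun (congrFun h a) b
      simp only [x, Matrix.vecMulVec_apply, Matrix.zero_apply, mul_eq_zero] at this
      exact this.elim ha hb
    have h1 : M * x = L i • x := by
      simp only [x]
      rw [Matrix.mul_vecMulVec, hv', Matrix.smul_vecMulVec]
    have h2 : x * M = L k • x := by
      simp only [x]
      rw [Matrix.vecMulVec_mul, ← Matrix.mulVec_transpose, hw', Matrix.vecMulVec_smul]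
    have h3 : M * rho F U g⁻¹ = 1 := by rw [hM, ← map_mul, mul_inv_cancel, map_one]
    have h4 : L k • (x * rho F U g⁻¹) = x := by
      rw [← Matrix.smul_mul, ← h2, Matrix.mul_assoc, h3, Matrix.mul_one]
    have h5 : x * rho F U g⁻¹ = (L k)⁻¹ • x := by
      rw [← h4, smul_smul, inv_mul_cancel₀ (hne k), one_smul, h4]
    have h6 : cjL U F g x = (L i / L k) • x := by
      rw [cjL_apply, ← hM, h1, Matrix.smul_mul, h5, smul_smul, div_eq_mul_inv]
    refine ⟨C.b.repr x, ?_, ?_⟩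
    · intro h
      apply hx0
      apply C.b.repr.injective
      rw [map_zero]
      exact DFunLike.coe_injective h
    · rw [LinearMap.toMatrix_mulVec_repr, h6]
      ext a
      simp
  choose μ hμ hμ' using hmu
  have hnu : ∀ i, ∃ ν, ν ^ d = ∏ k, μ i k ∧ umap U j ν = L i := by
    intro i
    obtain ⟨y, hy, hy'⟩ := lift_root (umap U j) (Polynomial.X ^ d - Polynomial.C (∏ k, μ i k)) (Polynomial.X_pow_sub_C_ne_zero (Nat.pos_of_ne_zero hd0) _) (L i) (by
      rw [Polynomial.mem_roots', Polynomial.IsRoot.def]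
      refine ⟨?_, ?_⟩
      · simp only [Polynomial.map_sub, Polynomial.map_pow, Polynomial.map_X, Polynomial.map_C]
        exact Polynomial.X_pow_sub_C_ne_zero (Nat.pos_of_ne_zero hd0) _
      · simp only [Polynomial.map_sub, Polynomial.map_pow, Polynomial.map_X, Polynomial.map_C, Polynomial.eval_sub, Polynomial.eval_pow, Polynomial.eval_X, Polynomial.eval_C]
        rw [map_prod]
        simp only [hμ']
        rw [Finset.prod_div_distrib, hprod]
        simp)
    refine ⟨y, ?_, hy'⟩
    rw [Polynomial.mem_roots', Polynomial.IsRoot.def] at hy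
    have := hy.2
    simp only [Polynomial.eval_sub, Polynomial.eval_pow, Polynomial.eval_X, Polynomial.eval_C] at this
    exact sub_eq_zero.mp this
  choose ν hν hν' using hnu
  refine ⟨ν, μ, hμ, hν, ?_⟩
  apply uj_inj (U := U) (j := j)
  rw [uj_Xc htr hg, map_sum, ← hM, ← hsum]
  simp only [hν']
end Eig
end Tits

namespace Tits
set_option linter.unusedSectionVars false
set_option linter.all false
open Filter Pointwise
open scoped commutatorElement

lemma ult_exists {U : Ultrafilter ℕ} {ι : Type} [Finite ι] (p : ι → ℕ → Prop) (h : ∀ᶠ n in (U : Filter ℕ), ∃ i, p i n) :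
    ∃ i, ∀ᶠ n in (U : Filter ℕ), p i n := by
  by_contra hcon
  push Not at hcon
  have h1 : ∀ i, ∀ᶠ n in (U : Filter ℕ), ¬ p i n := hcon
  obtain ⟨n, h2, i, h3⟩ := ((eventually_all.mpr h1).and h).exists
  exact h2 i h3

lemma ult_lim {U : Ultrafilter ℕ} (s : ℕ → ℝ) (K : ℝ) (h0 : ∀ n, 0 ≤ s n) (h : ∀ᶠ n in (U : Filter ℕ), s n ≤ K) :
    ∃ a, Tendsto s U (nhds a) := by
  obtain ⟨a, -, ha⟩ := isCompact_Icc.ultrafilter_le_nhds (U.map s) (s := Set.Icc 0 K) (by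
    rw [le_principal_iff]
    exact h.mono fun n hn => ⟨h0 n, hn⟩)
  exact ⟨a, ha⟩

lemma root_bound {B : Type} [Field B] (u : AbsoluteValue B ℝ) (N : ℕ) (hN : 0 < N) (a : ℕ → B) (z : B) (K : ℕ → ℝ) (hK : ∀ i ∈ Finset.range N, u (a i) ≤ K i)
    (h : z ^ N = - ∑ i ∈ Finset.range N, a i * z ^ i) : u z ≤ max 1 (∑ i ∈ Finset.range N, K i) := by
  by_cases h1 : u z ≤ 1
  · exact h1.trans (le_max_left _ _)
  · push Not at h1
    refine le_trans ?_ (le_max_right _ _)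
    obtain ⟨M, rfl⟩ : ∃ M, N = M + 1 := ⟨N - 1, by omega⟩
    have h2 : u z * u z ^ M ≤ (∑ i ∈ Finset.range (M + 1), K i) * u z ^ M := by
      rw [← pow_succ', ← map_pow, h, map_neg_eq_map]
      refine (u.sum_le _ _).trans ?_
      rw [Finset.sum_mul]
      refine Finset.sum_le_sum fun i hi => ?_
      rw [map_mul, map_pow]
      have h3 : u z ^ i ≤ u z ^ M := pow_le_pow_right₀ h1.le (by simpa [Nat.lt_succ_iff] using hi)
      exact mul_le_mul (hK i hi) h3 (by have := u.nonneg z; positivity) ((u.nonneg _).trans (hK i hi))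
    exact le_of_mul_le_mul_right h2 (by positivity)

section Av
variable {U : Ultrafilter ℕ} {B : ℕ → Type} [∀ n, Field (B n)] (u : ∀ n, AbsoluteValue (B n) ℝ) (E : Subfield (Ult U B))

lemma alg_bdd (hE : ∀ x ∈ E, ∃ K, ∀ᶠ n in (U : Filter ℕ), u n (urep U x n) ≤ K) (x : Ult U B) (hx : IsAlgebraic E x) :
    ∃ K, ∀ᶠ n in (U : Filter ℕ), u n (urep U x n) ≤ K := by
  have hi : IsIntegral E x := hx.isIntegral
  set p := minpoly E x with hp
  have hm : p.Monic := minpoly.monic hi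
  have h0 : 0 < p.natDegree := minpoly.natDegree_pos hi
  have hev : Polynomial.aeval x p = 0 := minpoly.aeval _ _
  choose K hK using fun i => hE (p.coeff i : Ult U B) (p.coeff i).2
  refine ⟨max 1 (∑ i ∈ Finset.range p.natDegree, K i), ?_⟩
  have h1 : x ^ p.natDegree = - ∑ i ∈ Finset.range p.natDegree, (p.coeff i : Ult U B) * x ^ i := by
    rw [Polynomial.aeval_eq_sum_range, Finset.sum_range_succ, hm.coeff_natDegree, one_smul] at hev
    rw [eq_neg_iff_add_eq_zero, add_comm]
    exact hev
  have h2 : ∀ᶠ n in (U : Filter ℕ), (urep U x n) ^ p.natDegree = - ∑ i ∈ Finset.range p.natDegree, urep U (p.coeff i : Ult U B) n * (urep U x n) ^ i := by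
    have : umk U ((urep U x) ^ p.natDegree) = umk U (- ∑ i ∈ Finset.range p.natDegree, urep U (p.coeff i : Ult U B) * (urep U x) ^ i) := by
      simpa using h1
    rw [umk_eq] at this
    filter_upwards [this] with n hn
    simpa using hn
  have h3 : ∀ᶠ n in (U : Filter ℕ), ∀ i ∈ Finset.range p.natDegree, u n (urep U (p.coeff i : Ult U B) n) ≤ K i :=
    (eventually_all_finset _).mpr fun i _ => hK i
  filter_upwards [h2, h3] with n h2 h3
  exact root_bound (u n) _ h0 (fun i => urep U (p.coeff i : Ult U B) n) _ K h3 h2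

lemma av_exists (hE : ∀ x ∈ E, ∃ K, ∀ᶠ n in (U : Filter ℕ), u n (urep U x n) ≤ K) :
    ∃ av : AbsoluteValue (algebraicClosure E (Ult U B)) ℝ, ∀ (x : algebraicClosure E (Ult U B)) (z : ∀ n, B n), umk U z = x → 
      Tendsto (fun n => u n (z n)) U (nhds (av x)) := by
  have h1 : ∀ x : algebraicClosure E (Ult U B), ∃ a, Tendsto (fun n => u n (urep U (x : Ult U B) n)) U (nhds a) := by
    intro x
    obtain ⟨K, hK⟩ := alg_bdd u E hE x (mem_algebraicClosure_iff.mp x.2)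
    exact ult_lim _ K (fun n => (u n).nonneg _) hK
  choose a ha using h1
  have h2 : ∀ (x : algebraicClosure E (Ult U B)) (z : ∀ n, B n), umk U z = x → Tendsto (fun n => u n (z n)) U (nhds (a x)) := by
    intro x z hz
    refine (ha x).congr' ?_
    have : umk U (urep U (x : Ult U B)) = umk U z := by rw [hz, umk_urep]
    filter_upwards [(umk_eq U).mp this] with n hn
    rw [hn]
  have hmul : ∀ x y, a (x * y) = a x * a y := by
    intro x y
    have h3 := h2 (x * y) (urep U (x : Ult U B) * urep U (y : Ult U B)) (by simp)
    refine tendsto_nhds_unique h3 (((ha x).mul (ha y)).congr fun n => ?_)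
    simp
  have hone : a 1 = 1 := by
    refine tendsto_nhds_unique (h2 1 1 (by simp)) ?_
    simp
  have hzero : a 0 = 0 := by
    refine tendsto_nhds_unique (h2 0 0 (by simp)) ?_
    simp
  refine ⟨{ toFun := a, map_mul' := hmul, nonneg' := fun x => ge_of_tendsto' (ha x) fun n => (u n).nonneg _, eq_zero' := fun x => ⟨fun h => ?_, fun h => h ▸ hzero⟩, add_le' := fun x y => ?_ }, h2⟩
  · by_contra hx
    have := hmul x x⁻¹
    rw [mul_inv_cancel₀ hx, hone, h, zero_mul] at this
    exact one_ne_zero this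
  · have h3 := h2 (x + y) (urep U (x : Ult U B) + urep U (y : Ult U B)) (by simp)
    exact le_of_tendsto_of_tendsto' h3 ((ha x).add (ha y)) fun n => (u n).add_le _ _
end Av

section CC
variable {d : ℕ} {U : Ultrafilter ℕ} {Ω : ℕ → Type} [∀ n, Field (Ω n)]
    {F : ∀ n, Set (GL (Fin d) (Ω n))} {B : ℕ → Type} [∀ n, Field (B n)] {H : Type} [Group H] (φ : H →* Gam F)

lemma contra_core {k : Type} [NormedField k] [IsAlgClosed k] (f : k →+* Ult U B) (u : ∀ n, AbsoluteValue (B n) ℝ)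
    (hav : ∀ x (z : ∀ n, B n), umk U z = f x → Tendsto (fun n => u n (z n)) U (nhds ‖x‖))
    (hbad : Bad F) (hU : ∀ N, ∀ᶠ n in (U : Filter ℕ), N ≤ n)
    {m : ℕ} (A : H →* Matrix (Fin m) (Fin m) k) (hA : Good φ (bch f A)) (hI : Irr (entAlg A) Set.univ) (g : H) (hg : g ∈ commutator H)
    (μ : k) (hμ : μ ∈ (A g).charpoly.roots) (hμ1 : 1 < ‖μ‖) : False := by
  obtain ⟨r, M, p, ψ, lam, hr, hM, hlam, hent, h1, h2, h3, h4⟩ := prox (good_closed φ f) A hA hI g hg μ hμ hμ1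
  obtain ⟨x, y, p', φ', θ, v0, α, E, δ, ε, h⟩ := pingpong (entAlg_reg A) hI M hent hr p ψ lam hlam h2 h3 g h4
  exact transfer φ f (NormedField.toAbsoluteValue k) u hav hbad hU M hM x y p' φ' θ v0 α E δ ε h

lemma contra_av {k : Type} [Field k] [hk : IsAlgClosed k] (av : AbsoluteValue k ℝ) (f : k →+* Ult U B) (u : ∀ n, AbsoluteValue (B n) ℝ)
    (hav : ∀ x (z : ∀ n, B n), umk U z = f x → Tendsto (fun n => u n (z n)) U (nhds (av x)))
    (hbad : Bad F) (hU : ∀ N, ∀ᶠ n in (U : Filter ℕ), N ≤ n)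
    {m : ℕ} (A : H →* Matrix (Fin m) (Fin m) k) (hA : Good φ (bch f A)) (hI : Irr (entAlg A) Set.univ) (g : H) (hg : g ∈ commutator H)
    (μ : k) (hμ : μ ∈ (A g).charpoly.roots) (hμ1 : 1 < av μ) : False :=
  @contra_core d U Ω _ F B _ H _ φ k av.toNormedField hk f u hav hbad hU m A hA hI g hg μ hμ hμ1
end CC

section Dense
variable {d : ℕ} {U : Ultrafilter ℕ} {Ω : ℕ → Type} [∀ n, Field (Ω n)]
    {F : ∀ n, Set (GL (Fin d) (Ω n))} (C : Core d U Ω F)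

noncomputable def rhoH : C.H →* Matrix (Fin d) (Fin d) (Ult U Ω) := (rho F U).comp C.H.subtype

lemma rhoH_irr : Irr (entAlg (rhoH C)) Set.univ := by
  refine Irr.of_emb (RingHom.id _) (rhoH C) (pull C.H.subtype (entAlg (rho F U))) ?_ ?_ (pull_irr _ C.irr)
  · intro i k
    exact ⟨_, ent_mem (rho F U) i k, rfl⟩
  · intro i k
    exact ⟨_, ent_inv_mem (rho F U) i k, by ext; simp [rhoH]⟩

lemma exists_dense (Y : Set C.H) (hY : Y.Countable) : ∃ H1 : Subgroup C.H, Y ⊆ H1 ∧ Countable H1 ∧ 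
    (∀ f ∈ entAlg (rhoH C), (∀ h ∈ H1, f h = 0) → ∀ h, f h = 0) ∧ Irr (pull H1.subtype (entAlg (rhoH C))) Set.univ := by
  have hfg : (entAlg (rhoH C)).FG := Subalgebra.fg_def.mpr ⟨_, Set.toFinite _, rfl⟩
  obtain ⟨H1, h1, h2, h3⟩ := countable_dense (entAlg (rhoH C)) hfg Y hY
  refine ⟨H1, h1, h2, h3, pull_irr H1 ?_⟩
  rintro f₁ hf₁ f₂ hf₂ ⟨s, hs, e1⟩ ⟨t, ht, e2⟩
  obtain ⟨x, -, hx⟩ := rhoH_irr C f₁ hf₁ f₂ hf₂ ⟨s, trivial, e1⟩ ⟨t, trivial, e2⟩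
  by_contra hcon
  push Not at hcon
  have := h3 (fun x => f₁ x * f₂ x) (fun_mul_mem _ hf₁ hf₂) (fun h hh => by
    by_cases h5 : f₁ h = 0
    · simp [h5]
    · simp [hcon h hh h5]) x
  exact (mul_ne_zero hx.1 hx.2) this

lemma comm_lift (g : Gam F) (hg : g ∈ ⁅C.H, C.H⁆) : ∃ Y : Finset C.H, ∀ H1 : Subgroup C.H, (∀ y ∈ Y, y ∈ H1) → 
    ∃ g' ∈ commutator H1, ((g' : C.H) : Gam F) = g := by
  rw [← Subgroup.map_subtype_commutator] at hg
  obtain ⟨z, hz, rfl⟩ := hg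
  obtain ⟨Y, hY⟩ := mem_comm_finite hz
  refine ⟨Y, fun H1 h => ?_⟩
  have := hY H1 h
  rw [← Subgroup.map_subtype_commutator] at this
  obtain ⟨g', h1, h2⟩ := this
  exact ⟨g', h1, by rw [← h2]; rfl⟩

set_option maxHeartbeats 1000000 in
lemma cj_ent {K : Type} [Group K] (φ : K →* Gam F) (i k : Fin C.m) :
    (fun h => LinearMap.toMatrix C.b C.b (cjL U F (φ h)) i k) ∈ entAlg ((rho F U).comp φ) := by
  have h1 : ∀ x : Matrix (Fin d) (Fin d) (Ult U Ω), C.b.repr x i = ∑ a, ∑ b, x a b * C.b.repr (Matrix.single a b 1) i := by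
    intro x
    conv_lhs => rw [Matrix.matrix_eq_sum_single x]
    simp only [map_sum, Finsupp.finsetSum_apply]
    refine Finset.sum_congr rfl fun a _ => Finset.sum_congr rfl fun b _ => ?_
    have : Matrix.single a b (x a b) = x a b • Matrix.single a b 1 := by simp
    rw [this, map_smul]; simp
  have e : (fun h => LinearMap.toMatrix C.b C.b (cjL U F (φ h)) i k) = fun h => ∑ a, ∑ b, (rho F U (φ h) * C.b k * rho F U (φ h)⁻¹) a b * C.b.repr (Matrix.single a b 1) i := by
    funext h; rw [LinearMap.toMatrix_apply, cjL_apply, h1]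
  rw [e]
  refine fun_sum_mem _ _ (fun a h => _) fun a _ => fun_sum_mem _ _ (fun b h => _) fun b _ => fun_mul_mem _ ?_ (fun_const_mem _ _)
  have hA := fun i k => ent_mem ((rho F U).comp φ) i k
  have hB : ∀ i k, (fun h => rho F U (φ h)⁻¹ i k) ∈ entAlg ((rho F U).comp φ) := by
    intro i k
    have := ent_inv_mem ((rho F U).comp φ) i k
    simpa only [MonoidHom.comp_apply, map_inv] using this
  have hAB := mat_mul_mem (entAlg ((rho F U).comp φ)) (fun h => rho F U (φ h)) (fun _ => C.b k) hA (fun i k => fun_const_mem _ _)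
  exact mat_mul_mem (entAlg ((rho F U).comp φ)) (fun h => rho F U (φ h) * C.b k) (fun h => rho F U (φ h)⁻¹) hAB hB a b
end Dense
end Tits

namespace Tits
set_option linter.unusedSectionVars false
set_option linter.all false
open Filter Pointwise
open scoped commutatorElement

lemma exists_place {U : Ultrafilter ℕ} (hU : ∀ N, ∀ᶠ n in (U : Filter ℕ), N ≤ n) {B : ℕ → Type} [∀ n, Field (B n)] 
    {I : ℕ → Type} [∀ n, Fintype (I n)] [∀ n, Nonempty (I n)]
    (P : ∀ n, I n → Pl (B n)) (Q : ∀ n, Set (B n)) (t : ∀ n, I n → ℝ) (S : ℕ → ℝ) (hSt : ∀ n, S n = ∑ i, t n i) (ε : ℝ) 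
    (hS : ∀ᶠ n in (U : Filter ℕ), 0 < S n) (hW : ∀ᶠ n in (U : Filter ℕ), ε * Wt (P n) ≤ S n) (x : ℕ → Ult U B) (hx : ∀ i, Bpred U P Q S (x i)) :
    ∃ v : ∀ n, I n, (∀ᶠ n in (U : Filter ℕ), 0 < t n (v n) - ε / 2 * (if (P n (v n)).ar = true then (1:ℝ) else 0)) ∧ 
      ∀ i, ∃ K, 0 ≤ K ∧ ∀ᶠ n in (U : Filter ℕ), Real.posLog ((P n (v n)).v (urep U (x i) n)) ≤ K * (t n (v n) - ε / 2 * (if (P n (v n)).ar = true then (1:ℝ) else 0)) := by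
  have h1 : ∀ i, ∃ c, 0 ≤ c ∧ ∀ᶠ n in (U : Filter ℕ), Ht (P n) (urep U (x i) n) ≤ c * S n := by
    intro i
    obtain ⟨z, hz, k, c, hc⟩ := hx i
    refine ⟨max c 0, le_max_right _ _, ?_⟩
    have : umk U z = umk U (urep U (x i)) := by rw [hz, umk_urep]
    filter_upwards [(umk_eq U).mp this, hc, hS] with n h1 h2 h3
    rw [← h1]
    exact h2.2.trans (mul_le_mul_of_nonneg_right (le_max_left _ _) h3.le)
  choose c hc0 hc using h1
  let t' : ∀ n, I n → ℝ := fun n v => t n v - ε / 2 * (if (P n v).ar = true then (1:ℝ) else 0)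
  let p : ℕ → ∀ n, I n → Prop := fun i n v => 0 < t' n v ∧ Real.posLog ((P n v).v (urep U (x i) n)) ≤ 2 ^ (i + 2) * (c i + 1) * t' n v
  obtain ⟨v, hv⟩ := saturate hU p (by
    intro J
    have h2 : ∀ᶠ n in (U : Filter ℕ), ∀ i ∈ Finset.range J, Ht (P n) (urep U (x i) n) ≤ c i * S n := (eventually_all_finset _).mpr fun i _ => hc i
    filter_upwards [hS, hW, h2] with n h3 h4 h5
    obtain ⟨v, h6, h7⟩ := averaging (t' n) (fun i v => Real.posLog ((P n v).v (urep U (x i) n))) (fun _ _ => Real.posLog_nonneg) c hc0 (S n) h3 (by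
      simp only [t', Finset.sum_sub_distrib, ← hSt, ← Finset.mul_sum]
      have : ε / 2 * Wt (P n) ≤ S n / 2 := by linarith
      unfold Wt at this
      linarith) J (fun i hi => h5 i (Finset.mem_range.mpr hi))
    exact ⟨v, fun i hi => ⟨h6, h7 i hi⟩⟩)
  refine ⟨v, (hv 0).mono fun n h => h.1, fun i => ⟨2 ^ (i + 2) * (c i + 1), by have := hc0 i; positivity, (hv i).mono fun n h => h.2⟩⟩

section T7
variable {d : ℕ} {U : Ultrafilter ℕ} {Ω : ℕ → Type} [∀ n, Field (Ω n)] [∀ n, IsAlgClosed (Ω n)]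
    {F : ∀ n, Set (GL (Fin d) (Ω n))} {C : Core d U Ω F}
    {B : ℕ → Type} [∀ n, Field (B n)] [∀ n, IsAlgClosed (B n)] {j : ∀ n, B n →+* Ω n}
    {I : ℕ → Type} [∀ n, Fintype (I n)] [∀ n, Nonempty (I n)] (P : ∀ n, I n → Pl (B n))

lemma big_eig (htr : HTr C j) (g : Gam F) (hg : g ∈ ⁅C.H, C.H⁆) (v : ∀ n, I n) (r : ℕ → ℝ) (hr : ∀ n, 0 < r n) (hr1 : ∀ n, (P n (v n)).ar = true → 1 ≤ r n) (K : ℝ) (hK : 0 < K)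
    (h : ∀ᶠ n in (U : Filter ℕ), K * r n ≤ Real.posLog ((P n (v n)).v (chi j n (ev g n)) / (P n (v n)).dv d)) :
    ∃ μ ∈ (Ar C j htr g).charpoly.roots, ∀ᶠ n in (U : Filter ℕ), Real.exp K ≤ (P n (v n)).pow (r n) (hr n) (hr1 n) (urep U μ n) := by
  obtain ⟨ν, μ, h1, h2, h3⟩ := eig_data htr g hg
  have hd1 : 1 ≤ d := by have := C.hd; omega
  have h4 : ∀ᶠ n in (U : Filter ℕ), chi j n (ev g n) = ∑ i, urep U (ν i) n := by
    have : umk U (fun n => chi j n (ev g n)) = umk U (∑ i, urep U (ν i)) := by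
      rw [map_sum]; simpa [Xc] using h3
    filter_upwards [(umk_eq U).mp this] with n hn
    simpa using hn
  have h5 : ∀ i, ∀ᶠ n in (U : Filter ℕ), urep U (ν i) n ^ d = ∏ k, urep U (μ i k) n := by
    intro i
    have : umk U (urep U (ν i) ^ d) = umk U (∏ k, urep U (μ i k)) := by
      rw [map_prod]; simpa using h2 i
    filter_upwards [(umk_eq U).mp this] with n hn
    simpa using hn
  obtain ⟨⟨i, k⟩, h6⟩ := ult_exists (ι := Fin d × Fin d) (U := U) (fun p n => Real.exp K ≤ (P n (v n)).pow (r n) (hr n) (hr1 n) (urep U (μ p.1 p.2) n)) (by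
    filter_upwards [h, h4, eventually_all.mpr h5] with n e1 e2 e3
    obtain ⟨i, hi⟩ := (P n (v n)).big_root hd1 (fun i => urep U (ν i) n) _ e2 (K * r n) (by have := hr n; positivity) e1
    have e4 := (P n (v n)).le_pow (r n) (hr n) (hr1 n) _ K hi
    by_contra hcon
    push Not at hcon
    set u := (P n (v n)).pow (r n) (hr n) (hr1 n)
    have e5 : u (urep U (ν i) n) ^ d = ∏ k, u (urep U (μ i k) n) := by rw [← map_pow, e3 i, map_prod]
    haveI : Nonempty (Fin d) := ⟨⟨0, hd1⟩⟩
    have e6 : Real.exp K ^ d ≤ ∏ k, u (urep U (μ i k) n) := by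
      rw [← e5]
      exact pow_le_pow_left₀ (Real.exp_pos _).le e4 d
    have hne : ∀ k, 0 < u (urep U (μ i k) n) := by
      intro k
      refine lt_of_le_of_ne (u.nonneg _) fun h0 => ?_
      have : ∏ k, u (urep U (μ i k) n) = 0 := Finset.prod_eq_zero (Finset.mem_univ k) h0.symm
      rw [this] at e6
      have : 0 < Real.exp K ^ d := by positivity
      linarith
    have e7 : ∏ k, u (urep U (μ i k) n) < ∏ k : Fin d, Real.exp K :=
      Finset.prod_lt_prod_of_nonempty (fun k _ => hne k) (fun k _ => hcon (i, k)) Finset.univ_nonempty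
    simp at e7 e6
    linarith)
  exact ⟨_, h1 i k, h6⟩

lemma countable_closure {k : Type} [Field k] (s : Set k) (hs : s.Countable) : Countable (Subfield.closure s) := by
  rw [← Cardinal.mk_le_aleph0_iff]
  refine (Subfield.cardinalMk_closure_le_max s).trans (max_le ?_ le_rfl)
  exact Cardinal.mk_le_aleph0_iff.mpr hs.to_subtype

theorem theorem7 (htr : HTr C j) (hPF : ∀ᶠ n in (U : Filter ℕ), ∀ q ∈ Qs j F n, q ≠ 0 → ∑ i, Real.log ((P n i).v q) = 0)
    (T : Finset (Gam F)) (hT : ∀ g ∈ T, g ∈ ⁅C.H, C.H⁆) (ε : ℝ) (hε : 0 < ε) (hS : ∀ᶠ n in (U : Filter ℕ), 0 < Sn j P T n)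
    (hW : ∀ᶠ n in (U : Filter ℕ), ε * Wt (P n) ≤ Sn j P T n) : False := by
  classical
  obtain ⟨T', hTT, hT', E, hE, hAr⟩ := exists_big C j P C.bad C.hU htr hPF T hT (1 / ε) (by
    filter_upwards [hW] with n hn
    rw [one_div_mul_eq_div, le_div_iff₀ hε]; linarith) (by positivity)
  have hS' : ∀ᶠ n in (U : Filter ℕ), 0 < Sn j P T' n := hS.mono fun n h => h.trans_le (Sn_mono j P hTT n)
  have hW' : ∀ᶠ n in (U : Filter ℕ), ε * Wt (P n) ≤ Sn j P T' n := hW.mono fun n h => h.trans (Sn_mono j P hTT n)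
  -- dense subgroup
  choose Y hY using fun g : T' => comm_lift C g.1 (hT' g.1 g.2)
  obtain ⟨H1, hYH, hcount, -, hirr⟩ := exists_dense C (⋃ g : T', (Y g : Set C.H)) (Set.countable_iUnion fun g => (Y g).countable_toSet)
  have hlift : ∀ g : T', ∃ g' ∈ commutator H1, ((g' : C.H) : Gam F) = g := fun g => hY g H1 fun y hy => hYH (Set.mem_iUnion.mpr ⟨g, hy⟩)
  let φ : H1 →* Gam F := C.H.subtype.comp H1.subtype
  let s : Set (Ult U B) := Set.range (fun p : H1 × Fin C.m × Fin C.m => Ar C j htr (φ p.1) p.2.1 p.2.2)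
  have hs : s.Countable := Set.countable_range _
  let E1 := Subfield.closure s
  haveI : Countable E1 := countable_closure s hs
  have hEE : E1 ≤ E := Subfield.closure_le.mpr (by rintro _ ⟨p, rfl⟩; exact hAr _ _ _)
  obtain ⟨x, hx⟩ := exists_surjective_nat E1
  obtain ⟨v, hv0, hv⟩ := exists_place C.hU P (Q0 j F) (tv j P T') (Sn j P T') (fun n => rfl) ε hS' hW' (fun i => (x i : Ult U B)) (fun i => hE _ (hEE (x i).2))
  let r : ℕ → ℝ := fun n => if (P n (v n)).ar = true then max 1 (tv j P T' n (v n)) else if 0 < tv j P T' n (v n) then tv j P T' n (v n) else 1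
  have hr : ∀ n, 0 < r n := by
    intro n; simp only [r]
    split_ifs with h1 h2
    · exact lt_of_lt_of_le one_pos (le_max_left _ _)
    · exact h2
    · norm_num
  have hr1 : ∀ n, (P n (v n)).ar = true → 1 ≤ r n := by
    intro n h; simp only [r]; rw [if_pos h]; exact le_max_left _ _
  have hrt : ∀ᶠ n in (U : Filter ℕ), 0 < tv j P T' n (v n) ∧ tv j P T' n (v n) ≤ r n ∧ min (ε / 2) 1 * r n ≤ tv j P T' n (v n) := by
    filter_upwards [hv0] with n hn
    by_cases h : (P n (v n)).ar = true
    · rw [if_pos h, mul_one] at hn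
      simp only [r, if_pos h]
      have h0 : 0 < tv j P T' n (v n) := by linarith
      refine ⟨h0, le_max_right _ _, ?_⟩
      rcases max_choice 1 (tv j P T' n (v n)) with h | h <;> rw [h]
      · rw [mul_one]; exact (min_le_left _ _).trans (by linarith)
      · have := min_le_right (ε / 2) 1
        nlinarith
    · rw [if_neg h, mul_zero, sub_zero] at hn
      simp only [r, if_neg h, if_pos hn]
      refine ⟨hn, le_rfl, ?_⟩
      have := min_le_right (ε / 2) 1
      nlinarith
  let u : ∀ n, AbsoluteValue (B n) ℝ := fun n => (P n (v n)).pow (r n) (hr n) (hr1 n)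
  obtain ⟨av, hav⟩ := av_exists u E1 (by
    intro y hy
    obtain ⟨i, hi⟩ := hx ⟨y, hy⟩
    obtain ⟨K, hK0, hK⟩ := hv i
    rw [hi] at hK
    refine ⟨Real.exp K, ?_⟩
    filter_upwards [hK, hrt] with n h1 h2
    refine (P n (v n)).pow_le (r n) (hr n) (hr1 n) _ K (h1.trans ?_)
    refine mul_le_mul_of_nonneg_left ?_ hK0
    refine le_trans ?_ h2.2.1
    have : 0 ≤ ε / 2 * (if (P n (v n)).ar = true then (1:ℝ) else 0) := by split_ifs <;> positivity
    linarith)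
  -- the element g
  have hcard : ∀ᶠ n in (U : Filter ℕ), ∃ g : T', tv j P T' n (v n) / T'.card ≤ Real.posLog ((P n (v n)).v (chi j n (ev g.1 n)) / (P n (v n)).dv d) := by
    filter_upwards [hrt] with n hn
    have hne : T'.Nonempty := by
      by_contra hne
      rw [Finset.not_nonempty_iff_eq_empty] at hne
      have := hn.1
      rw [hne] at this
      simp [tv] at this
    obtain ⟨g, hg, h⟩ := Finset.exists_le_of_sum_le (s := T') (f := fun _ => tv j P T' n (v n) / T'.card) (g := fun g => Real.posLog ((P n (v n)).v (chi j n (ev g n)) / (P n (v n)).dv d)) hne (by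
      rw [Finset.sum_const, nsmul_eq_mul, mul_div_cancel₀ _ (by exact_mod_cast hne.card_pos.ne')]
      rfl)
    exact ⟨⟨g, hg⟩, h⟩
  obtain ⟨g, hg⟩ := ult_exists _ hcard
  have hTpos : (0 : ℝ) < T'.card := by exact_mod_cast Finset.card_pos.mpr ⟨g.1, g.2⟩
  set K := min (ε / 2) 1 / T'.card with hKdef
  have hK : 0 < K := div_pos (lt_min (by positivity) one_pos) hTpos
  obtain ⟨μ, hμ, hμ1⟩ := big_eig P htr g.1 (hT' g.1 g.2) v r hr hr1 K hK (by
    filter_upwards [hg, hrt] with n h1 h2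
    refine le_trans ?_ h1
    rw [hKdef, div_mul_eq_mul_div]
    exact div_le_div_of_nonneg_right h2.2.2 hTpos.le)
  -- representation over the closure
  obtain ⟨g', hg', hgg⟩ := hlift g
  have hs1 : ∀ (h : H1) i k, Ar C j htr (φ h) i k ∈ E1 := fun h i k => Subfield.subset_closure ⟨(h, i, k), rfl⟩
  let A0 : H1 →* Matrix (Fin C.m) (Fin C.m) E1 := 
    { toFun := fun h i k => ⟨Ar C j htr (φ h) i k, hs1 h i k⟩
      map_one' := by
        ext i k
        show Ar C j htr (φ 1) i k = _
        rw [map_one, map_one, Matrix.one_apply, Matrix.one_apply]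
        split_ifs <;> rfl
      map_mul' := by
        intro h h'
        ext i k
        show Ar C j htr (φ (h * h')) i k = _
        rw [map_mul, map_mul, Matrix.mul_apply]
        exact (map_sum E1.subtype (fun a => (⟨Ar C j htr (φ h) i a, hs1 h i a⟩ : E1) * ⟨Ar C j htr (φ h') a k, hs1 h' a k⟩) Finset.univ).symm }
  let L := algebraicClosure E1 (Ult U B)
  let A1 : H1 →* Matrix (Fin C.m) (Fin C.m) L := bch (algebraMap E1 L) A0
  haveI : IsAlgClosed L := (algebraicClosure.isAlgClosure E1 (Ult U B)).isAlgClosed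
  let f : L →+* Ult U B := L.val.toRingHom
  have hfA : ∀ h, (A1 h).map f = Ar C j htr (φ h) := fun h => rfl
  have hμL : μ ∈ L := by
    rw [mem_algebraicClosure_iff]
    refine ⟨(A0 g').charpoly, (A0 g').charpoly_monic.ne_zero, ?_⟩
    rw [Polynomial.aeval_def, ← Polynomial.eval_map, ← Matrix.charpoly_map]
    have : (A0 g').map (algebraMap E1 (Ult U B)) = Ar C j htr g.1 := by rw [← hgg]; rfl
    rw [this]
    exact (Polynomial.mem_roots'.mp hμ).2
  refine contra_av φ av f u hav C.bad C.hU A1 ?_ ?_ g' hg' ⟨μ, hμL⟩ ?_ ?_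
  · exact good_Ar htr φ
  · refine Irr.of_emb ((umap U j).comp f) A1 (pull H1.subtype (entAlg (rhoH C))) ?_ ?_ hirr
    · intro i k
      refine ⟨_, cj_ent C C.H.subtype i k, ?_⟩
      funext h
      rw [← Ar_map htr]
      rfl
    · intro i k
      refine ⟨_, (entAlg_reg (rhoH C)).inv _ (cj_ent C C.H.subtype i k), ?_⟩
      funext h
      rw [← Ar_map htr]
      rfl
  · rw [Polynomial.mem_roots (Matrix.charpoly_monic _).ne_zero, Polynomial.IsRoot.def]
    apply f.injective
    rw [map_zero, ← Polynomial.eval₂_hom, ← Polynomial.eval_map, ← Matrix.charpoly_map]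
    have : (A1 g').map f = Ar C j htr g.1 := by rw [← hgg]; rfl
    rw [this]
    exact (Polynomial.mem_roots'.mp hμ).2
  · refine lt_of_lt_of_le (Real.one_lt_exp_iff.mpr hK) ?_
    exact ge_of_tendsto (hav ⟨μ, hμL⟩ (urep U μ) (umk_urep U μ)) hμ1
end T7
end Tits

namespace Tits
set_option linter.unusedSectionVars false
set_option linter.all false
open Filter Pointwise
open scoped commutatorElement

/-! ### Packing and commutators of isometries -/
section Pack
open MeasureTheory Metric Module

lemma packing {E : Type} [NormedAddCommGroup E] [NormedSpace ℝ E] [FiniteDimensional ℝ E] (s : Finset E) (hs : ∀ c ∈ s, ‖c‖ ≤ 1)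
    (h : ∀ c ∈ s, ∀ d ∈ s, c ≠ d → 1 / 8 ≤ ‖c - d‖) : s.card ≤ 17 ^ finrank ℝ E := by
  borelize E
  let μ : Measure E := Measure.addHaar
  let δ : ℝ := (1 : ℝ) / 16
  let ρ : ℝ := (17 : ℝ) / 16
  have ρpos : 0 < ρ := by norm_num [ρ]
  set A := ⋃ c ∈ s, ball (c : E) δ with hA
  have D : Set.Pairwise (s : Set E) (Function.onFun Disjoint fun c => ball (c : E) δ) := by
    rintro c hc d hd hcd
    apply ball_disjoint_ball
    rw [dist_eq_norm]
    refine le_trans (le_of_eq ?_) (h c hc d hd hcd)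
    norm_num [δ]
  have A_subset : A ⊆ ball (0 : E) ρ := by
    refine Set.iUnion₂_subset fun x hx => ?_
    apply ball_subset_ball'
    calc
      δ + dist x 0 ≤ δ + 1 := by rw [dist_zero_right]; exact add_le_add le_rfl (hs x hx)
      _ = 17 / 16 := by norm_num [δ]
  have I :
    (s.card : ENNReal) * ENNReal.ofReal (δ ^ finrank ℝ E) * μ (ball 0 1) ≤
      ENNReal.ofReal (ρ ^ finrank ℝ E) * μ (ball 0 1) :=
    calc
      (s.card : ENNReal) * ENNReal.ofReal (δ ^ finrank ℝ E) * μ (ball 0 1) = μ A := by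
        rw [hA, measure_biUnion_finset D fun c _ => measurableSet_ball]
        have I : 0 < δ := by norm_num [δ]
        simp only [μ.addHaar_ball_of_pos _ I]
        simp only [Finset.sum_const, nsmul_eq_mul, mul_assoc]
      _ ≤ μ (ball (0 : E) ρ) := measure_mono A_subset
      _ = ENNReal.ofReal (ρ ^ finrank ℝ E) * μ (ball 0 1) := by
        simp only [μ.addHaar_ball_of_pos _ ρpos]
  have J : (s.card : ENNReal) * ENNReal.ofReal (δ ^ finrank ℝ E) ≤ ENNReal.ofReal (ρ ^ finrank ℝ E) :=
    (ENNReal.mul_le_mul_iff_left (measure_ball_pos _ _ zero_lt_one).ne' measure_ball_lt_top.ne).1 I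
  have K : (s.card : ℝ) ≤ (17 : ℝ) ^ finrank ℝ E := by
    have := ENNReal.toReal_le_of_le_ofReal (pow_nonneg ρpos.le _) J
    simpa [ρ, δ, div_eq_mul_inv, mul_pow] using this
  exact mod_cast K

lemma packing' {E : Type} [NormedAddCommGroup E] [NormedSpace ℝ E] [FiniteDimensional ℝ E] {J : ℕ} (z : Fin J → E) (hz : ∀ i, ‖z i‖ ≤ 1)
    (hJ : 17 ^ finrank ℝ E < J) : ∃ i k, i ≠ k ∧ ‖z i - z k‖ ≤ 1 / 8 := by
  classical
  by_contra hcon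
  push Not at hcon
  have hinj : Function.Injective z := by
    intro i k hik
    by_contra hne
    have := hcon i k hne
    rw [hik, sub_self, norm_zero] at this
    linarith
  have := packing (Finset.univ.image z) (by simpa using hz) (by
    simp only [Finset.mem_image, Finset.mem_univ, true_and]
    rintro _ ⟨i, rfl⟩ _ ⟨k, rfl⟩ hne
    exact (hcon i k fun h => hne (by rw [h])).le)
  rw [Finset.card_image_of_injective _ hinj, Finset.card_univ, Fintype.card_fin] at this
  omega
end Pack

lemma prod_le_of_small {ι : Type} (l : List ι) (f : ι → ℝ) (h0 : ∀ i, 0 ≤ f i) (h4 : ∀ i, f i ≤ 4) (x : ℝ) (hx : 0 ≤ x) (p : ι) (hp : p ∈ l) (hfp : f p ≤ x) :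
    (l.map f).prod ≤ 4 ^ l.length * x := by
  have key : ∀ l : List ι, 0 ≤ (l.map f).prod ∧ (l.map f).prod ≤ 4 ^ l.length := by
    intro l
    induction l with
    | nil => simp
    | cons a l ih =>
      rw [List.map_cons, List.prod_cons, List.length_cons, pow_succ, mul_comm]
      exact ⟨mul_nonneg ih.1 (h0 a), mul_le_mul ih.2 (h4 a) (h0 a) (by positivity)⟩
  induction l with
  | nil => simp at hp
  | cons a l ih =>
    rw [List.map_cons, List.prod_cons, List.length_cons, pow_succ]
    rcases List.mem_cons.mp hp with rfl | hp
    · calc f p * (l.map f).prod ≤ x * 4 ^ l.length := mul_le_mul hfp (key l).2 (key l).1 hx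
        _ ≤ _ := by nlinarith [show (0:ℝ) ≤ 4 ^ l.length * x by positivity]
    · calc f a * (l.map f).prod ≤ 4 * (4 ^ l.length * x) := mul_le_mul (h4 a) (ih hp) (key l).1 (by norm_num)
        _ = _ := by ring

section Iso
variable {G A : Type} [Group G] [NormedRing A] (π : G →* A)

lemma iso_conj (hπ : ∀ g, ‖π g‖ ≤ 1) (y a : G) : ‖π (y * a * y⁻¹) - 1‖ ≤ ‖π a - 1‖ := by
  have : π (y * a * y⁻¹) - 1 = π y * (π a - 1) * π y⁻¹ := by
    rw [mul_sub, sub_mul, mul_one, ← map_mul, ← map_mul, ← map_mul, mul_inv_cancel, map_one]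
  rw [this]
  calc _ ≤ ‖π y * (π a - 1)‖ * ‖π y⁻¹‖ := norm_mul_le _ _
    _ ≤ ‖π y * (π a - 1)‖ * 1 := by gcongr; exact hπ _
    _ ≤ ‖π y‖ * ‖π a - 1‖ := by rw [mul_one]; exact norm_mul_le _ _
    _ ≤ 1 * ‖π a - 1‖ := by gcongr; exact hπ _
    _ = _ := one_mul _

lemma iso_comm (hπ : ∀ g, ‖π g‖ ≤ 1) (a b : G) : ‖π ⁅a, b⁆ - 1‖ ≤ 2 * ‖π a - 1‖ * ‖π b - 1‖ := by
  have : π ⁅a, b⁆ - 1 = ((π a - 1) * (π b - 1) - (π b - 1) * (π a - 1)) * π (b * a)⁻¹ := by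
    have e : π (b * a) * π (b * a)⁻¹ = 1 := by rw [← map_mul, mul_inv_cancel, map_one]
    have : ((π a - 1) * (π b - 1) - (π b - 1) * (π a - 1)) = π (a * b) - π (b * a) := by
      rw [map_mul, map_mul]; noncomm_ring
    rw [this, sub_mul, e, ← map_mul]
    congr 2
    rw [commutatorElement_def]; group
  rw [this]
  calc _ ≤ ‖(π a - 1) * (π b - 1) - (π b - 1) * (π a - 1)‖ * ‖π (b * a)⁻¹‖ := norm_mul_le _ _
    _ ≤ ‖(π a - 1) * (π b - 1) - (π b - 1) * (π a - 1)‖ * 1 := by gcongr; exact hπ _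
    _ ≤ ‖(π a - 1) * (π b - 1)‖ + ‖(π b - 1) * (π a - 1)‖ := by rw [mul_one]; exact norm_sub_le _ _
    _ ≤ ‖π a - 1‖ * ‖π b - 1‖ + ‖π b - 1‖ * ‖π a - 1‖ := add_le_add (norm_mul_le _ _) (norm_mul_le _ _)
    _ = _ := by ring

lemma iso_nest (hπ : ∀ g, ‖π g‖ ≤ 1) {l : List G} {b : G} (h : Nest l b) : ‖π b - 1‖ ≤ 1 / 2 * (l.map fun a => 2 * ‖π a - 1‖).prod := by
  induction h with
  | single a => simp
  | cons a l b y _ ih =>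
    have h0 : 0 ≤ ‖π a - 1‖ := norm_nonneg _
    calc _ ≤ 2 * ‖π b - 1‖ * ‖π (y * a * y⁻¹) - 1‖ := iso_comm π hπ _ _
      _ ≤ 2 * (1 / 2 * (l.map fun a => 2 * ‖π a - 1‖).prod) * ‖π a - 1‖ := by
        have := iso_conj π hπ y a
        have h1 : 0 ≤ ‖π b - 1‖ := norm_nonneg _
        gcongr
        linarith
      _ = _ := by rw [List.map_cons, List.prod_cons]; ring

lemma iso_alc (hπ : ∀ g, ‖π g‖ ≤ 1) {J M : ℕ} {b : G} (h : ALc J M (fun x => x = b)) (hz : ∀ z : Fin J → G, ∃ i k, i ≠ k ∧ ‖π (z i) - π (z k)‖ ≤ 1 / 8) :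
    ‖π b - 1‖ ≤ 4 ^ (pairs J).length * (1 / 4) ^ M := by
  have hone : ∀ a, ‖π a - 1‖ ≤ 2 := by
    intro a
    have h1 := hπ 1
    rw [map_one] at h1
    have := norm_sub_le (π a) 1
    have := hπ a
    linarith
  obtain ⟨z, e, b', h1, h2, rfl⟩ := h
  obtain ⟨i, k, hne, hik⟩ := hz z
  have hp : (i, k) ∈ pairs J := mem_pairs.mpr hne
  have h3 : ‖π ((z i)⁻¹ * z k) - 1‖ ≤ 1 / 8 := by
    have : π ((z i)⁻¹ * z k) - 1 = - (π (z i)⁻¹ * (π (z i) - π (z k))) := by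
      rw [mul_sub, ← map_mul, ← map_mul, inv_mul_cancel, map_one]; abel
    rw [this, norm_neg]
    calc _ ≤ ‖π (z i)⁻¹‖ * ‖π (z i) - π (z k)‖ := norm_mul_le _ _
      _ ≤ 1 * ‖π (z i) - π (z k)‖ := by gcongr; exact hπ _
      _ ≤ _ := by rw [one_mul]; exact hik
  have h4 : ‖π (e (i, k)) - 1‖ ≤ 1 / 2 * (1 / 4) ^ M := by
    refine (iso_nest π hπ (h1 _ hp)).trans ?_
    rw [List.map_replicate, List.prod_replicate]
    have h5 : 0 ≤ ‖π ((z i)⁻¹ * z k) - 1‖ := norm_nonneg _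
    gcongr
    simp only
    linarith
  refine (iso_nest π hπ h2).trans ?_
  rw [List.map_map]
  have := prod_le_of_small (pairs J) (fun p => 2 * ‖π (e p) - 1‖) (fun p => by positivity) (fun p => by have := hone (e p); linarith) ((1 / 4) ^ M) (by positivity) (i, k) hp (by linarith)
  have h6 : (0:ℝ) ≤ 4 ^ (pairs J).length * (1 / 4) ^ M := by positivity
  have h7 : ((pairs J).map ((fun a => 2 * ‖π a - 1‖) ∘ e)).prod ≤ 4 ^ (pairs J).length * (1 / 4) ^ M := this
  linarith
end Iso

lemma iso_fd {G E : Type} [Group G] [NormedAddCommGroup E] [NormedSpace ℂ E] [FiniteDimensional ℂ E] (m : ℕ) {J M : ℕ} (hJ : 17 ^ (2 * (m * m)) < J)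
    (hm : Module.finrank ℂ E ≤ m) (π : G →* (E →L[ℂ] E)) (hπ : ∀ g, ‖π g‖ ≤ 1) {b : G} (h : ALc J M (fun x => x = b)) :
    ‖π b - 1‖ ≤ 4 ^ (pairs J).length * (1 / 4) ^ M := by
  haveI : FiniteDimensional ℂ (E →L[ℂ] E) := inferInstance
  haveI : FiniteDimensional ℝ (E →L[ℂ] E) := FiniteDimensional.trans ℝ ℂ _
  have hdim : Module.finrank ℝ (E →L[ℂ] E) ≤ 2 * (m * m) := by
    rw [← Module.finrank_mul_finrank ℝ ℂ (E →L[ℂ] E), Complex.finrank_real_complex, ← (LinearMap.toContinuousLinearMap (𝕜 := ℂ) (E := E) (F' := E)).finrank_eq, Module.finrank_linearMap]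
    gcongr
  refine iso_alc (A := E →L[ℂ] E) π hπ h (fun z => ?_)
  exact packing' (fun i => π (z i)) (fun i => hπ _) (lt_of_le_of_lt (Nat.pow_le_pow_right (by norm_num) hdim) hJ)

/-! ### translates of a bounded function -/
section Tr
variable {G : Type} [Group G]

lemma indep_det {m : ℕ} (f : Fin m → G → ℂ) (h : LinearIndependent ℂ f) : ∃ a : Fin m → G, (Matrix.of fun i k => f k (a i)).det ≠ 0 := by
  let v : G → (Fin m → ℂ) := fun g k => f k g
  have hspan : Submodule.span ℂ (Set.range v) = ⊤ := by
    by_contra hne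
    obtain ⟨φ, hφ, hφ2⟩ := Submodule.exists_le_ker_of_lt_top _ (lt_top_iff_ne_top.mpr hne)
    have h1 : ∑ k, φ (Pi.single k 1) • f k = 0 := by
      funext g
      have h2 : φ (v g) = 0 := hφ2 (Submodule.subset_span ⟨g, rfl⟩)
      rw [pi_eq_sum_univ' (v g), map_sum] at h2
      simp only [map_smul, smul_eq_mul] at h2
      rw [Finset.sum_apply, Pi.zero_apply, ← h2]
      refine Finset.sum_congr rfl fun k _ => ?_
      simp [v, mul_comm]
    have h3 := Fintype.linearIndependent_iff.mp h _ h1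
    apply hφ
    refine LinearMap.pi_ext' fun k => ?_
    ext
    simpa using h3 k
  obtain ⟨b, hb1, hb2, hb3⟩ := exists_linearIndependent ℂ (Set.range v)
  rw [hspan] at hb2
  let bs : Module.Basis b ℂ (Fin m → ℂ) := Module.Basis.mk hb3 (by rw [Subtype.range_coe, hb2])
  haveI : Fintype b := FiniteDimensional.fintypeBasisIndex bs
  have hcard : Fintype.card b = m := by
    rw [← Module.finrank_eq_card_basis bs, Module.finrank_fin_fun]
  let eq : Fin m ≃ b := (Fintype.equivFinOfCardEq hcard).symm
  choose a ha using fun i : Fin m => hb1 (eq i).2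
  refine ⟨a, ?_⟩
  have h4 : LinearIndependent ℂ (fun i => (eq i : Fin m → ℂ)) := hb3.comp eq eq.injective
  have h5 : (Matrix.of fun i k => f k (a i)).row = fun i => (eq i : Fin m → ℂ) := by
    funext i; exact ha i
  have h6 := (Matrix.linearIndependent_rows_iff_isUnit (A := Matrix.of fun i k => f k (a i))).mp (by rw [h5]; exact h4)
  exact ((Matrix.isUnit_iff_isUnit_det _).mp h6).ne_zero

theorem bounded_alc (χ : G → ℂ) (m : ℕ) (c : ℝ) (hc : 0 ≤ c) (hχ : ∀ g, ‖χ g‖ ≤ c) 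
    (hdet : ∀ a b : Fin (m + 1) → G, (Matrix.of fun i k => χ (a i * b k)).det = 0) {J M : ℕ} (hJ : 17 ^ (2 * (m * m)) < J) {b0 : G} 
    (h : ALc J M (fun x => x = b0)) (γ : G) : ‖χ (γ * b0) - χ γ‖ ≤ 4 ^ (pairs J).length * (1 / 4) ^ M * c := by
  letI : TopologicalSpace G := ⊥
  haveI : DiscreteTopology G := ⟨rfl⟩
  let X : BoundedContinuousFunction G ℂ := BoundedContinuousFunction.ofNormedAddCommGroupDiscrete χ c hχ
  let R : G → BoundedContinuousFunction G ℂ →ₗ[ℂ] BoundedContinuousFunction G ℂ := fun h => 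
    { toFun := fun f => f.compContinuous ⟨fun g => g * h, continuous_of_discreteTopology⟩
      map_add' := fun _ _ => rfl
      map_smul' := fun _ _ => rfl }
  have hR : ∀ h f g, R h f g = f (g * h) := fun _ _ _ => rfl
  have hRn : ∀ h f, ‖R h f‖ ≤ ‖f‖ := by
    intro h f
    rw [BoundedContinuousFunction.norm_le (norm_nonneg _)]
    intro g
    rw [hR]; exact f.norm_coe_le_norm _
  have hRm : ∀ h h' f, R (h * h') f = R h (R h' f) := by
    intro h h' f
    ext g
    rw [hR, hR, hR, mul_assoc]
  have hR1 : ∀ f, R 1 f = f := by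
    intro f; ext g; rw [hR, mul_one]
  let W : Submodule ℂ (BoundedContinuousFunction G ℂ) := Submodule.span ℂ (Set.range fun h => R h X)
  have hW : ∀ h, ∀ f ∈ W, R h f ∈ W := by
    intro h f hf
    have : W.map (R h) ≤ W := by
      rw [Submodule.map_span, Submodule.span_le]
      rintro _ ⟨_, ⟨h', rfl⟩, rfl⟩
      exact Submodule.subset_span ⟨h * h', hRm _ _ _⟩
    exact this ⟨f, hf, rfl⟩
  -- dimension
  obtain ⟨b, hb1, hb2, hb3⟩ := exists_linearIndependent ℂ (Set.range fun h => R h X)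
  have hbm : Cardinal.mk b ≤ m := by
    by_contra hcon
    push Not at hcon
    have h1 : Cardinal.mk (Fin (m + 1)) ≤ Cardinal.mk b := by
      rw [Cardinal.mk_fin, Nat.cast_succ]
      exact Order.succ_le_of_lt hcon |>.trans' (by rw [Cardinal.succ_eq_of_lt_aleph0 (Cardinal.natCast_lt_aleph0)])
    obtain ⟨e⟩ := h1
    choose t ht using fun i : Fin (m + 1) => hb1 (e i).2
    have h2 : LinearIndependent ℂ (fun i : Fin (m + 1) => (e i : BoundedContinuousFunction G ℂ)) := hb3.comp e e.injective
    let cf : BoundedContinuousFunction G ℂ →ₗ[ℂ] (G → ℂ) := { toFun := fun f => f, map_add' := fun _ _ => rfl, map_smul' := fun _ _ => rfl }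
    have h3 : LinearIndependent ℂ (fun i : Fin (m + 1) => (fun g => χ (g * t i) : G → ℂ)) := by
      have := h2.map' cf (LinearMap.ker_eq_bot.mpr DFunLike.coe_injective)
      have h4 : (fun i : Fin (m + 1) => (fun g => χ (g * t i) : G → ℂ)) = cf ∘ (fun i : Fin (m + 1) => (e i : BoundedContinuousFunction G ℂ)) := by
        funext i
        show _ = cf (e i)
        rw [← ht i]; rfl
      rw [h4]; exact this
    obtain ⟨a, ha⟩ := indep_det _ h3
    exact ha (hdet a t)
  have hbW : Submodule.span ℂ b = W := hb2
  haveI : Finite b := Cardinal.lt_aleph0_iff_finite.mp (hbm.trans_lt Cardinal.natCast_lt_aleph0)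
  haveI : FiniteDimensional ℂ W := by
    rw [← hbW]; exact FiniteDimensional.span_of_finite ℂ (Set.toFinite b)
  have hfin : Module.finrank ℂ W ≤ m := by
    haveI : Fintype b := Fintype.ofFinite b
    rw [← hbW]
    refine (finrank_span_le_card b).trans ?_
    rw [Cardinal.mk_fintype] at hbm
    rw [Set.toFinset_card]
    exact_mod_cast hbm
  let π : G →* (W →L[ℂ] W) :=
    { toFun := fun h => LinearMap.mkContinuous ((R h).restrict (hW h)) 1 (fun f => by rw [one_mul]; exact hRn h f)
      map_one' := by
        ext f g
        show R 1 f g = _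
        rw [hR1]; rfl
      map_mul' := by
        intro h h'
        ext f g
        show R (h * h') f g = _
        rw [hRm]; rfl }
  have hπ : ∀ g, ‖π g‖ ≤ 1 := fun g => LinearMap.mkContinuous_norm_le ((R g).restrict (hW g)) zero_le_one (fun f => by rw [one_mul]; exact hRn g f)
  have hπR : ∀ h (f : W), ((π h f : W) : BoundedContinuousFunction G ℂ) = R h f := fun _ _ => rfl
  clear_value π
  have key := iso_fd m hJ hfin π hπ h
  let XW : W := ⟨X, Submodule.subset_span ⟨1, hR1 X⟩⟩
  have hX : ‖XW‖ ≤ c := BoundedContinuousFunction.norm_ofNormedAddCommGroup_le _ hc hχ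
  have h8 : χ (γ * b0) - χ γ = (((π b0 - 1) XW : W) : BoundedContinuousFunction G ℂ) γ := by
    rw [ContinuousLinearMap.sub_apply, Submodule.coe_sub, BoundedContinuousFunction.sub_apply, hπR, hR]; rfl
  rw [h8]
  calc _ ≤ ‖((π b0 - 1) XW : W)‖ := BoundedContinuousFunction.norm_coe_le_norm _ _
    _ ≤ ‖π b0 - 1‖ * ‖XW‖ := ContinuousLinearMap.le_opNorm _ _
    _ ≤ _ := mul_le_mul key hX (norm_nonneg _) (by positivity)
end Tr

/-! ### passing to finitely generated subgroups -/
lemma Nest.sub {H : Type} [Group H] {l : List H} {b : H} (h : Nest l b) : ∃ Y : Finset H, ∀ H1 : Subgroup H, (∀ y ∈ Y, y ∈ H1) → 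
    ∀ l' : List H1, l'.map (fun x : H1 => (x : H)) = l → ∃ b' : H1, (b' : H) = b ∧ Nest l' b' := by
  classical
  induction h with
  | single a =>
    refine ⟨∅, fun H1 _ l' hl => ?_⟩
    obtain ⟨a', rfl, ha⟩ := List.map_eq_singleton_iff.mp hl
    exact ⟨a', ha, Nest.single _⟩
  | cons a l b y _ ih =>
    obtain ⟨Y, hY⟩ := ih
    refine ⟨insert y Y, fun H1 h l' hl => ?_⟩
    obtain ⟨a', l'', rfl, ha, hl'⟩ := List.map_eq_cons_iff.mp hl
    obtain ⟨b', hb, hn⟩ := hY H1 (fun y hy => h y (Finset.mem_insert_of_mem hy)) l'' hl'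
    let y' : H1 := ⟨y, h y (Finset.mem_insert_self _ _)⟩
    refine ⟨⁅b', y' * a' * y'⁻¹⁆, ?_, Nest.cons a' l'' b' y' hn⟩
    rw [← hb, ← ha]; rfl

lemma ALc.sub {H : Type} [Group H] {J M : ℕ} {P : H → Prop} (h : ALc J M P) : ∃ b, P b ∧ ∃ Y : Finset H, ∀ H1 : Subgroup H, (∀ y ∈ Y, y ∈ H1) → 
    ∃ b' : H1, (b' : H) = b ∧ ALc J M (fun x : H1 => x = b') := by
  classical
  obtain ⟨z, e, b, h1, h2, h3⟩ := h
  obtain ⟨Y0, hY0⟩ := h2.sub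
  have : ∀ p : Fin J × Fin J, ∃ Y : Finset H, p ∈ pairs J → ∀ H1 : Subgroup H, (∀ y ∈ Y, y ∈ H1) → 
    ∀ l' : List H1, l'.map (fun x : H1 => (x : H)) = List.replicate M ((z p.1)⁻¹ * z p.2) → ∃ b' : H1, (b' : H) = e p ∧ Nest l' b' := by
    intro p
    by_cases hp : p ∈ pairs J
    · obtain ⟨Y, hY⟩ := (h1 p hp).sub
      exact ⟨Y, fun _ => hY⟩
    · exact ⟨∅, fun h => absurd h hp⟩
  choose Yp hYp using this
  refine ⟨b, h3, Y0 ∪ Finset.univ.image z ∪ Finset.univ.biUnion Yp, fun H1 hH => ?_⟩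
  let z' : Fin J → H1 := fun i => ⟨z i, hH _ (by simp)⟩
  have : ∀ p : Fin J × Fin J, ∃ e' : H1, p ∈ pairs J → (e' : H) = e p ∧ Nest (List.replicate M ((z' p.1)⁻¹ * z' p.2)) e' := by
    intro p
    by_cases hp : p ∈ pairs J
    · obtain ⟨b', hb⟩ := hYp p hp H1 (fun y hy => hH _ (by 
        apply Finset.mem_union_right
        exact Finset.mem_biUnion.mpr ⟨p, Finset.mem_univ _, hy⟩)) (List.replicate M ((z' p.1)⁻¹ * z' p.2)) (by simp [z'])
      exact ⟨b', fun _ => hb⟩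
    · exact ⟨1, fun h => absurd h hp⟩
  choose e' he' using this
  obtain ⟨b', hb1, hb2⟩ := hY0 H1 (fun y hy => hH _ (by simp [hy])) ((pairs J).map e') (by
    rw [List.map_map]
    exact List.map_congr_left fun p hp => (he' p hp).1)
  exact ⟨b', hb1, z', e', b', fun p hp => (he' p hp).2, hb2, rfl⟩
end Tits

namespace Tits
set_option linter.unusedSectionVars false
set_option linter.all false
open Filter Pointwise
open scoped commutatorElement

section T6
variable {d : ℕ} {U : Ultrafilter ℕ} {Ω : ℕ → Type} [∀ n, Field (Ω n)]
    {F : ∀ n, Set (GL (Fin d) (Ω n))} {C : Core d U Ω F}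
    {B : ℕ → Type} [∀ n, Field (B n)] {j : ∀ n, B n →+* Ω n}
    {I : ℕ → Type} [∀ n, Fintype (I n)] (P : ∀ n, I n → Pl (B n))

lemma tv_le {T : Finset (Gam F)} {g : Gam F} (hd : 1 ≤ d) (hg : g ∈ T) (n : ℕ) (i : I n) :
    (P n i).v (chi j n (ev g n)) ≤ (P n i).dv d * Real.exp (tv j P T n i) := by
  have h1 : Real.posLog ((P n i).v (chi j n (ev g n)) / (P n i).dv d) ≤ tv j P T n i :=
    Finset.single_le_sum (f := fun g => Real.posLog ((P n i).v (chi j n (ev g n)) / (P n i).dv d)) (fun _ _ => Real.posLog_nonneg) hg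
  have hdv : 0 < (P n i).dv d := by
    unfold Pl.dv; split_ifs
    · exact_mod_cast hd
    · exact one_pos
  rcases eq_or_lt_of_le ((P n i).v.nonneg (chi j n (ev g n))) with h0 | h0
  · rw [← h0]; positivity
  have h2 : Real.log ((P n i).v (chi j n (ev g n)) / (P n i).dv d) ≤ tv j P T n i := le_trans (le_max_right _ _) h1
  rw [Real.log_le_iff_le_exp (by positivity), div_le_iff₀ hdv] at h2
  linarith

lemma arch_place (hd : 1 ≤ d) (T : Finset (Gam F)) (γ₁ γ₂ : Gam F) (h1 : γ₁ ∈ T) (h2 : γ₂ ∈ T) (n : ℕ) (f : B n) (hf : f = chi j n (ev γ₁ n) - chi j n (ev γ₂ n)) (hf0 : f ≠ 0)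
    (hPF : ∑ i, Real.log ((P n i).v f) = 0) (δ : ℝ) (hδ : 0 < δ) (hS : ((Real.log (2 * d) + Real.log 2) / δ + 1) * Sn j P T n < Real.log 2 * Wt (P n)) :
    ∃ v, (P n v).ar = true ∧ tv j P T n v ≤ δ ∧ 1 / 2 ≤ (P n v).v f := by
  by_contra hcon
  push Not at hcon
  have hd' : (1 : ℝ) ≤ d := by exact_mod_cast hd
  set a := Real.log (2 * d) + Real.log 2 with ha
  have hl2 : 0 < Real.log 2 := Real.log_pos (by norm_num)
  have hl3 : 0 < Real.log (2 * d) := Real.log_pos (by linarith)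
  have ha0 : 0 < a := by positivity
  have key : ∀ i, Real.log ((P n i).v f) ≤ (a / δ + 1) * tv j P T n i - Real.log 2 * (if (P n i).ar = true then (1:ℝ) else 0) := by
    intro i
    have ht := tv_nonneg j P T n i
    have hvf : 0 < (P n i).v f := (P n i).v.pos hf0
    have e1 := tv_le (j := j) P hd h1 n i
    have e2 := tv_le (j := j) P hd h2 n i
    have e0 : 0 ≤ a / δ * tv j P T n i := by positivity
    by_cases har : (P n i).ar = true
    · rw [if_pos har]
      have hdv : (P n i).dv d = d := by simp [Pl.dv, har]
      rw [hdv] at e1 e2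
      by_cases htd : tv j P T n i ≤ δ
      · have := hcon i har htd
        have := Real.log_le_log hvf this.le
        rw [one_div, Real.log_inv] at this
        nlinarith
      · push Not at htd
        have e3 : (P n i).v f ≤ 2 * d * Real.exp (tv j P T n i) := by
          rw [hf]
          have := (P n i).v.sub_le_add (chi j n (ev γ₁ n)) (chi j n (ev γ₂ n))
          linarith
        have e4 := Real.log_le_log hvf e3
        rw [Real.log_mul (by positivity) (by positivity), Real.log_exp] at e4
        have e5 : a ≤ a / δ * tv j P T n i := by
          rw [div_mul_eq_mul_div, le_div_iff₀ hδ]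
          exact mul_le_mul_of_nonneg_left htd.le ha0.le
        linarith
    · have har' : (P n i).ar = false := by simpa using har
      rw [if_neg har]
      have hdv : (P n i).dv d = 1 := by simp [Pl.dv, har]
      rw [hdv, one_mul] at e1 e2
      have e3 : (P n i).v f ≤ Real.exp (tv j P T n i) := by
        rw [hf, sub_eq_add_neg]
        refine ((P n i).na har' _ _).trans (max_le e1 ?_)
        rw [AbsoluteValue.map_neg]; exact e2
      have e4 := Real.log_le_log hvf e3
      rw [Real.log_exp] at e4
      linarith
  have := Finset.sum_le_sum fun i (_ : i ∈ Finset.univ) => key i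
  rw [hPF, Finset.sum_sub_distrib, ← Finset.mul_sum, ← Finset.mul_sum] at this
  unfold Sn Wt at hS
  linarith

variable (C)
/-- the derived subgroup as a group mapping to Gam -/
noncomputable def phi0 : commutator C.H →* Gam F := C.H.subtype.comp (commutator C.H).subtype

lemma phi0_mem (g : commutator C.H) : phi0 C g ∈ ⁅C.H, C.H⁆ := by
  rw [← Subgroup.map_subtype_commutator]
  exact ⟨g.1, g.2, rfl⟩

lemma phi0_surj (g : Gam F) (hg : g ∈ ⁅C.H, C.H⁆) : ∃ x, phi0 C x = g := by
  rw [← Subgroup.map_subtype_commutator] at hg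
  obtain ⟨z, hz, rfl⟩ := hg
  exact ⟨⟨z, hz⟩, rfl⟩

lemma alc_exists [∀ n, IsAlgClosed (Ω n)] (J M : ℕ) (hJ : 2 ≤ J) (hM : 1 ≤ M) : 
    ALc J M (fun b : commutator C.H => ¬ IsSc (toEnd ((rho F U).comp (phi0 C)) b)) := by
  haveI : IsAlgClosed (Ult U Ω) := ult_algClosed U
  refine almost_law J M hJ hM (Ult U Ω) d (commutator C.H) (Fin d → Ult U Ω) (pull (commutator C.H).subtype (entAlg (rhoH C)))
    (toEnd ((rho F U).comp (phi0 C))) (pull_reg _ (entAlg_reg _)) ?_ (pull_irr _ (commutator_irr (entAlg_reg _) (rhoH_irr C))) ?_ (by simp) C.hd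
  · exact toEnd_coef _ _ (fun i k => ⟨_, ent_mem (rhoH C) i k, rfl⟩)
  · intro X hX
    by_contra hcon
    push Not at hcon
    obtain ⟨x, hx, hx0⟩ := X.exists_mem_ne_zero_of_ne_bot hcon.1
    apply hcon.2
    have h1 : ∀ A : Matrix (Fin d) (Fin d) (Ult U Ω), A.mulVec x ∈ X := by
      intro A
      rw [← C.b.sum_repr A, Matrix.sum_mulVec]
      refine X.sum_mem fun i _ => ?_
      rw [Matrix.smul_mulVec]
      refine X.smul_mem _ ?_
      obtain ⟨g, hg⟩ := phi0_surj C (C.w i) (C.w_mem i)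
      have := hX g x hx
      rw [toEnd_apply, MonoidHom.comp_apply, hg, ← C.hb] at this
      exact this
    rw [eq_top_iff]
    intro y _
    obtain ⟨i, hi⟩ : ∃ i, x i ≠ 0 := Function.ne_iff.mp hx0
    have := h1 (Matrix.of fun k l => if l = i then y k * (x i)⁻¹ else 0)
    convert this
    funext k
    simp [Matrix.mulVec, dotProduct, hi]

lemma trace_sep (b : commutator C.H) (hb : ¬ IsSc (toEnd ((rho F U).comp (phi0 C)) b)) : ∃ γ : commutator C.H, 
    (rho F U (phi0 C (γ * b))).trace ≠ (rho F U (phi0 C γ)).trace := by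
  by_contra hcon
  push Not at hcon
  apply hb
  have h1 : rho F U (phi0 C b) - 1 = 0 := by
    apply trace_nondeg
    intro y
    rw [Matrix.trace_mul_comm]
    rw [← C.b.sum_repr y, Finset.sum_mul, Matrix.trace_sum]
    refine Finset.sum_eq_zero fun i _ => ?_
    obtain ⟨g, hg⟩ := phi0_surj C (C.w i) (C.w_mem i)
    have := hcon g
    rw [map_mul, map_mul, hg, ← C.hb] at this
    rw [smul_mul_assoc, Matrix.trace_smul, mul_sub, Matrix.trace_sub, this, mul_one, sub_self, smul_zero]
  refine ⟨1, ?_⟩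
  rw [one_smul]
  apply LinearMap.ext
  intro x
  rw [toEnd_apply, MonoidHom.comp_apply, sub_eq_zero.mp h1, Matrix.one_mulVec]; rfl

variable {C}
lemma chi_det (htr : HTr C j) (a b : Fin (d * d + 1) → commutator C.H) : 
    ∀ᶠ n in (U : Filter ℕ), (Matrix.of fun i k => chi j n (ev (phi0 C (a i * b k)) n)).det = 0 := by
  have h1 : (Matrix.of fun i k => (rho F U (phi0 C (a i * b k))).trace).det = 0 := by
    have hdep : ¬ LinearIndependent (Ult U Ω) (fun i => rho F U (phi0 C (a i))) := by
      intro h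
      have := h.fintype_card_le_finrank
      rw [Module.finrank_matrix] at this
      simp at this
    rw [Fintype.not_linearIndependent_iff] at hdep
    obtain ⟨c, hc, i, hi⟩ := hdep
    refine Matrix.exists_vecMul_eq_zero_iff.mp ⟨c, fun h => hi (congrFun h i), ?_⟩
    funext k
    simp only [Matrix.vecMul, dotProduct, Matrix.of_apply, map_mul, Pi.zero_apply]
    have := congrArg (fun X => (X * rho F U (phi0 C (b k))).trace) hc
    simp only [Finset.sum_mul, Matrix.trace_sum, smul_mul_assoc, Matrix.trace_smul, zero_mul, Matrix.trace_zero, smul_eq_mul] at this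
    exact this
  have h2 : (Matrix.of fun i k => Xc U j (phi0 C (a i * b k))).det = 0 := by
    apply (umap U j).injective
    rw [map_zero, RingHom.map_det, ← h1]
    congr 1
    ext i k
    exact uj_Xc htr (phi0_mem C _)
  have h3 : (Matrix.of fun i k => Xc U j (phi0 C (a i * b k))) = umat U (fun n => Matrix.of fun i k => chi j n (ev (phi0 C (a i * b k)) n)) := by
    ext i k; rfl
  rw [h3, umat_det, umk_eq_zero] at h2
  exact h2

set_option maxHeartbeats 1600000 in
theorem theorem6 [∀ n, IsAlgClosed (Ω n)] [∀ n, Nonempty (I n)] (htr : HTr C j) (hPF : ∀ᶠ n in (U : Filter ℕ), ∀ q ∈ Qs j F n, q ≠ 0 → ∑ i, Real.log ((P n i).v q) = 0)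
    (hS : ∀ T : Finset (Gam F), (∀ g ∈ T, g ∈ ⁅C.H, C.H⁆) → ∀ ε : ℝ, 0 < ε → ∀ᶠ n in (U : Filter ℕ), Sn j P T n < ε * Wt (P n)) : False := by
  classical
  have hd1 : 1 ≤ d := by have := C.hd; omega
  obtain ⟨J, hJ, hJ2⟩ : ∃ J : ℕ, 17 ^ (2 * ((d * d) * (d * d))) < J ∧ 2 ≤ J := ⟨_ + 2, by exact Nat.lt_add_of_pos_right (by norm_num), Nat.le_add_left _ _⟩
  obtain ⟨M, hM⟩ : ∃ M : ℕ, M = (pairs J).length + d + 1 := ⟨_, rfl⟩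
  obtain ⟨b0, hb0, Y, hY⟩ := (alc_exists C J M hJ2 (by omega)).sub
  obtain ⟨γ, hγ⟩ := trace_sep C b0 hb0
  let D1 : Subgroup (commutator C.H) := Subgroup.closure (insert γ (Y : Set _))
  haveI : Countable D1 := cble_subgroup ((Finset.countable_toSet Y).insert γ)
  have hγ1 : γ ∈ D1 := Subgroup.subset_closure (Set.mem_insert _ _)
  obtain ⟨b1, hb1, hALc⟩ := hY D1 fun y hy => Subgroup.subset_closure (Set.mem_insert_of_mem _ hy)
  let γ1 : D1 := ⟨γ, hγ1⟩
  let ψ : D1 →* Gam F := (phi0 C).comp D1.subtype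
  have hψ : ∀ g, ψ g ∈ ⁅C.H, C.H⁆ := fun g => phi0_mem C _
  let f : ∀ n, B n := fun n => chi j n (ev (ψ (γ1 * b1)) n) - chi j n (ev (ψ γ1) n)
  have hf0 : ∀ᶠ n in (U : Filter ℕ), f n ≠ 0 := by
    by_contra h
    rw [← Ultrafilter.eventually_not] at h
    simp only [ne_eq, not_not] at h
    apply hγ
    have h1 : Xc U j (ψ (γ1 * b1)) = Xc U j (ψ γ1) := by
      rw [Xc, Xc, umk_eq]
      filter_upwards [h] with n hn
      exact sub_eq_zero.mp hn
    have h2 := congrArg (umap U j) h1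
    rw [uj_Xc htr (hψ _), uj_Xc htr (hψ _)] at h2
    rw [← hb1]
    exact h2
  have hfQ : ∀ᶠ n in (U : Filter ℕ), f n ∈ Qs j F n := by
    filter_upwards [ev_Q0 j C.hU C.bad.symm (ψ (γ1 * b1)), ev_Q0 j C.hU C.bad.symm (ψ γ1), C.hU 2] with n h1 h2 h3
    have e1 : chi j n (ev (ψ (γ1 * b1)) n) ∈ Cs (Q0 j F n) 0 := Or.inl h1
    have e2 : chi j n (ev (ψ γ1) n) ∈ Cs (Q0 j F n) 0 := Or.inl h2
    have := Cs_add e1 (Cs_neg e2)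
    show _ ∈ Cs _ _
    simp only [f, sub_eq_add_neg]
    exact Cs_mono _ h3 this
  -- saturation
  obtain ⟨x, hx⟩ := exists_surjective_nat (D1 × ℕ)
  let p : ℕ → ∀ n, I n → Prop := fun i n v => (P n v).ar = true ∧ 1 / 2 ≤ (P n v).v (f n) ∧ 
    (P n v).v (chi j n (ev (ψ (x i).1) n)) ≤ d * Real.exp (1 / ((x i).2 + 1))
  obtain ⟨v, hv⟩ := saturate C.hU p (by
    intro L
    obtain ⟨δ, hδ, hδL⟩ : ∃ δ : ℝ, 0 < δ ∧ ∀ i < L, δ ≤ 1 / ((x i).2 + 1) := by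
      refine ⟨1 / (∑ i ∈ Finset.range L, ((x i).2 : ℝ) + 1), by positivity, fun i hi => ?_⟩
      apply one_div_le_one_div_of_le (by positivity)
      have := Finset.single_le_sum (f := fun i => ((x i).2 : ℝ)) (fun _ _ => by positivity) (Finset.mem_range.mpr hi)
      linarith
    let T : Finset (Gam F) := insert (ψ (γ1 * b1)) (insert (ψ γ1) ((Finset.range L).image fun i => ψ (x i).1))
    have hT : ∀ g ∈ T, g ∈ ⁅C.H, C.H⁆ := by
      intro g hg
      simp only [T, Finset.mem_insert, Finset.mem_image] at hg
      rcases hg with rfl | rfl | ⟨i, -, rfl⟩ <;> exact hψ _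
    set c : ℝ := (Real.log (2 * d) + Real.log 2) / δ + 1 with hc
    have hd' : (1 : ℝ) ≤ d := by exact_mod_cast hd1
    have hc0 : 0 < c := by
      have hl2 : 0 < Real.log 2 := Real.log_pos (by norm_num)
      have hl3 : 0 < Real.log (2 * d) := Real.log_pos (by linarith)
      positivity
    have hl2 : 0 < Real.log 2 := Real.log_pos (by norm_num)
    filter_upwards [hS T hT (Real.log 2 / c) (by positivity), hf0, hfQ, hPF] with n h1 h2 h3 h4
    obtain ⟨v, e1, e2, e3⟩ := arch_place (j := j) P hd1 T (ψ (γ1 * b1)) (ψ γ1) (by simp [T]) (by simp [T]) n (f n) rfl h2 (h4 _ h3 h2) δ hδ (by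
      rw [div_mul_eq_mul_div, lt_div_iff₀ hc0] at h1
      rw [← hc]; linarith)
    refine ⟨v, fun i hi => ⟨e1, e3, ?_⟩⟩
    have e4 := tv_le (j := j) P hd1 (show ψ (x i).1 ∈ T by 
      simp only [T, Finset.mem_insert, Finset.mem_image]
      exact Or.inr (Or.inr ⟨i, Finset.mem_range.mpr hi, rfl⟩)) n v
    have hdv : (P n v).dv d = d := by simp [Pl.dv, e1]
    rw [hdv] at e4
    refine e4.trans ?_
    gcongr
    exact e2.trans (hδL i hi))
  -- limit
  have hemb : ∀ n, ∃ ι : B n → ℂ, (P n (v n)).ar = true → ∃ ι' : B n →+* ℂ, (∀ x, (P n (v n)).v x = ‖ι' x‖) ∧ ∀ x, ι x = ι' x := by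
    intro n
    by_cases h : (P n (v n)).ar = true
    · obtain ⟨ι, hι⟩ := (P n (v n)).emb h
      exact ⟨ι, fun _ => ⟨ι, hι, fun _ => rfl⟩⟩
    · exact ⟨0, fun h' => absurd h' h⟩
  choose ι hι using hemb
  have hbd : ∀ (g : D1) (s : ℕ), ∀ᶠ n in (U : Filter ℕ), ‖ι n (chi j n (ev (ψ g) n))‖ ≤ d * Real.exp (1 / (s + 1)) := by
    intro g s
    obtain ⟨i, hi⟩ := hx (g, s)
    filter_upwards [hv i] with n hn
    obtain ⟨ι', h1, h2⟩ := hι n hn.1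
    rw [h2, ← h1]
    have := hn.2.2
    rw [hi] at this
    exact this
  have hlim : ∀ g : D1, ∃ z : ℂ, Tendsto (fun n => ι n (chi j n (ev (ψ g) n))) U (nhds z) := by
    intro g
    have hcpt : IsCompact (Metric.closedBall (0 : ℂ) (d * Real.exp (1 / ((0:ℕ) + 1)))) := isCompact_closedBall _ _
    obtain ⟨z, -, hz⟩ := hcpt.ultrafilter_le_nhds (U.map fun n => ι n (chi j n (ev (ψ g) n))) (by
      rw [le_principal_iff]
      show ∀ᶠ n in (U : Filter ℕ), _
      filter_upwards [hbd g 0] with n hn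
      simpa using hn)
    exact ⟨z, hz⟩
  choose χ hχ using hlim
  have hχd : ∀ g, ‖χ g‖ ≤ d := by
    intro g
    have h1 : ∀ s : ℕ, ‖χ g‖ ≤ d * Real.exp (1 / (s + 1)) := fun s => le_of_tendsto (hχ g).norm (hbd g s)
    have h2 : Tendsto (fun s : ℕ => (d : ℝ) * Real.exp (1 / ((s : ℝ) + 1))) atTop (nhds (d * Real.exp 0)) :=
      ((Real.continuous_exp.tendsto 0).comp tendsto_one_div_add_atTop_nhds_zero_nat).const_mul _
    rw [Real.exp_zero, mul_one] at h2
    exact ge_of_tendsto' h2 h1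
  have har : ∀ᶠ n in (U : Filter ℕ), (P n (v n)).ar = true ∧ 1 / 2 ≤ (P n (v n)).v (f n) := (hv 0).mono fun n h => ⟨h.1, h.2.1⟩
  have hdet : ∀ a b : Fin (d * d + 1) → D1, (Matrix.of fun i k => χ (a i * b k)).det = 0 := by
    intro a b
    have h1 : Tendsto (fun n => (Matrix.of fun i k => ι n (chi j n (ev (ψ (a i * b k)) n))).det) U (nhds (Matrix.of fun i k => χ (a i * b k)).det) := by
      have hcont : Continuous (fun A : Matrix (Fin (d * d + 1)) (Fin (d * d + 1)) ℂ => A.det) := Continuous.matrix_det continuous_id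
      refine (hcont.tendsto _).comp ?_
      refine tendsto_pi_nhds.mpr fun i => tendsto_pi_nhds.mpr fun k => ?_
      exact hχ (a i * b k)
    refine tendsto_nhds_unique h1 ?_
    refine Tendsto.congr' ?_ tendsto_const_nhds
    filter_upwards [har, chi_det htr (fun i => (a i : commutator C.H)) (fun i => (b i : commutator C.H))] with n h2 h3
    obtain ⟨ι', e1, e2⟩ := hι n h2.1
    have h4 := congrArg ι' h3
    rw [map_zero, RingHom.map_det] at h4
    rw [← h4]
    congr 1
    ext i k
    exact (e2 _).symm
  have hfin := bounded_alc χ (d * d) d (by positivity) hχd hdet (J := J) (M := M) hJ hALc γ1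
  have hge : 1 / 2 ≤ ‖χ (γ1 * b1) - χ γ1‖ := by
    refine ge_of_tendsto ((hχ (γ1 * b1)).sub (hχ γ1)).norm ?_
    filter_upwards [har] with n hn
    obtain ⟨ι', e1, e2⟩ := hι n hn.1
    rw [e2, e2, ← map_sub, ← e1]
    exact hn.2
  have hsm : (4:ℝ) ^ (pairs J).length * (1 / 4) ^ M * d ≤ 1 / 4 := by
    have e1 : (4:ℝ) ^ (pairs J).length * (1 / 4) ^ M = 1 / 4 * (1 / 4) ^ d := by
      rw [hM, pow_add, pow_add, ← mul_assoc, ← mul_assoc, ← mul_pow]; norm_num; ring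
    have e2 : (d : ℝ) ≤ 4 ^ d := by exact_mod_cast (Nat.lt_pow_self (n := d) (a := 4) (by norm_num)).le
    rw [e1]
    have e3 : (1 / 4 : ℝ) ^ d * 4 ^ d = 1 := by rw [← mul_pow]; norm_num
    have e4 : (0:ℝ) ≤ (1 / 4) ^ d := by positivity
    nlinarith [mul_le_mul_of_nonneg_left e2 e4]
  linarith
end T6
end Tits

namespace Tits
set_option linter.unusedSectionVars false
set_option linter.all false
open Filter Pointwise
open scoped commutatorElement

/-- the trivial place -/
noncomputable def trivPl (B : Type) [Field B] : Pl B where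
  v := by
    classical
    exact AbsoluteValue.trivial
  ar := false
  na := by
    classical
    intro _ x y
    by_cases hx : x = 0
    · subst hx; simp
    · by_cases hy : y = 0
      · subst hy; simp
      · by_cases hxy : x + y = 0
        · rw [hxy, map_zero]; exact le_max_of_le_left (AbsoluteValue.nonneg _ _)
        · rw [AbsoluteValue.trivial_apply hxy, AbsoluteValue.trivial_apply hx]; exact le_max_left _ _
  emb := by intro h; cases h

section fin
variable {d : ℕ} {U : Ultrafilter ℕ} {Ω : ℕ → Type} [∀ n, Field (Ω n)] [∀ n, IsAlgClosed (Ω n)]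
    {F : ∀ n, Set (GL (Fin d) (Ω n))}

lemma caseI (C : Core d U Ω F) (γ : Gam F) (hγ : γ ∈ ⁅C.H, C.H⁆)
    (ht : ∀ᶠ n in (U : Filter ℕ), Transcendental (⊥ : Subfield (Ω n)) (ev γ n).val.trace) : False := by
  classical
  let j : ∀ n, Ω n →+* Ω n := fun n => RingHom.id _
  have htr : HTr C j := fun γ _ => Eventually.of_forall fun n => ⟨_, rfl⟩
  have hex : ∀ n, ∃ (I : Type) (_ : Fintype I) (_ : Nonempty I) (P : I → Pl (Ω n)),
      Transcendental (⊥ : Subfield (Ω n)) (ev γ n).val.trace →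
        (∀ q ∈ Qs j F n, q ≠ 0 → ∑ i, Real.log ((P i).v q) = 0) ∧ (∀ i, (P i).ar = false) ∧
          ∃ i0, 1 < (P i0).v (ev γ n).val.trace := by
    intro n
    by_cases h : Transcendental (⊥ : Subfield (Ω n)) (ev γ n).val.trace
    · obtain ⟨I, hI, P, h1, h2, i0, h3⟩ := pf_tr (Ω n) _ h (Qs_fin j C.bad.fin n).toFinset
      exact ⟨I, hI, ⟨i0⟩, P, fun _ => ⟨fun q hq => h1 q (by simpa using hq), h2, i0, h3⟩⟩
    · exact ⟨PUnit, inferInstance, inferInstance, fun _ => trivPl _, fun h' => absurd h' h⟩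
  choose I hI hI' P hP using hex
  refine theorem7 (j := j) P htr (ht.mono fun n hn => (hP n hn).1) {γ} (by simpa using hγ) 1 one_pos ?_ ?_
  · filter_upwards [ht] with n hn
    obtain ⟨-, h2, i0, h3⟩ := hP n hn
    have hc : chi j n (ev γ n) = (ev γ n).val.trace := j_chi j (n := n) (x := ev γ n) ⟨_, rfl⟩
    refine lt_of_lt_of_le ?_ (Finset.single_le_sum (f := fun i => tv j P {γ} n i) (fun i _ => tv_nonneg j P {γ} n i) (Finset.mem_univ i0))
    simp only [tv, Finset.sum_singleton, hc, Pl.dv, h2, Bool.false_eq_true, if_false, div_one]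
    exact lt_of_lt_of_le (Real.log_pos h3) (le_max_right _ _)
  · filter_upwards [ht] with n hn
    have : Wt (P n) = 0 := by simp [Wt, (hP n hn).2.1]
    rw [this, mul_zero]
    exact Finset.sum_nonneg fun i _ => tv_nonneg j P {γ} n i

lemma caseII (C : Core d U Ω F)
    (ht : ∀ γ ∈ ⁅C.H, C.H⁆, ∀ᶠ n in (U : Filter ℕ), IsAlgebraic (⊥ : Subfield (Ω n)) (ev γ n).val.trace) : False := by
  classical
  let j : ∀ n, Bal (Ω n) →+* Ω n := fun n => algebraMap (Bal (Ω n)) (Ω n)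
  have htr : HTr C j := fun γ hγ => (ht γ hγ).mono fun n hn => ⟨⟨_, mem_algebraicClosure_iff.mpr hn⟩, rfl⟩
  have hc0 := ev_charZero htr
  have hex : ∀ n, ∃ (I : Type) (_ : Fintype I) (_ : Nonempty I) (P : I → Pl (Bal (Ω n))),
      CharZero (Ω n) →
        (∀ q ∈ Qs j F n, q ≠ 0 → ∑ i, Real.log ((P i).v q) = 0) ∧ ∃ i0, (P i0).ar = true := by
    intro n
    by_cases h : CharZero (Ω n)
    · haveI := bal_alg (Ω n)
      obtain ⟨I, hI, P, h1, i0, h3⟩ := pf_num (Bal (Ω n)) (Qs_fin j C.bad.fin n).toFinset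
      exact ⟨I, hI, ⟨i0⟩, P, fun _ => ⟨fun q hq => h1 q (by simpa using hq), i0, h3⟩⟩
    · exact ⟨PUnit, inferInstance, inferInstance, fun _ => trivPl _, fun h' => absurd h' h⟩
  choose I hI hI' P hP using hex
  have hPF := hc0.mono fun n hn => (hP n hn).1
  have hW : ∀ᶠ n in (U : Filter ℕ), 0 < Wt (P n) := by
    filter_upwards [hc0] with n hn
    obtain ⟨-, i0, h3⟩ := hP n hn
    refine lt_of_lt_of_le ?_ (Finset.single_le_sum (f := fun i => if (P n i).ar = true then (1 : ℝ) else 0) (fun i _ => by split_ifs <;> norm_num) (Finset.mem_univ i0))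
    simp [h3]
  by_cases hS : ∀ T : Finset (Gam F), (∀ g ∈ T, g ∈ ⁅C.H, C.H⁆) → ∀ ε : ℝ, 0 < ε → ∀ᶠ n in (U : Filter ℕ), Sn j P T n < ε * Wt (P n)
  · exact theorem6 (j := j) P htr hPF hS
  · push Not at hS
    obtain ⟨T, hT, ε, hε, h⟩ := hS
    have h' : ∀ᶠ n in (U : Filter ℕ), ε * Wt (P n) ≤ Sn j P T n := h
    refine theorem7 (j := j) P htr hPF T hT ε hε ?_ h'
    filter_upwards [h', hW] with n h1 h2
    exact lt_of_lt_of_le (mul_pos hε h2) h1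

end fin

theorem prp_all : ∀ d : ℕ, 1 ≤ d → Prp d := by
  intro d
  induction d using Nat.strong_induction_on with
  | _ d ih =>
    intro hd1
    rcases eq_or_lt_of_le hd1 with h1 | hd
    · subst h1
      refine ⟨0, fun K _ F _ _ _ => Or.inr (VS.of_comm fun x y => Subtype.ext (Units.ext ?_))⟩
      ext a b
      simp [Matrix.mul_apply, Subsingleton.elim a 0, Subsingleton.elim b 0, mul_comm]
    · by_contra hcon
      obtain ⟨Ω, _, _, F, hB⟩ := exists_bad hcon
      let U : Ultrafilter ℕ := hyperfilter ℕ
      have hU : ∀ N, ∀ᶠ n in (U : Filter ℕ), N ≤ n := fun N => 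
        (Nat.hyperfilter_le_atTop) (eventually_ge_atTop N)
      obtain ⟨C⟩ := exists_core U (fun a h1 h2 => ih a h2 h1) hB hU hd
      by_cases h : ∃ γ ∈ ⁅C.H, C.H⁆, ∀ᶠ n in (U : Filter ℕ), Transcendental (⊥ : Subfield (Ω n)) (ev γ n).val.trace
      · obtain ⟨γ, hγ, ht⟩ := h
        exact caseI C γ hγ ht
      · apply caseII C
        intro γ hγ
        by_contra hn
        rw [← Ultrafilter.eventually_not] at hn
        exact h ⟨γ, hγ, hn⟩
end Tits

open scoped MatrixGroups
theorem strong_tits_alternative :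
    ∀ d : ℕ, 1 ≤ d → ∃ N : ℕ,
      ∀ (K : Type) [Field K], ∀ F : Set (GL (Fin d) K),
        F.Finite → (1 : GL (Fin d) K) ∈ F → (∀ f ∈ F, f⁻¹ ∈ F) →
        ((∃ x y : GL (Fin d) K,
            (∃ l : List (GL (Fin d) K), l.length ≤ N ∧ (∀ g ∈ l, g ∈ F) ∧ l.prod = x) ∧
            (∃ l : List (GL (Fin d) K), l.length ≤ N ∧ (∀ g ∈ l, g ∈ F) ∧ l.prod = y) ∧
            Function.Injective
              ⇑(FreeGroup.lift (fun i : Fin 2 => if i = 0 then x else y))) ∨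
          (∃ H : Subgroup ↥(Subgroup.closure F), H.FiniteIndex ∧ IsSolvable ↥H)) := by
  intro d hd
  exact Tits.prp_all d hd
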